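/- Let k be a field of characteristic zero. For n ≥ 1 let Cr_n(k) = Aut_k(k(x₁,…,x_n)) be the group of field automorphisms of the rational function field in n variables over k fixing k pointwise, and let ι_n : Cr_n(k) → Cr_{n+1}(k) be the group homomorphism sending σ to its unique extension to k(x₁,…,x_{n+1}) that agrees with σ on k(x₁,…,x_n) and fixes x_{n+1}. Then for every n ≥ 4, the induced homomorphism of abelianizations Cr_n(k)^{ab} → Cr_{n+1}(k)^{ab} is not surjective. -/

import Mathlib

namespace Cr
section Val
variable {Ω F : Type*} [Field Ω] [Field F] [Algebra Ω F]

theorem integral_of_forall (S : Subalgebra Ω F) (z : F)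
    (h : ∀ O : ValuationSubring F, (∀ r ∈ S, r ∈ O) → z ∈ O) : IsIntegral S z := by
  have h1 : z ∈ (⨅ V : {V : ValuationSubring F // (S : Set F) ⊆ V.toSubring}, V.1.toSubring) := by
    rw [Subring.mem_iInf]
    rintro ⟨V, hV⟩
    exact h V (fun r hr => hV hr)
  rw [iInf_valuationSubring_superset] at h1
  have h2 : IsIntegral (Subring.closure (S : Set F)) z := h1
  obtain ⟨p, hp, hpz⟩ := h2
  have hle : Subring.closure (S : Set F) ≤ S.toSubring := by
    rw [Subring.closure_le]; exact fun x hx => hx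
  refine ⟨p.map (Subring.inclusion hle), hp.map _, ?_⟩
  rw [Polynomial.eval₂_map]
  exact hpz

theorem isAlgebraic_of_forall (z : F)
    (h : ∀ O : ValuationSubring F, (∀ c : Ω, algebraMap Ω F c ∈ O) → z ∈ O) :
    IsAlgebraic Ω z := by
  have := integral_of_forall (⊥ : Subalgebra Ω F) z
    (fun O hO => h O (fun c => hO _ (Subalgebra.algebraMap_mem _ c)))
  have h2 : IsIntegral Ω z := isIntegral_trans (R := Ω) (A := (⊥ : Subalgebra Ω F)) z this
  exact h2.isAlgebraic

theorem mem_of_isIntegral (O : ValuationSubring F) (hO : ∀ c : Ω, algebraMap Ω F c ∈ O)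
    {z : F} (hz : IsIntegral Ω z) : z ∈ O := by
  obtain ⟨p, hp, hpz⟩ := hz
  let φ : Ω →+* O := (algebraMap Ω F).codRestrict O.toSubring hO
  have : IsIntegral O z := by
    refine ⟨p.map φ, hp.map _, ?_⟩
    rw [Polynomial.eval₂_map]
    exact hpz
  obtain ⟨y, hy⟩ := (IsIntegrallyClosed.isIntegral_iff (R := O) (K := F)).1 this
  rw [← hy]; exact y.2

theorem val_eq_one_of_mem (O : ValuationSubring F) {z : F} (h0 : z ≠ 0) (h1 : z ∈ O)
    (h2 : z⁻¹ ∈ O) : O.valuation z = 1 := by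
  apply le_antisymm ((O.valuation_le_one_iff z).2 h1)
  have := (O.valuation_le_one_iff _).2 h2
  rw [map_inv₀] at this
  have h3 : O.valuation z ≠ 0 := (Valuation.ne_zero_iff _).2 h0
  by_contra hlt
  push Not at hlt
  exact absurd this (not_le.2 ((one_lt_inv₀ (zero_lt_iff.2 h3)).2 hlt))

theorem val_algebraic (O : ValuationSubring F) (hO : ∀ c : Ω, algebraMap Ω F c ∈ O)
    {z : F} (hz : IsAlgebraic Ω z) (h0 : z ≠ 0) : O.valuation z = 1 :=
  val_eq_one_of_mem O h0 (mem_of_isIntegral O hO hz.isIntegral)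
    (mem_of_isIntegral O hO hz.inv.isIntegral)

theorem val_const (O : ValuationSubring F) (hO : ∀ c : Ω, algebraMap Ω F c ∈ O)
    {c : Ω} (h0 : c ≠ 0) : O.valuation (algebraMap Ω F c) = 1 :=
  val_algebraic O hO (isAlgebraic_algebraMap c) (by simpa using h0)

/-- Localization lemma. -/
theorem loc (R : Subalgebra Ω F) (hfg : R.FG)
    (hfrac : ∀ z : F, ∃ n ∈ R, ∃ d ∈ R, d ≠ 0 ∧ z * d = n)
    (O : ValuationSubring F) (hRO : ∀ r ∈ R, r ∈ O) (π : F) (hπ : π ∈ R)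
    (hπm : O.valuation π < 1)
    (key : ∀ n ∈ R, O.valuation n < 1 → ∃ d ∈ R, ∃ n' ∈ R, O.valuation d = 1 ∧ n * d = π * n') :
    ∀ z ∈ O, ∃ n ∈ R, ∃ d ∈ R, O.valuation d = 1 ∧ z * d = n := by
  have : IsNoetherianRing R := isNoetherianRing_of_fg hfg
  let j : R →+* O := R.val.toRingHom.codRestrict O.toSubring (fun r => hRO _ r.2)
  let P : Ideal R := (IsLocalRing.maximalIdeal O).comap j
  have hP : P.IsPrime := Ideal.comap_isPrime _ _
  have memP : ∀ r : R, r ∈ P ↔ O.valuation (r : F) < 1 := fun r => by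
    rw [Ideal.mem_comap, ValuationSubring.valuation_lt_one_iff]; rfl
  have val1 : ∀ r : R, r ∉ P → O.valuation (r : F) = 1 := fun r hr => by
    rw [memP, not_lt] at hr
    exact le_antisymm ((O.valuation_le_one_iff _).2 (hRO _ r.2)) hr
  let L := Localization.AtPrime P
  have : IsDomain L := IsLocalization.isDomain_localization (Ideal.primeCompl_le_nonZeroDivisors P)
  have : IsNoetherianRing L := IsLocalization.isNoetherianRing P.primeCompl L inferInstance
  have hpr : Submodule.IsPrincipal (IsLocalRing.maximalIdeal L) := by
    refine ⟨algebraMap R L ⟨π, hπ⟩, ?_⟩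
    apply le_antisymm
    · rw [← Localization.AtPrime.map_eq_maximalIdeal, Ideal.map_le_iff_le_comap]
      intro n hn
      rw [Ideal.mem_comap]
      obtain ⟨d, hd, n', hn', hd1, he⟩ := key n n.2 ((memP n).1 hn)
      have hdP : (⟨d, hd⟩ : R) ∈ P.primeCompl := fun h => by
        have := (memP _).1 h
        rw [hd1] at this; exact lt_irrefl _ this
      have hu : IsUnit (algebraMap R L ⟨d, hd⟩) := IsLocalization.map_units L ⟨_, hdP⟩
      obtain ⟨u, hu⟩ := hu
      change _ ∈ Ideal.span _
      rw [Ideal.mem_span_singleton']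
      refine ⟨algebraMap R L ⟨n', hn'⟩ * (u⁻¹ : Lˣ), ?_⟩
      have h3 : n * (⟨d, hd⟩ : R) = ⟨π, hπ⟩ * ⟨n', hn'⟩ := Subtype.ext he
      have h4 := congrArg (algebraMap R L) h3
      rw [map_mul, map_mul, ← hu] at h4
      calc _ = (algebraMap R L ⟨π, hπ⟩ * algebraMap R L ⟨n', hn'⟩) * (u⁻¹ : Lˣ) := by ring
        _ = _ := by rw [← h4]; simp; rfl
    · change Ideal.span _ ≤ _
      rw [Ideal.span_singleton_le_iff_mem, ← Localization.AtPrime.map_eq_maximalIdeal]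
      exact Ideal.mem_map_of_mem _ ((memP _).2 hπm)
  have hV : ValuationRing L :=
    ((tfae_of_isNoetherianRing_of_isLocalRing_of_isDomain L).out 4 1).1 hpr
  intro z hz
  obtain ⟨n, hn, d, hd, hd0, hzd⟩ := hfrac z
  have hinj : Function.Injective (algebraMap R L) :=
    IsLocalization.injective L (Ideal.primeCompl_le_nonZeroDivisors P)
  obtain ⟨c, hc⟩ := ValuationRing.cond (algebraMap R L ⟨n, hn⟩) (algebraMap R L ⟨d, hd⟩)
  obtain ⟨⟨c1, c2⟩, hcc⟩ := IsLocalization.mk'_surjective P.primeCompl c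
  simp only at hcc
  have hc2 : c * algebraMap R L c2 = algebraMap R L c1 := by
    rw [← hcc]; exact IsLocalization.mk'_spec L c1 c2
  have hv2 := val1 c2 c2.2
  rcases hc with hc | hc
  · have h5 : (⟨n, hn⟩ : R) * c1 = ⟨d, hd⟩ * c2 := by
      apply hinj; rw [map_mul, map_mul, ← hc2, ← hc]; ring
    have h6 : n * c1 = d * c2 := congrArg Subtype.val h5
    have h7 : z * c1 = c2 := by
      apply mul_left_cancel₀ hd0; rw [← h6, ← hzd]; ring
    refine ⟨c2, c2.1.2, c1, c1.2, ?_, h7⟩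
    apply le_antisymm ((O.valuation_le_one_iff _).2 (hRO _ c1.2))
    rw [← hv2, ← h7, map_mul]
    exact mul_le_of_le_one_left' ((O.valuation_le_one_iff _).2 hz)
  · have h5 : (⟨d, hd⟩ : R) * c1 = ⟨n, hn⟩ * c2 := by
      apply hinj; rw [map_mul, map_mul, ← hc2, ← hc]; ring
    have h6 : d * c1 = n * c2 := congrArg Subtype.val h5
    refine ⟨c1, c1.2, c2, c2.1.2, hv2, ?_⟩
    apply mul_left_cancel₀ hd0; rw [h6, ← hzd]; ring
end Val
end Cr

namespace Cr
open Polynomial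

theorem exists_derivation {Ω R F : Type*} [Field Ω] [CommRing R] [Field F] [Algebra Ω R]
    [Algebra R F] [Algebra Ω F] [IsScalarTower Ω R F] [IsFractionRing R F]
    (φ : R →ₐ[Ω] TrivSqZeroExt F F) (hφ : ∀ r, (φ r).fst = algebraMap R F r) :
    ∃ D : Derivation Ω F F, ∀ r, D (algebraMap R F r) = (φ r).snd := by
  have hu : ∀ y : nonZeroDivisors R, IsUnit (φ y) := fun y => by
    rw [TrivSqZeroExt.isUnit_iff_isUnit_fst, hφ]
    exact IsLocalization.map_units F y
  let Φ : F →ₐ[Ω] TrivSqZeroExt F F := IsLocalization.liftAlgHom (M := nonZeroDivisors R) hu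
  have h1 : ∀ r, Φ (algebraMap R F r) = φ r := fun r => by
    exact IsLocalization.lift_eq (M := nonZeroDivisors R) (g := (φ : R →+* TrivSqZeroExt F F)) hu r
  have h2 : ∀ z, (Φ z).fst = z := fun z => by
    obtain ⟨a, b, hb, rfl⟩ := IsFractionRing.div_surjective (A := R) z
    have hb0 : algebraMap R F b ≠ 0 := by
      have := IsLocalization.map_units F (⟨b, hb⟩ : nonZeroDivisors R)
      exact this.ne_zero
    have h3 : Φ (algebraMap R F a / algebraMap R F b) * φ b = φ a := by
      rw [← h1, ← h1, ← map_mul, div_mul_cancel₀ _ hb0]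
    have h4 := congrArg TrivSqZeroExt.fst h3
    rw [TrivSqZeroExt.fst_mul, hφ, hφ] at h4
    rw [eq_div_iff hb0, h4]
  let D : F →ₗ[Ω] F :=
    { toFun := fun z => (Φ z).snd
      map_add' := fun a b => by simp
      map_smul' := fun a b => by simp }
  refine ⟨Derivation.mk' D (fun a b => ?_), fun r => ?_⟩
  · change (Φ (a * b)).snd = a • (Φ b).snd + b • (Φ a).snd
    rw [map_mul, TrivSqZeroExt.snd_mul, h2, h2]; simp [mul_comm]
  · change (Φ (algebraMap R F r)).snd = _
    rw [h1]

/-- `F = Ω(X,W)` with `W² = X³ + A X + B`. -/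
structure EF (Ω F : Type*) [Field Ω] [Field F] [Algebra Ω F] (A B : Ω) (X W : F) : Prop where
  eq : W ^ 2 = X ^ 3 + algebraMap Ω F A * X + algebraMap Ω F B
  tr : Transcendental Ω X
  gen : IntermediateField.adjoin Ω {X, W} = ⊤

noncomputable def Phi {Ω : Type*} [Field Ω] (A B : Ω) : Polynomial Ω := X ^ 3 + C A * X + C B

theorem Phi_natDegree {Ω : Type*} [Field Ω] (A B : Ω) : (Phi A B).natDegree = 3 := by
  unfold Phi; compute_degree!

theorem Phi_ne {Ω : Type*} [Field Ω] (A B : Ω) : Phi A B ≠ 0 := by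
  intro h; have := Phi_natDegree A B; rw [h] at this; simp at this

theorem parity {Ω : Type*} [Field Ω] (A B : Ω) {p q : Polynomial Ω} (h : p ^ 2 = q ^ 2 * Phi A B) :
    p = 0 ∧ q = 0 := by
  by_cases hq : q = 0
  · subst hq; simp at h; exact ⟨h, rfl⟩
  · exfalso
    have := congrArg natDegree h
    rw [natDegree_pow, natDegree_mul (pow_ne_zero 2 hq) (Phi_ne A B), natDegree_pow,
      Phi_natDegree] at this
    omega

namespace EF
variable {Ω F : Type*} [Field Ω] [Field F] [Algebra Ω F] {A B : Ω} {x w : F}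

theorem eqPhi (h : EF Ω F A B x w) : w ^ 2 = aeval x (Phi A B) := by
  rw [h.eq]; simp [Phi]

theorem inj (h : EF Ω F A B x w) {p : Polynomial Ω} (hp : aeval x p = 0) : p = 0 := by
  have := transcendental_iff_injective.1 h.tr
  exact this (by simpa using hp)

theorem ne (h : EF Ω F A B x w) {p : Polynomial Ω} (hp : p ≠ 0) : aeval x p ≠ 0 :=
  fun h' => hp (h.inj h')

theorem indep' (eq : w ^ 2 = x ^ 3 + algebraMap Ω F A * x + algebraMap Ω F B)
    (tr : Transcendental Ω x) {p q : Polynomial Ω} (hp : aeval x p + aeval x q * w = 0) :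
    p = 0 ∧ q = 0 := by
  apply parity A B
  have h1 : aeval x (p ^ 2 - q ^ 2 * Phi A B) = 0 := by
    have : aeval x (Phi A B) = w ^ 2 := by rw [eq]; simp [Phi]
    simp only [map_sub, map_mul, map_pow, this]
    linear_combination (aeval x p - aeval x q * w) * hp
  have := transcendental_iff_injective.1 tr (h1.trans (map_zero _).symm)
  exact sub_eq_zero.1 this

theorem indep (h : EF Ω F A B x w) {p q : Polynomial Ω} (hp : aeval x p + aeval x q * w = 0) :
    p = 0 ∧ q = 0 := indep' h.eq h.tr hp

theorem adjoin_rep (eq : w ^ 2 = x ^ 3 + algebraMap Ω F A * x + algebraMap Ω F B) {z : F}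
    (hz : z ∈ Algebra.adjoin Ω {x, w}) : ∃ p q : Polynomial Ω, z = aeval x p + aeval x q * w := by
  induction hz using Algebra.adjoin_induction with
  | mem z hz =>
    rcases hz with rfl | rfl
    · exact ⟨X, 0, by simp⟩
    · exact ⟨0, 1, by simp⟩
  | algebraMap r => exact ⟨C r, 0, by simp⟩
  | add a b _ _ ha hb =>
    obtain ⟨p, q, rfl⟩ := ha
    obtain ⟨p', q', rfl⟩ := hb
    exact ⟨p + p', q + q', by simp; ring⟩
  | mul a b _ _ ha hb =>
    obtain ⟨p, q, rfl⟩ := ha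
    obtain ⟨p', q', rfl⟩ := hb
    refine ⟨p * p' + q * q' * Phi A B, p * q' + q * p', ?_⟩
    have : aeval x (Phi A B) = w ^ 2 := by rw [eq]; simp [Phi]
    simp only [map_add, map_mul, this]; ring

theorem rep (h : EF Ω F A B x w) (z : F) : ∃ p q d : Polynomial Ω, d ≠ 0 ∧
    z * aeval x d = aeval x p + aeval x q * w := by
  have hz : z ∈ IntermediateField.adjoin Ω {x, w} := by rw [h.gen]; trivial
  obtain ⟨r, hr, s, hs, rfl⟩ := IntermediateField.mem_adjoin_iff_div.1 hz
  obtain ⟨p, q, rfl⟩ := adjoin_rep h.eq hr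
  obtain ⟨p', q', rfl⟩ := adjoin_rep h.eq hs
  by_cases h0 : aeval x p' + aeval x q' * w = 0
  · exact ⟨0, 0, 1, one_ne_zero, by rw [h0]; simp⟩
  · refine ⟨p * p' - q * q' * Phi A B, q * p' - p * q', p' ^ 2 - q' ^ 2 * Phi A B, ?_, ?_⟩
    · intro h1
      obtain ⟨rfl, rfl⟩ := parity A B (sub_eq_zero.1 h1)
      simp at h0
    · rw [div_mul_eq_mul_div, div_eq_iff h0]
      simp only [map_sub, map_mul, map_pow, ← h.eqPhi]; ring

/-- the coordinate ring -/
noncomputable abbrev hpoly (A B : Ω) : Polynomial (Polynomial Ω) := X ^ 2 - C (Phi A B)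

theorem hpoly_monic : (hpoly A B).Monic := monic_X_pow_sub_C _ two_ne_zero

theorem coord_rep (r : AdjoinRoot (hpoly A B)) : ∃ p q : Polynomial Ω,
    r = AdjoinRoot.of _ p + AdjoinRoot.of _ q * AdjoinRoot.root _ := by
  obtain ⟨s, rfl⟩ := AdjoinRoot.mk_surjective r
  have h1 : (s %ₘ hpoly A B).natDegree ≤ 1 := by
    have := natDegree_modByMonic_lt s (hpoly_monic (A := A) (B := B)) (by
      intro h
      have := congrArg natDegree h
      rw [natDegree_X_pow_sub_C] at this; simp at this)
    rw [natDegree_X_pow_sub_C] at this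
    omega
  obtain ⟨q, p, hpq⟩ := exists_eq_X_add_C_of_natDegree_le_one h1
  refine ⟨p, q, ?_⟩
  conv_lhs => rw [← modByMonic_add_div s (hpoly A B), hpq]
  simp only [map_add, map_mul, AdjoinRoot.mk_self, zero_mul, add_zero, AdjoinRoot.mk_C,
    AdjoinRoot.mk_X]
  ring

/-- evaluation from the coordinate ring -/
noncomputable def ev {T : Type*} [CommRing T] [Algebra Ω T] {X' W' : T}
    (eq : W' ^ 2 = X' ^ 3 + algebraMap Ω T A * X' + algebraMap Ω T B) :
    AdjoinRoot (hpoly A B) →ₐ[Ω] T :=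
  AdjoinRoot.liftAlgHom (hpoly A B) (aeval X') W' (by
    rw [hpoly, eval₂_sub, eval₂_pow, eval₂_X, eval₂_C]; simp [Phi, eq])

theorem ev_rep {T : Type*} [CommRing T] [Algebra Ω T] {X' W' : T}
    (eq : W' ^ 2 = X' ^ 3 + algebraMap Ω T A * X' + algebraMap Ω T B) (p q : Polynomial Ω) :
    ev eq (AdjoinRoot.of _ p + AdjoinRoot.of _ q * AdjoinRoot.root _) =
      aeval X' p + aeval X' q * W' := by
  simp [ev]

theorem frac (h : EF Ω F A B x w) :
    letI := (ev h.eq).toRingHom.toAlgebra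
    IsFractionRing (AdjoinRoot (hpoly A B)) F := by
  letI := (ev h.eq).toRingHom.toAlgebra
  have hinj : Function.Injective (algebraMap (AdjoinRoot (hpoly A B)) F) := by
    rw [injective_iff_map_eq_zero]
    intro r hr
    obtain ⟨p, q, rfl⟩ := coord_rep r
    change ev h.eq _ = 0 at hr
    rw [ev_rep] at hr
    obtain ⟨rfl, rfl⟩ := h.indep hr
    simp
  have : FaithfulSMul (AdjoinRoot (hpoly A B)) F :=
    (faithfulSMul_iff_algebraMap_injective _ _).2 hinj
  apply IsFractionRing.of_field
  intro z
  obtain ⟨p, q, d, hd, hz⟩ := h.rep z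
  refine ⟨AdjoinRoot.of _ p + AdjoinRoot.of _ q * AdjoinRoot.root _, AdjoinRoot.of _ d, ?_⟩
  change _ = ev h.eq _ / ev h.eq _
  have h2 := ev_rep h.eq d 0
  simp only [map_zero, zero_mul, add_zero] at h2
  rw [ev_rep, h2, eq_div_iff (h.ne hd), hz]

theorem lift (h : EF Ω F A B x w) {F' : Type*} [Field F'] [Algebra Ω F'] {x' w' : F'}
    (eq' : w' ^ 2 = x' ^ 3 + algebraMap Ω F' A * x' + algebraMap Ω F' B)
    (tr' : Transcendental Ω x') : ∃ φ : F →ₐ[Ω] F', φ x = x' ∧ φ w = w' := by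
  letI := (ev h.eq).toRingHom.toAlgebra
  have := h.frac
  have : IsScalarTower Ω (AdjoinRoot (hpoly A B)) F := IsScalarTower.of_algHom (ev h.eq)
  have hg : Function.Injective (ev eq') := by
    rw [injective_iff_map_eq_zero]
    intro r hr
    obtain ⟨p, q, rfl⟩ := coord_rep r
    rw [ev_rep] at hr
    obtain ⟨rfl, rfl⟩ := indep' eq' tr' hr
    simp
  have key : ∀ r, (IsFractionRing.liftAlgHom hg : F →ₐ[Ω] F') (ev h.eq r) = ev eq' r := fun r =>
    IsFractionRing.lift_algebraMap (A := AdjoinRoot (hpoly A B)) (K := F)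
      (g := (ev eq').toRingHom) hg r
  refine ⟨IsFractionRing.liftAlgHom hg, ?_, ?_⟩
  · have := key (AdjoinRoot.of _ X + AdjoinRoot.of _ 0 * AdjoinRoot.root _)
    rw [ev_rep, ev_rep] at this; simpa using this
  · have := key (AdjoinRoot.of _ 0 + AdjoinRoot.of _ 1 * AdjoinRoot.root _)
    rw [ev_rep, ev_rep] at this; simpa using this

theorem exists_D (h : EF Ω F A B x w) : ∃ D : Derivation Ω F F, D x = 2 * w ∧
    D w = 3 * x ^ 2 + algebraMap Ω F A := by
  letI := (ev h.eq).toRingHom.toAlgebra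
  have := h.frac
  have : IsScalarTower Ω (AdjoinRoot (hpoly A B)) F := IsScalarTower.of_algHom (ev h.eq)
  let X' : TrivSqZeroExt F F := TrivSqZeroExt.inl x + TrivSqZeroExt.inr (2 * w)
  let W' : TrivSqZeroExt F F := TrivSqZeroExt.inl w + TrivSqZeroExt.inr (3 * x ^ 2 + algebraMap Ω F A)
  have eq' : W' ^ 2 = X' ^ 3 + algebraMap Ω _ A * X' + algebraMap Ω _ B := by
    ext
    · simp [X', W', h.eq, pow_two, pow_succ, TrivSqZeroExt.algebraMap_eq_inl']
      linear_combination h.eq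
    · simp [X', W', pow_two, pow_succ, TrivSqZeroExt.algebraMap_eq_inl']
      ring
  let φ := ev eq'
  have hfst : ∀ r, (φ r).fst = algebraMap (AdjoinRoot (hpoly A B)) F r := by
    have : (TrivSqZeroExt.fstHom Ω F F).comp φ = ev h.eq := by
      apply AdjoinRoot.algHom_ext'
      · apply Polynomial.algHom_ext
        have := ev_rep eq' X 0
        have h2 := ev_rep h.eq X 0
        simp at this h2
        change TrivSqZeroExt.fst (ev eq' (AdjoinRoot.of _ X)) = ev h.eq (AdjoinRoot.of _ X)
        rw [this, h2]; simp [X']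
      · have := ev_rep eq' 0 1
        have h2 := ev_rep h.eq 0 1
        simp at this h2
        change TrivSqZeroExt.fst (ev eq' (AdjoinRoot.root _)) = ev h.eq (AdjoinRoot.root _)
        rw [this, h2]; simp [W']
    intro r
    exact DFunLike.congr_fun this r
  obtain ⟨D, hD⟩ := exists_derivation φ hfst
  refine ⟨D, ?_, ?_⟩
  · have := hD (AdjoinRoot.of _ X + AdjoinRoot.of _ 0 * AdjoinRoot.root _)
    change D (ev h.eq _) = (ev eq' _).snd at this
    rw [ev_rep, ev_rep] at this; simpa [X'] using this
  · have := hD (AdjoinRoot.of _ 0 + AdjoinRoot.of _ 1 * AdjoinRoot.root _)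
    change D (ev h.eq _) = (ev eq' _).snd at this
    rw [ev_rep, ev_rep] at this; simpa [W'] using this
end EF
end Cr

namespace Cr
open Polynomial

section Core
variable {Ω F : Type*} [Field Ω] [Field F] [Algebra Ω F]

theorem vle (O : ValuationSubring F) {z : F} : O.valuation z ≤ 1 ↔ z ∈ O := O.valuation_le_one_iff z

theorem vlt_add (O : ValuationSubring F) {a b : F} (ha : O.valuation a < 1) (hb : O.valuation b < 1) :
    O.valuation (a + b) < 1 := (O.valuation.map_add a b).trans_lt (max_lt ha hb)

theorem vlt_sub (O : ValuationSubring F) {a b : F} (ha : O.valuation a < 1) (hb : O.valuation b < 1) :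
    O.valuation (a - b) < 1 := (O.valuation.map_sub a b).trans_lt (max_lt ha hb)

theorem vlt_mul (O : ValuationSubring F) {a b : F} (ha : O.valuation a < 1) (hb : b ∈ O) :
    O.valuation (a * b) < 1 := by
  rw [map_mul]; exact mul_lt_one_of_lt_of_le ha ((vle O).2 hb)

theorem vlt_mul' (O : ValuationSubring F) {a b : F} (ha : a ∈ O) (hb : O.valuation b < 1) :
    O.valuation (a * b) < 1 := by
  rw [mul_comm]; exact vlt_mul O hb ha

theorem mem_of_vlt (O : ValuationSubring F) {a : F} (ha : O.valuation a < 1) : a ∈ O :=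
  (vle O).1 ha.le

theorem inv_mem_of_v1 (O : ValuationSubring F) {a : F} (ha : O.valuation a = 1) : a⁻¹ ∈ O := by
  rw [← vle, map_inv₀, ha, inv_one]

theorem v1_or (O : ValuationSubring F) {a : F} (ha : a ∈ O) :
    O.valuation a = 1 ∨ O.valuation a < 1 := by
  rcases ((vle O).2 ha).lt_or_eq with h | h <;> tauto

theorem inv_vlt (O : ValuationSubring F) {a : F} (ha : a ∉ O) : O.valuation a⁻¹ < 1 := by
  rw [← vle, not_le] at ha
  rw [map_inv₀]
  exact inv_lt_one_of_one_lt₀ ha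

theorem v1_add (O : ValuationSubring F) {a b : F} (ha : O.valuation a = 1)
    (hb : O.valuation b < 1) : O.valuation (a + b) = 1 := by
  rw [Valuation.map_add_eq_of_lt_left _ (by rw [ha]; exact hb), ha]

theorem v1_mul (O : ValuationSubring F) {a b : F} (ha : O.valuation a = 1)
    (hb : O.valuation b = 1) : O.valuation (a * b) = 1 := by rw [map_mul, ha, hb, one_mul]

theorem vlt_of_pow (O : ValuationSubring F) {a : F} {n : ℕ} (h : O.valuation (a ^ n) < 1) :
    O.valuation a < 1 := by
  by_contra h1
  rw [map_pow] at h
  exact absurd h (not_lt.2 (one_le_pow_of_one_le' (not_lt.1 h1) n))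

/-- the expansion of elements of `Ω[p,q]`. -/
theorem expand {p q : F} (p0 q0 : Ω) {r : F} (hr : r ∈ Algebra.adjoin Ω {p, q}) :
    ∃ c : Ω, ∃ r1 ∈ Algebra.adjoin Ω {p, q}, ∃ r2 ∈ Algebra.adjoin Ω {p, q},
      r = algebraMap Ω F c + (p - algebraMap Ω F p0) * r1 + (q - algebraMap Ω F q0) * r2 := by
  induction hr using Algebra.adjoin_induction with
  | mem z hz =>
    rcases hz with rfl | rfl
    · exact ⟨p0, 1, one_mem _, 0, zero_mem _, by ring⟩
    · exact ⟨q0, 0, zero_mem _, 1, one_mem _, by ring⟩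
  | algebraMap r => exact ⟨r, 0, zero_mem _, 0, zero_mem _, by ring⟩
  | add a b _ _ ha hb =>
    obtain ⟨c, r1, h1, r2, h2, rfl⟩ := ha
    obtain ⟨c', r1', h1', r2', h2', rfl⟩ := hb
    exact ⟨c + c', r1 + r1', add_mem h1 h1', r2 + r2', add_mem h2 h2', by rw [map_add]; ring⟩
  | mul a b hma hmb ha hb =>
    obtain ⟨c, r1, h1, r2, h2, e⟩ := ha
    obtain ⟨c', r1', h1', r2', h2', e'⟩ := hb
    have hc := Subalgebra.algebraMap_mem (Algebra.adjoin Ω {p, q}) c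
    refine ⟨c * c', algebraMap Ω F c * r1' + r1 * b, add_mem (mul_mem hc h1') (mul_mem h1 hmb),
      algebraMap Ω F c * r2' + r2 * b, add_mem (mul_mem hc h2') (mul_mem h2 hmb), ?_⟩
    rw [map_mul]
    linear_combination (b) * e + algebraMap Ω F c * e'

theorem adjoin_le_O {S : Set F} (O : ValuationSubring F) (hO : ∀ c : Ω, algebraMap Ω F c ∈ O)
    (hS : ∀ s ∈ S, s ∈ O) {r : F} (hr : r ∈ Algebra.adjoin Ω S) : r ∈ O := by
  induction hr using Algebra.adjoin_induction with
  | mem z hz => exact hS z hz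
  | algebraMap r => exact hO r
  | add a b _ _ ha hb => exact add_mem ha hb
  | mul a b _ _ ha hb => exact mul_mem ha hb

theorem D_adjoin {S : Set F} (D : Derivation Ω F F) (hD : ∀ s ∈ S, D s ∈ Algebra.adjoin Ω S) {r : F}
    (hr : r ∈ Algebra.adjoin Ω S) : D r ∈ Algebra.adjoin Ω S := by
  induction hr using Algebra.adjoin_induction with
  | mem z hz => exact hD z hz
  | algebraMap r => rw [D.map_algebraMap]; exact zero_mem _
  | add a b _ _ ha hb => rw [map_add]; exact add_mem ha hb
  | mul a b h1 h2 ha hb =>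
    rw [D.leibniz]; exact add_mem (mul_mem h1 hb) (mul_mem h2 ha)

theorem core {p q : F} (O : ValuationSubring F) (hO : ∀ c : Ω, algebraMap Ω F c ∈ O)
    (p0 q0 : Ω) (hp : O.valuation (p - algebraMap Ω F p0) < 1)
    (hq : O.valuation (q - algebraMap Ω F q0) < 1)
    (gen : IntermediateField.adjoin Ω {p, q} = ⊤)
    {π d n1 n2 : F} (hπ : π ∈ Algebra.adjoin Ω {p, q}) (hd : d ∈ Algebra.adjoin Ω {p, q})
    (hn1 : n1 ∈ Algebra.adjoin Ω {p, q}) (hn2 : n2 ∈ Algebra.adjoin Ω {p, q})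
    (hπ1 : O.valuation π < 1) (hd1 : O.valuation d = 1)
    (h1 : (p - algebraMap Ω F p0) * d = π * n1) (h2 : (q - algebraMap Ω F q0) * d = π * n2) :
    ∀ z ∈ O, ∃ n ∈ Algebra.adjoin Ω {p, q}, ∃ d ∈ Algebra.adjoin Ω {p, q},
      O.valuation d = 1 ∧ z * d = n := by
  have hRO : ∀ r ∈ Algebra.adjoin Ω {p, q}, r ∈ O := fun r hr => by
    refine adjoin_le_O O hO ?_ hr
    rintro s (rfl | rfl)
    · have := add_mem (mem_of_vlt O hp) (hO p0); simpa using this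
    · have := add_mem (mem_of_vlt O hq) (hO q0); simpa using this
  refine loc _ (Subalgebra.fg_adjoin_finset (R := Ω) (A := F) ({p, q} : Set F).toFinite.toFinset |> fun h => by simpa using h) ?_ O hRO π hπ hπ1 ?_
  · intro z
    have hz : z ∈ IntermediateField.adjoin Ω {p, q} := by rw [gen]; trivial
    obtain ⟨r, hr, s, hs, rfl⟩ := IntermediateField.mem_adjoin_iff_div.1 hz
    by_cases h0 : s = 0
    · exact ⟨0, zero_mem _, 1, one_mem _, one_ne_zero, by simp [h0]⟩
    · exact ⟨r, hr, s, hs, h0, by field_simp⟩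
  · intro n hn hn1'
    obtain ⟨c, r1, hr1, r2, hr2, e⟩ := expand p0 q0 hn
    have hc : c = 0 := by
      by_contra hc
      have h3 := val_const O hO hc
      have h4 : algebraMap Ω F c = n - ((p - algebraMap Ω F p0) * r1 + (q - algebraMap Ω F q0) * r2) := by
        rw [e]; ring
      have h5 := vlt_sub O hn1' (vlt_add O (vlt_mul O hp (hRO _ hr1)) (vlt_mul O hq (hRO _ hr2)))
      rw [← h4, h3] at h5
      exact lt_irrefl _ h5
    refine ⟨d, hd, n1 * r1 + n2 * r2, add_mem (mul_mem hn1 hr1) (mul_mem hn2 hr2), hd1, ?_⟩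
    rw [e, hc, map_zero]
    linear_combination r1 * h1 + r2 * h2

theorem core_D {S : Set F} (O : ValuationSubring F) (hO : ∀ c : Ω, algebraMap Ω F c ∈ O)
    (hS : ∀ s ∈ S, s ∈ O)
    (D : Derivation Ω F F) (hD : ∀ s ∈ S, D s ∈ Algebra.adjoin Ω S)
    (hc : ∀ z ∈ O, ∃ n ∈ Algebra.adjoin Ω S, ∃ d ∈ Algebra.adjoin Ω S,
      O.valuation d = 1 ∧ z * d = n) : ∀ z ∈ O, D z ∈ O := by
  intro z hz
  obtain ⟨n, hn, d, hd, hd1, e⟩ := hc z hz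
  have h0 : d ≠ 0 := fun h => by rw [h] at hd1; simp at hd1
  have h1 := congrArg D e
  rw [D.leibniz] at h1
  simp only [smul_eq_mul] at h1
  have h2 : D z = d⁻¹ * (D n - z * D d) := by
    rw [← h1]; field_simp; ring
  rw [h2]
  have hR : ∀ r ∈ Algebra.adjoin Ω S, r ∈ O := fun r hr => adjoin_le_O O hO hS hr
  exact mul_mem (inv_mem_of_v1 O hd1) (sub_mem (hR _ (D_adjoin D hD hn))
    (mul_mem hz (hR _ (D_adjoin D hD hd))))

theorem core_res {p q : F} (O : ValuationSubring F) (hO : ∀ c : Ω, algebraMap Ω F c ∈ O)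
    (p0 q0 : Ω) (hp : O.valuation (p - algebraMap Ω F p0) < 1)
    (hq : O.valuation (q - algebraMap Ω F q0) < 1)
    {r : F} (hr : r ∈ Algebra.adjoin Ω {p, q}) :
    ∃ c : Ω, ∀ O : ValuationSubring F, (∀ c : Ω, algebraMap Ω F c ∈ O) →
      O.valuation (p - algebraMap Ω F p0) < 1 → O.valuation (q - algebraMap Ω F q0) < 1 →
      O.valuation (r - algebraMap Ω F c) < 1 := by
  obtain ⟨c, r1, hr1, r2, hr2, e⟩ := expand p0 q0 hr
  refine ⟨c, fun O hO hp hq => ?_⟩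
  have hRO : ∀ r ∈ Algebra.adjoin Ω {p, q}, r ∈ O := fun r hr => by
    refine adjoin_le_O O hO ?_ hr
    rintro s (rfl | rfl)
    · have := add_mem (mem_of_vlt O hp) (hO p0); simpa using this
    · have := add_mem (mem_of_vlt O hq) (hO q0); simpa using this
  have : r - algebraMap Ω F c = ((p - algebraMap Ω F p0) * r1 + (q - algebraMap Ω F q0) * r2) := by
        rw [e]; ring
  rw [this]
  exact (vlt_add O (vlt_mul O hp (hRO _ hr1)) (vlt_mul O hq (hRO _ hr2)))

theorem core_res' {p q : F} (O : ValuationSubring F) (hO : ∀ c : Ω, algebraMap Ω F c ∈ O)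
    (p0 q0 : Ω) (hp : O.valuation (p - algebraMap Ω F p0) < 1)
    (hq : O.valuation (q - algebraMap Ω F q0) < 1)
    (hc : ∀ z ∈ O, ∃ n ∈ Algebra.adjoin Ω {p, q}, ∃ d ∈ Algebra.adjoin Ω {p, q},
      O.valuation d = 1 ∧ z * d = n) {z : F} (hz : z ∈ O) :
    ∃ c : Ω, ∀ O : ValuationSubring F, (∀ c : Ω, algebraMap Ω F c ∈ O) →
      O.valuation (p - algebraMap Ω F p0) < 1 → O.valuation (q - algebraMap Ω F q0) < 1 →
      O.valuation (z - algebraMap Ω F c) < 1 := by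
  obtain ⟨n, hn, d, hd, hd1, e⟩ := hc z hz
  obtain ⟨cn, hcn⟩ := core_res O hO p0 q0 hp hq hn
  obtain ⟨cd, hcd⟩ := core_res O hO p0 q0 hp hq hd
  have hcd0 : cd ≠ 0 := by
    rintro rfl
    have := hcd O hO hp hq
    rw [map_zero, sub_zero, hd1] at this
    exact lt_irrefl _ this
  refine ⟨cn / cd, fun O' hO' hp' hq' => ?_⟩
  have h1 := hcn O' hO' hp' hq'
  have h2 := hcd O' hO' hp' hq'
  have h0 : d ≠ 0 := fun h => by rw [h] at hd1; simp at hd1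
  have hcd0' : algebraMap Ω F cd ≠ 0 := by simpa using hcd0
  have h3 : O'.valuation d = 1 := by
    have := v1_add O' (val_const O' hO' hcd0) h2
    simpa using this
  have h4 : z - algebraMap Ω F (cn / cd) = d⁻¹ * ((n - algebraMap Ω F cn) -
      algebraMap Ω F (cn / cd) * (d - algebraMap Ω F cd)) := by
    rw [map_div₀]; field_simp; rw [← e]; ring
  rw [h4]
  exact vlt_mul' O' (inv_mem_of_v1 O' h3) (vlt_sub O' h1 (vlt_mul' O' (hO' _) h2))

end Core
end Cr

namespace Cr
open Polynomial

theorem adj2_congr {Ω F : Type*} [Field Ω] [Field F] [Algebra Ω F] {a b c d : F}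
    (hg : IntermediateField.adjoin Ω {a, b} = ⊤) (ha : a ∈ IntermediateField.adjoin Ω {c, d})
    (hb : b ∈ IntermediateField.adjoin Ω {c, d}) : IntermediateField.adjoin Ω {c, d} = ⊤ := by
  rw [eq_top_iff, ← hg, IntermediateField.adjoin_le_iff]
  rintro z (rfl | rfl) <;> assumption

theorem eq_top_of_forall_mem {F : Type*} [Field F] (O : ValuationSubring F) (h : ∀ z, z ∈ O) : O = ⊤ := by
  ext z; simpa using h z

namespace EF
variable {Ω F : Type*} [Field Ω] [Field F] [Algebra Ω F] {A B : Ω} {x w : F}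

theorem w_mem (h : EF Ω F A B x w) (O : ValuationSubring F) (hO : ∀ c : Ω, algebraMap Ω F c ∈ O)
    (hx : x ∈ O) : w ∈ O := by
  rw [← vle]
  by_contra h1
  have h2 : w ^ 2 ∈ O := by
    rw [h.eq]; exact add_mem (add_mem (pow_mem hx 3) (mul_mem (hO _) hx)) (hO _)
  rw [← vle, map_pow] at h2
  exact absurd h2 (not_le.2 (one_lt_pow₀ (not_le.1 h1) two_ne_zero))

theorem poly_val [IsAlgClosed Ω] (O : ValuationSubring F)
    (hc : ∀ c : Ω, O.valuation (x - algebraMap Ω F c) = 1) (hO : ∀ c : Ω, algebraMap Ω F c ∈ O)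
    (p : Polynomial Ω) (hp : p ≠ 0) : O.valuation (aeval x p) = 1 := by
  have hs := IsAlgClosed.splits p
  rw [hs.eq_prod_roots, map_mul, aeval_C, map_mul, val_const O hO (leadingCoeff_ne_zero.2 hp), one_mul]
  rw [map_multiset_prod, Multiset.map_map, map_multiset_prod, Multiset.map_map]
  apply Multiset.prod_eq_one
  intro y hy
  obtain ⟨r, _, rfl⟩ := Multiset.mem_map.1 hy
  simpa using hc r

theorem exists_res [IsAlgClosed Ω] (h : EF Ω F A B x w) (O : ValuationSubring F)
    (hO : ∀ c : Ω, algebraMap Ω F c ∈ O) (hx : x ∈ O) (hT : O ≠ ⊤) :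
    ∃ c : Ω, O.valuation (x - algebraMap Ω F c) < 1 := by
  by_contra! hc
  apply hT
  have hc' : ∀ c : Ω, O.valuation (x - algebraMap Ω F c) = 1 := fun c =>
    le_antisymm ((vle O).2 (sub_mem hx (hO c))) (hc c)
  apply eq_top_of_forall_mem
  intro z
  obtain ⟨p, q, d, hd, e⟩ := h.rep z
  have hxp : ∀ p : Polynomial Ω, aeval x p ∈ O := fun p => by
    by_cases hp : p = 0
    · rw [hp]; simp
    · rw [← vle, poly_val O hc' hO p hp]
  have h1 := poly_val O hc' hO d hd
  have h2 : z = (aeval x p + aeval x q * w) * (aeval x d)⁻¹ := by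
    rw [← e]; have := h.ne hd; field_simp
  rw [h2]
  exact mul_mem (add_mem (hxp _) (mul_mem (hxp _) (h.w_mem O hO hx))) (inv_mem_of_v1 O h1)

/-- chart at infinity: `a = x/w`, `b = 1/w`. -/
theorem inf_chart (h : EF Ω F A B x w) (O : ValuationSubring F)
    (hO : ∀ c : Ω, algebraMap Ω F c ∈ O) (hx : x ∉ O) :
    w ≠ 0 ∧ O.valuation (x / w) < 1 ∧ O.valuation (1 / w) < 1 := by
  have hx0 : x ≠ 0 := by rintro rfl; exact hx (zero_mem O)
  have hi := inv_vlt O hx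
  have hu : O.valuation (1 + algebraMap Ω F A * (x⁻¹) ^ 2 + algebraMap Ω F B * (x⁻¹) ^ 3) = 1 := by
    rw [add_assoc]
    apply v1_add O (map_one _)
    have hm := mem_of_vlt O hi
    apply vlt_add O
    · rw [pow_two, ← mul_assoc]; exact vlt_mul' O (mul_mem (hO _) hm) hi
    · rw [pow_succ, ← mul_assoc]; exact vlt_mul' O (mul_mem (hO _) (pow_mem hm 2)) hi
  have e : w ^ 2 = x ^ 3 * (1 + algebraMap Ω F A * (x⁻¹) ^ 2 + algebraMap Ω F B * (x⁻¹) ^ 3) := by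
    rw [h.eq]; field_simp
  have hw : w ≠ 0 := by
    rintro rfl
    have h3 : (1 + algebraMap Ω F A * (x⁻¹) ^ 2 + algebraMap Ω F B * (x⁻¹) ^ 3) = 0 := by
      have := e.symm; simpa [hx0] using this
    rw [h3] at hu; simp at hu
  have ha : O.valuation (x / w) < 1 := by
    apply vlt_of_pow O (n := 2)
    have : (x / w) ^ 2 = x⁻¹ * (1 + algebraMap Ω F A * (x⁻¹) ^ 2 + algebraMap Ω F B * (x⁻¹) ^ 3)⁻¹ := by
      have hne : (1 + algebraMap Ω F A * (x⁻¹) ^ 2 + algebraMap Ω F B * (x⁻¹) ^ 3) ≠ 0 := by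
        intro h3; rw [h3] at hu; simp at hu
      rw [div_pow, e, ← mul_inv, div_eq_iff (mul_ne_zero (pow_ne_zero 3 hx0) hne)]
      generalize (1 + algebraMap Ω F A * (x⁻¹) ^ 2 + algebraMap Ω F B * (x⁻¹) ^ 3) = u at hne
      field_simp
    rw [this]; exact vlt_mul O hi (inv_mem_of_v1 O hu)
  refine ⟨hw, ha, ?_⟩
  have : 1 / w = (x / w) * x⁻¹ := by field_simp
  rw [this]; exact vlt_mul' O (mem_of_vlt O ha) hi

theorem chart [IsAlgClosed Ω] [CharZero Ω] (h : EF Ω F A B x w) (hd : 4 * A ^ 3 + 27 * B ^ 2 ≠ 0)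
    {D : Derivation Ω F F} (hDx : D x = 2 * w) (hDw : D w = 3 * x ^ 2 + algebraMap Ω F A)
    (O : ValuationSubring F) (hO : ∀ c : Ω, algebraMap Ω F c ∈ O) (hT : O ≠ ⊤) :
    (∀ z ∈ O, D z ∈ O) ∧ (∀ z ∈ O, ∃ c : Ω, O.valuation (z - algebraMap Ω F c) < 1 ∧
      (x ∉ O → ∀ O' : ValuationSubring F, (∀ c : Ω, algebraMap Ω F c ∈ O') → x ∉ O' →
        O'.valuation (z - algebraMap Ω F c) < 1)) := by
  by_cases hx : x ∈ O
  · have hw := h.w_mem O hO hx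
    obtain ⟨x0, hx0⟩ := h.exists_res O hO hx hT
    obtain ⟨w0, hw0⟩ := IsAlgClosed.exists_pow_nat_eq (x0 ^ 3 + A * x0 + B) (n := 2) two_pos
    have hfac : (w - algebraMap Ω F w0) * (w + algebraMap Ω F w0) =
        (x - algebraMap Ω F x0) * (x ^ 2 + x * algebraMap Ω F x0 + algebraMap Ω F x0 ^ 2 + algebraMap Ω F A) := by
      have := congrArg (algebraMap Ω F) hw0
      simp only [map_pow, map_add, map_mul] at this
      linear_combination h.eq - this
    obtain ⟨w0, hw0, hv, hfac⟩ : ∃ w0 : Ω, w0 ^ 2 = (x0 ^ 3 + A * x0 + B) ∧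
        O.valuation (w - algebraMap Ω F w0) < 1 ∧
        (w - algebraMap Ω F w0) * (w + algebraMap Ω F w0) =
        (x - algebraMap Ω F x0) * (x ^ 2 + x * algebraMap Ω F x0 + algebraMap Ω F x0 ^ 2 + algebraMap Ω F A) := by
      have h1 : O.valuation ((w - algebraMap Ω F w0) * (w + algebraMap Ω F w0)) < 1 := by
        rw [hfac]
        exact vlt_mul O hx0 (add_mem (add_mem (add_mem (pow_mem hx 2) (mul_mem hx (hO _)))
          (pow_mem (hO _) 2)) (hO _))
      rcases v1_or O (sub_mem hw (hO w0)) with h2 | h2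
      · refine ⟨-w0, by rw [← hw0]; ring, ?_, ?_⟩
        · rw [map_mul, h2, one_mul] at h1; simpa using h1
        · rw [← hfac]; simp; ring
      · exact ⟨w0, hw0, h2, hfac⟩
    have hxm : x ∈ Algebra.adjoin Ω {x, w} := Algebra.subset_adjoin (by simp)
    have hwm : w ∈ Algebra.adjoin Ω {x, w} := Algebra.subset_adjoin (by simp)
    have hcm : ∀ c, algebraMap Ω F c ∈ Algebra.adjoin Ω {x, w} := fun c => Subalgebra.algebraMap_mem _ c
    have hG : x ^ 2 + x * algebraMap Ω F x0 + algebraMap Ω F x0 ^ 2 + algebraMap Ω F A ∈ Algebra.adjoin Ω {x, w} :=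
      add_mem (add_mem (add_mem (pow_mem hxm 2) (mul_mem hxm (hcm _)))
          (pow_mem (hcm _) 2)) (hcm _)
    have hloc : ∀ z ∈ O, ∃ n ∈ Algebra.adjoin Ω {x, w}, ∃ d ∈ Algebra.adjoin Ω {x, w},
      O.valuation d = 1 ∧ z * d = n := by
      by_cases hw00 : w0 = 0
      · subst hw00
        refine core O hO x0 0 hx0 hv h.gen (π := w) (d := x ^ 2 + x * algebraMap Ω F x0 + algebraMap Ω F x0 ^ 2 + algebraMap Ω F A)
          (n1 := w) (n2 := x ^ 2 + x * algebraMap Ω F x0 + algebraMap Ω F x0 ^ 2 + algebraMap Ω F A) hwm hG hwm hG (by simpa using hv) ?_ ?_ ?_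
        · have hne : 3 * x0 ^ 2 + A ≠ 0 := by
            intro h3
            apply hd
            have hA : A = - 3 * x0 ^ 2 := by linear_combination h3
            have hB : B = 2 * x0 ^ 3 := by rw [hA] at hw0; linear_combination - hw0
            rw [hA, hB]; ring
          have h4 : x ^ 2 + x * algebraMap Ω F x0 + algebraMap Ω F x0 ^ 2 + algebraMap Ω F A =
            algebraMap Ω F (3 * x0 ^ 2 + A) + (x - algebraMap Ω F x0) * (x + 2 * algebraMap Ω F x0) := by
            simp only [map_add, map_mul, map_pow, map_ofNat]; ring
          rw [h4]
          refine v1_add O (val_const O hO hne) (vlt_mul O hx0 (add_mem hx (mul_mem ?_ (hO _))))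
          have := hO 2; simpa using this
        · rw [← hfac]; simp
        · simp
      · refine core O hO x0 w0 hx0 hv h.gen (π := x - algebraMap Ω F x0) (d := w + algebraMap Ω F w0)
          (n1 := w + algebraMap Ω F w0) (n2 := x ^ 2 + x * algebraMap Ω F x0 + algebraMap Ω F x0 ^ 2 + algebraMap Ω F A)
          (sub_mem hxm (hcm _)) (add_mem hwm (hcm _)) (add_mem hwm (hcm _)) hG hx0 ?_ rfl hfac
        have h4 : w + algebraMap Ω F w0 = algebraMap Ω F (2 * w0) + (w - algebraMap Ω F w0) := by
          simp only [map_add, map_mul, map_pow, map_ofNat]; ring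
        rw [h4]
        exact v1_add O (val_const O hO (by simpa using hw00)) hv
    refine ⟨core_D O hO ?_ D ?_ hloc, fun z hz => ?_⟩
    · rintro s (rfl | rfl) <;> assumption
    · have h2m : ∀ n : ℕ, (n : F) ∈ Algebra.adjoin Ω {x, w} := fun n => natCast_mem _ n
      rintro s (rfl | rfl)
      · rw [hDx]; exact mul_mem (h2m 2) hwm
      · rw [hDw]; exact add_mem (mul_mem (h2m 3) (pow_mem hxm 2)) (hcm _)
    · obtain ⟨c, hc⟩ := core_res' O hO x0 w0 hx0 hv hloc hz
      exact ⟨c, hc O hO hx0 hv, fun h => absurd hx h⟩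
  · obtain ⟨hw, ha, hb⟩ := h.inf_chart O hO hx
    have hx0 : x ≠ 0 := by rintro rfl; exact hx (zero_mem O)
    have ham : x / w ∈ Algebra.adjoin Ω {x / w, 1 / w} := Algebra.subset_adjoin (by simp)
    have hbm : 1 / w ∈ Algebra.adjoin Ω {x / w, 1 / w} := Algebra.subset_adjoin (by simp)
    have hcm : ∀ c, algebraMap Ω F c ∈ Algebra.adjoin Ω {x / w, 1 / w} := fun c => Subalgebra.algebraMap_mem _ c
    have h2m : ∀ n : ℕ, (n : F) ∈ Algebra.adjoin Ω {x / w, 1 / w} := fun n => natCast_mem _ n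
    have hgen : IntermediateField.adjoin Ω {x / w, 1 / w} = ⊤ := by
      have h1 : x / w ∈ IntermediateField.adjoin Ω {x / w, 1 / w} := IntermediateField.subset_adjoin _ _ (by simp)
      have h2 : 1 / w ∈ IntermediateField.adjoin Ω {x / w, 1 / w} := IntermediateField.subset_adjoin _ _ (by simp)
      apply adj2_congr h.gen
      · have := div_mem h1 h2; field_simp at this; exact this
      · have := inv_mem h2; simpa using this
    have ha' : O.valuation (x / w - algebraMap Ω F 0) < 1 := by simpa using ha
    have hb' : O.valuation (1 / w - algebraMap Ω F 0) < 1 := by simpa using hb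
    -- b * (1 - A a b - B b^2) = a^3
    have hrel : (1 / w) * (1 - algebraMap Ω F A * (x / w) * (1 / w) - algebraMap Ω F B * (1 / w) ^ 2) = (x / w) * (x / w) ^ 2 := by
      field_simp; linear_combination h.eq
    have hdm : (1 - algebraMap Ω F A * (x / w) * (1 / w) - algebraMap Ω F B * (1 / w) ^ 2) ∈ Algebra.adjoin Ω {x / w, 1 / w} :=
      sub_mem (sub_mem (one_mem _) (mul_mem (mul_mem (hcm _) ham) hbm)) (mul_mem (hcm _) (pow_mem hbm 2))
    have haO := mem_of_vlt O ha
    have hbO := mem_of_vlt O hb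
    have hloc : ∀ z ∈ O, ∃ n ∈ Algebra.adjoin Ω {x / w, 1 / w}, ∃ d ∈ Algebra.adjoin Ω {x / w, 1 / w},
      O.valuation d = 1 ∧ z * d = n := by
      refine core O hO 0 0 ha' hb' hgen (π := x / w) (d := (1 - algebraMap Ω F A * (x / w) * (1 / w) - algebraMap Ω F B * (1 / w) ^ 2))
        (n1 := (1 - algebraMap Ω F A * (x / w) * (1 / w) - algebraMap Ω F B * (1 / w) ^ 2)) (n2 := (x / w) ^ 2)
        ham hdm hdm (pow_mem ham 2) ha ?_ (by simp) (by rw [map_zero, sub_zero]; exact hrel)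
      have : (1 - algebraMap Ω F A * (x / w) * (1 / w) - algebraMap Ω F B * (1 / w) ^ 2) =
        1 + (1 / w) * (- algebraMap Ω F A * (x / w) - algebraMap Ω F B * (1 / w)) := by ring
      rw [this]
      exact v1_add O (map_one _) (vlt_mul O hb (sub_mem (mul_mem (neg_mem (hO _)) haO) (mul_mem (hO _) hbO)))
    refine ⟨core_D O hO ?_ D ?_ hloc, fun z hz => ?_⟩
    · rintro s (rfl | rfl) <;> assumption
    · have hDb : D (1 / w) = - (3 * (x / w) ^ 2 + algebraMap Ω F A * (1 / w) ^ 2) := by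
        have h3 : D (1 / w * w) = 0 := by rw [one_div, inv_mul_cancel₀ hw]; simp
        rw [D.leibniz, hDw] at h3
        simp only [smul_eq_mul] at h3
        field_simp at h3 ⊢
        linear_combination h3
      rintro s (rfl | rfl)
      · have h3 : x / w = x * (1 / w) := by ring
        rw [h3, D.leibniz, hDb, hDx]
        have : x • -(3 * (x / w) ^ 2 + algebraMap Ω F A * (1 / w) ^ 2) + (1 / w) • (2 * w) =
          2 * algebraMap Ω F A * (x / w) * (1 / w) + 3 * algebraMap Ω F B * (1 / w) ^ 2 - 1 := by
          simp only [smul_eq_mul]; field_simp; linear_combination 3 * h.eq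
        rw [this, ← h3]
        exact sub_mem (add_mem (mul_mem (mul_mem (mul_mem (h2m 2) (hcm _)) ham) hbm)
          (mul_mem (mul_mem (h2m 3) (hcm _)) (pow_mem hbm 2))) (one_mem _)
      · rw [hDb]; exact neg_mem (add_mem (mul_mem (h2m 3) (pow_mem ham 2)) (mul_mem (hcm _) (pow_mem hbm 2)))
    · obtain ⟨c, hc⟩ := core_res' O hO 0 0 ha' hb' hloc hz
      refine ⟨c, hc O hO ha' hb', fun _ O' hO' hx' => ?_⟩
      obtain ⟨_, ha', hb'⟩ := h.inf_chart O' hO' hx'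
      exact hc O' hO' (by simpa using ha') (by simpa using hb')

end EF
end Cr

namespace Cr
open Polynomial

section Curve
variable {F : Type*} [Field F]

/-- the two functions -/
def gg {R : Type*} [CommRing R] (i : Bool) (x y : R) : R :=
  if i then x * y + x ^ 2 + y else x * y - 2 * x ^ 2 + 3 * x - 1

theorem y_mem (O : ValuationSubring F) {x y : F} (h : y ^ 2 + y = x ^ 3 - x ^ 2) (hx : x ∈ O) : y ∈ O := by
  by_contra hy
  have h1 := inv_vlt O hy
  have hy0 : y ≠ 0 := by rintro rfl; exact hy (zero_mem O)
  have h2 : O.valuation (1 + y⁻¹) = 1 := v1_add O (map_one _) h1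
  have h3 : (y⁻¹) ^ 2 * (x ^ 3 - x ^ 2) = 1 + y⁻¹ := by rw [← h]; field_simp
  rw [← h3] at h2
  have h4 : O.valuation ((y⁻¹) ^ 2 * (x ^ 3 - x ^ 2)) < 1 := by
    apply vlt_mul O _ (sub_mem (pow_mem hx 3) (pow_mem hx 2))
    rw [pow_two]; exact vlt_mul O h1 (mem_of_vlt O h1)
  exact absurd h2 h4.ne

theorem sw_chart (O : ValuationSubring F) {x y : F} (h : y ^ 2 + y = x ^ 3 - x ^ 2) (hx : x ∉ O) :
    x ≠ 0 ∧ y ≠ 0 ∧ O.valuation (x / y) < 1 ∧ O.valuation (1 / y) < 1 ∧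
      (1 / y) * (1 + 1 / y + (x / y) ^ 2) = (x / y) ^ 3 := by
  have hx0 : x ≠ 0 := by rintro rfl; exact hx (zero_mem O)
  have hi := inv_vlt O hx
  have hy : y ∉ O := fun hy => by
    have hu : O.valuation (1 + (-x⁻¹)) = 1 := v1_add O (map_one _) (by rwa [Valuation.map_neg])
    have hne : (1 + (-x⁻¹)) ≠ 0 := fun h => by rw [h] at hu; simp at hu
    have e : x = (y ^ 2 + y) * (x⁻¹) ^ 2 * (1 + (-x⁻¹))⁻¹ := by
      rw [h, eq_mul_inv_iff_mul_eq₀ hne]; field_simp; ring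
    apply hx; rw [e]
    exact mul_mem (mul_mem (add_mem (pow_mem hy 2) hy) (pow_mem (mem_of_vlt O hi) 2)) (inv_mem_of_v1 O hu)
  have hy0 : y ≠ 0 := by rintro rfl; exact hy (zero_mem O)
  have hb : O.valuation (1 / y) < 1 := by rw [one_div]; exact inv_vlt O hy
  have hbm := mem_of_vlt O hb
  have rel : (1 / y) * (1 + 1 / y + (x / y) ^ 2) = (x / y) ^ 3 := by
    field_simp; linear_combination h
  have hs : x / y ∈ O := by
    by_contra hs
    have h1 := inv_vlt O hs
    have hm := mem_of_vlt O h1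
    have e : (1 : F) = (x / y)⁻¹ * ((1 / y) * (1 + 1 / y) * ((x / y)⁻¹) ^ 2 + (1 / y)) := by
      have h0 : x / y ≠ 0 := div_ne_zero hx0 hy0
      have : (1 : F) = (x / y) ^ 3 * ((x / y)⁻¹) ^ 3 := by
        rw [← mul_pow, mul_inv_cancel₀ h0, one_pow]
      refine this.trans ?_
      rw [← rel]; field_simp
    have h2 := vlt_mul O h1 (add_mem (mul_mem (mul_mem hbm (add_mem (one_mem O) hbm)) (pow_mem hm 2)) hbm)
    rw [← e] at h2; simp at h2
  refine ⟨hx0, hy0, ?_, hb, rel⟩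
  apply vlt_of_pow O (n := 3)
  rw [← rel]
  exact vlt_mul O hb (add_mem (add_mem (one_mem O) hbm) (pow_mem hs 2))

theorem loc5 (i : Bool) (O : ValuationSubring F) {x y : F} (h : y ^ 2 + y = x ^ 3 - x ^ 2) :
    ∃ ϖ ε : F, O.valuation ε = 1 ∧ gg i x y = ϖ ^ 5 * ε ∧
      ((x ∈ O ∧ y ∈ O ∧ ε = gg i x y) ∨ (x ∈ O ∧ y ∈ O ∧ ε * gg i x (-y - 1) = -1 ∧ O.valuation (gg i x (-y-1)) = 1) ∨
        (x ∉ O ∧ O.valuation (ε - 1) < 1)) := by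
  by_cases hx : x ∈ O
  · have hy := y_mem O h hx
    have hm : ∀ x y : F, x ∈ O → y ∈ O → gg i x y ∈ O := fun x y hx hy => by
      have h2 : (2 : F) ∈ O := by have := natCast_mem O 2; simpa using this
      have h3 : (3 : F) ∈ O := by have := natCast_mem O 3; simpa using this
      unfold gg; split_ifs
      · exact add_mem (add_mem (mul_mem hx hy) (pow_mem hx 2)) hy
      · exact sub_mem (add_mem (sub_mem (mul_mem hx hy) (mul_mem h2 (pow_mem hx 2))) (mul_mem h3 hx)) (one_mem O)
    rcases v1_or O (hm x y hx hy) with h1 | h1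
    · exact ⟨1, gg i x y, h1, by ring, Or.inl ⟨hx, hy, rfl⟩⟩
    · have key : ∃ ϖ : F, gg i x y * gg i x (-y - 1) = - ϖ ^ 5 ∧ ∃ r ∈ O,
          gg i x y + gg i x (-y - 1) = -1 + ϖ * r := by
        have h2 : ∀ n : ℕ, (n : F) ∈ O := fun n => natCast_mem O n
        cases i
        · refine ⟨x - 1, ?_, 1 - 4 * x, ?_, ?_⟩
          · simp only [gg]; norm_num; linear_combination (-x ^2) * h
          · exact sub_mem (one_mem _) (mul_mem (h2 4) hx)
          · simp only [gg]; norm_num; ring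
        · refine ⟨x, ?_, 2 * x - 1, ?_, ?_⟩
          · simp only [gg]; norm_num; linear_combination (-x ^2 - 2 * x - 1) * h
          · exact sub_mem (mul_mem (h2 2) hx) (one_mem _)
          · simp only [gg]; norm_num; ring
      obtain ⟨ϖ, e1, r, hr, e2⟩ := key
      have hm2 := hm x (-y - 1) hx (sub_mem (neg_mem hy) (one_mem _))
      have hϖ : O.valuation ϖ < 1 := by
        apply vlt_of_pow O (n := 5)
        rw [← Valuation.map_neg, ← e1]; exact vlt_mul O h1 hm2
      have h3 : O.valuation (gg i x (-y - 1)) = 1 := by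
        have : gg i x (-y - 1) = -1 + (ϖ * r - gg i x y) := by linear_combination e2
        rw [this]
        exact v1_add O (by simp) (vlt_sub O (vlt_mul O hϖ hr) h1)
      have hne : gg i x (-y - 1) ≠ 0 := fun h => by rw [h] at h3; simp at h3
      refine ⟨ϖ, - (gg i x (-y - 1))⁻¹, ?_, ?_, Or.inr (Or.inl ⟨hx, hy, ?_, h3⟩)⟩
      · rw [Valuation.map_neg, map_inv₀, h3, inv_one]
      · field_simp; linear_combination e1
      · field_simp
  · obtain ⟨hx0, hy0, hs, hw, rel⟩ := sw_chart O h hx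
    have hsm := mem_of_vlt O hs
    have hwm := mem_of_vlt O hw
    have key : ∃ t ∈ O, gg i x y * (x / y) ^ 5 = 1 + (x / y) * t := by
      have h2 : ∀ n : ℕ, (n : F) ∈ O := fun n => natCast_mem O n
      set s := x / y with hsd
      set w := 1 / y with hwd
      have hs0 : s ≠ 0 := div_ne_zero hx0 hy0
      have hw0 : w ≠ 0 := one_div_ne_zero hy0
      have ey : y = 1 / w := by rw [hwd]; field_simp
      have ex : x = s / w := by rw [hwd, hsd]; field_simp
      have hw2 : w = s * (s ^ 2 - w * s) - w ^ 2 := by linear_combination rel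
      -- everything in terms of s, w ; u = 1 + w + s^2
      have hO1 : 1 + w + s ^ 2 ∈ O := add_mem (add_mem (one_mem O) hwm) (pow_mem hsm 2)
      -- w = s * w' with w' = s^2 / u
      have hu : O.valuation (1 + w + s ^ 2) = 1 := by
        rw [add_assoc]; apply v1_add O (map_one _) (vlt_add O hw _)
        rw [pow_two]; exact vlt_mul O hs hsm
      have hu0 : (1 + w + s ^ 2) ≠ 0 := fun h => by rw [h] at hu; simp at hu
      obtain ⟨w', hw'm, hw'⟩ : ∃ w' ∈ O, w = s * w' :=
        ⟨s ^ 2 * (1 + w + s ^ 2)⁻¹, mul_mem (pow_mem hsm 2) (inv_mem_of_v1 O hu), by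
          rw [← mul_assoc, eq_mul_inv_iff_mul_eq₀ hu0]; linear_combination rel⟩
      have hum : ∃ u' ∈ O, 1 + w + s ^ 2 = 1 + s * u' := ⟨w' + s, add_mem hw'm hsm, by rw [hw']; ring⟩
      obtain ⟨u', hu'm, hu'⟩ := hum
      have e3 : s ^ 3 = w * (1 + s * u') := by rw [← hu', rel]
      cases i
      · refine ⟨-2 * (1 + s * u') ^ 2 + 2 * u' + s * u' ^ 2 + 3 * s ^ 2 * (1 + s * u') - s ^ 4, ?_, ?_⟩
        · have hU := add_mem (one_mem O) (mul_mem hsm hu'm)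
          have h2' := neg_mem (h2 2)
          exact sub_mem (add_mem (add_mem (add_mem (mul_mem h2' (pow_mem hU 2)) (mul_mem (h2 2) hu'm))
            (mul_mem hsm (pow_mem hu'm 2))) (mul_mem (mul_mem (h2 3) (pow_mem hsm 2)) hU)) (pow_mem hsm 4)
        · have : gg false x y * s ^ 5 * w ^ 2 = (s ^ 3) ^ 2 * (1 - 2 * s) + 3 * s ^ 3 * s ^ 3 * w - s ^ 5 * w ^ 2 := by
            simp only [gg]; rw [ex, ey]; norm_num; field_simp
          apply mul_right_cancel₀ (pow_ne_zero 2 hw0)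
          rw [this]
          have e4 : (s ^ 3) ^ 2 = w ^ 2 * (1 + s * u') ^ 2 := by rw [e3]; ring
          rw [e4]
          have e5 : 3 * s ^ 3 * s ^ 3 * w = 3 * s ^ 3 * w ^ 2 * (1 + s * u') := by linear_combination (3 * s ^ 3 * w) * e3
          rw [e5]; ring
      · refine ⟨(1 + s * u') ^ 2 + 2 * u' + s * u' ^ 2 + s * (1 + s * u'), ?_, ?_⟩
        · have hU := add_mem (one_mem O) (mul_mem hsm hu'm)
          exact (add_mem (add_mem (add_mem ((pow_mem hU 2)) (mul_mem (h2 2) hu'm))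
            (mul_mem hsm (pow_mem hu'm 2))) (mul_mem hsm hU))
        · have : gg true x y * s ^ 5 * w ^ 2 = (s ^ 3) ^ 2 * (1 + s) + s ^ 2 * s ^ 3 * w := by
            simp only [gg]; rw [ex, ey]; norm_num; field_simp
          apply mul_right_cancel₀ (pow_ne_zero 2 hw0)
          rw [this]
          have e4 : (s ^ 3) ^ 2 = w ^ 2 * (1 + s * u') ^ 2 := by rw [e3]; ring
          rw [e4]
          have e5 : s ^ 2 * s ^ 3 * w = s ^ 2 * w ^ 2 * (1 + s * u') := by linear_combination (s ^ 2 * w) * e3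
          rw [e5]; ring
    obtain ⟨t, ht, e⟩ := key
    refine ⟨y / x, gg i x y * (x / y) ^ 5, ?_, ?_, Or.inr (Or.inr ⟨hx, ?_⟩)⟩
    · rw [e]; exact v1_add O (map_one _) (vlt_mul O hs ht)
    · field_simp
    · rw [e, add_sub_cancel_left]; exact vlt_mul O hs ht

end Curve
end Cr

namespace Cr
open Polynomial

theorem const_of_algebraic {Ω F : Type*} [Field Ω] [Field F] [Algebra Ω F] [IsAlgClosed Ω] {z : F}
    (hz : IsAlgebraic Ω z) : ∃ c : Ω, algebraMap Ω F c = z := by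
  have := IsAlgClosed.degree_eq_one_of_irreducible Ω (minpoly.irreducible hz.isIntegral)
  exact minpoly.mem_range_of_degree_eq_one Ω z this

theorem const_of_forall {Ω F : Type*} [Field Ω] [Field F] [Algebra Ω F] [IsAlgClosed Ω] {z : F}
    (h : ∀ O : ValuationSubring F, (∀ c : Ω, algebraMap Ω F c ∈ O) → z ∈ O) :
    ∃ c : Ω, algebraMap Ω F c = z := const_of_algebraic (isAlgebraic_of_forall z h)

/-- The equations. -/
structure TE {G : Type*} [Field G] (i : Bool) (R : ℕ) (xs ys : ℕ → G) (x y u : G) : Prop where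
  tower : ∀ j < R, xs j ^ 5 + ys j * ys (j + 1) ^ 5 = 1
  ne : ∀ j ≤ R, ys j ≠ 0
  ne1 : ys 0 ^ 5 ≠ 1
  une : u ≠ 0
  curve : y ^ 2 + y = x ^ 3 - x ^ 2
  cover : (1 - ys 0 ^ 5) * u ^ 5 = gg i x y

theorem gg_map {G H : Type*} [CommRing G] [CommRing H] (f : G →+* H) (i : Bool) (x y : G) :
    f (gg i x y) = gg i (f x) (f y) := by
  cases i <;> simp [gg, map_ofNat]

theorem TE.map {G H : Type*} [Field G] [Field H] (f : G →+* H) {i : Bool} {R : ℕ} {xs ys : ℕ → G}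
    {x y u : G} (h : TE i R xs ys x y u) :
    TE i R (fun j => f (xs j)) (fun j => f (ys j)) (f x) (f y) (f u) where
  tower j hj := by rw [← map_pow, ← map_pow, ← map_mul, ← map_add, h.tower j hj, map_one]
  ne j hj := (map_ne_zero f).2 (h.ne j hj)
  ne1 := by rw [← map_pow, ← map_one f]; exact fun h' => h.ne1 (f.injective h')
  une := (map_ne_zero f).2 h.une
  curve := by rw [← map_pow, ← map_pow, ← map_pow, ← map_add, h.curve, map_sub]
  cover := by rw [← gg_map, ← h.cover]; simp

namespace EF
variable {Ω F : Type*} [Field Ω] [Field F] [Algebra Ω F] {A B : Ω} {x w : F}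
  [IsAlgClosed Ω] [CharZero Ω]

theorem stab (h : EF Ω F A B x w) (hd : 4 * A ^ 3 + 27 * B ^ 2 ≠ 0)
    {D : Derivation Ω F F} (hDx : D x = 2 * w) (hDw : D w = 3 * x ^ 2 + algebraMap Ω F A)
    (O : ValuationSubring F) (hO : ∀ c : Ω, algebraMap Ω F c ∈ O) {z : F} (hz : z ∈ O) : D z ∈ O := by
  by_cases hT : O = ⊤
  · rw [hT]; trivial
  · exact (h.chart hd hDx hDw O hO hT).1 z hz

theorem w_ne (h : EF Ω F A B x w) : w ≠ 0 := by
  rintro rfl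
  have := (h.indep (p := 0) (q := 1)) (by simp)
  exact one_ne_zero this.2

theorem ker_D (h : EF Ω F A B x w)
    {D : Derivation Ω F F} (hDx : D x = 2 * w) {z : F} (hz : D z = 0) :
    ∃ c : Ω, algebraMap Ω F c = z := by
  by_contra hzc
  have : CharZero F := charZero_of_injective_algebraMap (algebraMap Ω F).injective
  let E : IntermediateField Ω F :=
    { carrier := {z | D z = 0}
      mul_mem' := fun {a b} ha hb => by
        simp only [Set.mem_setOf_eq] at *; rw [D.leibniz, ha, hb]; simp
      add_mem' := fun {a b} ha hb => by
        simp only [Set.mem_setOf_eq] at *; rw [map_add, ha, hb]; simp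
      algebraMap_mem' := fun c => by simp
      inv_mem' := fun a ha => by
        simp only [Set.mem_setOf_eq] at *
        rw [D.leibniz_inv, ha]; simp }
  let D' : Derivation E F F := Derivation.mk'
    { toFun := D
      map_add' := fun a b => map_add D a b
      map_smul' := fun a b => by
        have : D (a : F) = 0 := a.2
        change D ((a : F) * b) = (a : F) * D b
        rw [D.leibniz, this]; simp } (fun a b => D.leibniz a b)
  obtain ⟨p, q, d, hd, e⟩ := h.rep z
  have hxalg : IsAlgebraic E x := by
    let zE : E := ⟨z, hz⟩
    let m : Polynomial Ω → Polynomial E := fun p => p.map (algebraMap Ω E)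
    refine ⟨(C zE * m d - m p) ^ 2 - (m q) ^ 2 * Phi (algebraMap Ω E A) (algebraMap Ω E B), ?_, ?_⟩
    · intro h0
      obtain ⟨h1, h2⟩ := parity _ _ (sub_eq_zero.1 h0)
      obtain ⟨i, hi⟩ : ∃ i, d.coeff i ≠ 0 := by
        by_contra! hc; exact hd (Polynomial.ext (by simpa using hc))
      have h3 := congrArg (fun p => coeff p i) h1
      simp only [coeff_sub, coeff_C_mul, m, coeff_map, coeff_zero] at h3
      apply hzc
      refine ⟨p.coeff i / d.coeff i, ?_⟩
      have h4 : z * algebraMap Ω F (d.coeff i) - algebraMap Ω F (p.coeff i) = 0 := congrArg Subtype.val h3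
      have h5 : algebraMap Ω F (d.coeff i) ≠ 0 := by simpa using hi
      rw [map_div₀, div_eq_iff h5]; linear_combination -h4
    · have hm : ∀ p, aeval x (m p) = aeval x p := fun p => by simp [m]
      have hP : aeval x (Phi (algebraMap Ω E A) (algebraMap Ω E B)) = w ^ 2 := by
        rw [h.eq]; simp [Phi, ← IsScalarTower.algebraMap_apply]
      rw [map_sub, map_pow, map_sub, map_mul, map_mul, map_pow, hP, hm, hm, hm, aeval_C]
      change (z * aeval x d - aeval x p) ^ 2 - _ = _
      rw [e]; ring
  have h1 : D' (aeval x (minpoly E x)) = 0 := by rw [minpoly.aeval]; simp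
  rw [Derivation.map_aeval] at h1
  have h2 : aeval x (derivative (minpoly E x)) ≠ 0 :=
    (minpoly.irreducible hxalg.isIntegral).separable.aeval_derivative_ne_zero (minpoly.aeval _ _)
  have h3 : D' x = 2 * w := hDx
  rw [h3, smul_eq_mul] at h1
  rcases mul_eq_zero.1 h1 with h1 | h1
  · exact h2 h1
  · exact h.w_ne (by simpa using h1)

theorem fermat_const (h : EF Ω F A B x w) (hd : 4 * A ^ 3 + 27 * B ^ 2 ≠ 0) {z : F}
    (hz : ∀ O : ValuationSubring F, (∀ c : Ω, algebraMap Ω F c ∈ O) →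
      ∃ ϖ ε : F, O.valuation ε = 1 ∧ 1 - z ^ 5 = ϖ ^ 5 * ε) : ∃ c : Ω, algebraMap Ω F c = z := by
  have : CharZero F := charZero_of_injective_algebraMap (algebraMap Ω F).injective
  obtain ⟨D, hDx, hDw⟩ := h.exists_D
  have hst := fun O hO z hz => h.stab hd hDx hDw O hO (z := z) hz
  by_contra hzc
  have h0 : 1 - z ^ 5 ≠ 0 := fun h0 => hzc (const_of_algebraic ⟨1 - X ^ 5, by
    intro h1
    have := congrArg (fun p => coeff p 5) h1
    simp [coeff_one] at this, by simpa using h0⟩)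
  -- a
  have hneg : ∀ O : ValuationSubring F, (∀ c : Ω, algebraMap Ω F c ∈ O) → z ∉ O →
      O.valuation ((D z) ^ 5 / (1 - z ^ 5) ^ 4) < 1 := fun O hO hzO => by
    have hz0 : z ≠ 0 := by rintro rfl; exact hzO (zero_mem O)
    have hi := inv_vlt O hzO
    have him := mem_of_vlt O hi
    have hDi : D z⁻¹ ∈ O := hst O hO _ him
    have e : D z = - z ^ 2 * D z⁻¹ := by rw [D.leibniz_inv]; simp; field_simp
    have hu : O.valuation (-1 + (z⁻¹) ^ 5) = 1 := v1_add O (by simp) (by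
      rw [pow_succ]; exact vlt_mul' O (pow_mem him 4) hi)
    have hu0 : (-1 + (z⁻¹) ^ 5) ≠ 0 := fun h => by rw [h] at hu; simp at hu
    have e2 : (D z) ^ 5 / (1 - z ^ 5) ^ 4 = - (z⁻¹ * ((z⁻¹) ^ 9 * (D z⁻¹) ^ 5 * ((-1 + (z⁻¹) ^ 5)⁻¹) ^ 4)) := by
      have e3 : 1 - z ^ 5 = z ^ 5 * (-1 + (z⁻¹) ^ 5) := by field_simp; ring
      rw [e, e3]
      generalize (-1 + (z⁻¹) ^ 5) = u at hu0
      generalize D z⁻¹ = v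
      field_simp
    rw [e2, Valuation.map_neg]
    exact vlt_mul O hi (mul_mem (mul_mem (pow_mem him 9) (pow_mem hDi 5)) (pow_mem (inv_mem_of_v1 O hu) 4))
  obtain ⟨a, ha⟩ := const_of_forall (Ω := Ω) (z := (D z) ^ 5 / (1 - z ^ 5) ^ 4) (fun O hO => by
    by_cases hzO : z ∈ O
    · obtain ⟨ϖ, ε, hε, e⟩ := hz O hO
      have hε0 : ε ≠ 0 := fun h => by rw [h] at hε; simp at hε
      have hϖ0 : ϖ ≠ 0 := by rintro rfl; apply h0; rw [e]; simp
      have hϖ : ϖ ∈ O := by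
        rw [← vle]; by_contra h1
        have h2 : 1 - z ^ 5 ∈ O := sub_mem (one_mem _) (pow_mem hzO 5)
        rw [e, ← vle, map_mul, hε, mul_one, map_pow] at h2
        exact absurd h2 (not_le.2 (one_lt_pow₀ (not_le.1 h1) (by norm_num)))
      have hεm : ε ∈ O := by rw [← vle, hε]
      have hDz := hst O hO _ hzO
      have hDϖ := hst O hO _ hϖ
      have hDε := hst O hO _ hεm
      have e2 := congrArg D e
      rw [D.leibniz, D.leibniz_pow, map_sub, D.leibniz_pow] at e2
      simp only [Derivation.map_one_eq_zero, smul_eq_mul, nsmul_eq_mul] at e2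
      push_cast at e2
      norm_num at e2
      rcases v1_or O hϖ with h1 | h1
      · rw [e, div_eq_mul_inv]
        refine mul_mem (pow_mem hDz 5) ?_
        rw [← inv_pow, mul_inv, ← inv_pow]
        exact pow_mem (mul_mem (pow_mem (inv_mem_of_v1 O h1) 5) (inv_mem_of_v1 O hε)) 4
      · have hz1 : O.valuation z = 1 := by
          have h3 : O.valuation (z ^ 5) = 1 := by
            have : z ^ 5 = 1 + (- (ϖ ^ 5 * ε)) := by linear_combination -e
            rw [this]
            refine v1_add O (map_one _) ?_
            rw [Valuation.map_neg]; exact vlt_mul O (by rw [pow_succ]; exact vlt_mul' O (pow_mem hϖ 4) h1) hεm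
          rcases v1_or O hzO with h4 | h4
          · exact h4
          · exfalso
            have : O.valuation (z ^ 5) < 1 := by rw [pow_succ]; exact vlt_mul' O (pow_mem hzO 4) h4
            exact absurd h3 this.ne
        have hz0 : z ≠ 0 := by rintro rfl; simp at hz1
        have h5 : (5 : F)⁻¹ ∈ O := by have := hO (5 : Ω)⁻¹; simpa [map_ofNat] using this
        have e3 : D z = ϖ ^ 4 * (- (5⁻¹ * (z⁻¹) ^ 4 * (5 * D ϖ * ε + ϖ * D ε))) := by
          field_simp; linear_combination -e2
        have e4 : (D z) ^ 5 / (1 - z ^ 5) ^ 4 = (- (5⁻¹ * (z⁻¹) ^ 4 * (5 * D ϖ * ε + ϖ * D ε))) ^ 5 * (ε⁻¹) ^ 4 := by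
          rw [e3, e]
          generalize (- (5⁻¹ * (z⁻¹) ^ 4 * (5 * D ϖ * ε + ϖ * D ε))) = q
          field_simp
        rw [e4]
        have h55 : (5 : F) ∈ O := by have := hO (5 : Ω); simpa [map_ofNat] using this
        exact mul_mem (pow_mem (neg_mem (mul_mem (mul_mem h5 (pow_mem (inv_mem_of_v1 O hz1) 4))
          (add_mem (mul_mem (mul_mem h55 hDϖ) hεm) (mul_mem hϖ hDε)))) 5) (pow_mem (inv_mem_of_v1 O hε) 4)
    · exact mem_of_vlt O (hneg O hO hzO))
  -- find a pole
  have hpole : ∃ O : ValuationSubring F, (∀ c : Ω, algebraMap Ω F c ∈ O) ∧ z ∉ O := by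
    by_contra! hc; exact hzc (const_of_forall hc)
  obtain ⟨O, hO, hzO⟩ := hpole
  have h1 := hneg O hO hzO
  rw [← ha] at h1
  have ha0 : a = 0 := by
    by_contra ha0; rw [val_const O hO ha0] at h1; exact lt_irrefl _ h1
  rw [ha0, map_zero] at ha
  have h2 : (D z) = 0 := by
    have := ha.symm
    rw [div_eq_zero_iff] at this
    rcases this with h3 | h3
    · exact pow_eq_zero_iff (by norm_num) |>.1 h3
    · exact absurd (pow_eq_zero_iff (by norm_num) |>.1 h3) h0
  exact hzc (h.ker_D hDx h2)

theorem pow_const {z : F} {n : ℕ} (hn : n ≠ 0) {c : Ω} (h : algebraMap Ω F c = z ^ n) :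
    ∃ c : Ω, algebraMap Ω F c = z := by
  apply const_of_algebraic
  refine IsAlgebraic.of_pow (Nat.pos_of_ne_zero hn) ?_
  rw [← h]; exact isAlgebraic_algebraMap c

theorem mach (h : EF Ω F A B x w) (hd : 4 * A ^ 3 + 27 * B ^ 2 ≠ 0) {i : Bool} {R : ℕ}
    {xs ys : ℕ → F} {x' y' u' : F} (ht : TE i R xs ys x' y' u') :
    (∀ j < R, ∃ c : Ω, algebraMap Ω F c = xs j) ∧ (∀ j ≤ R, ∃ c : Ω, algebraMap Ω F c = ys j) := by
  have h0 : ∃ c : Ω, algebraMap Ω F c = ys 0 := h.fermat_const hd (fun O hO => by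
    obtain ⟨ϖ, ε, hε, e, _⟩ := loc5 i O ht.curve
    refine ⟨ϖ / u', ε, hε, ?_⟩
    have := ht.une
    field_simp; rw [ht.cover, e])
  have step : ∀ j < R, (∃ c : Ω, algebraMap Ω F c = ys j) → (∃ c : Ω, algebraMap Ω F c = xs j) ∧
      (∃ c : Ω, algebraMap Ω F c = ys (j + 1)) := by
    rintro j hj ⟨c, hc⟩
    have hc0 : c ≠ 0 := by rintro rfl; exact ht.ne j hj.le (by rw [← hc, map_zero])
    have h1 : ∃ c : Ω, algebraMap Ω F c = xs j := h.fermat_const hd (fun O hO =>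
      ⟨ys (j + 1), algebraMap Ω F c, val_const O hO hc0, by rw [hc]; linear_combination -ht.tower j hj⟩)
    refine ⟨h1, ?_⟩
    obtain ⟨d, hd'⟩ := h1
    refine pow_const (n := 5) (by norm_num) (c := (1 - d ^ 5) / c) ?_
    rw [map_div₀, map_sub, map_one, map_pow, hc, hd', div_eq_iff (ht.ne j hj.le)]
    linear_combination -ht.tower j hj
  have hy : ∀ j ≤ R, ∃ c : Ω, algebraMap Ω F c = ys j := by
    intro j
    induction j with
    | zero => exact fun _ => h0
    | succ j ih => exact fun hj => (step j hj (ih (by omega))).2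
  exact ⟨fun j hj => (step j hj (hy j hj.le)).1, hy⟩

theorem inv_diff (h : EF Ω F A B x w) (hd : 4 * A ^ 3 + 27 * B ^ 2 ≠ 0)
    {D : Derivation Ω F F} (hDx : D x = 2 * w) (hDw : D w = 3 * x ^ 2 + algebraMap Ω F A)
    {x' y' : F} (hc : y' ^ 2 + y' = x' ^ 3 - x' ^ 2) : ∃ c : Ω, algebraMap Ω F c = D x' / (2 * y' + 1) := by
  have : CharZero F := charZero_of_injective_algebraMap (algebraMap Ω F).injective
  have hst := fun O hO z hz => h.stab hd hDx hDw O hO (z := z) hz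
  have e1 : (2 * y' + 1) * D y' = (3 * x' ^ 2 - 2 * x') * D x' := by
    have := congrArg D hc
    rw [map_add, map_sub, D.leibniz_pow, D.leibniz_pow, D.leibniz_pow] at this
    simp only [smul_eq_mul, nsmul_eq_mul] at this
    push_cast at this
    norm_num at this
    linear_combination this
  apply const_of_forall
  intro O hO
  by_cases h0 : 2 * y' + 1 = 0
  · rw [h0]; simp
  by_cases hx : x' ∈ O
  · have hy := y_mem O hc hx
    have hn : ∀ n : ℕ, (n : F) ∈ O := fun n => natCast_mem O n
    have hm : 2 * y' + 1 ∈ O := add_mem (mul_mem (hn 2) hy) (one_mem _)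
    rcases v1_or O hm with h1 | h1
    · rw [div_eq_mul_inv]; exact mul_mem (hst O hO _ hx) (inv_mem_of_v1 O h1)
    · have hm2 : 3 * x' ^ 2 - 2 * x' ∈ O := sub_mem (mul_mem (hn 3) (pow_mem hx 2)) (mul_mem (hn 2) hx)
      have h2 : O.valuation (3 * x' ^ 2 - 2 * x') = 1 := by
        rcases v1_or O hm2 with h2 | h2
        · exact h2
        · exfalso
          -- x is a unit or in m
          have h11 : O.valuation (11 : F) = 1 := by
            have := val_const O hO (c := (11 : Ω)) (by norm_num)
            rwa [map_ofNat] at this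
          have hx1 : O.valuation x' < 1 ∨ O.valuation (3 * x' - 2) < 1 := by
            have : 3 * x' ^ 2 - 2 * x' = x' * (3 * x' - 2) := by ring
            rw [this] at h2
            rcases v1_or O hx with h5 | h5
            · right; rwa [map_mul, h5, one_mul] at h2
            · left; exact h5
          rcases hx1 with h5 | h5
          · have : (1 : F) = (2 * y' + 1) * (2 * y' + 1) - x' * (4 * x' ^ 2 - 4 * x') := by linear_combination (-4) * hc
            have h6 := vlt_sub O (vlt_mul O h1 hm) (vlt_mul O h5 (sub_mem (mul_mem (hn 4) (pow_mem hx 2)) (mul_mem (hn 4) hx)))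
            push_cast at h6
            rw [← this] at h6; simp at h6
          · have : (11 : F) = (2 * y' + 1) * ((2 * y' + 1) * 27) - (3 * x' - 2) * (36 * x' ^ 2 - 12 * x' - 8) := by linear_combination (-108) * hc
            have h6 := vlt_sub O (vlt_mul O h1 (mul_mem hm (hn 27))) (vlt_mul O h5 (sub_mem (sub_mem (mul_mem (hn 36) (pow_mem hx 2)) (mul_mem (hn 12) hx)) (hn 8)))
            push_cast at h6
            rw [← this] at h6; exact absurd h11 h6.ne
      have h30 : 3 * x' ^ 2 - 2 * x' ≠ 0 := fun h => by rw [h] at h2; simp at h2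
      have : D x' / (2 * y' + 1) = D y' * (3 * x' ^ 2 - 2 * x')⁻¹ := by
        rw [← div_eq_mul_inv, div_eq_div_iff h0 h30]; linear_combination -e1
      rw [this]; exact mul_mem (hst O hO _ hy) (inv_mem_of_v1 O h2)
  · obtain ⟨hx0, hy0, hs, hw, rel⟩ := sw_chart O hc hx
    have hn : ∀ n : ℕ, (n : F) ∈ O := fun n => natCast_mem O n
    have hsm := mem_of_vlt O hs
    have hDs := hst O hO _ hsm
    have hu : O.valuation (1 + (2 * (1 / y') + (x' / y') ^ 2)) = 1 :=
      v1_add O (map_one _) (vlt_add O (vlt_mul' O (hn 2) hw) (by rw [pow_two]; exact vlt_mul O hs hsm))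
    have hu0 : (1 + (2 * (1 / y') + (x' / y') ^ 2)) ≠ 0 := fun h => by rw [h] at hu; simp at hu
    have e2 : D (x' / y') * y' ^ 2 = D x' * y' - x' * D y' := by
      have : D x' = D (x' / y' * y') := by rw [div_mul_cancel₀ _ hy0]
      rw [this, D.leibniz]; simp only [smul_eq_mul]; field_simp; ring
    have : D x' / (2 * y' + 1) = - (D (x' / y') * (1 + (2 * (1 / y') + (x' / y') ^ 2))⁻¹) := by
      rw [← div_eq_mul_inv, ← neg_div, div_eq_div_iff h0 hu0]
      have e3 : D (x' / y') = (D x' * y' - x' * D y') / y' ^ 2 := by rw [← e2]; field_simp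
      rw [e3]; field_simp
      linear_combination -x' * e1 + 3 * D x' * hc
    rw [this]; exact neg_mem (mul_mem hDs (inv_mem_of_v1 O hu))

theorem rat_const (h : EF Ω F A B x w) (hd : 4 * A ^ 3 + 27 * B ^ 2 ≠ 0)
    {x' y' : F} (hc : y' ^ 2 + y' = x' ^ 3 - x' ^ 2) (hx : x' ∈ IntermediateField.adjoin Ω {x})
    (hy : y' ∈ IntermediateField.adjoin Ω {x}) :
    (∃ c : Ω, algebraMap Ω F c = x') ∧ ∃ c : Ω, algebraMap Ω F c = y' := by
  have : CharZero F := charZero_of_injective_algebraMap (algebraMap Ω F).injective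
  obtain ⟨D, hDx, hDw⟩ := h.exists_D
  have hxm : x ∈ IntermediateField.adjoin Ω {x} := IntermediateField.mem_adjoin_simple_self _ _
  have hw : w ∉ IntermediateField.adjoin Ω {x} := fun hw => by
    obtain ⟨r, s, e⟩ := (IntermediateField.mem_adjoin_simple_iff Ω w).1 hw
    have hs : aeval x s ≠ 0 := fun h1 => h.w_ne (by rw [e, h1]; simp)
    have := h.indep (p := -r) (q := s) (by rw [e]; field_simp; simp)
    rw [this.2] at hs; simp at hs
  have hDm : ∀ z ∈ IntermediateField.adjoin Ω {x}, ∃ b ∈ IntermediateField.adjoin Ω {x}, D z = w * b := by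
    intro z hz
    induction hz using IntermediateField.adjoin_induction with
    | mem z hz => rw [Set.mem_singleton_iff] at hz; subst hz; exact ⟨2, ofNat_mem _ 2, by rw [hDx]; ring⟩
    | algebraMap c => exact ⟨0, zero_mem _, by simp⟩
    | add a b _ _ ha hb =>
      obtain ⟨c, hc, e⟩ := ha
      obtain ⟨c', hc', e'⟩ := hb
      exact ⟨c + c', add_mem hc hc', by rw [map_add, e, e']; ring⟩
    | inv a ha' ha =>
      obtain ⟨c, hc, e⟩ := ha
      refine ⟨- a⁻¹ ^ 2 * c, mul_mem (neg_mem (pow_mem (inv_mem ha') 2)) hc, ?_⟩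
      rw [D.leibniz_inv, e, smul_eq_mul]; ring
    | mul a b ha' hb' ha hb =>
      obtain ⟨c, hc, e⟩ := ha
      obtain ⟨c', hc', e'⟩ := hb
      exact ⟨a * c' + b * c, add_mem (mul_mem ha' hc') (mul_mem hb' hc), by
        rw [D.leibniz, e, e', smul_eq_mul, smul_eq_mul]; ring⟩
  have hxc : ∃ c : Ω, algebraMap Ω F c = x' := by
    by_cases h0 : 2 * y' + 1 = 0
    · -- constant
      apply const_of_algebraic
      refine ⟨4 * X ^ 3 - 4 * X ^ 2 + 1, ?_, ?_⟩
      · intro h1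
        have := congrArg (fun p => coeff p 0) h1
        simp at this
      · simp [map_ofNat]; linear_combination (-4) * hc + (2 * y' + 1) * h0
    · obtain ⟨a, ha⟩ := h.inv_diff hd hDx hDw hc
      obtain ⟨b, hb, e⟩ := hDm x' hx
      have h2 : D x' = 0 := by
        by_contra hne
        have hb0 : b ≠ 0 := by rintro rfl; simp [e] at hne
        apply hw
        have : w = algebraMap Ω F a * (2 * y' + 1) / b := by
          rw [ha, e]; field_simp
        rw [this]
        exact div_mem (mul_mem (IntermediateField.algebraMap_mem _ _) (add_mem (mul_mem (ofNat_mem _ 2) hy) (one_mem _))) hb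
      exact h.ker_D hDx h2
  refine ⟨hxc, ?_⟩
  obtain ⟨c, rfl⟩ := hxc
  apply const_of_algebraic
  refine ⟨X ^ 2 + X - C (c ^ 3 - c ^ 2), ?_, ?_⟩
  · intro h1
    have := congrArg (fun p => coeff p 2) h1
    simp only [coeff_sub, coeff_add, coeff_X_pow, coeff_X, coeff_C] at this
    simp at this
  · simp [hc]

end EF
end Cr

namespace Cr
open Polynomial

theorem EF.ofAdjoin {Ω Λ : Type*} [Field Ω] [Field Λ] [Algebra Ω Λ] {A B : Ω} {X W : Λ}
    (eq : W ^ 2 = X ^ 3 + algebraMap Ω Λ A * X + algebraMap Ω Λ B) (tr : Transcendental Ω X)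
    (hX : X ∈ IntermediateField.adjoin Ω {X, W}) (hW : W ∈ IntermediateField.adjoin Ω {X, W}) :
    EF Ω (IntermediateField.adjoin Ω {X, W}) A B ⟨X, hX⟩ ⟨W, hW⟩ where
  eq := Subtype.ext eq
  tr := by
    intro h
    apply tr
    have := h.algebraMap (A := Λ)
    exact this
  gen := by
    apply IntermediateField.map_injective (IntermediateField.adjoin Ω {X, W}).val
    rw [IntermediateField.adjoin_map, ← AlgHom.fieldRange_eq_map, IntermediateField.fieldRange_val]
    congr 1
    ext z; simp [eq_comm]

section
variable {Ω F : Type*} [Field Ω] [Field F] [Algebra Ω F] {A B : Ω} {x w : F}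
  [IsAlgClosed Ω] [CharZero Ω]

theorem EF.tower_const (h : EF Ω F A B x w) (hd : 4 * A ^ 3 + 27 * B ^ 2 ≠ 0) {R : ℕ}
    {xs ys : ℕ → F} (tower : ∀ j < R, xs j ^ 5 + ys j * ys (j + 1) ^ 5 = 1)
    (ne : ∀ j ≤ R, ys j ≠ 0) (h0 : ∃ c : Ω, algebraMap Ω F c = ys 0) :
    (∀ j < R, ∃ c : Ω, algebraMap Ω F c = xs j) ∧ (∀ j ≤ R, ∃ c : Ω, algebraMap Ω F c = ys j) := by
  have step : ∀ j < R, (∃ c : Ω, algebraMap Ω F c = ys j) → (∃ c : Ω, algebraMap Ω F c = xs j) ∧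
      (∃ c : Ω, algebraMap Ω F c = ys (j + 1)) := by
    rintro j hj ⟨c, hc⟩
    have hc0 : c ≠ 0 := by rintro rfl; exact ne j hj.le (by rw [← hc, map_zero])
    have h1 : ∃ c : Ω, algebraMap Ω F c = xs j := h.fermat_const hd (fun O hO =>
      ⟨ys (j + 1), algebraMap Ω F c, val_const O hO hc0, by rw [hc]; linear_combination -tower j hj⟩)
    refine ⟨h1, ?_⟩
    obtain ⟨d, hd'⟩ := h1
    refine EF.pow_const (n := 5) (by norm_num) (c := (1 - d ^ 5) / c) ?_
    rw [map_div₀, map_sub, map_one, map_pow, hc, hd', div_eq_iff (ne j hj.le)]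
    linear_combination -tower j hj
  have hy : ∀ j ≤ R, ∃ c : Ω, algebraMap Ω F c = ys j := by
    intro j
    induction j with
    | zero => exact fun _ => h0
    | succ j ih => exact fun hj => (step j hj (ih (by omega))).2
  exact ⟨fun j hj => (step j hj (hy j hj.le)).1, hy⟩
end

/-- reduction to a curve over an algebraically closed constant field -/
theorem rig_setup.{u} {E : Type*} {Λ : Type u} [Field E] [Field Λ] [Algebra E Λ] [CharZero E] {ρ : Λ}
    (hρ : Transcendental E ρ) : ∃ (Ω F : Type u) (_ : Field Ω) (_ : Field F) (_ : Algebra Ω F)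
      (_ : IsAlgClosed Ω) (_ : CharZero Ω) (x w : F) (_ : EF Ω F 1 0 x w)
      (g : IntermediateField.adjoin E {ρ} →+* F),
      (∀ z, g z ∈ IntermediateField.adjoin Ω {x}) ∧
      (∀ z, (∃ c : Ω, algebraMap Ω F c = g z) ↔ IsAlgebraic E (z : Λ)) := by
  let Λ' := AlgebraicClosure Λ
  let Ω := algebraicClosure E Λ'
  have hΩ : IsAlgClosed Ω := (algebraicClosure.isAlgClosure E Λ').1
  have hc : CharZero Ω := charZero_of_injective_algebraMap (algebraMap E Ω).injective
  let ρ' : Λ' := algebraMap Λ Λ' ρ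
  have hρ' : Transcendental E ρ' := (transcendental_algebraMap_iff (algebraMap Λ Λ').injective).2 hρ
  have hρΩ : Transcendental Ω ρ' := hρ'.algebraicClosure
  obtain ⟨w, hw⟩ := IsAlgClosed.exists_pow_nat_eq (ρ' ^ 3 + ρ') (n := 2) (by norm_num)
  have hX : ρ' ∈ IntermediateField.adjoin Ω {ρ', w} := IntermediateField.subset_adjoin _ _ (by simp)
  have hW : w ∈ IntermediateField.adjoin Ω {ρ', w} := IntermediateField.subset_adjoin _ _ (by simp)
  have hEF := EF.ofAdjoin (Ω := Ω) (A := 1) (B := 0) (X := ρ') (W := w) (by rw [hw]; simp) hρΩ hX hW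
  have key : ∀ z ∈ IntermediateField.adjoin E {ρ},
      algebraMap Λ Λ' z ∈ IntermediateField.adjoin Ω {ρ'} := by
    intro z hz
    induction hz using IntermediateField.adjoin_induction with
    | mem z hz =>
      rw [Set.mem_singleton_iff] at hz; subst hz
      exact IntermediateField.mem_adjoin_simple_self _ _
    | algebraMap c =>
      have : algebraMap Λ Λ' (algebraMap E Λ c) = algebraMap Ω Λ' (algebraMap E Ω c) := rfl
      rw [this]; exact IntermediateField.algebraMap_mem _ _
    | add a b _ _ ha hb => rw [map_add]; exact add_mem ha hb
    | inv a _ ha => rw [map_inv₀]; exact inv_mem ha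
    | mul a b _ _ ha hb => rw [map_mul]; exact mul_mem ha hb
  have hle : IntermediateField.adjoin Ω {ρ'} ≤ IntermediateField.adjoin Ω {ρ', w} :=
    IntermediateField.adjoin.mono _ _ _ (by simp)
  let g : IntermediateField.adjoin E {ρ} →+* IntermediateField.adjoin Ω {ρ', w} :=
    ((algebraMap Λ Λ').comp (IntermediateField.adjoin E {ρ}).val.toRingHom).codRestrict _
      (fun z => hle (key z z.2))
  refine ⟨Ω, IntermediateField.adjoin Ω {ρ', w}, inferInstance, inferInstance, inferInstance, hΩ, hc,
    ⟨ρ', hX⟩, ⟨w, hW⟩, hEF, g, ?_, ?_⟩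
  · intro z
    have h1 : (g z : Λ') ∈ IntermediateField.adjoin Ω {ρ'} := key z z.2
    rw [← IntermediateField.mem_lift (F := IntermediateField.adjoin Ω {ρ', w})]
    rw [IntermediateField.lift, IntermediateField.adjoin_map]
    simpa using h1
  · intro z
    have h1 : IsAlgebraic E (z : Λ) ↔ IsAlgebraic E (algebraMap Λ Λ' (z : Λ)) :=
      (isAlgebraic_algebraMap_iff (algebraMap Λ Λ').injective).symm
    rw [h1, ← mem_algebraicClosure_iff]
    constructor
    · rintro ⟨c, hc⟩
      have : (c : Λ') = algebraMap Λ Λ' z := congrArg Subtype.val hc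
      rw [← this]; exact c.2
    · intro h; exact ⟨⟨_, h⟩, rfl⟩

theorem isAlgebraic_of_mem_adjoin {E Λ : Type*} [Field E] [Field Λ] [Algebra E Λ] {ρ : Λ}
    (hρ : IsAlgebraic E ρ) {z : Λ} (hz : z ∈ IntermediateField.adjoin E {ρ}) : IsAlgebraic E z := by
  have : Algebra.IsAlgebraic E (IntermediateField.adjoin E {ρ}) :=
    IntermediateField.isAlgebraic_adjoin_simple hρ.isIntegral
  exact (isAlgebraic_algebraMap_iff (R := E) (A := Λ)
    (algebraMap (IntermediateField.adjoin E {ρ}) Λ).injective).2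
    (Algebra.IsAlgebraic.isAlgebraic (⟨z, hz⟩ : IntermediateField.adjoin E {ρ}))

theorem rigid {E Λ : Type*} [Field E] [Field Λ] [Algebra E Λ] [CharZero E] {ρ : Λ} {i : Bool} {R : ℕ}
    {xs ys : ℕ → IntermediateField.adjoin E {ρ}} {x y u : IntermediateField.adjoin E {ρ}}
    (h : TE i R xs ys x y u) : (∀ j < R, IsAlgebraic E (xs j : Λ)) ∧ (∀ j ≤ R, IsAlgebraic E (ys j : Λ))
      ∧ IsAlgebraic E (x : Λ) ∧ IsAlgebraic E (y : Λ) ∧ IsAlgebraic E (u : Λ) := by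
  by_cases hρ : IsAlgebraic E ρ
  · have := fun z : IntermediateField.adjoin E {ρ} => isAlgebraic_of_mem_adjoin hρ z.2
    exact ⟨fun j _ => this _, fun j _ => this _, this _, this _, this _⟩
  obtain ⟨Ω, F, _, _, _, _, _, X, W, hEF, g, hg, halg⟩ := rig_setup hρ
  have hd : 4 * (1 : Ω) ^ 3 + 27 * (0 : Ω) ^ 2 ≠ 0 := by norm_num
  have h' := h.map g
  obtain ⟨h1, h2⟩ := hEF.mach hd h'
  obtain ⟨⟨a, ha⟩, ⟨b, hb⟩⟩ := hEF.rat_const hd h'.curve (hg _) (hg _)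
  refine ⟨fun j hj => (halg _).1 (h1 j hj), fun j hj => (halg _).1 (h2 j hj), (halg _).1 ⟨a, ha⟩,
    (halg _).1 ⟨b, hb⟩, (halg _).1 ?_⟩
  obtain ⟨c, hc⟩ := h2 0 (Nat.zero_le _)
  refine EF.pow_const (n := 5) (by norm_num) (c := gg i a b / (1 - c ^ 5)) ?_
  have h3 := h'.cover
  have h4 : (1 : F) - g (ys 0) ^ 5 ≠ 0 := fun h5 => h'.ne1 (sub_eq_zero.1 h5).symm
  rw [map_div₀, gg_map, map_sub, map_one, map_pow, ha, hb, hc, ← h3]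
  field_simp

theorem rigid_tower {E Λ : Type*} [Field E] [Field Λ] [Algebra E Λ] [CharZero E] {ρ : Λ} {R : ℕ}
    {xs ys : ℕ → IntermediateField.adjoin E {ρ}}
    (tower : ∀ j < R, xs j ^ 5 + ys j * ys (j + 1) ^ 5 = 1)
    (ne : ∀ j ≤ R, ys j ≠ 0) (h0 : IsAlgebraic E (ys 0 : Λ)) :
    (∀ j < R, IsAlgebraic E (xs j : Λ)) ∧ (∀ j ≤ R, IsAlgebraic E (ys j : Λ)) := by
  by_cases hρ : IsAlgebraic E ρ
  · have := fun z : IntermediateField.adjoin E {ρ} => isAlgebraic_of_mem_adjoin hρ z.2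
    exact ⟨fun j _ => this _, fun j _ => this _⟩
  obtain ⟨Ω, F, _, _, _, _, _, X, W, hEF, g, hg, halg⟩ := rig_setup hρ
  have hd : 4 * (1 : Ω) ^ 3 + 27 * (0 : Ω) ^ 2 ≠ 0 := by norm_num
  obtain ⟨h1, h2⟩ := hEF.tower_const hd (R := R) (xs := fun j => g (xs j)) (ys := fun j => g (ys j))
    (fun j hj => by rw [← map_pow, ← map_pow, ← map_mul, ← map_add, tower j hj, map_one])
    (fun j hj => (map_ne_zero g).2 (ne j hj)) ((halg _).2 h0)
  exact ⟨fun j hj => (halg _).1 (h1 j hj), fun j hj => (halg _).1 (h2 j hj)⟩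

end Cr

namespace Cr
open Polynomial

section Dv
variable {k L : Type*} [Field k] [Field L] [Algebra k L]

/-- `O` is the localisation of `A` at a principal prime. -/
def Dv (A : Subalgebra k L) (O : ValuationSubring L) : Prop :=
  (∀ n ∈ A, n ∈ O) ∧ ∃ q ∈ A, q ≠ 0 ∧ ∀ n ∈ A, (O.valuation n < 1 ↔ ∃ m ∈ A, n = q * m)

structure Nice (A : Subalgebra k L) : Prop where
  ufm : UniqueFactorizationMonoid A
  fr : ∀ z : L, ∃ n ∈ A, ∃ d ∈ A, d ≠ 0 ∧ z * d = n

variable {A B : Subalgebra k L} {O : ValuationSubring L}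

theorem Nice.decomp (hA : Nice A) (hAO : ∀ n ∈ A, n ∈ O) {q : L} (hq : q ∈ A) (hq0 : q ≠ 0)
    (h : ∀ n ∈ A, (O.valuation n < 1 ↔ ∃ m ∈ A, n = q * m)) {n : L} (hn : n ∈ A) (hn0 : n ≠ 0) :
    ∃ (j : ℕ) (n' : L), n' ∈ A ∧ O.valuation n' = 1 ∧ n = q ^ j * n' := by
  have := hA.ufm
  have hqu : ¬ IsUnit (⟨q, hq⟩ : A) := by
    intro hu
    obtain ⟨m, hm⟩ := hu.exists_right_inv
    have h1 : O.valuation q < 1 := (h q hq).2 ⟨1, one_mem _, by ring⟩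
    have h2 := vlt_mul O h1 (hAO m m.2)
    have h3 : q * (m : L) = 1 := congrArg Subtype.val hm
    rw [h3, map_one] at h2; exact lt_irrefl _ h2
  obtain ⟨j, a, ha, e⟩ := WfDvdMonoid.max_power_factor' (a₀ := (⟨n, hn⟩ : A)) (x := ⟨q, hq⟩)
    (by intro h0; exact hn0 (congrArg Subtype.val h0)) hqu
  refine ⟨j, a, a.2, ?_, congrArg Subtype.val e⟩
  rcases v1_or O (hAO a a.2) with h1 | h1
  · exact h1
  · obtain ⟨m, hm, e'⟩ := (h a a.2).1 h1
    exact absurd ⟨⟨m, hm⟩, Subtype.ext e'⟩ ha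

theorem Nice.num_den (hA : Nice A) (h : Dv A O) {z : L} (hz : z ∈ O) :
    ∃ n ∈ A, ∃ d ∈ A, O.valuation d = 1 ∧ z * d = n := by
  obtain ⟨hAO, q, hq, hq0, hm⟩ := h
  have hq1 : O.valuation q < 1 := (hm q hq).2 ⟨1, one_mem _, by ring⟩
  by_cases hz0 : z = 0
  · exact ⟨0, zero_mem _, 1, one_mem _, by simp, by simp [hz0]⟩
  obtain ⟨n, hn, d, hd, hd0, e⟩ := hA.fr z
  have hn0 : n ≠ 0 := by rw [← e]; exact mul_ne_zero hz0 hd0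
  obtain ⟨i, n', hn', hn1, en⟩ := hA.decomp hAO hq hq0 hm hn hn0
  obtain ⟨j, d', hd', hd1, ed⟩ := hA.decomp hAO hq hq0 hm hd hd0
  have hij : j ≤ i := by
    by_contra hij
    have h1 : O.valuation z ≤ 1 := (vle O).2 hz
    have h2 : O.valuation z * O.valuation q ^ j = O.valuation q ^ i := by
      have := congrArg O.valuation e
      rw [en, ed] at this
      simpa [hn1, hd1] using this
    have h3 : O.valuation q ^ j < O.valuation q ^ i :=
      pow_lt_pow_right_of_lt_one₀ (by simpa [zero_lt_iff] using hq0) hq1 (not_le.1 hij)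
    have h4 : O.valuation z * O.valuation q ^ j ≤ O.valuation q ^ j := mul_le_of_le_one_left' h1
    rw [h2] at h4
    exact absurd h3 (not_lt.2 h4)
  refine ⟨q ^ (i - j) * n', mul_mem (pow_mem hq _) hn', d', hd', hd1, ?_⟩
  have : q ^ j ≠ 0 := pow_ne_zero _ hq0
  apply mul_left_cancel₀ this
  calc q ^ j * (z * d') = z * d := by rw [ed]; ring
    _ = n := e
    _ = q ^ (j + (i - j)) * n' := by rw [en]; congr 2; omega
    _ = _ := by ring

theorem Dv.ne_top (h : Dv A O) : O ≠ ⊤ := by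
  rintro rfl
  obtain ⟨hAO, q, hq, hq0, hm⟩ := h
  have h1 := (hm q hq).2 ⟨1, one_mem _, by ring⟩
  have h2 : q⁻¹ ∈ (⊤ : ValuationSubring L) := trivial
  have h3 := vlt_mul _ h1 h2
  rw [mul_inv_cancel₀ hq0, map_one] at h3; exact lt_irrefl _ h3

theorem Nice.le_of (hA : Nice A) {O' : ValuationSubring L} (h : Dv A O) (h' : ∀ n ∈ A, n ∈ O')
    (hm : ∀ n ∈ A, O'.valuation n < 1 → O.valuation n < 1) : O ≤ O' := by
  intro z hz
  obtain ⟨n, hn, d, hd, hd1, e⟩ := hA.num_den h hz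
  have hd1' : O'.valuation d = 1 := by
    rcases v1_or O' (h' d hd) with h1 | h1
    · exact h1
    · exact absurd hd1 (hm d hd h1).ne
  have hd0 : d ≠ 0 := fun h => by rw [h] at hd1; simp at hd1
  have : z = n * d⁻¹ := by rw [← e]; field_simp
  rw [this]; exact mul_mem (h' n hn) (inv_mem_of_v1 O' hd1')

theorem Nice.finite_of (hA : Nice A) {h : L} (hh : h ∈ A) (h0 : h ≠ 0) :
    {O : ValuationSubring L | Dv A O ∧ O.valuation h < 1}.Finite := by
  have := hA.ufm
  have key : ∀ a : A, a ≠ 0 → {O : ValuationSubring L | Dv A O ∧ O.valuation (a : L) < 1}.Finite := by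
    intro a
    refine UniqueFactorizationMonoid.induction_on_prime a (fun h => absurd rfl h) ?_ ?_
    · intro x hx _
      convert Set.finite_empty
      ext O
      simp only [Set.mem_setOf_eq, Set.mem_empty_iff_false, iff_false]
      rintro ⟨hD, h1⟩
      obtain ⟨m, hm⟩ := hx.exists_right_inv
      have h2 := vlt_mul O h1 (hD.1 m m.2)
      have h3 : (x : L) * (m : L) = 1 := congrArg Subtype.val hm
      rw [h3, map_one] at h2; exact lt_irrefl _ h2
    · intro a p ha hp ih _
      have hsub : {O : ValuationSubring L | Dv A O ∧ O.valuation ((p * a : A) : L) < 1} ⊆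
          {O : ValuationSubring L | Dv A O ∧ O.valuation (p : L) < 1} ∪
          {O : ValuationSubring L | Dv A O ∧ O.valuation (a : L) < 1} := by
        rintro O ⟨hD, h1⟩
        rcases v1_or O (hD.1 p p.2) with h2 | h2
        · right; refine ⟨hD, ?_⟩
          rw [Subalgebra.coe_mul, map_mul, h2, one_mul] at h1; exact h1
        · left; exact ⟨hD, h2⟩
      refine Set.Finite.subset (Set.Finite.union ?_ (ih ha)) hsub
      apply Set.Subsingleton.finite
      have main : ∀ O : ValuationSubring L, Dv A O → O.valuation (p : L) < 1 →
          ∀ n ∈ A, (O.valuation n < 1 ↔ ∃ m ∈ A, n = p * m) := by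
        intro O hD h1 n hn
        obtain ⟨hAO, q, hq, hq0, hm⟩ := hD
        constructor
        · intro h2
          obtain ⟨m, hmA, e⟩ := (hm n hn).1 h2
          obtain ⟨c, hcA, e2⟩ := (hm p p.2).1 h1
          have e3 : p = (⟨q, hq⟩ : A) * ⟨c, hcA⟩ := Subtype.ext e2
          have hq1 : O.valuation q < 1 := (hm q hq).2 ⟨1, one_mem _, by ring⟩
          rcases hp.irreducible.isUnit_or_isUnit e3 with hu | hu
          · exfalso
            obtain ⟨m, hm⟩ := hu.exists_right_inv
            have h2 := vlt_mul O hq1 (hAO m m.2)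
            have h3 : q * (m : L) = 1 := congrArg Subtype.val hm
            rw [h3, map_one] at h2; exact lt_irrefl _ h2
          · obtain ⟨d, hd⟩ := hu.exists_right_inv
            have h3 : c * (d : L) = 1 := congrArg Subtype.val hd
            refine ⟨d * m, mul_mem d.2 hmA, ?_⟩
            rw [e2, e]; linear_combination (- q * m) * h3
        · rintro ⟨m, hmA, rfl⟩
          exact vlt_mul O h1 (hAO m hmA)
      rintro O ⟨hD, h1⟩ O' ⟨hD', h1'⟩
      apply le_antisymm
      · exact hA.le_of hD hD'.1 (fun n hn h => (main O hD h1 n hn).2 ((main O' hD' h1' n hn).1 h))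
      · exact hA.le_of hD' hD.1 (fun n hn h => (main O' hD' h1' n hn).2 ((main O hD h1 n hn).1 h))
  exact key ⟨h, hh⟩ (fun h1 => h0 (congrArg Subtype.val h1))

theorem Nice.common_den (hA : Nice A) (s : Set L) (hs : s.Finite) :
    ∃ h ∈ A, h ≠ 0 ∧ ∀ b ∈ Algebra.adjoin k s, ∃ j : ℕ, h ^ j * b ∈ A := by
  have h1 : ∃ h ∈ A, h ≠ 0 ∧ ∀ b ∈ s, h * b ∈ A := by
    induction s, hs using Set.Finite.induction_on with
    | empty => exact ⟨1, one_mem _, one_ne_zero, by simp⟩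
    | @insert z s _ _ ih =>
      obtain ⟨h, hh, h0, hb⟩ := ih
      obtain ⟨n, hn, d, hd, hd0, e⟩ := hA.fr z
      refine ⟨h * d, mul_mem hh hd, mul_ne_zero h0 hd0, ?_⟩
      rintro b (rfl | hbs)
      · have : h * d * b = h * n := by rw [← e]; ring
        rw [this]; exact mul_mem hh hn
      · have : h * d * b = d * (h * b) := by ring
        rw [this]; exact mul_mem hd (hb b hbs)
  obtain ⟨h, hh, h0, hb⟩ := h1
  refine ⟨h, hh, h0, fun b hbs => ?_⟩
  induction hbs using Algebra.adjoin_induction with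
  | mem b hbs => exact ⟨1, by simpa using hb b hbs⟩
  | algebraMap c => exact ⟨0, by simpa using A.algebraMap_mem c⟩
  | add a b _ _ ha hb =>
    obtain ⟨i, hi⟩ := ha
    obtain ⟨j, hj⟩ := hb
    refine ⟨i + j, ?_⟩
    have : h ^ (i + j) * (a + b) = h ^ j * (h ^ i * a) + h ^ i * (h ^ j * b) := by ring
    rw [this]; exact add_mem (mul_mem (pow_mem hh _) hi) (mul_mem (pow_mem hh _) hj)
  | mul a b _ _ ha hb =>
    obtain ⟨i, hi⟩ := ha
    obtain ⟨j, hj⟩ := hb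
    refine ⟨i + j, ?_⟩
    have : h ^ (i + j) * (a * b) = (h ^ i * a) * (h ^ j * b) := by ring
    rw [this]; exact mul_mem hi hj

theorem Nice.finite_diff (hA : Nice A) (hB : Nice B) {s t : Set L} (hs : s.Finite) (ht : t.Finite)
    (hAs : A = Algebra.adjoin k s) (hBt : B = Algebra.adjoin k t) :
    {O : ValuationSubring L | Dv A O ∧ ¬ Dv B O}.Finite := by
  obtain ⟨h, hhA, h0, hh⟩ := hA.common_den t ht
  rw [← hBt] at hh
  obtain ⟨g, hgB, g0, hg⟩ := hB.common_den s hs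
  rw [← hAs] at hg
  obtain ⟨i, hi⟩ := hh g hgB
  refine Set.Finite.subset (hA.finite_of (mul_mem hhA hi) (mul_ne_zero h0 (mul_ne_zero (pow_ne_zero _ h0) g0))) ?_
  rintro O ⟨hD, hnD⟩
  refine ⟨hD, ?_⟩
  by_contra hlt
  apply hnD
  have hAO := hD.1
  have hv : O.valuation (h * (h ^ i * g)) = 1 :=
    (v1_or O (hAO _ (mul_mem hhA hi))).resolve_right hlt
  have hvh : O.valuation h = 1 := by
    rcases v1_or O (hAO h hhA) with h1 | h1
    · exact h1
    · exact absurd hv (vlt_mul O h1 (hAO _ hi)).ne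
  have hvg : O.valuation g = 1 := by simpa [hvh] using hv
  have hBO : ∀ n ∈ B, n ∈ O := by
    intro b hb
    obtain ⟨j, hj⟩ := hh b hb
    have := (vle O).2 (hAO _ hj)
    rw [map_mul, map_pow, hvh, one_pow, one_mul] at this
    exact (vle O).1 this
  refine ⟨hBO, ?_⟩
  obtain ⟨-, q, hq, hq0, hm⟩ := hD
  have hq1 : O.valuation q < 1 := (hm q hq).2 ⟨1, one_mem _, by ring⟩
  obtain ⟨j, hj⟩ := hg q hq
  have := hB.ufm
  have hex : ∃ r : B, Prime r ∧ r ∣ ⟨g ^ j * q, hj⟩ ∧ O.valuation (r : L) < 1 := by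
    have key : ∀ a : B, a ≠ 0 → O.valuation (a : L) < 1 → ∃ r : B, Prime r ∧ r ∣ a ∧ O.valuation (r : L) < 1 := by
      intro a
      refine UniqueFactorizationMonoid.induction_on_prime a (fun h => absurd rfl h) ?_ ?_
      · intro x hx _ h1
        exfalso
        obtain ⟨m, hm⟩ := hx.exists_right_inv
        have h2 := vlt_mul O h1 (hBO m m.2)
        have h3 : (x : L) * (m : L) = 1 := congrArg Subtype.val hm
        rw [h3, map_one] at h2; exact lt_irrefl _ h2
      · intro a p ha hp ih _ h1
        rcases v1_or O (hBO p p.2) with h2 | h2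
        · rw [Subalgebra.coe_mul, map_mul, h2, one_mul] at h1
          obtain ⟨r, hr, hra, hr1⟩ := ih ha h1
          exact ⟨r, hr, hra.mul_left _, hr1⟩
        · exact ⟨p, hp, dvd_mul_right _ _, h2⟩
    refine key _ ?_ ?_
    · intro h; exact mul_ne_zero (pow_ne_zero _ g0) hq0 (congrArg Subtype.val h)
    · simpa [hvg] using hq1
  obtain ⟨r, hr, ⟨c, hc⟩, hr1⟩ := hex
  have hc' : g ^ j * q = r * c := congrArg Subtype.val hc
  refine ⟨r, r.2, fun h => hr.ne_zero (Subtype.ext h), fun b hb => ⟨fun hb1 => ?_, ?_⟩⟩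
  · obtain ⟨e, he⟩ := hh b hb
    have h1 : O.valuation (h ^ e * b) < 1 := by simpa [hvh] using hb1
    obtain ⟨a, ha, ea⟩ := (hm _ he).1 h1
    obtain ⟨e1, he1⟩ := hg a ha
    obtain ⟨e2, he2⟩ := hg (h ^ e) (pow_mem hhA _)
    have hdvd : r ∣ (⟨g ^ (e2 + j + e1) * h ^ e, by
        have : g ^ (e2 + j + e1) * h ^ e = g ^ (j + e1) * (g ^ e2 * h ^ e) := by ring
        rw [this]; exact mul_mem (pow_mem hgB _) he2⟩ : B) * ⟨b, hb⟩ := by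
      refine ⟨c * ⟨g ^ e2, pow_mem hgB _⟩ * ⟨g ^ e1 * a, he1⟩, Subtype.ext ?_⟩
      change g ^ (e2 + j + e1) * h ^ e * b = r * (c * g ^ e2 * (g ^ e1 * a))
      linear_combination g ^ (e2 + j + e1) * ea + g ^ e2 * g ^ e1 * a * hc'
    rcases hr.dvd_or_dvd hdvd with ⟨d, hd⟩ | ⟨d, hd⟩
    · exfalso
      have h2 : g ^ (e2 + j + e1) * h ^ e = r * d := congrArg Subtype.val hd
      have h3 := vlt_mul O hr1 (hBO d d.2)
      rw [← h2] at h3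
      simp [hvg, hvh] at h3
    · exact ⟨d, d.2, congrArg Subtype.val hd⟩
  · rintro ⟨m, hm, rfl⟩
    exact vlt_mul O hr1 (hBO m hm)

end Dv
end Cr

namespace Cr
open Polynomial

section rank
variable (k : Type*) {G : Type*} [Field k] [Field G] [Algebra k G]

/-- algebraic matroid -/
noncomputable abbrev Mt (k G : Type*) [Field k] [Field G] [Algebra k G] : Matroid G :=
  AlgebraicIndependent.matroid k G

noncomputable abbrev rk (S : Set G) : ℕ∞ := (Mt k G).eRk S

/-- the relative algebraic closure of `k(S)` -/
noncomputable def cl (S : Set G) : IntermediateField k G :=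
  (algebraicClosure (IntermediateField.adjoin k S) G).restrictScalars k

variable {k}

theorem mem_cl {S : Set G} {z : G} : z ∈ cl k S ↔ IsAlgebraic (IntermediateField.adjoin k S) z := by
  rw [cl, IntermediateField.mem_restrictScalars, mem_algebraicClosure_iff]

theorem isAlg_adjoin_iff {S : Set G} {z : G} :
    IsAlgebraic (IntermediateField.adjoin k S) z ↔ IsAlgebraic (Algebra.adjoin k S) z := by
  open scoped IntermediateField.algebraAdjoinAdjoin in
  exact (IsFractionRing.isAlgebraic_iff (Algebra.adjoin k S) (IntermediateField.adjoin k S) G).symm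

theorem closure_eq (S : Set G) : (Mt k G).closure S = cl k S := by
  rw [AlgebraicIndependent.matroid_closure_eq]
  ext z
  rw [SetLike.mem_coe, Subalgebra.mem_algebraicClosure, SetLike.mem_coe, mem_cl, isAlg_adjoin_iff]

theorem subset_cl (S : Set G) : S ⊆ cl k S := by
  rw [← closure_eq]; exact (Mt k G).subset_closure S

theorem cl_mono {S T : Set G} (h : S ⊆ T) : cl k S ≤ cl k T := by
  have := (Mt k G).closure_subset_closure h
  rwa [closure_eq, closure_eq] at this

theorem cl_le {S T : Set G} (h : S ⊆ cl k T) : cl k S ≤ cl k T := by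
  have := (Mt k G).closure_subset_closure h
  rw [← closure_eq T, (Mt k G).closure_closure, closure_eq, closure_eq] at this
  exact this

theorem adjoin_le_cl (S : Set G) : IntermediateField.adjoin k S ≤ cl k S :=
  IntermediateField.adjoin_le_iff.2 (subset_cl S)

theorem cl_adjoin (S : Set G) : cl k (IntermediateField.adjoin k S : Set G) = cl k S :=
  le_antisymm (cl_le (adjoin_le_cl S)) (cl_mono (IntermediateField.subset_adjoin _ _))

theorem mem_cl_of_alg {S : Set G} {E : IntermediateField k G} (hE : (E : Set G) ⊆ cl k S) {z : G}
    (hz : IsAlgebraic E z) : z ∈ cl k S := by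
  have h1 : z ∈ cl k (E : Set G) := by
    rw [mem_cl, IntermediateField.adjoin_self]; exact hz
  exact cl_le hE h1

theorem mem_cl_of_pow {S : Set G} {z : G} {n : ℕ} (hn : 0 < n) (hz : z ^ n ∈ cl k S) : z ∈ cl k S := by
  rw [mem_cl] at *; exact hz.of_pow hn

theorem mem_cl_of_root {S : Set G} {z : G} (p : Polynomial (cl k S)) (hp : p ≠ 0) (h : aeval z p = 0) :
    z ∈ cl k S := mem_cl_of_alg (E := cl k S) le_rfl ⟨p, hp, h⟩

theorem rk_cl (S : Set G) : rk k (cl k S : Set G) = rk k S := by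
  rw [rk, ← closure_eq, Matroid.eRk_closure_eq]

theorem rk_le_of_subset {S T : Set G} (h : S ⊆ cl k T) : rk k S ≤ rk k T := by
  rw [← rk_cl T]; exact (Mt k G).eRk_mono h

theorem rk_le_encard (S : Set G) : rk k S ≤ S.encard := (Mt k G).eRk_le_encard S

theorem rk_mono {S T : Set G} (h : S ⊆ T) : rk k S ≤ rk k T := (Mt k G).eRk_mono h

theorem rk_insert_le (z : G) (S : Set G) : rk k (insert z S) ≤ rk k S + 1 :=
  (Mt k G).eRk_insert_le_add_one z S

theorem rk_range_le {ι : Type*} [Fintype ι] (a : ι → G) : rk k (Set.range a) ≤ Fintype.card ι := by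
  refine (rk_le_encard _).trans ?_
  rw [← Set.image_univ]
  refine (Set.encard_image_le _ _).trans ?_
  simp

theorem rk_of_indep {ι : Type*} [Fintype ι] {a : ι → G} (h : AlgebraicIndependent k a) :
    rk k (Set.range a) = Fintype.card ι := by
  have h1 : (Mt k G).Indep (Set.range a) := by
    rw [AlgebraicIndependent.matroid_indep_iff]; exact h.coe_range
  rw [rk, h1.eRk_eq_encard, ← Set.image_univ, h.injective.injOn.encard_image]
  simp

theorem indep_of_rk {ι : Type*} [Fintype ι] {a : ι → G} (h : (Fintype.card ι : ℕ∞) ≤ rk k (Set.range a)) :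
    AlgebraicIndependent k a := by
  have h2 : (Set.range a).encard ≤ Fintype.card ι := by
    rw [← Set.image_univ]; refine (Set.encard_image_le _ _).trans ?_; simp
  have h3 : (Set.range a).encard = Fintype.card ι := le_antisymm h2 (h.trans (rk_le_encard _))
  have hinj : Function.Injective a := by
    rw [← Set.injOn_univ]
    refine Set.Finite.injOn_of_encard_image_eq Set.finite_univ ?_
    rw [Set.image_univ, h3]; simp
  have h1 : (Mt k G).Indep (Set.range a) := by
    rw [Matroid.indep_iff_eRk_eq_encard_of_finite (Set.finite_range a)]
    exact le_antisymm (rk_le_encard _) (by rw [h3]; exact h)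
  rw [AlgebraicIndependent.matroid_indep_iff] at h1
  exact (algebraicIndependent_subtype_range hinj).1 h1

/-- In a family of `m+1` elements of rank at least `m`, one may skip an element. -/
theorem exists_skip {m : ℕ} {ι : Type*} [Fintype ι] [DecidableEq ι] (hc : Fintype.card ι = m + 1) {a : ι → G}
    (h : (m : ℕ∞) ≤ rk k (Set.range a)) :
    ∃ i, AlgebraicIndependent k (fun j : {j // j ≠ i} => a j.1) := by
  obtain ⟨I, hI, hind, hcard⟩ := Matroid.le_eRk_iff.1 h
  have : ∀ z : I, ∃ j, a j = z := fun z => hI z.2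
  choose s hs using this
  have hfin : I.Finite := (Set.finite_range a).subset hI
  have := hfin.fintype
  have hIc : Fintype.card I = m := by
    have : (Fintype.card I : ℕ∞) = m := by rw [← hcard, Set.encard_eq_coe_toFinset_card, Set.toFinset_card]
    exact_mod_cast this
  have hns : ¬ Function.Surjective s := fun hs' => by
    have := Fintype.card_le_of_surjective s hs'; omega
  obtain ⟨i, hi⟩ := not_forall.1 hns
  refine ⟨i, indep_of_rk ?_⟩
  have : Fintype.card {j // j ≠ i} = m := by
    rw [Fintype.card_subtype_compl]; simp [hc]
  rw [this, ← hcard, ← hind.eRk_eq_encard]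
  apply rk_mono
  intro z hz
  exact ⟨⟨s ⟨z, hz⟩, fun h => hi ⟨_, h⟩⟩, hs _⟩

end rank

section place
variable {k L G : Type*} [Field k] [Field L] [Algebra k L] [Field G] [Algebra k G]

/-- A place (total function, junk outside `O`). -/
structure Place (k : Type*) {L G : Type*} [Field k] [Field L] [Algebra k L] [Field G] [Algebra k G]
    (O : ValuationSubring L) (π : L → G) : Prop where
  add : ∀ {a b}, a ∈ O → b ∈ O → π (a + b) = π a + π b
  mul : ∀ {a b}, a ∈ O → b ∈ O → π (a * b) = π a * π b
  cmem : ∀ c : k, algebraMap k L c ∈ O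
  const : ∀ c : k, π (algebraMap k L c) = algebraMap k G c
  zero : ∀ {a}, a ∈ O → (π a = 0 ↔ O.valuation a < 1)

namespace Place
variable {O : ValuationSubring L} {π : L → G}

theorem map_one (h : Place k O π) : π 1 = 1 := by have := h.const 1; rwa [_root_.map_one, _root_.map_one] at this
theorem map_zero (h : Place k O π) : π 0 = 0 := by have := h.const 0; rwa [_root_.map_zero, _root_.map_zero] at this
theorem neg (h : Place k O π) {a} (ha : a ∈ O) : π (-a) = - π a := by
  have := h.add ha (neg_mem ha)
  rw [add_neg_cancel, h.map_zero] at this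
  linear_combination -this
theorem sub (h : Place k O π) {a b} (ha : a ∈ O) (hb : b ∈ O) : π (a - b) = π a - π b := by
  rw [sub_eq_add_neg, h.add ha (neg_mem hb), h.neg hb]; ring
theorem pow (h : Place k O π) {a} (ha : a ∈ O) (n : ℕ) : π (a ^ n) = π a ^ n := by
  induction n with
  | zero => simpa using h.map_one
  | succ n ih => rw [pow_succ, h.mul (pow_mem ha n) ha, ih, pow_succ]
theorem ne_zero (h : Place k O π) {a} (ha : O.valuation a = 1) : π a ≠ 0 := fun h0 => by
  have := (h.zero ((vle O).1 ha.le)).1 h0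
  exact absurd ha this.ne
theorem v1 (h : Place k O π) {a} (ha : a ∈ O) (h0 : π a ≠ 0) : O.valuation a = 1 := by
  rcases v1_or O ha with h1 | h1
  · exact h1
  · exact absurd ((h.zero ha).2 h1) h0
theorem inv (h : Place k O π) {a} (ha : O.valuation a = 1) : π a⁻¹ = (π a)⁻¹ := by
  have ha0 : a ≠ 0 := fun h => by rw [h] at ha; simp at ha
  have := h.mul ((vle O).1 ha.le) (inv_mem_of_v1 O ha)
  rw [mul_inv_cancel₀ ha0, h.map_one] at this
  exact eq_inv_of_mul_eq_one_right this.symm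
theorem div (h : Place k O π) {a b} (ha : a ∈ O) (hb : O.valuation b = 1) : π (a / b) = π a / π b := by
  rw [div_eq_mul_inv, h.mul ha (inv_mem_of_v1 O hb), h.inv hb, div_eq_mul_inv]

/-- the ring hom -/
def hom (h : Place k O π) : O →+* G where
  toFun z := π z
  map_one' := h.map_one
  map_mul' a b := h.mul a.2 b.2
  map_zero' := h.map_zero
  map_add' a b := h.add a.2 b.2

theorem mvaeval (h : Place k O π) {ι : Type*} {a : ι → L} (ha : ∀ i, a i ∈ O) (p : MvPolynomial ι k) :
    MvPolynomial.aeval a p ∈ O ∧ π (MvPolynomial.aeval a p) = MvPolynomial.aeval (fun i => π (a i)) p := by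
  induction p using MvPolynomial.induction_on with
  | C c => simpa using ⟨h.cmem c, h.const c⟩
  | add p q hp hq => rw [_root_.map_add, _root_.map_add, h.add hp.1 hq.1, hp.2, hq.2]; exact ⟨add_mem hp.1 hq.1, rfl⟩
  | mul_X p i hp =>
    rw [_root_.map_mul, _root_.map_mul, MvPolynomial.aeval_X, MvPolynomial.aeval_X, h.mul hp.1 (ha i), hp.2]
    exact ⟨mul_mem hp.1 (ha i), rfl⟩

theorem indep_lift (h : Place k O π) {ι : Type*} {a : ι → L} (ha : ∀ i, a i ∈ O)
    (hi : AlgebraicIndependent k (fun i => π (a i))) : AlgebraicIndependent k a := by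
  rw [algebraicIndependent_iff] at *
  intro p hp
  apply hi
  rw [← (h.mvaeval ha p).2, hp, h.map_zero]

theorem adjoin_mem (h : Place k O π) {ι : Type*} {a : ι → L} (ha : ∀ i, a i ∈ O) :
    ∀ z ∈ Algebra.adjoin k (Set.range a), z ∈ O := by
  intro z hz
  rw [Algebra.adjoin_range_eq_range_aeval] at hz
  obtain ⟨p, rfl⟩ := hz
  exact (h.mvaeval ha p).1

theorem adjoin_v1 (h : Place k O π) {ι : Type*} {a : ι → L} (ha : ∀ i, a i ∈ O)
    (hi : AlgebraicIndependent k (fun i => π (a i))) :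
    ∀ z ∈ Algebra.adjoin k (Set.range a), z ≠ 0 → O.valuation z = 1 := by
  intro z hz hz0
  rw [Algebra.adjoin_range_eq_range_aeval] at hz
  obtain ⟨p, rfl⟩ := hz
  refine h.v1 (h.mvaeval ha p).1 ?_
  intro h0
  apply hz0
  change π (MvPolynomial.aeval a p) = 0 at h0
  rw [(h.mvaeval ha p).2] at h0
  rw [algebraicIndependent_iff.1 hi p h0]; simp

/-- residues of elements of `k[S]` lie in the algebra generated by residues -/
theorem res_adjoin (h : Place k O π) {S : Set L} (hS : ∀ z ∈ S, z ∈ O) : ∀ z ∈ Algebra.adjoin k S, z ∈ O ∧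
    π z ∈ Algebra.adjoin k (π '' S) := by
  intro z hz
  induction hz using Algebra.adjoin_induction with
  | mem z hz => exact ⟨hS z hz, Algebra.subset_adjoin ⟨z, hz, rfl⟩⟩
  | algebraMap c => exact ⟨h.cmem c, by rw [h.const]; exact Subalgebra.algebraMap_mem _ c⟩
  | add a b _ _ ha hb => exact ⟨add_mem ha.1 hb.1, by rw [h.add ha.1 hb.1]; exact add_mem ha.2 hb.2⟩
  | mul a b _ _ ha hb => exact ⟨mul_mem ha.1 hb.1, by rw [h.mul ha.1 hb.1]; exact mul_mem ha.2 hb.2⟩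

theorem res_Dv (h : Place k O π) {S : Set L} (hA : Nice (Algebra.adjoin k S)) (hD : Dv (Algebra.adjoin k S) O) {z : L}
    (hz : z ∈ O) : π z ∈ IntermediateField.adjoin k (π '' S) := by
  obtain ⟨n, hn, d, hd, hd1, e⟩ := hA.num_den hD hz
  have hS : ∀ z ∈ S, z ∈ O := fun z hz => hD.1 z (Algebra.subset_adjoin hz)
  have hle := IntermediateField.algebra_adjoin_le_adjoin k (π '' S)
  have h1 := hle (h.res_adjoin hS n hn).2
  have h2 := hle (h.res_adjoin hS d hd).2
  have h3 : π z * π d = π n := by rw [← h.mul hz ((vle O).1 hd1.le), e]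
  have h4 := h.ne_zero hd1
  have : π z = π n / π d := by rw [← h3]; field_simp
  rw [this]; exact div_mem h1 h2

/-- If the residues of elements of a field `S` have full rank then `S ⊆ O`. -/
theorem subfield_mem (h : Place k O π) {m : ℕ} (S : IntermediateField k L) (hS : rk k (S : Set L) ≤ m)
    (hr : (m : ℕ∞) ≤ rk k (π '' {z | z ∈ S ∧ z ∈ O})) : ∀ z ∈ S, z ∈ O := by
  obtain ⟨I, hI, hind, hcard⟩ := Matroid.le_eRk_iff.1 hr
  have hfin : I.Finite := Set.finite_of_encard_eq_coe hcard
  have := hfin.fintype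
  have hIc : Fintype.card I = m := by
    have : (Fintype.card I : ℕ∞) = m := by rw [← hcard, Set.encard_eq_coe_toFinset_card, Set.toFinset_card]
    exact_mod_cast this
  have : ∀ z : I, ∃ y, (y ∈ S ∧ y ∈ O) ∧ π y = z := fun z => hI z.2
  choose a ha ha' using this
  have hi : AlgebraicIndependent k (fun i => π (a i)) := by
    rw [AlgebraicIndependent.matroid_indep_iff] at hind
    have : (fun i => π (a i)) = fun i : I => (i : G) := funext ha'
    rw [this]; exact hind
  have hia := h.indep_lift (fun i => (ha i).2) hi
  have hrk := rk_of_indep hia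
  have hsub : Set.range a ⊆ S := by rintro _ ⟨i, rfl⟩; exact (ha i).1
  have hcl : (S : Set L) ⊆ cl k (Set.range a) := by
    have hrf : (Mt k L).IsRkFinite (Set.range a) := by
      rw [← Matroid.eRk_lt_top_iff (M := Mt k L) (X := Set.range a)]; exact lt_of_le_of_lt ((rk_mono hsub).trans hS) (by simp)
    have h1 := hrf.closure_eq_closure_of_subset_of_eRk_ge_eRk hsub (by
      change rk k _ ≤ rk k _; rw [hrk, hIc]; exact hS)
    rw [← closure_eq, h1]; exact (Mt k L).subset_closure _ (fun _ _ => trivial)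
  have hadj := h.adjoin_v1 (fun i => (ha i).2) hi
  have hF : ∀ z ∈ IntermediateField.adjoin k (Set.range a), z ∈ O := by
    intro z hz
    obtain ⟨r, hr, s, hs, e⟩ := (IntermediateField.mem_adjoin_iff_div (F := k)).1 hz
    rw [e]
    by_cases hs0 : s = 0
    · rw [hs0, div_zero]; exact zero_mem _
    · rw [div_eq_mul_inv]
      exact mul_mem (h.adjoin_mem (fun i => (ha i).2) _ hr) (inv_mem_of_v1 O (hadj s hs hs0))
  intro z hz
  have h2 := mem_cl.1 (hcl hz)
  exact mem_of_isIntegral (Ω := IntermediateField.adjoin k (Set.range a)) O (fun c => hF c c.2) h2.isIntegral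

end Place
end place
end Cr

namespace Cr
open Polynomial

section H
variable {k L : Type*} [Field k] [Field L] [Algebra k L]

theorem subset_cl_of_rk {ι : Type*} [Fintype ι] {a : ι → L} {T : Set L} (hsub : Set.range a ⊆ T)
    (h : rk k T ≤ rk k (Set.range a)) : T ⊆ cl k (Set.range a) := by
  have hrf : (Mt k L).IsRkFinite (Set.range a) := by
    rw [← Matroid.eRk_lt_top_iff (M := Mt k L) (X := Set.range a)]
    exact lt_of_le_of_lt (rk_range_le a) (by simp)
  have h1 := hrf.closure_eq_closure_of_subset_of_eRk_ge_eRk hsub h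
  rw [← closure_eq, h1]; exact (Mt k L).subset_closure _ (fun _ _ => trivial)

theorem nice_of {ι : Type*} {a : ι → L} (hi : AlgebraicIndependent k a)
    (hg : IntermediateField.adjoin k (Set.range a) = ⊤) : Nice (Algebra.adjoin k (Set.range a)) := by
  constructor
  · exact (hi.aevalEquiv.toMulEquiv).uniqueFactorizationMonoid inferInstance
  · intro z
    have hz : z ∈ IntermediateField.adjoin k (Set.range a) := by rw [hg]; trivial
    obtain ⟨r, hr, s, hs, e⟩ := (IntermediateField.mem_adjoin_iff_div (F := k)).1 hz
    by_cases h0 : s = 0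
    · refine ⟨0, zero_mem _, 1, one_mem _, one_ne_zero, ?_⟩
      rw [e, h0]; simp
    · exact ⟨r, hr, s, hs, h0, by rw [e]; field_simp⟩

/-- Lemma H -/
theorem Nice.lemmaH {A0 A : Subalgebra k L} (hA : Nice A) (h0 : A0 ≤ A) {s : L} (hs : s ∈ A)
    (htr : Transcendental A0 s) (hrep : ∀ n ∈ A, ∃ p : Polynomial A0, aeval s p = n)
    {O : ValuationSubring L} (hAO : ∀ n ∈ A, n ∈ O) (hT : O ≠ ⊤)
    (h1 : ∀ z ∈ A0, z ≠ 0 → O.valuation z = 1) : Dv A O := by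
  classical
  have := hA.ufm
  have hmem : ∀ p : Polynomial A0, aeval s p ∈ A := by
    intro p
    rw [aeval_eq_sum_range]
    refine sum_mem fun i _ => ?_
    rw [Algebra.smul_def]
    exact mul_mem (h0 (p.coeff i).2) (pow_mem hs i)
  have hinj : ∀ p : Polynomial A0, aeval s p = 0 → p = 0 := by
    intro p hp; by_contra h; exact htr ⟨p, h, hp⟩
  have hex : ∃ d, ∃ p : Polynomial A0, p ≠ 0 ∧ O.valuation (aeval s p) < 1 ∧ p.natDegree = d := by
    obtain ⟨z, hz⟩ : ∃ z, z ∉ O := by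
      by_contra h; push Not at h; exact hT (eq_top_iff.2 fun z _ => h z)
    obtain ⟨n, hn, d, hd, hd0, e⟩ := hA.fr z
    have hz0 : z ≠ 0 := fun h => hz (h ▸ zero_mem _)
    have h2 : O.valuation d < 1 := by
      have := vlt_mul O (inv_vlt O hz) (hAO n hn)
      rwa [← e, inv_mul_cancel_left₀ hz0] at this
    obtain ⟨p, hp⟩ := hrep d hd
    refine ⟨_, p, ?_, by rwa [hp], rfl⟩
    rintro rfl; simp at hp; exact hd0 hp.symm
  obtain ⟨p0, hp0, hp0v, hp0d⟩ := Nat.find_spec hex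
  have hmin : ∀ p : Polynomial A0, p ≠ 0 → O.valuation (aeval s p) < 1 → p0.natDegree ≤ p.natDegree :=
    fun p h1 h2 => by rw [hp0d]; exact Nat.find_min' hex ⟨p, h1, h2, rfl⟩
  -- prime factor
  have hfac : ∃ r : A, Prime r ∧ O.valuation (r : L) < 1 ∧ ∃ m : A, (r : L) * m = aeval s p0 := by
    have hne : (⟨aeval s p0, hmem p0⟩ : A) ≠ 0 := fun h => hp0 (hinj _ (congrArg Subtype.val h))
    obtain ⟨f, hf, hfa⟩ := UniqueFactorizationMonoid.exists_prime_factors _ hne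
    by_contra hcon
    push Not at hcon
    have hall : ∀ g : Multiset A, (∀ b ∈ g, Prime b ∧ b ∈ f) → O.valuation (g.prod : A).1 = 1 := by
      intro g
      induction g using Multiset.induction_on with
      | empty => intro _; simp
      | cons b g ih =>
        intro hg
        have hb := hg b (Multiset.mem_cons_self _ _)
        have h3 := ih (fun c hc => hg c (Multiset.mem_cons_of_mem hc))
        rw [Multiset.prod_cons]
        change O.valuation (b.1 * _) = 1
        refine v1_mul O ?_ h3
        rcases v1_or O (hAO b b.2) with h4 | h4
        · exact h4
        · obtain ⟨m, hm⟩ := (Multiset.dvd_prod hb.2).trans hfa.dvd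
          exact absurd (congrArg Subtype.val hm.symm) (hcon b hb.1 h4 m)
    have h5 := hall f (fun b hb => ⟨hf b hb, hb⟩)
    obtain ⟨u, hu⟩ := hfa
    have hu' : (f.prod : A).1 * (u : A).1 = aeval s p0 := congrArg Subtype.val hu
    have hu1 : O.valuation (u : A).1 = 1 := by
      have e : (u : A).1 * ((u⁻¹ : Aˣ) : A).1 = 1 := congrArg Subtype.val (Units.mul_inv u)
      rcases v1_or O (hAO _ (u : A).2) with h4 | h4
      · exact h4
      · have := vlt_mul O h4 (hAO _ ((u⁻¹ : Aˣ) : A).2)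
        rw [e] at this; simp at this
    rw [← hu'] at hp0v
    exact absurd (v1_mul O h5 hu1) hp0v.ne
  obtain ⟨r, hr, hrv, m, hrm⟩ := hfac
  obtain ⟨pr, hpr⟩ := hrep r r.2
  obtain ⟨pm, hpm⟩ := hrep m m.2
  have hprm : pr * pm = p0 := by
    apply sub_eq_zero.1; apply hinj; rw [map_sub, map_mul, hpr, hpm, hrm, sub_self]
  have hpr0 : pr ≠ 0 := by rintro rfl; simp at hprm; exact hp0 hprm.symm
  have hpm0 : pm ≠ 0 := by rintro rfl; simp at hprm; exact hp0 hprm.symm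
  have hdeg : pr.natDegree ≤ p0.natDegree := by
    rw [← hprm, natDegree_mul hpr0 hpm0]; omega
  have key : ∀ N, ∀ p : Polynomial A0, p.natDegree < N → O.valuation (aeval s p) < 1 →
      ∃ m ∈ A, aeval s p = r * m := by
    intro N
    induction N with
    | zero => intro p hp; omega
    | succ N ih =>
      intro p hpN hpv
      by_cases hp : p = 0
      · exact ⟨0, zero_mem _, by simp [hp]⟩
      have hle := hdeg.trans (hmin p hp hpv)
      have hlr : pr.leadingCoeff ≠ 0 := leadingCoeff_ne_zero.2 hpr0
      have hlp : p.leadingCoeff ≠ 0 := leadingCoeff_ne_zero.2 hp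
      set a := C pr.leadingCoeff * p with ha
      set b := C p.leadingCoeff * X ^ (p.natDegree - pr.natDegree) * pr with hb
      have hda : a.degree = p.degree := by rw [ha, degree_C_mul hlr]
      have hdb : b.degree = p.degree := by
        rw [hb, mul_assoc, degree_C_mul hlp, degree_mul, degree_X_pow, degree_eq_natDegree hp,
          degree_eq_natDegree hpr0, ← Nat.cast_add]
        congr 1; omega
      have hlt : (a - b).degree < a.degree := by
        apply degree_sub_lt (hda.trans hdb.symm) (mul_ne_zero (by simpa using hlr) hp)
        rw [ha, hb, leadingCoeff_mul, leadingCoeff_mul, leadingCoeff_mul, leadingCoeff_C, leadingCoeff_C,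
          leadingCoeff_X_pow]; ring
      have hv : O.valuation (aeval s (a - b)) < 1 := by
        rw [map_sub]
        apply vlt_sub
        · rw [ha, map_mul]; exact vlt_mul' O (hAO _ (hmem _)) hpv
        · rw [hb, map_mul, hpr]; exact vlt_mul' O (hAO _ (hmem _)) hrv
      have hab : ∃ m ∈ A, aeval s (a - b) = r * m := by
        by_cases hz : a - b = 0
        · exact ⟨0, zero_mem _, by simp [hz]⟩
        · apply ih _ _ hv
          rw [hda] at hlt
          have := natDegree_lt_natDegree hz hlt
          omega
      obtain ⟨m, hm, e⟩ := hab
      have e2 : (pr.leadingCoeff : L) * aeval s p = r * (m + aeval s (C p.leadingCoeff * X ^ (p.natDegree - pr.natDegree))) := by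
        have : aeval s a = (pr.leadingCoeff : L) * aeval s p := by
          rw [ha, map_mul, aeval_C]; rfl
        rw [← this]
        have h3 : aeval s b = aeval s (C p.leadingCoeff * X ^ (p.natDegree - pr.natDegree)) * r := by
          rw [hb, map_mul, hpr]
        rw [map_sub, h3] at e
        linear_combination e
      have hdvd : r ∣ (⟨pr.leadingCoeff, h0 pr.leadingCoeff.2⟩ : A) * ⟨aeval s p, hmem p⟩ :=
        ⟨⟨_, add_mem hm (hmem _)⟩, Subtype.ext e2⟩
      rcases hr.dvd_or_dvd hdvd with h3 | h3
      · obtain ⟨c, hc⟩ := h3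
        have hc' : (pr.leadingCoeff : L) = r * c := congrArg Subtype.val hc
        have h4 := vlt_mul O hrv (hAO c c.2)
        rw [← hc', h1 _ pr.leadingCoeff.2 (by simpa using hlr)] at h4
        simp at h4
      · obtain ⟨c, hc⟩ := h3
        exact ⟨c, c.2, congrArg Subtype.val hc⟩
  refine ⟨hAO, r, r.2, by simpa using hr.ne_zero, ?_⟩
  intro n hn
  constructor
  · intro hv
    obtain ⟨p, rfl⟩ := hrep n hn
    exact key _ p (Nat.lt_succ_self _) hv
  · rintro ⟨m, hm, rfl⟩
    exact vlt_mul O hrv (hAO m hm)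

theorem rep_of {ι : Type*} [DecidableEq ι] (a : ι → L) (i : ι) :
    ∀ n ∈ Algebra.adjoin k (Set.range a),
      ∃ p : Polynomial (Algebra.adjoin k (Set.range fun j : {j // j ≠ i} => a j.1)), aeval (a i) p = n := by
  set A0 := Algebra.adjoin k (Set.range fun j : {j // j ≠ i} => a j.1)
  have : Algebra.adjoin k (Set.range a) ≤ ((aeval (R := A0) (a i)).range).restrictScalars k := by
    apply Algebra.adjoin_le
    rintro _ ⟨j, rfl⟩
    by_cases hj : j = i
    · exact ⟨X, by simp [hj]⟩
    · refine ⟨C ⟨a j, Algebra.subset_adjoin ⟨⟨j, hj⟩, rfl⟩⟩, ?_⟩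
      simp [Algebra.algebraMap_eq_smul_one, Subalgebra.smul_def]
  intro n hn
  exact this hn

theorem trans_of {ι : Type*} [DecidableEq ι] {a : ι → L} (hi : AlgebraicIndependent k a) (i : ι) :
    Transcendental (Algebra.adjoin k (Set.range fun j : {j // j ≠ i} => a j.1)) (a i) := by
  have h1 := hi.transcendental_adjoin (s := {j | j ≠ i}) (i := i) (by simp)
  have : a '' {j | j ≠ i} = Set.range fun j : {j // j ≠ i} => a j.1 := by
    ext z; simp
  rwa [this] at h1

/-- `H` for the polynomial algebra. -/
theorem lemmaH' {ι : Type*} [DecidableEq ι] {a : ι → L} (hi : AlgebraicIndependent k a)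
    (hg : IntermediateField.adjoin k (Set.range a) = ⊤) (i : ι) {O : ValuationSubring L}
    (hAO : ∀ n ∈ Algebra.adjoin k (Set.range a), n ∈ O) (hT : O ≠ ⊤)
    (h1 : ∀ z ∈ Algebra.adjoin k (Set.range fun j : {j // j ≠ i} => a j.1), z ≠ 0 → O.valuation z = 1) :
    Dv (Algebra.adjoin k (Set.range a)) O := by
  refine (nice_of hi hg).lemmaH (Algebra.adjoin_mono ?_) (Algebra.subset_adjoin ⟨i, rfl⟩) (trans_of hi i)
    (rep_of a i) hAO hT h1
  rintro _ ⟨j, rfl⟩; exact ⟨j.1, rfl⟩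

/-- Valuation rings containing `k[a]`, with residues of `a` of corank at most 1. -/
theorem Place.dv {G : Type*} [Field G] [Algebra k G] {ι : Type*} [Fintype ι] [DecidableEq ι] {a : ι → L}
    (hi : AlgebraicIndependent k a)
    (hg : IntermediateField.adjoin k (Set.range a) = ⊤) {O : ValuationSubring L} {π : L → G}
    (h : Place k O π) (ha : ∀ i, a i ∈ O) (hT : O ≠ ⊤) {m : ℕ} (hc : Fintype.card ι = m + 1)
    (hr : (m : ℕ∞) ≤ rk k (Set.range fun i => π (a i))) : Dv (Algebra.adjoin k (Set.range a)) O := by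
  obtain ⟨i, hi'⟩ := exists_skip hc hr
  exact lemmaH' hi hg i (h.adjoin_mem ha) hT (h.adjoin_v1 (fun j => ha j.1) hi')

end H
end Cr

namespace Cr
open Polynomial

section exist
variable {k L : Type*} [Field k] [Field L] [Algebra k L]

theorem v_lt_one_iff (O : ValuationSubring L) (z : L) (hz : z ∈ O) :
    O.valuation z < 1 ↔ ¬ IsUnit (⟨z, hz⟩ : O) := by
  have h2 : IsUnit (⟨z, hz⟩ : O) ↔ O.valuation z = 1 := O.valuation_eq_one_iff ⟨z, hz⟩
  rw [h2]
  have h1 : O.valuation z ≤ 1 := (vle O).2 hz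
  constructor
  · intro h; exact h.ne
  · intro h; exact lt_of_le_of_ne h1 h

theorem exists_O {A : Subring L} {G : Type*} [Field G] (ψ : A →+* G) :
    ∃ O : ValuationSubring L, ∀ n : A, (n : L) ∈ O ∧ (O.valuation (n : L) < 1 ↔ ψ n = 0) := by
  set P := RingHom.ker ψ
  have : P.IsPrime := RingHom.ker_isPrime ψ
  have hunit : ∀ y : P.primeCompl, IsUnit (A.subtype y) := by
    rintro ⟨y, hy⟩
    rw [isUnit_iff_ne_zero]
    intro h
    have : y = 0 := Subtype.ext h
    exact hy (by rw [this]; exact zero_mem _)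
  let f : Localization.AtPrime P →+* L := IsLocalization.lift hunit
  obtain ⟨O, hf, hloc⟩ := IsLocalRing.exists_factor_valuationRing f
  refine ⟨O, fun n => ?_⟩
  have e : f (algebraMap A _ n) = n := IsLocalization.lift_eq hunit n
  have hn : (n : L) ∈ O := by rw [← e]; exact hf _
  refine ⟨hn, ?_⟩
  rw [v_lt_one_iff O _ hn]
  have h1 : ψ n = 0 ↔ ¬ IsUnit (algebraMap A (Localization.AtPrime P) n) := by
    rw [IsLocalization.AtPrime.isUnit_to_map_iff (Localization.AtPrime P) P]
    simp [Ideal.primeCompl, P, RingHom.mem_ker]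
  have e2 : f.codRestrict O.toSubring hf (algebraMap A _ n) = (⟨n, hn⟩ : O.toSubring) := Subtype.ext e
  rw [h1, not_iff_not]
  constructor
  · intro hu
    apply hloc.map_nonunit
    rw [e2]; exact hu
  · intro hu
    have := hu.map (f.codRestrict O.toSubring hf)
    rw [e2] at this; exact this

theorem exists_place {G : Type*} [Field G] [Algebra k G] {ι : Type*} [Fintype ι] [DecidableEq ι] {a : ι → L}
    (hi : AlgebraicIndependent k a) (hg : IntermediateField.adjoin k (Set.range a) = ⊤) (g : ι → G)
    (hG : IntermediateField.adjoin k (Set.range g) = ⊤) {m : ℕ} (hc : Fintype.card ι = m + 1)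
    (hr : rk k (Set.range g) = m) :
    ∃ (O : ValuationSubring L) (π : L → G), Place k O π ∧ Dv (Algebra.adjoin k (Set.range a)) O ∧
      (∀ i, π (a i) = g i) ∧ ∀ y, ∃ z ∈ O, π z = y := by
  classical
  set A := Algebra.adjoin k (Set.range a) with hA
  have hN := nice_of hi hg
  have hmA : ∀ p, MvPolynomial.aeval a p ∈ A := fun p => by
    rw [hA, Algebra.adjoin_range_eq_range_aeval]; exact ⟨p, rfl⟩
  let ψ : A →ₐ[k] G := (MvPolynomial.aeval g).comp hi.aevalEquiv.symm.toAlgHom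
  have hψ : ∀ p, ψ ⟨MvPolynomial.aeval a p, hmA p⟩ =
      MvPolynomial.aeval g p := by
    intro p
    have : hi.aevalEquiv p = ⟨MvPolynomial.aeval a p, hmA p⟩ :=
      Subtype.ext (hi.algebraMap_aevalEquiv p)
    rw [← this]
    simp [ψ]
  have hrepA : ∀ n (hn : n ∈ A), ∃ p : MvPolynomial ι k, n = MvPolynomial.aeval a p ∧ ψ ⟨n, hn⟩ = MvPolynomial.aeval g p := by
    intro n hn
    have hn' := hn
    rw [hA, Algebra.adjoin_range_eq_range_aeval] at hn'
    obtain ⟨p, rfl⟩ := hn'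
    exact ⟨p, rfl, hψ p⟩
  obtain ⟨O, hO⟩ := exists_O (A := A.toSubring) (ψ : A →+* G)
  have hAO : ∀ n ∈ A, n ∈ O := fun n hn => (hO ⟨n, hn⟩).1
  have hAv : ∀ n (hn : n ∈ A), (O.valuation n < 1 ↔ ψ ⟨n, hn⟩ = 0) := fun n hn => (hO ⟨n, hn⟩).2
  have hT : O ≠ ⊤ := by
    have hni : ¬ AlgebraicIndependent k g := by
      intro h
      have := rk_of_indep h
      rw [hr, hc] at this
      have : m = m + 1 := by exact_mod_cast this
      omega
    rw [algebraicIndependent_iff] at hni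
    push Not at hni
    obtain ⟨p, hp, hp0⟩ := hni
    have hmem : MvPolynomial.aeval a p ∈ A := by rw [hA, Algebra.adjoin_range_eq_range_aeval]; exact ⟨p, rfl⟩
    have h0 : MvPolynomial.aeval a p ≠ 0 := fun h => hp0 (algebraicIndependent_iff.1 hi p h)
    have h1 := (hAv _ hmem).2 (by rw [hψ, hp])
    intro hT
    have h2 : (MvPolynomial.aeval a p)⁻¹ ∈ O := by rw [hT]; trivial
    have h3 := vlt_mul O h1 h2
    rw [mul_inv_cancel₀ h0] at h3; simp at h3
  have hD : Dv A O := by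
    obtain ⟨i, hi'⟩ := exists_skip hc hr.ge
    refine lemmaH' hi hg i hAO hT ?_
    intro z hz hz0
    rw [Algebra.adjoin_range_eq_range_aeval] at hz
    obtain ⟨p, hp⟩ := hz
    have e : z = MvPolynomial.aeval a (MvPolynomial.rename (fun j : {j // j ≠ i} => j.1) p) := by
      rw [MvPolynomial.aeval_rename, ← hp]; rfl
    have hzA : z ∈ A := by rw [hA, Algebra.adjoin_range_eq_range_aeval, e]; exact ⟨_, rfl⟩
    rcases v1_or O (hAO z hzA) with h1 | h1
    · exact h1
    · exfalso
      rw [hAv z hzA] at h1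
      subst e
      rw [hψ, MvPolynomial.aeval_rename] at h1
      have := algebraicIndependent_iff.1 hi' p h1
      apply hz0; rw [this]; simp
  -- the place
  have hnd : ∀ z : O, ∃ nd : A × A, O.valuation (nd.2 : L) = 1 ∧ (z : L) * nd.2 = nd.1 := by
    intro z
    obtain ⟨n, hn, d, hd, h1, h2⟩ := hN.num_den hD z.2
    exact ⟨(⟨n, hn⟩, ⟨d, hd⟩), h1, h2⟩
  choose F hF1 hF2 using hnd
  let π : L → G := fun z => if hz : z ∈ O then ψ (F ⟨z, hz⟩).1 / ψ (F ⟨z, hz⟩).2 else 0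
  have hne : ∀ d : A, O.valuation (d : L) = 1 → ψ d ≠ 0 := by
    intro d hd h0
    have := (hAv d d.2).2 h0
    exact absurd hd this.ne
  have hπ : ∀ z (n d : A), O.valuation (d : L) = 1 → z * (d : L) = n → z ∈ O ∧ π z = ψ n / ψ d := by
    intro z n d hd e
    have hd0 : (d : L) ≠ 0 := fun h => by rw [h] at hd; simp at hd
    have hz : z ∈ O := by
      have : z = n * (d : L)⁻¹ := by rw [← e]; field_simp
      rw [this]; exact mul_mem (hAO n n.2) (inv_mem_of_v1 O hd)
    refine ⟨hz, ?_⟩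
    simp only [π, dif_pos hz]
    rw [div_eq_div_iff (hne _ (hF1 _)) (hne _ hd), ← map_mul, ← map_mul]
    congr 1
    apply Subtype.ext
    have := hF2 ⟨z, hz⟩
    simp only [MulMemClass.coe_mul]
    rw [← this, ← e]; ring
  have hπA : ∀ n (hn : n ∈ A), π n = ψ ⟨n, hn⟩ := by
    intro n hn
    rw [(hπ n ⟨n, hn⟩ 1 (by simp) (by simp)).2]; simp
  refine ⟨O, π, ?_, hD, ?_, ?_⟩
  · refine ⟨?_, ?_, ?_, ?_, ?_⟩
    · intro x y hx hy
      have h1 := hF2 ⟨x, hx⟩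
      have h2 := hF2 ⟨y, hy⟩
      have := (hπ (x + y) ((F ⟨x, hx⟩).1 * (F ⟨y, hy⟩).2 + (F ⟨y, hy⟩).1 * (F ⟨x, hx⟩).2)
        ((F ⟨x, hx⟩).2 * (F ⟨y, hy⟩).2) (v1_mul O (hF1 _) (hF1 _)) (by
          simp only [MulMemClass.coe_mul, AddMemClass.coe_add]; rw [← h1, ← h2]; ring)).2
      rw [this]
      simp only [π, dif_pos hx, dif_pos hy, map_add, map_mul]
      have := hne _ (hF1 ⟨x, hx⟩)
      have := hne _ (hF1 ⟨y, hy⟩)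
      field_simp
    · intro x y hx hy
      have h1 := hF2 ⟨x, hx⟩
      have h2 := hF2 ⟨y, hy⟩
      have := (hπ (x * y) ((F ⟨x, hx⟩).1 * (F ⟨y, hy⟩).1)
        ((F ⟨x, hx⟩).2 * (F ⟨y, hy⟩).2) (v1_mul O (hF1 _) (hF1 _)) (by
          simp only [MulMemClass.coe_mul]; rw [← h1, ← h2]; ring)).2
      rw [this]
      simp only [π, dif_pos hx, dif_pos hy, map_mul]
      rw [div_mul_div_comm]
    · intro c; exact hAO _ (Subalgebra.algebraMap_mem _ c)
    · intro c
      rw [hπA _ (Subalgebra.algebraMap_mem _ c)]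
      exact ψ.commutes c
    · intro x hx
      simp only [π, dif_pos hx]
      rw [div_eq_zero_iff, or_iff_left (hne _ (hF1 _)), ← hAv _ (F ⟨x, hx⟩).1.2, ← hF2 ⟨x, hx⟩, map_mul, hF1, mul_one]
  · intro i
    have := hψ (MvPolynomial.X i)
    rw [hπA _ (Algebra.subset_adjoin ⟨i, rfl⟩)]
    simpa using this
  · intro y
    have hy : y ∈ IntermediateField.adjoin k (Set.range g) := by rw [hG]; trivial
    obtain ⟨r, hr, s, hs, e⟩ := (IntermediateField.mem_adjoin_iff_div (F := k)).1 hy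
    by_cases hs0 : s = 0
    · refine ⟨0, zero_mem _, ?_⟩
      rw [hπA 0 (zero_mem _), e, hs0, div_zero]
      exact map_zero ψ
    rw [Algebra.adjoin_range_eq_range_aeval] at hr hs
    obtain ⟨p, rfl⟩ := hr
    obtain ⟨q, rfl⟩ := hs
    have hq : MvPolynomial.aeval a q ∈ A := by rw [hA, Algebra.adjoin_range_eq_range_aeval]; exact ⟨q, rfl⟩
    have hp : MvPolynomial.aeval a p ∈ A := by rw [hA, Algebra.adjoin_range_eq_range_aeval]; exact ⟨p, rfl⟩
    have hq1 : O.valuation (MvPolynomial.aeval a q) = 1 := by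
      rcases v1_or O (hAO _ hq) with h1 | h1
      · exact h1
      · rw [hAv _ hq, hψ] at h1; exact absurd h1 hs0
    have hq0 : MvPolynomial.aeval a q ≠ 0 := fun h => by rw [h] at hq1; simp at hq1
    have := hπ (MvPolynomial.aeval a p / MvPolynomial.aeval a q) ⟨_, hp⟩ ⟨_, hq⟩ hq1 (by simp; field_simp)
    refine ⟨_, this.1, ?_⟩
    rw [this.2, hψ, hψ, e]; rfl

end exist
end Cr

namespace Cr
open Polynomial

section wo
universe u
variable {k : Type*} {L : Type u} [Field k] [Field L] [Algebra k L]

theorem exists_resplace (O : ValuationSubring L) (hO : ∀ c : k, algebraMap k L c ∈ O) :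
    ∃ (Λ : Type u) (_ : Field Λ) (_ : Algebra k Λ) (π : L → Λ), Place k O π ∧ ∀ y, ∃ z ∈ O, π z = y := by
  classical
  let j : k →+* O := (algebraMap k L).codRestrict O.toSubring hO
  letI : Algebra k (IsLocalRing.ResidueField O) := ((IsLocalRing.residue O).comp j).toAlgebra
  refine ⟨IsLocalRing.ResidueField O, inferInstance, inferInstance,
    fun z => if hz : z ∈ O then IsLocalRing.residue O ⟨z, hz⟩ else 0, ⟨?_, ?_, hO, ?_, ?_⟩, ?_⟩
  · intro a b ha hb
    simp only [dif_pos ha, dif_pos hb, dif_pos (add_mem ha hb), ← map_add]; rfl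
  · intro a b ha hb
    simp only [dif_pos ha, dif_pos hb, dif_pos (mul_mem ha hb), ← map_mul]; rfl
  · intro c
    simp only [dif_pos (hO c)]; rfl
  · intro a ha
    simp only [dif_pos ha]
    rw [IsLocalRing.residue_eq_zero_iff, v_lt_one_iff O a ha, IsLocalRing.mem_maximalIdeal, mem_nonunits_iff]
  · intro y
    obtain ⟨z, rfl⟩ := IsLocalRing.residue_surjective y
    exact ⟨z, z.2, by simp⟩

theorem Place.factor {L' G Λ : Type*} [Field L'] [Algebra k L'] [Field G] [Algebra k G] [Field Λ] [Algebra k Λ]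
    {O : ValuationSubring L} {O' : ValuationSubring L'} {π : L → G} {π' : L' → Λ} (h : Place k O π)
    (hs : ∀ y, ∃ z ∈ O, π z = y) (h' : Place k O' π') (j : L →ₐ[k] L') (h1 : ∀ z ∈ O, j z ∈ O')
    (h2 : ∀ z, O.valuation z < 1 → O'.valuation (j z) < 1) :
    ∃ f : G →ₐ[k] Λ, ∀ z ∈ O, f (π z) = π' (j z) := by
  choose s hsO hsπ using hs
  have key : ∀ z ∈ O, ∀ z' ∈ O, π z = π z' → π' (j z) = π' (j z') := by
    intro z hz z' hz' e
    have e1 : π (z - z') = 0 := by rw [h.sub hz hz', e, sub_self]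
    have e2 := h2 _ ((h.zero (sub_mem hz hz')).1 e1)
    have e3 := (h'.zero (h1 _ (sub_mem hz hz'))).2 e2
    rw [map_sub, h'.sub (h1 _ hz) (h1 _ hz')] at e3
    exact sub_eq_zero.1 e3
  have hf : ∀ z ∈ O, π' (j (s (π z))) = π' (j z) := fun z hz => key _ (hsO _) _ hz (hsπ _)
  refine ⟨{ toFun := fun y => π' (j (s y)), map_one' := ?_, map_mul' := ?_, map_zero' := ?_, map_add' := ?_, commutes' := ?_ }, hf⟩
  · have := hf 1 (one_mem _)
    rw [h.map_one, _root_.map_one j, h'.map_one] at this; exact this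
  · intro a b
    have := hf _ (mul_mem (hsO a) (hsO b))
    rw [h.mul (hsO a) (hsO b), hsπ, hsπ, map_mul, h'.mul (h1 _ (hsO a)) (h1 _ (hsO b))] at this
    exact this
  · have := hf 0 (zero_mem _)
    rw [h.map_zero, _root_.map_zero j, h'.map_zero] at this; exact this
  · intro a b
    have := hf _ (add_mem (hsO a) (hsO b))
    rw [h.add (hsO a) (hsO b), hsπ, hsπ, map_add, h'.add (h1 _ (hsO a)) (h1 _ (hsO b))] at this
    exact this
  · intro c
    have := hf _ (h.cmem c)
    rw [h.const] at this
    change π' (j (s (algebraMap k G c))) = _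
    rw [this, j.commutes, h'.const]

/-- residue field of a subfield -/
def Place.resField {G : Type*} [Field G] [Algebra k G] {O : ValuationSubring L} {π : L → G} (h : Place k O π)
    (S : IntermediateField k L) : IntermediateField k G where
  carrier := π '' {z | z ∈ S ∧ z ∈ O}
  mul_mem' := by
    rintro _ _ ⟨a, ha, rfl⟩ ⟨b, hb, rfl⟩
    exact ⟨a * b, ⟨mul_mem ha.1 hb.1, mul_mem ha.2 hb.2⟩, h.mul ha.2 hb.2⟩
  add_mem' := by
    rintro _ _ ⟨a, ha, rfl⟩ ⟨b, hb, rfl⟩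
    exact ⟨a + b, ⟨add_mem ha.1 hb.1, add_mem ha.2 hb.2⟩, h.add ha.2 hb.2⟩
  algebraMap_mem' := fun c => ⟨_, ⟨S.algebraMap_mem c, h.cmem c⟩, h.const c⟩
  inv_mem' := by
    rintro _ ⟨a, ha, rfl⟩
    by_cases h0 : π a = 0
    · rw [h0, inv_zero]; exact ⟨0, ⟨zero_mem _, zero_mem _⟩, h.map_zero⟩
    · have h1 := h.v1 ha.2 h0
      exact ⟨a⁻¹, ⟨inv_mem ha.1, inv_mem_of_v1 O h1⟩, h.inv h1⟩

theorem Place.mem_resField {G : Type*} [Field G] [Algebra k G] {O : ValuationSubring L} {π : L → G} (h : Place k O π)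
    (S : IntermediateField k L) {y : G} : y ∈ h.resField S ↔ ∃ z, (z ∈ S ∧ z ∈ O) ∧ π z = y := Iff.rfl

/-- weak form of the ruled residue theorem -/
theorem ruled {Λ : Type*} [Field Λ] [Algebra k Λ] {O : ValuationSubring L} {π : L → Λ} (h : Place k O π)
    (Lc : IntermediateField k L)
    (hroot : ∀ p : Polynomial Lc, p.natDegree ≠ 0 → ∃ b : Lc, p.IsRoot b)
    (a : L) (ha : a ∉ Lc) :
    ∃ ρ : Λ, ∀ z ∈ IntermediateField.adjoin Lc {a}, z ∈ O →
      π z ∈ IntermediateField.adjoin (h.resField Lc) {ρ} := by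
  classical
  set E := h.resField Lc with hE
  set v := O.valuation with hv
  have hane : ∀ b ∈ Lc, a - b ≠ 0 := fun b hb h0 => ha (by rwa [sub_eq_zero.1 h0])
  -- the set-up
  have main : ∃ (ρ : Λ) (ϖ : L), ϖ ≠ 0 ∧ (ϖ = 1 ∨ ∀ c ∈ Lc, v ϖ ≠ v c) ∧
      ∀ b ∈ Lc, ∃ c ∈ Lc, c ≠ 0 ∧ ∃ (j : ℤ) (ε : L), v ε = 1 ∧ π ε ∈ IntermediateField.adjoin E {ρ} ∧
        a - b = c * ϖ ^ j * ε := by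
    by_cases hc1 : ∃ b ∈ Lc, ∀ c ∈ Lc, v (a - b) ≠ v c
    · obtain ⟨b, hb, hbc⟩ := hc1
      refine ⟨0, a - b, hane b hb, Or.inr hbc, ?_⟩
      intro b' hb'
      have h1 : ∀ ε, v ε < 1 → v (1 + ε) = 1 ∧ π (1 + ε) ∈ IntermediateField.adjoin E {(0 : Λ)} := by
        intro ε hε
        refine ⟨v1_add O (by simp) hε, ?_⟩
        rw [h.add (one_mem _) (mem_of_vlt O hε), (h.zero (mem_of_vlt O hε)).2 hε, add_zero, h.map_one]
        exact one_mem _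
      have hab := hane b hb
      rcases lt_or_gt_of_ne (hbc (b - b') (sub_mem hb hb')) with hlt | hlt
      · have hbb : b - b' ≠ 0 := fun h0 => by rw [h0, map_zero] at hlt; exact not_lt_zero hlt
        obtain ⟨e1, e2⟩ := h1 ((a - b) / (b - b')) (by
          rw [map_div₀]; exact (div_lt_one₀ (by rw [zero_lt_iff]; simpa using hbb)).2 hlt)
        refine ⟨b - b', sub_mem hb hb', hbb, 0, _, e1, e2, ?_⟩
        rw [zpow_zero]; field_simp; ring
      · obtain ⟨e1, e2⟩ := h1 ((b - b') / (a - b)) (by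
          rw [map_div₀]; exact (div_lt_one₀ (by rw [zero_lt_iff]; simpa using hab)).2 hlt)
        refine ⟨1, one_mem _, one_ne_zero, 1, _, e1, e2, ?_⟩
        rw [zpow_one]; field_simp; ring
    · push Not at hc1
      by_cases hc2 : ∃ b ∈ Lc, ∃ d ∈ Lc, d ≠ 0 ∧ v ((a - b) / d) = 1 ∧ π ((a - b) / d) ∉ E
      · obtain ⟨b, hb, d, hd, hd0, hv1, hres⟩ := hc2
        refine ⟨π ((a - b) / d), 1, one_ne_zero, Or.inl rfl, ?_⟩
        intro b' hb'
        have hrO : (a - b) / d ∈ O := (vle O).1 hv1.le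
        by_cases he : (b - b') / d ∈ O
        · have heE : π ((b - b') / d) ∈ E := ⟨_, ⟨div_mem (sub_mem hb hb') hd, he⟩, rfl⟩
          have hsum : π ((a - b) / d + (b - b') / d) = π ((a - b) / d) + π ((b - b') / d) := h.add hrO he
          refine ⟨d, hd, hd0, 0, (a - b) / d + (b - b') / d, ?_, ?_, ?_⟩
          · apply h.v1 (add_mem hrO he)
            rw [hsum]
            intro h0
            apply hres
            rw [eq_neg_of_add_eq_zero_left h0]; exact neg_mem heE
          · rw [hsum]
            refine add_mem (IntermediateField.mem_adjoin_simple_self _ _) ?_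
            exact (IntermediateField.adjoin E {π ((a - b) / d)}).algebraMap_mem ⟨_, heE⟩
          · rw [zpow_zero]; field_simp; ring
        · have h2 := inv_vlt O he
          have hbb : b - b' ≠ 0 := fun h0 => he (by rw [h0, zero_div]; exact zero_mem _)
          have h3 := vlt_mul O h2 hrO
          refine ⟨b - b', sub_mem hb hb', hbb, 0, 1 + ((b - b') / d)⁻¹ * ((a - b) / d), v1_add O (by simp) h3, ?_, ?_⟩
          · rw [h.add (one_mem _) (mem_of_vlt O h3), (h.zero (mem_of_vlt O h3)).2 h3, add_zero, h.map_one]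
            exact one_mem _
          · rw [zpow_zero]; field_simp; ring
      · push Not at hc2
        refine ⟨0, 1, one_ne_zero, Or.inl rfl, ?_⟩
        intro b hb
        obtain ⟨c, hc, e⟩ := hc1 b hb
        have hc0 : c ≠ 0 := by
          rintro rfl
          rw [map_zero, map_eq_zero] at e; exact hane b hb e
        have h4 : v ((a - b) / c) = 1 := by
          rw [map_div₀, e, div_self]; simpa using hc0
        refine ⟨c, hc, hc0, 0, (a - b) / c, h4, ?_, by rw [zpow_zero]; field_simp⟩
        exact (IntermediateField.adjoin E {(0 : Λ)}).algebraMap_mem ⟨_, hc2 b hb c hc hc0 h4⟩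
  obtain ⟨ρ, ϖ, hϖ0, hϖ, hlin⟩ := main
  refine ⟨ρ, ?_⟩
  let P : L → Prop := fun z => ∃ c ∈ Lc, c ≠ 0 ∧ ∃ (j : ℤ) (ε : L), v ε = 1 ∧ π ε ∈ IntermediateField.adjoin E {ρ} ∧
        z = c * ϖ ^ j * ε
  have hPmul : ∀ z z', P z → P z' → P (z * z') := by
    rintro _ _ ⟨c, hc, hc0, j, ε, h1, h2, rfl⟩ ⟨c', hc', hc0', j', ε', h1', h2', rfl⟩
    refine ⟨c * c', mul_mem hc hc', mul_ne_zero hc0 hc0', j + j', ε * ε', v1_mul O h1 h1', ?_, ?_⟩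
    · rw [h.mul ((vle O).1 h1.le) ((vle O).1 h1'.le)]; exact mul_mem h2 h2'
    · rw [zpow_add₀ hϖ0]; ring
  have hPinv : ∀ z, P z → P z⁻¹ := by
    rintro _ ⟨c, hc, hc0, j, ε, h1, h2, rfl⟩
    refine ⟨c⁻¹, inv_mem hc, inv_ne_zero hc0, -j, ε⁻¹, by rw [map_inv₀, h1, inv_one], ?_, ?_⟩
    · rw [h.inv h1]; exact inv_mem h2
    · rw [zpow_neg, mul_inv, mul_inv]
  have hPc : ∀ c ∈ Lc, c ≠ 0 → P c := fun c hc hc0 =>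
    ⟨c, hc, hc0, 0, 1, by simp [hv], by rw [h.map_one]; exact one_mem _, by simp⟩
  have hPpoly : ∀ N, ∀ p : Polynomial Lc, p ≠ 0 → p.natDegree ≤ N → P (aeval a p) := by
    intro N
    induction N with
    | zero =>
      intro p hp hN
      rw [eq_C_of_natDegree_eq_zero (Nat.le_zero.1 hN)] at hp ⊢
      rw [aeval_C]
      apply hPc _ (p.coeff 0).2
      intro h0
      exact hp (by rw [show p.coeff 0 = 0 from Subtype.ext h0, C_0])
    | succ N ih =>
      intro p hp hN
      by_cases hd : p.natDegree = 0
      · exact ih p hp (by omega)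
      obtain ⟨b, hb⟩ := hroot p hd
      obtain ⟨q, rfl⟩ := dvd_iff_isRoot.2 hb
      have hq : q ≠ 0 := right_ne_zero_of_mul hp
      have hX : (X - C b : Polynomial Lc) ≠ 0 := left_ne_zero_of_mul hp
      rw [natDegree_mul hX hq, natDegree_X_sub_C] at hN
      rw [map_mul]
      refine hPmul _ _ ?_ (ih q hq (by omega))
      rw [map_sub, aeval_X, aeval_C]
      exact hlin b b.2
  intro z hz hzO
  by_cases hz1 : v z = 1
  · rw [IntermediateField.mem_adjoin_simple_iff] at hz
    obtain ⟨r, s, e⟩ := hz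
    have hz0 : z ≠ 0 := fun h => by rw [h, map_zero] at hz1; exact zero_ne_one hz1
    have hr : r ≠ 0 := by rintro rfl; simp at e; exact hz0 e
    have hs : s ≠ 0 := by rintro rfl; simp at e; exact hz0 e
    have hPz : P z := by
      rw [e, div_eq_mul_inv]; exact hPmul _ _ (hPpoly _ r hr le_rfl) (hPinv _ (hPpoly _ s hs le_rfl))
    obtain ⟨c, hc, hc0, j, ε, h1, h2, e⟩ := hPz
    have hcv : v c * v ϖ ^ j = 1 := by
      rw [e, map_mul, map_mul, h1, mul_one, map_zpow₀] at hz1; exact hz1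
    have hj : ϖ ^ j = 1 := by
      rcases hϖ with rfl | hϖ
      · simp
      · by_cases hj : j = 0
        · rw [hj, zpow_zero]
        exfalso
        -- extract a root
        have hroots : ∀ n : ℕ, n ≠ 0 → ∀ c ∈ Lc, ∃ b ∈ Lc, b ^ n = c := by
          intro n hn c hc
          obtain ⟨b, hb⟩ := hroot (X ^ n - C ⟨c, hc⟩) (by rw [natDegree_X_pow_sub_C]; exact hn)
          refine ⟨b, b.2, ?_⟩
          simp only [IsRoot, eval_sub, eval_pow, eval_X, eval_C] at hb
          exact congrArg Subtype.val (sub_eq_zero.1 hb)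
        obtain ⟨n, hn⟩ := j.eq_nat_or_neg
        obtain ⟨b, hb, eb⟩ := hroots n (by omega) c hc
        have hb0 : b ≠ 0 := by rintro rfl; rw [zero_pow (by omega)] at eb; exact hc0 eb.symm
        rcases hn with hj' | hj'
        · rw [← eb, hj', zpow_natCast, map_pow, ← mul_pow] at hcv
          have h3 : v b * v ϖ = 1 := (pow_eq_one_iff.1 hcv).resolve_right (by omega)
          exact hϖ b⁻¹ (inv_mem hb) (by rw [map_inv₀]; exact eq_inv_of_mul_eq_one_right h3)
        · rw [← eb, hj', zpow_neg, zpow_natCast, map_pow, ← inv_pow, ← mul_pow] at hcv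
          have h3 : v b * (v ϖ)⁻¹ = 1 := (pow_eq_one_iff.1 hcv).resolve_right (by omega)
          refine hϖ b hb ?_
          have h4 := eq_inv_of_mul_eq_one_left h3
          rw [inv_inv] at h4; exact h4.symm
    rw [hj, mul_one] at e
    have hc1 : v c = 1 := by rw [e, map_mul, h1, mul_one] at hz1; exact hz1
    rw [e, h.mul ((vle O).1 hc1.le) ((vle O).1 h1.le)]
    refine mul_mem ?_ h2
    exact (IntermediateField.adjoin E {ρ}).algebraMap_mem ⟨_, ⟨c, ⟨hc, (vle O).1 hc1.le⟩, rfl⟩⟩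
  · have hz2 : v z < 1 := by
      rcases v1_or O hzO with h1 | h1
      · exact absurd h1 hz1
      · exact h1
    rw [(h.zero hzO).2 hz2]; exact zero_mem _

end wo
end Cr

namespace Cr
open Polynomial
universe u

/-- rigid family -/
def Rig.{w, v1, v2, v3} (k : Type v1) {G : Type v2} {ι : Type v3} [Field k] [Field G] [Algebra k G] (w : ι → G) : Prop :=
  ∀ (Λ : Type w) [Field Λ] [Algebra k Λ] (f : G →ₐ[k] Λ) (E : IntermediateField k Λ) (ρ : Λ),
    (∀ g, f g ∈ IntermediateField.adjoin E {ρ}) → ∀ i, IsAlgebraic E (f (w i))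

section wo
variable {k : Type*} {L : Type u} [Field k] [Field L] [Algebra k L]

theorem Rig.rank {G : Type*} [Field G] [Algebra k G] {ι : Type*} [Fintype ι] {w : ι → G} (hr : Rig.{u} k w)
    (hw : AlgebraicIndependent k w) {Λ : Type u} [Field Λ] [Algebra k Λ] (f : G →ₐ[k] Λ)
    (E : IntermediateField k Λ) (ρ : Λ) (hf : ∀ g, f g ∈ IntermediateField.adjoin E {ρ}) :
    (Fintype.card ι : ℕ∞) ≤ rk k (E : Set Λ) := by
  have h1 := hr Λ f E ρ hf
  have h2 : AlgebraicIndependent k (fun i => f (w i)) := hw.map' (f := f) f.injective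
  rw [← rk_of_indep h2]
  apply rk_le_of_subset
  rintro _ ⟨i, rfl⟩
  exact mem_cl_of_alg (subset_cl _) (h1 i)

theorem mem_adj_of_mem {k Λ : Type*} [Field k] [Field Λ] [Algebra k Λ] {E : IntermediateField k Λ} {z : Λ} (ρ : Λ)
    (hz : z ∈ E) : z ∈ IntermediateField.adjoin E {ρ} :=
  (IntermediateField.adjoin E {ρ}).algebraMap_mem ⟨z, hz⟩

theorem mem_adj_of_adj {k Λ : Type*} [Field k] [Field Λ] [Algebra k Λ] {E : IntermediateField k Λ} {z : Λ} (ρ : Λ)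
    {S : Set Λ} (hS : ∀ s ∈ S, s ∈ IntermediateField.adjoin E {ρ}) (hz : z ∈ IntermediateField.adjoin k S) :
    z ∈ IntermediateField.adjoin E {ρ} := by
  have h5 : IntermediateField.adjoin k S ≤ (IntermediateField.adjoin E {ρ}).restrictScalars k := by
    rw [IntermediateField.adjoin_le_iff]
    exact hS
  exact h5 hz

theorem exists_ext (O : ValuationSubring L) (L' : Type*) [Field L'] [Algebra L L'] :
    ∃ O' : ValuationSubring L', (∀ z, algebraMap L L' z ∈ O' ↔ z ∈ O) ∧
      ∀ z, O.valuation z < 1 → O'.valuation (algebraMap L L' z) < 1 := by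
  let f : O →+* L' := (algebraMap L L').comp O.subtype
  obtain ⟨O', hf, hloc⟩ := IsLocalRing.exists_factor_valuationRing f
  have h1 : ∀ z ∈ O, algebraMap L L' z ∈ O' := fun z hz => hf ⟨z, hz⟩
  have h2 : ∀ z, O.valuation z < 1 → O'.valuation (algebraMap L L' z) < 1 := by
    intro z hz
    have hzO := mem_of_vlt O hz
    rw [v_lt_one_iff O' _ (h1 z hzO)]
    rw [v_lt_one_iff O _ hzO] at hz
    intro hu
    exact hz (hloc.map_nonunit _ hu)
  refine ⟨O', fun z => ⟨fun h => ?_, h1 z⟩, h2⟩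
  by_contra hz
  have hz0 : z ≠ 0 := fun h => hz (h ▸ zero_mem _)
  have h3 := vlt_mul O' (h2 _ (inv_vlt O hz)) h
  rw [← map_mul, inv_mul_cancel₀ hz0] at h3
  simp at h3

set_option maxHeartbeats 800000 in
theorem WO {G : Type*} [Field G] [Algebra k G] {ι κ : Type*} [Fintype ι] [DecidableEq ι] [Fintype κ] {a : ι → L}
    (hi : AlgebraicIndependent k a) (hg : IntermediateField.adjoin k (Set.range a) = ⊤)
    {O : ValuationSubring L} {π : L → G} (h : Place k O π) (hs : ∀ y, ∃ z ∈ O, π z = y) (hT : O ≠ ⊤)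
    {m : ℕ} (hc : Fintype.card ι = m + 2) {w : κ → G} (hcw : Fintype.card κ = m + 1)
    (hw : AlgebraicIndependent k w) (hrig : Rig.{u} k w) : Dv (Algebra.adjoin k (Set.range a)) O := by
  classical
  have hone : Nonempty ι := by rw [← Fintype.card_pos_iff]; omega
  obtain ⟨i⟩ := hone
  set a0 : {j // j ≠ i} → L := fun j => a j.1 with ha0
  have hc0 : Fintype.card {j // j ≠ i} = m + 1 := by
    rw [Fintype.card_subtype_compl, hc]; simp
  set K0 := IntermediateField.adjoin k (Set.range a0) with hK0
  by_cases hK : ∀ z ∈ K0, z ∈ O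
  · have hv1 : ∀ z ∈ Algebra.adjoin k (Set.range a0), z ≠ 0 → O.valuation z = 1 := by
      intro z hz hz0
      have := IntermediateField.algebra_adjoin_le_adjoin k _ hz
      exact val_eq_one_of_mem O hz0 (hK z this) (hK _ (inv_mem this))
    have ha0O : ∀ j, j ≠ i → a j ∈ O := fun j hj =>
      hK _ (IntermediateField.subset_adjoin _ _ ⟨⟨j, hj⟩, rfl⟩)
    by_cases hai : a i ∈ O
    · refine lemmaH' hi hg i (h.adjoin_mem ?_) hT hv1
      intro j
      by_cases hj : j = i
      · rw [hj]; exact hai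
      · exact ha0O j hj
    · exfalso
      have hai0 : a i ≠ 0 := fun h => hai (h ▸ zero_mem _)
      set a' := Function.update a i (a i)⁻¹ with ha'
      have haj : ∀ j, j ≠ i → a' j = a j := fun j hj => Function.update_of_ne hj _ _
      have hai' : a' i = (a i)⁻¹ := Function.update_self _ _ _
      have hin : ∀ F : IntermediateField k L, Set.range a' ⊆ F → Set.range a ⊆ F := by
        rintro F hF _ ⟨j, rfl⟩
        by_cases hj : j = i
        · have := hF ⟨i, rfl⟩
          rw [hai'] at this
          rw [hj, ← inv_inv (a i)]; exact inv_mem this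
        · rw [← haj j hj]; exact hF ⟨j, rfl⟩
      have hi' : AlgebraicIndependent k a' := by
        apply indep_of_rk
        rw [← rk_of_indep hi]
        exact rk_le_of_subset (hin _ (subset_cl _))
      have hg' : IntermediateField.adjoin k (Set.range a') = ⊤ := by
        rw [eq_top_iff, ← hg, IntermediateField.adjoin_le_iff]
        exact hin _ (IntermediateField.subset_adjoin _ _)
      have h2 := inv_vlt O hai
      have haO' : ∀ j, a' j ∈ O := by
        intro j
        by_cases hj : j = i
        · rw [hj, hai']; exact mem_of_vlt O h2
        · rw [haj j hj]; exact ha0O j hj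
      have heq : (fun j : {j // j ≠ i} => a' j.1) = a0 := by ext j; exact haj j.1 j.2
      have hD : Dv (Algebra.adjoin k (Set.range a')) O := by
        refine lemmaH' hi' hg' i (h.adjoin_mem haO') hT ?_
        rw [heq]; exact hv1
      obtain ⟨Λ, _, _, π', hp', -⟩ := exists_resplace (k := k) O h.cmem
      obtain ⟨f, hf⟩ := h.factor hs hp' (AlgHom.id k L) (fun z hz => hz) (fun z hz => hz)
      have hnt : Nontrivial ι := by rw [← Fintype.one_lt_card_iff_nontrivial]; omega
      obtain ⟨i1, hi1⟩ := exists_ne i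
      set E := IntermediateField.adjoin k (Set.range fun j : {j // j ≠ i ∧ j ≠ i1} => π' (a j.1)) with hE
      have hrk : rk k (E : Set Λ) ≤ m := by
        refine (rk_le_of_subset (adjoin_le_cl _)).trans ((rk_range_le _).trans ?_)
        rw [Fintype.card_subtype]
        have : (Finset.univ.filter fun j => j ≠ i ∧ j ≠ i1) = (Finset.univ.erase i).erase i1 := by
          ext j; simp [and_comm]
        rw [this, Finset.card_erase_of_mem (by simp [hi1]), Finset.card_erase_of_mem (by simp), Finset.card_univ, hc]
        simp
      have h3 := hrig.rank hw f E (π' (a i1)) (by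
        intro g
        obtain ⟨z, hz, rfl⟩ := hs g
        rw [hf z hz]
        have h4 := hp'.res_Dv (nice_of hi' hg') hD hz
        refine mem_adj_of_adj _ ?_ h4
        rintro _ ⟨_, ⟨j, rfl⟩, rfl⟩
        by_cases hj : j = i
        · rw [hj, hai', (hp'.zero (mem_of_vlt O h2)).2 h2]; exact zero_mem _
        · rw [haj j hj]
          by_cases hj1 : j = i1
          · rw [hj1]; exact IntermediateField.mem_adjoin_simple_self _ _
          · exact mem_adj_of_mem _ (IntermediateField.subset_adjoin _ _ ⟨⟨j, hj, hj1⟩, rfl⟩))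
      rw [hcw] at h3
      have h6 := h3.trans hrk
      have : m + 1 ≤ m := by exact_mod_cast h6
      omega
  · exfalso
    push Not at hK
    obtain ⟨z0, hz0, hz0O⟩ := hK
    let L' := AlgebraicClosure L
    obtain ⟨O', hO1, hO2⟩ := exists_ext O L'
    let j : L →ₐ[k] L' := IsScalarTower.toAlgHom k L L'
    obtain ⟨Λ, _, _, π', hp', -⟩ := exists_resplace (k := k) O' (fun c => by
      rw [IsScalarTower.algebraMap_apply k L L', hO1]; exact h.cmem c)
    obtain ⟨f, hf⟩ := h.factor hs hp' j (fun z hz => (hO1 z).2 hz) hO2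
    set Lc := cl k (Set.range fun i => j (a0 i)) with hLc
    have hjindep : AlgebraicIndependent k (fun i => j (a i)) := hi.map' (f := j) j.injective
    have hLcrk : rk k (Lc : Set L') ≤ (m + 1 : ℕ) := by
      rw [hLc, rk_cl]; exact (rk_range_le _).trans (by rw [hc0])
    have hai : j (a i) ∉ Lc := by
      intro hmem
      have h1 : Set.range (fun i => j (a i)) ⊆ Lc := by
        rintro _ ⟨l, rfl⟩
        by_cases hl : l = i
        · rw [hl]; exact hmem
        · exact subset_cl _ ⟨⟨l, hl⟩, rfl⟩
      have h2 := (rk_mono h1).trans hLcrk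
      rw [rk_of_indep hjindep, hc] at h2
      have : m + 2 ≤ m + 1 := by exact_mod_cast h2
      omega
    have hroot : ∀ p : Polynomial Lc, p.natDegree ≠ 0 → ∃ b : Lc, p.IsRoot b := by
      intro p hp
      obtain ⟨b, hb⟩ := IsAlgClosed.exists_aeval_eq_zero L' p (fun h0 => hp (natDegree_eq_of_degree_eq_some h0))
      have hbL := mem_cl_of_root p (by rintro rfl; simp at hp) hb
      refine ⟨⟨b, hbL⟩, ?_⟩
      apply (algebraMap Lc L').injective
      rw [map_zero, ← aeval_algebraMap_apply_eq_algebraMap_eval]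
      exact hb
    obtain ⟨ρ, hρ⟩ := ruled hp' Lc hroot (j (a i)) hai
    have hE : rk k (hp'.resField Lc : Set Λ) ≤ m := by
      by_contra hcon
      push Not at hcon
      have h1 : ((m + 1 : ℕ) : ℕ∞) ≤ rk k (hp'.resField Lc : Set Λ) := by
        have := Order.add_one_le_of_lt hcon
        exact_mod_cast this
      have h2 := hp'.subfield_mem Lc hLcrk h1
      apply hz0O
      rw [← hO1]
      apply h2
      have h3 : K0 ≤ Lc.comap j := by
        rw [hK0, IntermediateField.adjoin_le_iff]
        rintro _ ⟨l, rfl⟩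
        exact subset_cl _ ⟨l, rfl⟩
      exact h3 hz0
    have h3 := hrig.rank hw f (hp'.resField Lc) ρ (by
      intro g
      obtain ⟨z, hz, rfl⟩ := hs g
      rw [hf z hz]
      refine hρ _ ?_ ((hO1 z).2 hz)
      have h3 : IntermediateField.adjoin k (Set.range a) ≤
          ((IntermediateField.adjoin Lc {j (a i)}).restrictScalars k).comap j := by
        rw [IntermediateField.adjoin_le_iff]
        rintro _ ⟨l, rfl⟩
        by_cases hl : l = i
        · rw [hl]; exact IntermediateField.mem_adjoin_simple_self _ _
        · exact mem_adj_of_mem _ (subset_cl _ ⟨⟨l, hl⟩, rfl⟩)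
      rw [hg] at h3
      exact h3 trivial)
    rw [hcw] at h3
    have h6 := h3.trans hE
    have : m + 1 ≤ m := by exact_mod_cast h6
    omega

end wo
end Cr

namespace Cr
open Polynomial
universe u

/-- coordinates of the tower -/
def tw {G : Type*} (R : ℕ) (xs ys : ℕ → G) : Option (Fin R) → G := fun o => o.elim (ys R) (fun j => xs j)
/-- coordinates of the rigid part -/
def wf {G : Type*} (R : ℕ) (xs ys : ℕ → G) (x : G) : Option (Option (Fin R)) → G := fun o => o.elim x (tw R xs ys)

theorem card_tw (R : ℕ) : Fintype.card (Option (Fin R)) = R + 1 := by simp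
theorem card_wf (R : ℕ) : Fintype.card (Option (Option (Fin R))) = R + 2 := by simp

section a
variable {k G : Type*} [Field k] [Field G] [Algebra k G]

theorem alg_mem {E Λ : Type*} [Field E] [Field Λ] [Algebra E Λ] {ρ z : Λ} (hρ : Transcendental E ρ)
    (hz : z ∈ IntermediateField.adjoin E {ρ}) (ha : IsAlgebraic E z) : ∃ c : E, algebraMap E Λ c = z := by
  let e := RatFunc.algEquivOfTranscendental ρ hρ
  by_contra hne
  have h1 : Transcendental E (e.symm ⟨z, hz⟩) := by
    apply RatFunc.transcendental_of_ne_C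
    rintro ⟨c, hc⟩
    apply hne
    refine ⟨c, ?_⟩
    rw [AlgEquiv.symm_apply_eq] at hc
    have h2 : e (RatFunc.C c) = algebraMap E _ c := e.commutes c
    rw [h2] at hc
    exact (congrArg Subtype.val hc).symm
  apply h1
  have h3 : IsAlgebraic E (⟨z, hz⟩ : IntermediateField.adjoin E {ρ}) :=
    (isAlgebraic_algebraMap_iff (A := Λ) (algebraMap (IntermediateField.adjoin E {ρ}) Λ).injective).1 ha
  exact h3.algHom e.symm.toAlgHom

theorem ys_mem {R : ℕ} {xs ys : ℕ → G} (tower : ∀ j < R, xs j ^ 5 + ys j * ys (j + 1) ^ 5 = 1)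
    (ne : ∀ j ≤ R, ys j ≠ 0) {F : IntermediateField k G} (hF : ∀ o, tw R xs ys o ∈ F) : ∀ j ≤ R, ys j ∈ F := by
  have : ∀ d j, j + d = R → ys j ∈ F := by
    intro d
    induction d with
    | zero => intro j hj; simp at hj; rw [hj]; exact hF none
    | succ d ih =>
      intro j hj
      have h1 := ih (j + 1) (by omega)
      have h2 := hF (some ⟨j, by omega⟩)
      simp only [tw, Option.elim] at h2
      have h3 := ne (j + 1) (by omega)
      have : ys j = (1 - xs j ^ 5) / ys (j + 1) ^ 5 := by
        rw [eq_div_iff (pow_ne_zero _ h3), ← tower j (by omega)]; ring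
      rw [this]
      exact div_mem (sub_mem (one_mem _) (pow_mem h2 _)) (pow_mem h1 _)
  intro j hj
  exact this (R - j) j (by omega)

theorem gg_mem {F : IntermediateField k G} (i : Bool) {x y : G} (hx : x ∈ F) (hy : y ∈ F) : gg i x y ∈ F := by
  have := gg_map F.val.toRingHom i ⟨x, hx⟩ ⟨y, hy⟩
  have h2 : gg i x y = F.val.toRingHom (gg i ⟨x, hx⟩ ⟨y, hy⟩) := this.symm
  rw [h2]; exact (gg i (⟨x, hx⟩ : F) ⟨y, hy⟩).2

theorem y_mem_cl {S : Set G} {x y : G} (h : y ^ 2 + y = x ^ 3 - x ^ 2) (hx : x ∈ cl k S) : y ∈ cl k S := by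
  refine mem_cl_of_root (X ^ 2 + X - C ((⟨x, hx⟩ : cl k S) ^ 3 - ⟨x, hx⟩ ^ 2)) ?_ ?_
  · apply Monic.ne_zero
    monicity!
  · simp only [map_sub, map_add, map_pow, aeval_X, aeval_C]
    have : algebraMap (cl k S) G ⟨x, hx⟩ = x := rfl
    rw [this]; linear_combination h

theorem TE.one_sub_ne {i : Bool} {R : ℕ} {xs ys : ℕ → G} {x y u : G} (h : TE i R xs ys x y u) :
    1 - ys 0 ^ 5 ≠ 0 := fun h0 => h.ne1 (by linear_combination -h0)

theorem TE.mem_cl {i : Bool} {R : ℕ} {xs ys : ℕ → G} {x y u : G} (h : TE i R xs ys x y u) {S : Set G}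
    (hS : ∀ o, wf R xs ys x o ∈ cl k S) : y ∈ cl k S ∧ u ∈ cl k S := by
  have hx : x ∈ cl k S := hS none
  have hy := y_mem_cl h.curve hx
  refine ⟨hy, mem_cl_of_pow (n := 5) (by norm_num) ?_⟩
  have h0 := ys_mem (k := k) h.tower h.ne (fun o => hS (some o)) 0 (by omega)
  have : u ^ 5 = gg i x y / (1 - ys 0 ^ 5) := by rw [eq_div_iff h.one_sub_ne, ← h.cover]; ring
  rw [this]
  exact div_mem (gg_mem i hx hy) (sub_mem (one_mem _) (pow_mem h0 _))

theorem TE.rig.{w} {k G : Type*} [Field k] [Field G] [Algebra k G] [CharZero k] {i : Bool} {R : ℕ} {xs ys : ℕ → G} {x y u : G}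
    (h : TE i R xs ys x y u) : Rig.{w} k (wf R xs ys x) := by
  intro Λ _ _ f E ρ hf
  let g : G →+* IntermediateField.adjoin E {ρ} :=
    (f : G →+* Λ).codRestrict (IntermediateField.adjoin E {ρ}).toSubfield.toSubring hf
  have : CharZero E := charZero_of_injective_algebraMap (algebraMap k E).injective
  obtain ⟨h1, h2, h3, h4, h5⟩ := rigid (h.map g)
  rintro (_ | _ | j)
  · exact h3
  · exact h2 R le_rfl
  · exact h1 j j.2

/-- type `i` fields -/
def TypeF (i : Bool) (R : ℕ) (k G : Type*) [Field k] [Field G] [Algebra k G] : Prop :=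
  ∃ (xs ys : ℕ → G) (x y u s : G), TE i R xs ys x y u ∧
    IntermediateField.adjoin k (Set.range (tw R xs ys) ∪ {x, y, u, s}) = ⊤ ∧ ((R + 3 : ℕ) : ℕ∞) ≤ rk k (Set.univ : Set G)

theorem TE.indep {i : Bool} {R : ℕ} {xs ys : ℕ → G} {x y u s : G} (h : TE i R xs ys x y u)
    (hg : IntermediateField.adjoin k (Set.range (tw R xs ys) ∪ {x, y, u, s}) = ⊤)
    (hr : ((R + 3 : ℕ) : ℕ∞) ≤ rk k (Set.univ : Set G)) : AlgebraicIndependent k (wf R xs ys x) := by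
  apply indep_of_rk
  rw [card_wf]
  have h1 : rk k (Set.univ : Set G) ≤ rk k (insert s (Set.range (wf R xs ys x))) := by
    apply rk_le_of_subset
    have h2 : ∀ o, wf R xs ys x o ∈ cl k (insert s (Set.range (wf R xs ys x))) := fun o =>
      subset_cl _ (Or.inr ⟨o, rfl⟩)
    have h3 := h.mem_cl h2
    have : IntermediateField.adjoin k (Set.range (tw R xs ys) ∪ {x, y, u, s}) ≤
        cl k (insert s (Set.range (wf R xs ys x))) := by
      rw [IntermediateField.adjoin_le_iff]
      rintro z (⟨o, rfl⟩ | rfl | rfl | rfl | rfl)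
      · exact h2 (some o)
      · exact h2 none
      · exact h3.1
      · exact h3.2
      · exact subset_cl _ (Or.inl rfl)
    rw [hg] at this
    intro z _; exact this trivial
  have h4 := (hr.trans h1).trans (rk_insert_le _ _)
  have h5 : ((R + 3 : ℕ) : ℕ∞) = ((R + 2 : ℕ) : ℕ∞) + 1 := by norm_cast
  rw [h5] at h4
  exact (ENat.add_le_add_iff_right (by simp)).1 h4

end a

/-- type of a valuation ring -/
def TypO (i : Bool) (R : ℕ) (k : Type*) {L : Type u} [Field k] [Field L] [Algebra k L] (O : ValuationSubring L) : Prop :=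
  ∃ (G : Type u) (_ : Field G) (_ : Algebra k G) (π : L → G), Place k O π ∧ (∀ y, ∃ z ∈ O, π z = y) ∧ TypeF i R k G

end Cr

namespace Cr
open Polynomial
universe u

/-- adjoin the last variable -/
def bf {K K' : Type*} [Field K] [Field K'] [Algebra K K'] {ι : Type*} (a : ι → K) (t : K') : Option ι → K' :=
  fun o => o.elim t (fun i => algebraMap K K' (a i))

section b
variable {k K : Type*} {K' : Type u} [Field k] [Field K] [Field K'] [Algebra k K] [Algebra K K'] [Algebra k K']
  [IsScalarTower k K K'] {ι : Type*} {a : ι → K} {t : K'}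

theorem bf_indep (hi : AlgebraicIndependent k a) (ht : Transcendental K t) : AlgebraicIndependent k (bf a t) := by
  let j : K →ₐ[k] K' := IsScalarTower.toAlgHom k K K'
  have h1 : AlgebraicIndependent k (fun i => algebraMap K K' (a i)) := hi.map' (f := j) j.injective
  refine (h1.option_iff_transcendental t).2 ?_
  set A := Algebra.adjoin k (Set.range fun i => algebraMap K K' (a i)) with hA
  rintro ⟨p, hp, hpt⟩
  have h2 : A ≤ j.range := by
    apply Algebra.adjoin_le
    rintro _ ⟨i, rfl⟩; exact ⟨a i, rfl⟩
  let e : A →+* K := ((AlgEquiv.ofInjective j j.injective).symm.toAlgHom.comp (Subalgebra.inclusion h2)).toRingHom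
  have he : ∀ z : A, algebraMap K K' (e z) = z := by
    intro z
    have := congrArg Subtype.val ((AlgEquiv.ofInjective j j.injective).apply_symm_apply (Subalgebra.inclusion h2 z))
    exact this
  have hinj : Function.Injective e := fun z z' hz => Subtype.ext (by rw [← he, ← he, hz])
  apply ht
  refine ⟨p.map e, (Polynomial.map_ne_zero_iff hinj).2 hp, ?_⟩
  rw [aeval_def, eval₂_map]
  rw [aeval_def] at hpt
  rw [← hpt]
  congr 1
  ext z; exact he z

theorem bf_gen (hg : IntermediateField.adjoin k (Set.range a) = ⊤) (htg : IntermediateField.adjoin K {t} = ⊤) :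
    IntermediateField.adjoin k (Set.range (bf a t)) = ⊤ := by
  let j : K →ₐ[k] K' := IsScalarTower.toAlgHom k K K'
  rw [eq_top_iff]
  intro z _
  have h1 : ∀ x : K, algebraMap K K' x ∈ IntermediateField.adjoin k (Set.range (bf a t)) := by
    intro x
    have hx : x ∈ IntermediateField.adjoin k (Set.range a) := by rw [hg]; trivial
    have h2 : j x ∈ (IntermediateField.adjoin k (Set.range a)).map j := ⟨x, hx, rfl⟩
    rw [IntermediateField.adjoin_map] at h2
    refine IntermediateField.adjoin.mono _ _ _ ?_ h2
    rintro _ ⟨_, ⟨i, rfl⟩, rfl⟩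
    exact ⟨some i, rfl⟩
  have hz : z ∈ IntermediateField.adjoin K {t} := by rw [htg]; trivial
  induction hz using IntermediateField.adjoin_induction with
  | mem x hx => rw [Set.mem_singleton_iff.1 hx]; exact IntermediateField.subset_adjoin _ _ ⟨none, rfl⟩
  | algebraMap x => exact h1 x
  | add x y _ _ h h' => exact add_mem (h trivial) (h' trivial)
  | mul x y _ _ h h' => exact mul_mem (h trivial) (h' trivial)
  | inv x _ h => exact inv_mem (h trivial)

variable [Fintype ι] [DecidableEq ι] [CharZero k]

theorem Place.comap {G : Type*} [Field G] [Algebra k G] {O : ValuationSubring K'} {π : K' → G} (h : Place k O π) :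
    ∃ (O0 : ValuationSubring K) (π0 : K → h.resField (IsScalarTower.toAlgHom k K K').fieldRange),
      Place k O0 π0 ∧ (∀ y, ∃ z ∈ O0, π0 z = y) ∧ (∀ z, z ∈ O0 ↔ algebraMap K K' z ∈ O) ∧
      ∀ z ∈ O0, (π0 z : G) = π (algebraMap K K' z) := by
  classical
  let O0 := O.comap (algebraMap K K')
  have hO0 : ∀ z, z ∈ O0 ↔ algebraMap K K' z ∈ O := fun z => Iff.rfl
  let π0 : K → h.resField (IsScalarTower.toAlgHom k K K').fieldRange := fun z =>
    if hz : algebraMap K K' z ∈ O then ⟨π (algebraMap K K' z), ⟨_, ⟨⟨z, rfl⟩, hz⟩, rfl⟩⟩ else 0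
  have hπ0 : ∀ z ∈ O0, (π0 z : G) = π (algebraMap K K' z) := by
    intro z hz
    have hz' : algebraMap K K' z ∈ O := hz
    simp only [π0, dif_pos hz']
  refine ⟨O0, π0, ?_, ?_, hO0, hπ0⟩
  · constructor
    · intro a b ha hb
      apply Subtype.ext
      rw [hπ0 _ (add_mem ha hb), map_add, h.add ha hb]
      push_cast
      rw [hπ0 _ ha, hπ0 _ hb]
    · intro a b ha hb
      apply Subtype.ext
      rw [hπ0 _ (mul_mem ha hb), map_mul, h.mul ha hb]
      push_cast
      rw [hπ0 _ ha, hπ0 _ hb]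
    · intro c
      rw [hO0, ← IsScalarTower.algebraMap_apply]; exact h.cmem c
    · intro c
      apply Subtype.ext
      rw [hπ0]
      · rw [← IsScalarTower.algebraMap_apply, h.const]; rfl
      · rw [hO0, ← IsScalarTower.algebraMap_apply]; exact h.cmem c
    · intro a ha
      rw [← Subtype.coe_inj, hπ0 _ ha, ZeroMemClass.coe_zero, h.zero ha]
      by_cases ha0 : a = 0
      · simp [ha0]
      have : ∀ {L : Type _} [Field L] (O : ValuationSubring L) (a : L), a ≠ 0 → (O.valuation a < 1 ↔ a⁻¹ ∉ O) := by
        intro L _ O a ha0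
        rw [← vle O, map_inv₀, not_le, one_lt_inv₀]
        exact zero_lt_iff.2 ((_root_.map_ne_zero _).2 ha0)
      have this2 : ∀ {L : Type _} [Field L] (O : ValuationSubring L) (a : L), a ≠ 0 → (O.valuation a < 1 ↔ a⁻¹ ∉ O) := by
        intro L _ O a ha0
        rw [← vle O, map_inv₀, not_le, one_lt_inv₀]
        exact zero_lt_iff.2 ((_root_.map_ne_zero _).2 ha0)
      rw [this O _ ((_root_.map_ne_zero _).2 ha0), this2 O0 _ ha0, hO0, map_inv₀]
  · rintro ⟨_, _, ⟨⟨z, rfl⟩, hz⟩, rfl⟩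
    exact ⟨z, hz, Subtype.ext (hπ0 z hz)⟩

set_option maxHeartbeats 1600000 in
theorem lemB {R : ℕ} (hc : Fintype.card ι = R + 3) {a a' : ι → K} (hi : AlgebraicIndependent k a)
    (hg : IntermediateField.adjoin k (Set.range a) = ⊤) (hi' : AlgebraicIndependent k a')
    (hg' : IntermediateField.adjoin k (Set.range a') = ⊤) (ht : Transcendental K t)
    (htg : IntermediateField.adjoin K {t} = ⊤) {i : Bool} {O : ValuationSubring K'}
    (hD : Dv (Algebra.adjoin k (Set.range (bf a' t))) O) (hTy : TypO i R k O) :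
    Dv (Algebra.adjoin k (Set.range (bf a t))) O := by
  obtain ⟨G, _, _, π, h, hs, xs, ys, x, y, u, s, hTE, hgen, hrk⟩ := hTy
  have hbi := bf_indep hi ht
  have hbg := bf_gen hg htg
  have hbi' := bf_indep hi' ht
  have hbg' := bf_gen hg' htg
  have hN' := nice_of hbi' hbg'
  have htO : t ∈ O := hD.1 _ (Algebra.subset_adjoin ⟨none, rfl⟩)
  have hT : O ≠ ⊤ := hD.ne_top
  set j : K →ₐ[k] K' := IsScalarTower.toAlgHom k K K' with hj
  by_cases hK : ∀ z : K, algebraMap K K' z ∈ O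
  · refine lemmaH' hbi hbg none (h.adjoin_mem ?_) hT ?_
    · rintro (_ | i)
      · exact htO
      · exact hK _
    · intro z hz hz0
      have h1 : Algebra.adjoin k (Set.range fun o : {o : Option ι // o ≠ none} => bf a t o.1) ≤ j.range := by
        apply Algebra.adjoin_le
        rintro _ ⟨⟨_ | i, hi⟩, rfl⟩
        · exact absurd rfl hi
        · exact ⟨a i, rfl⟩
      obtain ⟨z, rfl⟩ := h1 hz
      exact val_eq_one_of_mem O hz0 (hK z) (by
        have := hK z⁻¹
        rwa [map_inv₀] at this)
  set κ := h.resField j.fieldRange with hκ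
  have hSr : rk k (j.fieldRange : Set K') ≤ (R + 3 : ℕ) := by
    rw [← hc]
    refine le_trans (rk_le_of_subset ?_) (rk_range_le (fun i => algebraMap K K' (a i)))
    rintro _ ⟨z, rfl⟩
    have hz : z ∈ IntermediateField.adjoin k (Set.range a) := by rw [hg]; trivial
    have h2 : j z ∈ (IntermediateField.adjoin k (Set.range a)).map j := ⟨z, hz, rfl⟩
    rw [IntermediateField.adjoin_map] at h2
    refine adjoin_le_cl _ (IntermediateField.adjoin.mono _ _ _ ?_ h2)
    rintro _ ⟨_, ⟨i, rfl⟩, rfl⟩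
    exact ⟨i, rfl⟩
  have hκr : rk k (κ : Set G) ≤ (R + 2 : ℕ) := by
    by_contra hlt
    push Not at hlt
    apply hK
    have h3 : ((R + 3 : ℕ) : ℕ∞) ≤ rk k (κ : Set G) := by
      have := Order.add_one_le_of_lt hlt
      exact_mod_cast this
    intro z
    exact h.subfield_mem j.fieldRange hSr h3 _ ⟨z, rfl⟩
  have hGadj : ∀ g : G, g ∈ IntermediateField.adjoin κ {π t} := by
    intro g
    obtain ⟨z, hz, rfl⟩ := hs g
    refine mem_adj_of_adj (π t) ?_ (h.res_Dv hN' hD hz)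
    rintro _ ⟨_, ⟨_ | i, rfl⟩, rfl⟩
    · exact IntermediateField.mem_adjoin_simple_self _ _
    · exact mem_adj_of_mem _ ⟨_, ⟨⟨a' i, rfl⟩, hD.1 _ (Algebra.subset_adjoin ⟨some i, rfl⟩)⟩, rfl⟩
  have htt : Transcendental κ (π t) := by
    intro halg
    have h4 : rk k (Set.univ : Set G) ≤ rk k (κ : Set G) := by
      apply rk_le_of_subset
      intro g _
      exact mem_cl_of_alg (subset_cl _) (isAlgebraic_of_mem_adjoin halg (hGadj g))
    have := (hrk.trans h4).trans hκr
    rw [Nat.cast_le] at this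
    omega
  have hmem : ∀ g : G, IsAlgebraic κ g → g ∈ κ := by
    intro g hg
    obtain ⟨c, rfl⟩ := alg_mem htt (hGadj g) hg
    exact c.2
  have hchar : CharZero κ := charZero_of_injective_algebraMap (algebraMap k κ).injective
  let gG : G →+* IntermediateField.adjoin κ {π t} :=
    (RingHom.id G).codRestrict (IntermediateField.adjoin κ {π t}).toSubfield.toSubring hGadj
  obtain ⟨r1, r2, r3, r4, r5⟩ := rigid (hTE.map gG)
  have hxs : ∀ j < R, xs j ∈ κ := fun j hj => hmem _ (r1 j hj)
  have hys : ∀ j ≤ R, ys j ∈ κ := fun j hj => hmem _ (r2 j hj)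
  have hx : x ∈ κ := hmem _ r3
  have hy : y ∈ κ := hmem _ r4
  have hu : u ∈ κ := hmem _ r5
  classical
  let xs' : ℕ → κ := fun j => if hj : j < R then ⟨xs j, hxs j hj⟩ else 0
  let ys' : ℕ → κ := fun j => if hj : j ≤ R then ⟨ys j, hys j hj⟩ else 0
  have exs : ∀ j < R, (xs' j : G) = xs j := fun j hj => by simp only [xs', dif_pos hj]
  have eys : ∀ j ≤ R, (ys' j : G) = ys j := fun j hj => by simp only [ys', dif_pos hj]
  have hTE' : TE i R xs' ys' ⟨x, hx⟩ ⟨y, hy⟩ ⟨u, hu⟩ := by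
    constructor
    · intro j hj
      apply Subtype.ext
      push_cast
      rw [exs j hj, eys j hj.le, eys (j + 1) hj]; exact hTE.tower j hj
    · intro j hj h0
      have := eys j hj
      rw [h0] at this
      exact hTE.ne j hj this.symm
    · intro h0
      apply hTE.ne1
      have := congrArg (Subtype.val) h0
      push_cast at this
      rwa [eys 0 (by omega)] at this
    · exact fun h0 => hTE.une (congrArg Subtype.val h0)
    · apply Subtype.ext; push_cast; exact hTE.curve
    · apply Subtype.ext
      have := gg_map κ.val.toRingHom i ⟨x, hx⟩ ⟨y, hy⟩
      push_cast
      rw [eys 0 (by omega), hTE.cover]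
      exact this.symm
  have hwi : AlgebraicIndependent k (wf R xs' ys' ⟨x, hx⟩) := by
    have h5 := hTE.indep hgen hrk
    have h6 : (fun o => κ.val (wf R xs' ys' ⟨x, hx⟩ o)) = wf R xs ys x := by
      funext o
      rcases o with _ | _ | j
      · rfl
      · exact eys R le_rfl
      · exact exs j j.2
    rw [← h6] at h5
    exact AlgebraicIndependent.of_comp κ.val h5
  obtain ⟨O0, π0, h0, hs0, hO0, hπ0⟩ := Place.comap (K := K) h
  have hT0 : O0 ≠ ⊤ := by
    intro hT0
    apply hK
    intro z
    rw [← hO0, hT0]; trivial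
  have hD0 := WO hi hg h0 hs0 hT0 (m := R + 1) (by rw [hc]) (by rw [card_wf]) hwi hTE'.rig
  have haO : ∀ i, algebraMap K K' (a i) ∈ O := fun i => (hO0 _).1 (hD0.1 _ (Algebra.subset_adjoin ⟨i, rfl⟩))
  refine h.dv hbi hbg ?_ hT (m := R + 3) (by simp [hc]) ?_
  · rintro (_ | i)
    · exact htO
    · exact haO i
  refine hrk.trans (rk_le_of_subset ?_)
  have hκm : ∀ z : κ, (z : G) ∈ IntermediateField.adjoin k (Set.range fun i => π (bf a t i)) := by
    intro z
    obtain ⟨w, hw, rfl⟩ := hs0 z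
    have h7 := h0.res_Dv (nice_of hi hg) hD0 hw
    have h8 : κ.val (π0 w) ∈ (IntermediateField.adjoin k (π0 '' Set.range a)).map κ.val := ⟨_, h7, rfl⟩
    rw [IntermediateField.adjoin_map] at h8
    refine IntermediateField.adjoin.mono _ _ _ ?_ h8
    rintro _ ⟨_, ⟨_, ⟨i, rfl⟩, rfl⟩, rfl⟩
    exact ⟨some i, (hπ0 _ ((hO0 _).2 (haO i))).symm⟩
  intro g _
  apply adjoin_le_cl
  have hg1 := hGadj g
  induction hg1 using IntermediateField.adjoin_induction with
  | mem x hx => rw [Set.mem_singleton_iff.1 hx]; exact IntermediateField.subset_adjoin _ _ ⟨none, rfl⟩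
  | algebraMap x => exact hκm x
  | add x y _ _ h h' => exact add_mem (h trivial) (h' trivial)
  | mul x y _ _ h h' => exact mul_mem (h trivial) (h' trivial)
  | inv x _ h => exact inv_mem (h trivial)

end b
end Cr

namespace Cr
open Polynomial Pointwise
universe u

section comm
variable {X : Type*}

theorem comm_aux {A B Y : Set X} (hY : Y.Finite) (h1 : A \ B ⊆ Y) (h2 : B \ A ⊆ Y) :
    ((A \ B).ncard : ℤ) - (B \ A).ncard = (A ∩ Y).ncard - (B ∩ Y).ncard := by
  have e1 := Set.ncard_inter_add_ncard_sdiff_eq_ncard (A ∩ Y) B (hY.subset Set.inter_subset_right)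
  have e2 := Set.ncard_inter_add_ncard_sdiff_eq_ncard (B ∩ Y) A (hY.subset Set.inter_subset_right)
  have e3 : (A ∩ Y) ∩ B = (B ∩ Y) ∩ A := by ext z; simp; tauto
  have e4 : (A ∩ Y) \ B = A \ B := by
    ext z; simp only [Set.mem_diff, Set.mem_inter_iff]
    exact ⟨fun h => ⟨h.1.1, h.2⟩, fun h => ⟨⟨h.1, h1 h⟩, h.2⟩⟩
  have e5 : (B ∩ Y) \ A = B \ A := by
    ext z; simp only [Set.mem_diff, Set.mem_inter_iff]
    exact ⟨fun h => ⟨h.1.1, h.2⟩, fun h => ⟨⟨h.1, h2 h⟩, h.2⟩⟩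
  rw [e3, e4] at e1
  rw [e5] at e2
  push_cast [← e1, ← e2]
  ring

theorem comm_cocycle {A B C : Set X} (h1 : (A \ B).Finite) (h2 : (B \ A).Finite) (h3 : (B \ C).Finite)
    (h4 : (C \ B).Finite) :
    ((A \ C).ncard : ℤ) - (C \ A).ncard =
      (((A \ B).ncard : ℤ) - (B \ A).ncard) + (((B \ C).ncard : ℤ) - (C \ B).ncard) := by
  have hY : ((A \ B) ∪ (B \ A) ∪ (B \ C) ∪ (C \ B)).Finite := ((h1.union h2).union h3).union h4
  rw [comm_aux hY (A := A) (B := C), comm_aux hY (A := A) (B := B), comm_aux hY (A := B) (B := C)]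
  · ring
  all_goals
    intro z; simp only [Set.mem_diff, Set.mem_union]; tauto

theorem not_surj {G H : Type*} [Group G] [Group H] (ι : G →* H) [MulAction H X] (S : Set X)
    (hfin : ∀ h : H, (h • S \ S).Finite) (hι : ∀ g, ι g • S = S) (φ : H)
    (h1 : (φ • S \ S).ncard ≠ (S \ φ • S).ncard) : ¬ Function.Surjective (Abelianization.map ι) := by
  intro hsurj
  have hfin' : ∀ h : H, (S \ h • S).Finite := by
    intro h
    have : S \ h • S = h • (h⁻¹ • S \ S) := by
      rw [Set.smul_set_sdiff, smul_inv_smul]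
    rw [this]; exact (hfin h⁻¹).smul_set
  let c : H →* Multiplicative ℤ :=
    { toFun := fun h => Multiplicative.ofAdd (((h • S \ S).ncard : ℤ) - (S \ h • S).ncard)
      map_one' := by simp
      map_mul' := by
        intro g h
        rw [← ofAdd_add]
        congr 1
        have e1 : (g * h) • S \ g • S = g • (h • S \ S) := by rw [Set.smul_set_sdiff, mul_smul]
        have e2 : g • S \ (g * h) • S = g • (S \ h • S) := by rw [Set.smul_set_sdiff, mul_smul]
        rw [comm_cocycle (A := (g * h) • S) (B := g • S) (C := S), e1, e2, Set.ncard_smul_set, Set.ncard_smul_set]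
        · ring
        · rw [e1]; exact (hfin h).smul_set
        · rw [e2]; exact (hfin' h).smul_set
        · exact hfin g
        · exact hfin' g }
  have hc : c φ ≠ 1 := by
    intro h
    have h2 : (((φ • S \ S).ncard : ℤ) - (S \ φ • S).ncard) = 0 := h
    apply h1
    have := sub_eq_zero.1 h2
    exact_mod_cast this
  have hcι : ∀ g, c (ι g) = 1 := by
    intro g
    have : c (ι g) = Multiplicative.ofAdd (((ι g • S \ S).ncard : ℤ) - (S \ ι g • S).ncard) := rfl
    rw [this, hι]; simp
  apply hc
  obtain ⟨y, hy⟩ := hsurj (Abelianization.of φ)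
  obtain ⟨g, rfl⟩ : ∃ g, Abelianization.of g = y := QuotientGroup.mk_surjective y
  rw [Abelianization.map_of] at hy
  have := congrArg (Abelianization.lift c) hy
  rw [Abelianization.lift_apply_of, Abelianization.lift_apply_of, hcι] at this
  exact this.symm
end comm

section act
variable {k : Type*} {L : Type u} [Field k] [Field L] [Algebra k L]

theorem vlt_iff {L : Type*} [Field L] (O : ValuationSubring L) {a : L} (ha0 : a ≠ 0) :
    O.valuation a < 1 ↔ a⁻¹ ∉ O := by
  rw [← vle O, map_inv₀, not_le, one_lt_inv₀]
  exact zero_lt_iff.2 ((_root_.map_ne_zero _).2 ha0)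

theorem smul_mem (σ : L ≃ₐ[k] L) (O : ValuationSubring L) (z : L) : σ z ∈ σ • O ↔ z ∈ O :=
  ValuationSubring.smul_mem_pointwise_smul_iff (g := σ) (S := O) (x := z)

theorem smul_vlt (σ : L ≃ₐ[k] L) (O : ValuationSubring L) (z : L) : (σ • O).valuation (σ z) < 1 ↔ O.valuation z < 1 := by
  by_cases hz : z = 0
  · simp [hz]
  · rw [vlt_iff O hz, vlt_iff _ ((_root_.map_ne_zero σ).2 hz), ← map_inv₀, smul_mem]

theorem TypO.smul {i : Bool} {R : ℕ} {O : ValuationSubring L} (h : TypO i R k O) (σ : L ≃ₐ[k] L) :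
    TypO i R k (σ • O) := by
  obtain ⟨G, _, _, π, h, hs, hT⟩ := h
  have key : ∀ z, z ∈ σ • O ↔ σ.symm z ∈ O := fun z => by rw [← smul_mem σ O, AlgEquiv.apply_symm_apply]
  refine ⟨G, _, _, fun z => π (σ.symm z), ?_, ?_, hT⟩
  · constructor
    · intro a b ha hb
      simp only [map_add]
      exact h.add ((key _).1 ha) ((key _).1 hb)
    · intro a b ha hb
      simp only [map_mul]
      exact h.mul ((key _).1 ha) ((key _).1 hb)
    · intro c; rw [key, AlgEquiv.commutes]; exact h.cmem c
    · intro c; simp only [AlgEquiv.commutes]; exact h.const c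
    · intro a ha
      rw [h.zero ((key _).1 ha), ← smul_vlt σ, AlgEquiv.apply_symm_apply]
  · intro y
    obtain ⟨z, hz, rfl⟩ := hs y
    exact ⟨σ z, (smul_mem σ O z).2 hz, by simp⟩

theorem TypO.smul_iff {i : Bool} {R : ℕ} {O : ValuationSubring L} (σ : L ≃ₐ[k] L) :
    TypO i R k (σ • O) ↔ TypO i R k O :=
  ⟨fun h => by have := h.smul σ⁻¹; rwa [inv_smul_smul] at this, fun h => h.smul σ⟩

theorem adj_map {ι : Type*} (a : ι → L) (σ : L ≃ₐ[k] L) (z : L) :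
    σ z ∈ Algebra.adjoin k (Set.range fun i => σ (a i)) ↔ z ∈ Algebra.adjoin k (Set.range a) := by
  have h1 : Algebra.adjoin k (Set.range fun i => σ (a i)) = (Algebra.adjoin k (Set.range a)).map σ.toAlgHom := by
    rw [AlgHom.map_adjoin, ← Set.range_comp]; rfl
  rw [h1, Subalgebra.mem_map]
  constructor
  · rintro ⟨w, hw, e⟩
    rwa [← σ.injective e]
  · intro h; exact ⟨z, h, rfl⟩

theorem Dv.smul {ι : Type*} {a : ι → L} {O : ValuationSubring L} (h : Dv (Algebra.adjoin k (Set.range a)) O)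
    (σ : L ≃ₐ[k] L) : Dv (Algebra.adjoin k (Set.range fun i => σ (a i))) (σ • O) := by
  obtain ⟨h1, q, hq, hq0, h2⟩ := h
  refine ⟨?_, σ q, (adj_map a σ q).2 hq, (_root_.map_ne_zero σ).2 hq0, ?_⟩
  · intro n hn
    obtain ⟨n, rfl⟩ := σ.surjective n
    exact (smul_mem σ O n).2 (h1 n ((adj_map a σ n).1 hn))
  · intro n hn
    obtain ⟨n, rfl⟩ := σ.surjective n
    rw [smul_vlt, h2 n ((adj_map a σ n).1 hn)]
    constructor
    · rintro ⟨m, hm, rfl⟩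
      exact ⟨σ m, (adj_map a σ m).2 hm, map_mul _ _ _⟩
    · rintro ⟨m, hm, e⟩
      obtain ⟨m, rfl⟩ := σ.surjective m
      rw [← map_mul] at e
      exact ⟨m, (adj_map a σ m).1 hm, σ.injective e⟩

theorem Dv.smul_iff {ι : Type*} {a : ι → L} {O : ValuationSubring L}
    (σ : L ≃ₐ[k] L) : Dv (Algebra.adjoin k (Set.range fun i => σ (a i))) (σ • O) ↔
      Dv (Algebra.adjoin k (Set.range a)) O := by
  refine ⟨fun h => ?_, fun h => h.smul σ⟩
  have := h.smul σ⁻¹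
  rw [inv_smul_smul] at this
  have e : (fun i => σ⁻¹ (σ (a i))) = a := by ext i; exact σ.symm_apply_apply (a i)
  rwa [e] at this

theorem map_indep {ι : Type*} {a : ι → L} (hi : AlgebraicIndependent k a) (σ : L ≃ₐ[k] L) :
    AlgebraicIndependent k (fun i => σ (a i)) := hi.map' (f := σ.toAlgHom) σ.injective

theorem map_gen {ι : Type*} {a : ι → L} (hg : IntermediateField.adjoin k (Set.range a) = ⊤) (σ : L ≃ₐ[k] L) :
    IntermediateField.adjoin k (Set.range fun i => σ (a i)) = ⊤ := by
  have h1 : (IntermediateField.adjoin k (Set.range a)).map σ.toAlgHom =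
      IntermediateField.adjoin k (Set.range fun i => σ (a i)) := by
    rw [IntermediateField.adjoin_map, ← Set.range_comp]; rfl
  rw [← h1, hg, eq_top_iff]
  intro z _
  exact ⟨σ.symm z, trivial, by simp⟩
end act

theorem reduction {k K : Type*} {K' : Type u} [Field k] [Field K] [Field K'] [CharZero k] [Algebra k K] [Algebra K K']
    [Algebra k K'] [IsScalarTower k K K'] (R : ℕ) {ι : Type*} [Fintype ι] [DecidableEq ι] (hc : Fintype.card ι = R + 3)
    (x : ι → K) (hx : AlgebraicIndependent k x) (hxgen : IntermediateField.adjoin k (Set.range x) = ⊤)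
    (t : K') (ht : Transcendental K t) (htgen : IntermediateField.adjoin K {t} = ⊤)
    (j : (K ≃ₐ[k] K) →* (K' ≃ₐ[k] K'))
    (hj : ∀ σ, (∀ a : K, j σ (algebraMap K K' a) = algebraMap K K' (σ a)) ∧ j σ t = t)
    (φ : K' ≃ₐ[k] K')
    (h1 : ∀ O : ValuationSubring K', Dv (Algebra.adjoin k (Set.range (bf x t))) O → TypO true R k O →
      Dv (Algebra.adjoin k (Set.range fun i => φ (bf x t i))) O)
    (O₁ : ValuationSubring K') (h2 : TypO true R k O₁) (h3 : Dv (Algebra.adjoin k (Set.range fun i => φ (bf x t i))) O₁)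
    (h4 : ¬ Dv (Algebra.adjoin k (Set.range (bf x t))) O₁) : ¬ Function.Surjective (Abelianization.map j) := by
  have hbi := bf_indep hx ht
  have hbg := bf_gen hxgen htgen
  set S : Set (ValuationSubring K') := {O | Dv (Algebra.adjoin k (Set.range (bf x t))) O ∧ TypO true R k O} with hS
  have hsm : ∀ σ : K' ≃ₐ[k] K', σ • S = {O | Dv (Algebra.adjoin k (Set.range fun i => σ (bf x t i))) O ∧ TypO true R k O} := by
    intro σ
    ext O
    rw [Set.mem_smul_set_iff_inv_smul_mem]
    simp only [hS, Set.mem_setOf_eq]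
    rw [TypO.smul_iff, ← Dv.smul_iff σ, smul_inv_smul]
  have hfin : ∀ σ : K' ≃ₐ[k] K', (σ • S \ S).Finite := by
    intro σ
    rw [hsm]
    refine ((nice_of (map_indep hbi σ) (map_gen hbg σ)).finite_diff (nice_of hbi hbg) (Set.finite_range _) (Set.finite_range _)
      rfl rfl).subset ?_
    rintro O ⟨⟨hO1, hO2⟩, hO3⟩
    exact ⟨hO1, fun h => hO3 ⟨h, hO2⟩⟩
  refine not_surj j S hfin ?_ φ ?_
  · intro σ
    have e : (fun i => j σ (bf x t i)) = bf (fun i => σ (x i)) t := by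
      funext o
      rcases o with _ | i
      · exact (hj σ).2
      · exact (hj σ).1 (x i)
    rw [hsm, e]
    have hx' := map_indep hx σ
    have hg' := map_gen hxgen σ
    ext O
    exact ⟨fun h => ⟨lemB hc hx hxgen hx' hg' ht htgen h.1 h.2, h.2⟩,
      fun h => ⟨lemB hc hx' hg' hx hxgen ht htgen h.1 h.2, h.2⟩⟩
  · have e1 : S \ φ • S = ∅ := by
      rw [hsm, Set.diff_eq_empty]
      rintro O ⟨hO1, hO2⟩
      exact ⟨h1 O hO1 hO2, hO2⟩
    rw [e1, Set.ncard_empty]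
    intro h0
    rw [Set.ncard_eq_zero (hfin φ)] at h0
    have : O₁ ∈ φ • S \ S := by
      rw [hsm]
      exact ⟨⟨h3, h2⟩, fun h => h4 h.1⟩
    rw [h0] at this
    exact this

end Cr

namespace Cr
open Polynomial
universe u

/-- the coordinates `xs` -/
def twx {G : Type*} [Zero G] {R : ℕ} (T : Option (Fin R) → G) : ℕ → G := fun j => if h : j < R then T (some ⟨j, h⟩) else 0
/-- the functions `ys`, downward -/
noncomputable def tyd {G : Type*} [Field G] {R : ℕ} (T : Option (Fin R) → G) : ℕ → G
  | 0 => T none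
  | d + 1 => (1 - twx T (R - (d + 1)) ^ 5) / tyd T d ^ 5
/-- the functions `ys` -/
noncomputable def twy {G : Type*} [Field G] {R : ℕ} (T : Option (Fin R) → G) : ℕ → G := fun j => tyd T (R - j)

section t
variable {k G : Type*} [Field k] [Field G] [Algebra k G] {R : ℕ} {T : Option (Fin R) → G}

theorem tw_eq : tw R (twx T) (twy T) = T := by
  funext o
  rcases o with _ | j
  · simp [tw, twy, tyd]
  · simp [tw, twx]

theorem twx_eq (j : Fin R) : twx T j = T (some j) := by simp [twx]

theorem twx_pow_ne (hT : AlgebraicIndependent k T) {j : ℕ} (hj : j < R) : 1 - twx T j ^ 5 ≠ 0 := by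
  intro h0
  have h1 : Transcendental k (T (some ⟨j, hj⟩)) := hT.transcendental _
  apply h1
  have : twx T j = T (some ⟨j, hj⟩) := by simp [twx, hj]
  rw [this] at h0
  refine ⟨1 - X ^ 5, ?_, ?_⟩
  · intro h2
    have := congrArg (eval 0) h2
    simp at this
  · simpa using h0

theorem tyd_ne (hT : AlgebraicIndependent k T) : ∀ d ≤ R, tyd T d ≠ 0 := by
  intro d
  induction d with
  | zero => intro _; exact hT.ne_zero none
  | succ d ih =>
    intro hd
    rw [tyd]
    exact div_ne_zero (twx_pow_ne hT (by omega)) (pow_ne_zero _ (ih (by omega)))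

theorem twy_ne (hT : AlgebraicIndependent k T) : ∀ j ≤ R, twy T j ≠ 0 := fun j _ => tyd_ne hT _ (by omega)

theorem twy_tower (hT : AlgebraicIndependent k T) : ∀ j < R, twx T j ^ 5 + twy T j * twy T (j + 1) ^ 5 = 1 := by
  intro j hj
  have h1 : twy T j = (1 - twx T j ^ 5) / twy T (j + 1) ^ 5 := by
    rw [twy, twy]
    obtain ⟨d, hd⟩ : ∃ d, R - j = d + 1 := ⟨R - j - 1, by omega⟩
    rw [hd, tyd, show R - (j + 1) = d by omega, show R - (d + 1) = j by omega]
  have h2 := twy_ne hT (j + 1) hj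
  rw [h1]; field_simp; ring

theorem tower_cl {xs ys : ℕ → G} (tower : ∀ j < R, xs j ^ 5 + ys j * ys (j + 1) ^ 5 = 1)
    (ne : ∀ j ≤ R, ys j ≠ 0) {S : Set G} (hx : ∀ j < R, xs j ∈ cl k S) (h0 : ys 0 ∈ cl k S) :
    ∀ j ≤ R, ys j ∈ cl k S := by
  intro j
  induction j with
  | zero => intro _; exact h0
  | succ j ih =>
    intro hj
    apply mem_cl_of_pow (n := 5) (by norm_num)
    have h1 := ih (by omega)
    have h2 := tower j hj
    have : ys (j + 1) ^ 5 = (1 - xs j ^ 5) / ys j := by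
      rw [eq_div_iff (ne j (by omega)), ← h2]; ring
    rw [this]
    exact div_mem (sub_mem (one_mem _) (pow_mem (hx j hj) _)) h1

theorem twy_not_cl (hT : AlgebraicIndependent k T) : twy T 0 ∉ cl k (Set.range fun j : Fin R => T (some j)) := by
  intro h0
  have h1 := tower_cl (k := k) (twy_tower hT) (twy_ne hT) (S := Set.range fun j : Fin R => T (some j))
    (fun j hj => subset_cl _ ⟨⟨j, hj⟩, by simp [twx, hj]⟩) h0 R le_rfl
  have h2 : twy T R = T none := by simp [twy, tyd]
  rw [h2] at h1
  have h3 : rk k (Set.range T) ≤ rk k (Set.range fun j : Fin R => T (some j)) := by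
    apply rk_le_of_subset
    rintro _ ⟨_ | j, rfl⟩
    · exact h1
    · exact subset_cl _ ⟨j, rfl⟩
  have h4 := h3.trans (rk_range_le _)
  rw [rk_of_indep hT, card_tw, Fintype.card_fin, Nat.cast_le] at h4
  omega

theorem twy_pow_ne (hT : AlgebraicIndependent k T) : twy T 0 ^ 5 ≠ 1 := by
  intro h
  apply twy_not_cl hT
  apply mem_cl_of_pow (n := 5) (by norm_num)
  rw [h]; exact one_mem _

theorem twy_mem {F : IntermediateField k G} (hF : ∀ o, T o ∈ F) (j : ℕ) : twy T j ∈ F := by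
  have hx : ∀ j, twx T j ∈ F := by
    intro j
    by_cases hj : j < R
    · rw [twx, dif_pos hj]; exact hF _
    · rw [twx, dif_neg hj]; exact zero_mem _
  have : ∀ d, tyd T d ∈ F := by
    intro d
    induction d with
    | zero => exact hF none
    | succ d ih => exact div_mem (sub_mem (one_mem _) (pow_mem (hx _) _)) (pow_mem ih _)
  exact this _

theorem twx_map {H : Type*} [Field H] (f : G →+* H) (j : ℕ) : twx (fun o => f (T o)) j = f (twx T j) := by
  by_cases hj : j < R
  · simp only [twx, dif_pos hj]
  · simp only [twx, dif_neg hj, map_zero]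

theorem twy_map {H : Type*} [Field H] (f : G →+* H) (j : ℕ) : twy (fun o => f (T o)) j = f (twy T j) := by
  have : ∀ d, tyd (fun o => f (T o)) d = f (tyd T d) := by
    intro d
    induction d with
    | zero => rfl
    | succ d ih => simp only [tyd, twx_map, ih, map_div₀, map_sub, map_pow, map_one]
  exact this _

theorem Place.twy {L : Type*} [Field L] [Algebra k L] {O : ValuationSubring L} {π : L → G} (h : Place k O π)
    {T : Option (Fin R) → L} (hTO : ∀ o, T o ∈ O) (hT : AlgebraicIndependent k (fun o => π (T o))) :
    (∀ j, twx T j ∈ O ∧ π (twx T j) = twx (fun o => π (T o)) j) ∧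
    ∀ j ≤ R, O.valuation (twy T j) = 1 ∧ π (Cr.twy T j) = Cr.twy (fun o => π (T o)) j := by
  have hx : ∀ j, twx T j ∈ O ∧ π (twx T j) = twx (fun o => π (T o)) j := by
    intro j
    by_cases hj : j < R
    · simp only [twx, dif_pos hj]; exact ⟨hTO _, trivial⟩
    · simp only [twx, dif_neg hj]; exact ⟨zero_mem _, h.map_zero⟩
  refine ⟨hx, ?_⟩
  have : ∀ d ≤ R, O.valuation (tyd T d) = 1 ∧ π (tyd T d) = tyd (fun o => π (T o)) d := by
    intro d
    induction d with
    | zero => intro _; exact ⟨h.v1 (hTO none) (hT.ne_zero none), rfl⟩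
    | succ d ih =>
      intro hd
      obtain ⟨h1, h2⟩ := ih (by omega)
      obtain ⟨h3, h4⟩ := hx (R - (d + 1))
      have h5 : 1 - twx T (R - (d + 1)) ^ 5 ∈ O := sub_mem (one_mem _) (pow_mem h3 _)
      have h6 : π (1 - twx T (R - (d + 1)) ^ 5) = 1 - twx (fun o => π (T o)) (R - (d + 1)) ^ 5 := by
        rw [h.sub (one_mem _) (pow_mem h3 _), h.map_one, h.pow h3, h4]
      have h7 := h.v1 h5 (by rw [h6]; exact twx_pow_ne hT (by omega))
      have h8 : O.valuation (tyd T d ^ 5) = 1 := by rw [map_pow, h1, one_pow]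
      simp only [tyd]
      refine ⟨by rw [map_div₀, h7, h8, div_one], ?_⟩
      rw [h.div h5 h8, h6, h.pow ((vle O).1 h1.le), h2]
  intro j hj
  exact this _ (by omega)

/-- RR lemma -/
theorem lemRR.{w} {k : Type*} {G : Type w} [Field k] [Field G] [Algebra k G] [CharZero k] {i : Bool} {R : ℕ} (hG : TypeF i R k G) (B : Set G) (hB : rk k B ≤ (R + 1 : ℕ)) (c1 c2 : G)
    (hgen : IntermediateField.adjoin k (B ∪ {c1, c2}) = ⊤) : False := by
  obtain ⟨xs, ys, x, y, u, s, hTE, hg, hr⟩ := hG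
  have hwi := hTE.indep hg hr
  have key : ∀ c1 c2 : G, IntermediateField.adjoin k (B ∪ {c1, c2}) = ⊤ →
      c2 ∉ cl k (insert c1 B) ∧ ∀ o, wf R xs ys x o ∈ cl k (insert c1 B) := by
    intro c1 c2 hgen
    constructor
    · intro hc
      have h1 : rk k (Set.univ : Set G) ≤ rk k (insert c1 B) := by
        apply rk_le_of_subset
        intro z _
        have hz : z ∈ IntermediateField.adjoin k (B ∪ {c1, c2}) := by rw [hgen]; trivial
        have hle : IntermediateField.adjoin k (B ∪ {c1, c2}) ≤ cl k (insert c1 B) := by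
          rw [IntermediateField.adjoin_le_iff]
          rintro w (hw | rfl | rfl)
          · exact subset_cl _ (Or.inr hw)
          · exact subset_cl _ (Or.inl rfl)
          · exact hc
        exact hle hz
      have h2 := ((hr.trans h1).trans (rk_insert_le _ _)).trans (add_le_add_left hB 1)
      have h3 : R + 3 ≤ R + 1 + 1 := by exact_mod_cast h2
      omega
    · intro o
      have h1 := hTE.rig (k := k) G (AlgHom.id k G) (IntermediateField.adjoin k (insert c1 B)) c2 ?_ o
      · exact mem_cl_of_alg (adjoin_le_cl _) h1
      · intro g
        have hz : g ∈ IntermediateField.adjoin k (B ∪ {c1, c2}) := by rw [hgen]; trivial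
        refine mem_adj_of_adj c2 ?_ hz
        rintro w (hw | rfl | rfl)
        · exact mem_adj_of_mem _ (IntermediateField.subset_adjoin _ _ (Or.inr hw))
        · exact mem_adj_of_mem _ (IntermediateField.subset_adjoin _ _ (Or.inl rfl))
        · exact IntermediateField.mem_adjoin_simple_self _ _
  obtain ⟨h1, h2⟩ := key c1 c2 hgen
  obtain ⟨h3, h4⟩ := key c2 c1 (by rw [Set.pair_comm]; exact hgen)
  have h5 : ∀ o, wf R xs ys x o ∈ cl k B := by
    intro o
    by_contra hno
    have h6 : wf R xs ys x o ∈ (Mt k G).closure (insert c1 B) \ (Mt k G).closure B := by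
      rw [closure_eq, closure_eq]; exact ⟨h2 o, hno⟩
    have h7 := (Matroid.closure_exchange h6).1
    rw [closure_eq] at h7
    apply h3
    refine cl_le ?_ h7
    rintro w (rfl | hw)
    · exact h4 o
    · exact subset_cl _ (Or.inr hw)
  have h8 : rk k (Set.range (wf R xs ys x)) ≤ rk k B := by
    apply rk_le_of_subset
    rintro _ ⟨o, rfl⟩; exact h5 o
  rw [rk_of_indep hwi, card_wf] at h8
  have := h8.trans hB
  rw [Nat.cast_le] at this
  omega

/-- U = V = 0 -/
theorem lemUV {α β γ f : G} (hU : -β * (α * γ - β ^ 2) + f * γ - α ^ 2 = 0)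
    (hV : -γ * (α * γ - β ^ 2) - α * β - f = 0) :
    (γ = 0 ∧ α ^ 2 = β ^ 3 ∧ f = -α * β) ∨
    (γ ≠ 0 ∧ ∃ x y : G, α = (y - x + 1) * γ ^ 3 ∧ β = (x - 1) * γ ^ 2 ∧ y ^ 2 + y = x ^ 3 - x ^ 2 ∧
      f * (-1 / γ) ^ 5 = gg false x y) := by
  by_cases hγ : γ = 0
  · left
    subst hγ
    exact ⟨rfl, by linear_combination -hU, by linear_combination -hV⟩
  · right
    refine ⟨hγ, β / γ ^ 2 + 1, α / γ ^ 3 + β / γ ^ 2, by field_simp; ring, by field_simp; ring, ?_, ?_⟩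
    · have hU2 : -β * (α * γ - β ^ 2) + (-γ * (α * γ - β ^ 2) - α * β) * γ - α ^ 2 = 0 := by
        linear_combination hU + γ * hV
      field_simp
      linear_combination -hU2
    · simp only [gg]
      field_simp
      simp only [Bool.false_eq_true, if_false]
      field_simp
      linear_combination hV

theorem x_mem_cl {S : Set G} {x y : G} (h : y ^ 2 + y = x ^ 3 - x ^ 2) (hx : gg false x y ∈ cl k S) : x ∈ cl k S := by
  set e : cl k S := ⟨gg false x y, hx⟩ with he
  refine mem_cl_of_root (X ^ 5 - X ^ 4 - (C e + 2 * X ^ 2 - 3 * X + 1) ^ 2 - X * (C e + 2 * X ^ 2 - 3 * X + 1)) ?_ ?_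
  · intro h0
    have := congrArg (fun p => coeff p 5) h0
    have h1 : (X ^ 4 + (C e + 2 * X ^ 2 - 3 * X + 1) ^ 2 + X * (C e + 2 * X ^ 2 - 3 * X + 1) : Polynomial (cl k S)).natDegree ≤ 4 := by
      compute_degree
    have h2 := coeff_eq_zero_of_natDegree_lt (lt_of_le_of_lt h1 (by norm_num : 4 < 5))
    have h3 : X ^ 5 - X ^ 4 - (C e + 2 * X ^ 2 - 3 * X + 1) ^ 2 - X * (C e + 2 * X ^ 2 - 3 * X + 1) = X ^ 5 - (X ^ 4 + (C e + 2 * X ^ 2 - 3 * X + 1) ^ 2 + X * (C e + 2 * X ^ 2 - 3 * X + 1) : Polynomial (cl k S)) := by ring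
    rw [h3] at this
    simp only [coeff_sub, h2, coeff_X_pow] at this
    simp at this
  · have he' : algebraMap (cl k S) G e = x * y - 2 * x ^ 2 + 3 * x - 1 := by
      show gg false x y = _
      simp [gg]
    simp only [map_sub, map_add, map_mul, map_pow, aeval_X, aeval_C, map_ofNat, map_one, he']
    linear_combination (- x ^ 2) * h

end t
end Cr

namespace Cr
open Polynomial
universe u

/-- full coordinate family -/
def cf {G : Type*} {R : ℕ} (T : Option (Fin R) → G) (a b c : G) : Option (Fin R) ⊕ Fin 3 → G := Sum.elim T ![a, b, c]

theorem card_cf (R : ℕ) : Fintype.card (Option (Fin R) ⊕ Fin 3) = R + 4 := by simp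

theorem cf_forall {G : Type*} {R : ℕ} {T : Option (Fin R) → G} {a b c : G} (P : G → Prop) :
    (∀ i, P (cf T a b c i)) ↔ (∀ o, P (T o)) ∧ P a ∧ P b ∧ P c := by
  constructor
  · intro h
    exact ⟨fun o => h (Sum.inl o), h (Sum.inr 0), h (Sum.inr 1), h (Sum.inr 2)⟩
  · rintro ⟨h1, h2, h3, h4⟩ (o | i)
    · exact h1 o
    · fin_cases i
      · exact h2
      · exact h3
      · exact h4

theorem cf_comp {G H : Type*} {R : ℕ} (T : Option (Fin R) → G) (a b c : G) (π : G → H) (i) :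
    π (cf T a b c i) = cf (fun o => π (T o)) (π a) (π b) (π c) i := by
  rcases i with o | i
  · rfl
  · fin_cases i <;> rfl

/-- the relation between the two coordinate systems -/
structure Rel {G : Type*} [Field G] (f α β γ ξ η ζ : G) : Prop where
  h1 : η = β + γ * ξ
  h2 : ζ = α + β * ξ
  h3 : (-β * (α * γ - β ^ 2) + f * γ - α ^ 2) + ξ * (-γ * (α * γ - β ^ 2) - α * β - f) = 0

section r
variable {G : Type*} [Field G] {f α β γ ξ η ζ : G}

theorem Rel.a (h : Rel f α β γ ξ η ζ) : α = ζ - η * ξ + γ * ξ ^ 2 := by rw [h.h1, h.h2]; ring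
theorem Rel.b (h : Rel f α β γ ξ η ζ) : β = η - γ * ξ := by rw [h.h1]; ring
theorem Rel.c (h : Rel f α β γ ξ η ζ) : (η ^ 3 - ζ ^ 2 + ξ * η * ζ - f * ξ) + γ * (f - η * ζ - ξ ^ 2 * ζ - ξ * η ^ 2) = 0 := by
  rw [h.h1, h.h2]; linear_combination h.h3
theorem Rel.mk' (h1 : α = ζ - η * ξ + γ * ξ ^ 2) (h2 : β = η - γ * ξ)
    (h3 : (η ^ 3 - ζ ^ 2 + ξ * η * ζ - f * ξ) + γ * (f - η * ζ - ξ ^ 2 * ζ - ξ * η ^ 2) = 0) : Rel f α β γ ξ η ζ := by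
  refine ⟨by rw [h2]; ring, by rw [h1, h2]; ring, ?_⟩
  rw [h1, h2]; linear_combination h3

variable {k : Type*} [Field k] [Algebra k G]
theorem Rel.mem1 (h : Rel f α β γ ξ η ζ) (hV : -γ * (α * γ - β ^ 2) - α * β - f ≠ 0) {F : IntermediateField k G}
    (hf : f ∈ F) (ha : α ∈ F) (hb : β ∈ F) (hc : γ ∈ F) : ξ ∈ F ∧ η ∈ F ∧ ζ ∈ F := by
  have h1 : ξ = -(-β * (α * γ - β ^ 2) + f * γ - α ^ 2) / (-γ * (α * γ - β ^ 2) - α * β - f) := by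
    rw [eq_div_iff hV]; linear_combination h.h3
  have h2 : ξ ∈ F := by
    have hD : α * γ - β ^ 2 ∈ F := sub_mem (mul_mem ha hc) (pow_mem hb _)
    rw [h1]
    exact div_mem (neg_mem (sub_mem (add_mem (mul_mem (neg_mem hb) hD) (mul_mem hf hc)) (pow_mem ha _)))
      (sub_mem (sub_mem (mul_mem (neg_mem hc) hD) (mul_mem ha hb)) hf)
  refine ⟨h2, ?_, ?_⟩
  · rw [h.h1]; exact add_mem hb (mul_mem hc h2)
  · rw [h.h2]; exact add_mem ha (mul_mem hb h2)

theorem top_mem {ι : Type*} {a : ι → G} (hg : IntermediateField.adjoin k (Set.range a) = ⊤) {F : IntermediateField k G}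
    (h : ∀ i, a i ∈ F) (z : G) : z ∈ F := by
  have h1 : IntermediateField.adjoin k (Set.range a) ≤ F := by
    rw [IntermediateField.adjoin_le_iff]; rintro _ ⟨i, rfl⟩; exact h i
  rw [hg] at h1; exact h1 trivial

variable {R : ℕ} {T : Option (Fin R) → G}

theorem top_cf {a b c : G} (hg : IntermediateField.adjoin k (Set.range (cf T a b c)) = ⊤) {F : IntermediateField k G}
    (hT : ∀ o, T o ∈ F) (ha : a ∈ F) (hb : b ∈ F) (hc : c ∈ F) (z : G) : z ∈ F :=
  top_mem hg ((cf_forall (fun w => w ∈ F)).2 ⟨hT, ha, hb, hc⟩) z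

theorem rk_T1 (a : G) : rk k (insert a (Set.range T)) ≤ (R + 2 : ℕ) := by
  refine (rk_insert_le _ _).trans ?_
  have h1 := rk_range_le (k := k) T
  rw [card_tw] at h1
  have := add_le_add_left h1 1
  exact_mod_cast this

theorem rk_T2 (a b : G) : rk k (insert a (insert b (Set.range T))) ≤ (R + 3 : ℕ) := by
  refine (rk_insert_le _ _).trans ?_
  have := add_le_add_left (rk_T1 (k := k) (T := T) b) 1
  exact_mod_cast this

theorem no2 {a b c d e : G} (hr : ((R + 4 : ℕ) : ℕ∞) ≤ rk k (Set.univ : Set G))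
    (hg : IntermediateField.adjoin k (Set.range (cf T a b c)) = ⊤) (ha : a ∈ cl k (insert d (insert e (Set.range T))))
    (hb : b ∈ cl k (insert d (insert e (Set.range T)))) (hc : c ∈ cl k (insert d (insert e (Set.range T)))) : False := by
  have h1 : rk k (Set.univ : Set G) ≤ rk k (insert d (insert e (Set.range T))) := by
    apply rk_le_of_subset
    intro z _
    exact top_cf hg (fun o => subset_cl _ (Or.inr (Or.inr ⟨o, rfl⟩))) ha hb hc z
  have h2 := (hr.trans h1).trans (rk_T2 _ _)
  rw [Nat.cast_le] at h2
  omega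

theorem no1 {a b c d : G} (hr : ((R + 3 : ℕ) : ℕ∞) ≤ rk k (Set.univ : Set G))
    (hg : IntermediateField.adjoin k (Set.range (cf T a b c)) = ⊤) (ha : a ∈ cl k (insert d (Set.range T)))
    (hb : b ∈ cl k (insert d (Set.range T))) (hc : c ∈ cl k (insert d (Set.range T))) : False := by
  have h1 : rk k (Set.univ : Set G) ≤ rk k (insert d (Set.range T)) := by
    apply rk_le_of_subset
    intro z _
    exact top_cf hg (fun o => subset_cl _ (Or.inr ⟨o, rfl⟩)) ha hb hc z
  have h2 := (hr.trans h1).trans (rk_T1 _)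
  rw [Nat.cast_le] at h2
  omega

theorem T_indep {a b c : G} (hi : AlgebraicIndependent k (cf T a b c)) : AlgebraicIndependent k T :=
  hi.comp Sum.inl Sum.inl_injective

/-- algebraicity when U = V = 0 -/
theorem UV_cl {S : Set G} (hU : -β * (α * γ - β ^ 2) + f * γ - α ^ 2 = 0)
    (hV : -γ * (α * γ - β ^ 2) - α * β - f = 0) (hf : f ∈ cl k S) (hγ : γ ∈ cl k S) : α ∈ cl k S ∧ β ∈ cl k S := by
  rcases lemUV hU hV with ⟨rfl, h1, h2⟩ | ⟨h0, x, y, h1, h2, h3, h4⟩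
  · have hb : β ∈ cl k S := by
      apply mem_cl_of_pow (n := 5) (by norm_num)
      have : β ^ 5 = f ^ 2 := by rw [h2]; linear_combination -β ^ 2 * h1
      rw [this]; exact pow_mem hf _
    refine ⟨?_, hb⟩
    apply mem_cl_of_pow (n := 2) (by norm_num)
    rw [h1]; exact pow_mem hb _
  · have hx : x ∈ cl k S := by
      apply x_mem_cl h3
      rw [← h4]
      exact mul_mem hf (pow_mem (div_mem (neg_mem (one_mem _)) hγ) _)
    have hy := y_mem_cl h3 hx
    rw [h1, h2]
    exact ⟨mul_mem (add_mem (sub_mem hy hx) (one_mem _)) (pow_mem hγ _), mul_mem (sub_mem hx (one_mem _)) (pow_mem hγ _)⟩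

end r

section c
variable {k : Type*} {L : Type u} [Field k] [Field L] [Algebra k L] [CharZero k] {R : ℕ} {T : Option (Fin R) → L}
  {ξ η ζ : L}

theorem f_mem {G : Type*} [Field G] [Algebra k G] {T : Option (Fin R) → G} {F : IntermediateField k G} (hF : ∀ o, T o ∈ F) :
    1 - twy T 0 ^ 5 ∈ F := sub_mem (one_mem _) (pow_mem (twy_mem hF 0) _)

theorem exists_rel (hi : AlgebraicIndependent k (cf T ξ η ζ)) (hg : IntermediateField.adjoin k (Set.range (cf T ξ η ζ)) = ⊤) :
    ∃ α β γ, Rel (1 - twy T 0 ^ 5) α β γ ξ η ζ ∧ AlgebraicIndependent k (cf T α β γ) ∧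
      IntermediateField.adjoin k (Set.range (cf T α β γ)) = ⊤ := by
  have hr : ((R + 4 : ℕ) : ℕ∞) ≤ rk k (Set.univ : Set L) := by
    rw [← card_cf, ← rk_of_indep hi]; exact rk_mono (Set.subset_univ _)
  set f := 1 - twy T 0 ^ 5 with hf
  have hfm : ∀ S : Set L, Set.range T ⊆ S → f ∈ cl k S := fun S hS =>
    f_mem (fun o => subset_cl _ (hS ⟨o, rfl⟩))
  have hS : f - η * ζ - ξ ^ 2 * ζ - ξ * η ^ 2 ≠ 0 := by
    intro h0
    by_cases h1 : η + ξ ^ 2 = 0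
    · have hx : ξ ∈ cl k (insert ξ (insert ζ (Set.range T))) := subset_cl _ (Or.inl rfl)
      refine no2 hr hg (d := ξ) (e := ζ) hx ?_ (subset_cl _ (Or.inr (Or.inl rfl)))
      rw [show η = - ξ ^ 2 by linear_combination h1]
      exact neg_mem (pow_mem hx _)
    · have hx : ξ ∈ cl k (insert ξ (insert η (Set.range T))) := subset_cl _ (Or.inl rfl)
      have hy : η ∈ cl k (insert ξ (insert η (Set.range T))) := subset_cl _ (Or.inr (Or.inl rfl))
      refine no2 hr hg (d := ξ) (e := η) hx hy ?_
      rw [show ζ = (f - ξ * η ^ 2) / (η + ξ ^ 2) by rw [eq_div_iff h1]; linear_combination -h0]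
      exact div_mem (sub_mem (hfm _ (fun z hz => Or.inr (Or.inr hz))) (mul_mem hx (pow_mem hy _))) (add_mem hy (pow_mem hx _))
  set γ := -(η ^ 3 - ζ ^ 2 + ξ * η * ζ - f * ξ) / (f - η * ζ - ξ ^ 2 * ζ - ξ * η ^ 2) with hγ
  have hrel : Rel f (ζ - η * ξ + γ * ξ ^ 2) (η - γ * ξ) γ ξ η ζ := by
    refine Rel.mk' rfl rfl ?_
    rw [hγ, div_mul_cancel₀ _ hS]; ring
  refine ⟨_, _, γ, hrel, ?_⟩
  set α := ζ - η * ξ + γ * ξ ^ 2 with hα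
  set β := η - γ * ξ with hβ
  have hV : -γ * (α * γ - β ^ 2) - α * β - f ≠ 0 := by
    intro hV
    have hU := hrel.h3
    rw [hV, mul_zero, add_zero] at hU
    have hc : γ ∈ cl k (insert ξ (insert γ (Set.range T))) := subset_cl _ (Or.inr (Or.inl rfl))
    have hx : ξ ∈ cl k (insert ξ (insert γ (Set.range T))) := subset_cl _ (Or.inl rfl)
    obtain ⟨ha, hb⟩ := UV_cl hU hV (hfm (insert ξ (insert γ (Set.range T))) (fun z hz => Or.inr (Or.inr hz))) hc
    refine no2 hr hg (d := ξ) (e := γ) hx ?_ ?_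
    · rw [hrel.h1]; exact add_mem hb (mul_mem hc hx)
    · rw [hrel.h2]; exact add_mem ha (mul_mem hb hx)
  have hgen : IntermediateField.adjoin k (Set.range (cf T α β γ)) = ⊤ := by
    rw [eq_top_iff]
    intro z _
    obtain ⟨m1, m2, m3, m4⟩ := (cf_forall (T := T) (a := α) (b := β) (c := γ) (· ∈ IntermediateField.adjoin k (Set.range (cf T α β γ)))).1
      (fun i => IntermediateField.subset_adjoin _ _ ⟨i, rfl⟩)
    obtain ⟨m5, m6, m7⟩ := hrel.mem1 hV (f_mem m1) m2 m3 m4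
    exact top_cf hg m1 m5 m6 m7 z
  refine ⟨?_, hgen⟩
  apply indep_of_rk
  rw [card_cf]
  refine hr.trans (rk_le_of_subset ?_)
  intro z _
  apply adjoin_le_cl; rw [hgen]; trivial

theorem exists_phi {ι : Type*} {a b : ι → L} (ha : AlgebraicIndependent k a) (hb : AlgebraicIndependent k b)
    (ga : IntermediateField.adjoin k (Set.range a) = ⊤) (gb : IntermediateField.adjoin k (Set.range b) = ⊤) :
    ∃ φ : L ≃ₐ[k] L, ∀ i, φ (a i) = b i := by
  let e1 := (ha.aevalEquivField.trans (IntermediateField.equivOfEq ga)).trans IntermediateField.topEquiv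
  let e2 := (hb.aevalEquivField.trans (IntermediateField.equivOfEq gb)).trans IntermediateField.topEquiv
  have h1 : ∀ i, e1 (algebraMap (MvPolynomial ι k) _ (MvPolynomial.X i)) = a i := by
    intro i
    simp [e1]
  have h2 : ∀ i, e2 (algebraMap (MvPolynomial ι k) _ (MvPolynomial.X i)) = b i := by
    intro i
    simp [e2]
  refine ⟨e1.symm.trans e2, fun i => ?_⟩
  rw [← h1 i, ← h2 i]
  simp

end c
end Cr

namespace Cr
open Polynomial
universe u

section c
variable {k : Type*} {L : Type u} [Field k] [Field L] [Algebra k L]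

theorem Rel.place {G : Type*} [Field G] [Algebra k G] {O : ValuationSubring L} {π : L → G} (h : Place k O π)
    {f α β γ ξ η ζ : L} (r : Rel f α β γ ξ η ζ) (hf : f ∈ O) (hα : α ∈ O) (hβ : β ∈ O) (hγ : γ ∈ O) (hξ : ξ ∈ O) :
    η ∈ O ∧ ζ ∈ O ∧ Rel (π f) (π α) (π β) (π γ) (π ξ) (π η) (π ζ) := by
  have hη : η ∈ O := by rw [r.h1]; exact add_mem hβ (mul_mem hγ hξ)
  have hζ : ζ ∈ O := by rw [r.h2]; exact add_mem hα (mul_mem hβ hξ)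
  refine ⟨hη, hζ, ?_, ?_, ?_⟩
  · rw [r.h1, h.add hβ (mul_mem hγ hξ), h.mul hγ hξ]
  · rw [r.h2, h.add hα (mul_mem hβ hξ), h.mul hβ hξ]
  · have e := r.h3
    lift f to O using hf
    lift α to O using hα
    lift β to O using hβ
    lift γ to O using hγ
    lift ξ to O using hξ
    have e2 : (-β * (α * γ - β ^ 2) + f * γ - α ^ 2) + ξ * (-γ * (α * γ - β ^ 2) - α * β - f) = 0 := by
      apply Subtype.ext; push_cast; exact e
    have e3 := congrArg h.hom e2
    simp only [map_add, map_sub, map_mul, map_neg, map_pow, _root_.map_zero] at e3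
    exact e3

variable [CharZero k] {R : ℕ} {T : Option (Fin R) → L} {ξ η ζ α β γ : L}

theorem res_gen {G : Type*} [Field G] [Algebra k G] {O : ValuationSubring L} {π : L → G} (h : Place k O π)
    (hs : ∀ y, ∃ z ∈ O, π z = y) {ξ η ζ : L}
    (hi : AlgebraicIndependent k (cf T ξ η ζ)) (hg : IntermediateField.adjoin k (Set.range (cf T ξ η ζ)) = ⊤)
    (hD : Dv (Algebra.adjoin k (Set.range (cf T ξ η ζ))) O) :
    IntermediateField.adjoin k (Set.range (cf (fun o => π (T o)) (π ξ) (π η) (π ζ))) = ⊤ := by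
  rw [eq_top_iff]
  intro g _
  obtain ⟨z, hz, rfl⟩ := hs g
  have := h.res_Dv (nice_of hi hg) hD hz
  refine IntermediateField.adjoin.mono _ _ _ ?_ this
  rintro _ ⟨_, ⟨i, rfl⟩, rfl⟩
  exact ⟨i, (cf_comp _ _ _ _ _ _).symm⟩

set_option maxHeartbeats 800000 in
theorem lemC2 (hE : ∀ (G : Type u) [Field G] [Algebra k G], TypeF true R k G → TypeF false R k G → False)
    (hi : AlgebraicIndependent k (cf T ξ η ζ)) (hg : IntermediateField.adjoin k (Set.range (cf T ξ η ζ)) = ⊤)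
    (hi2 : AlgebraicIndependent k (cf T α β γ)) (hg2 : IntermediateField.adjoin k (Set.range (cf T α β γ)) = ⊤)
    (r : Rel (1 - twy T 0 ^ 5) α β γ ξ η ζ) {O : ValuationSubring L}
    (hD : Dv (Algebra.adjoin k (Set.range (cf T ξ η ζ))) O) (hTy : TypO true R k O) :
    Dv (Algebra.adjoin k (Set.range (cf T α β γ))) O := by
  obtain ⟨G, _, _, π, h, hs, hF⟩ := hTy
  have hrk : ((R + 3 : ℕ) : ℕ∞) ≤ rk k (Set.univ : Set G) := by
    obtain ⟨_, _, _, _, _, _, _, _, h⟩ := hF; exact h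
  have hgG := res_gen h hs hi hg hD
  obtain ⟨hTO, hξ, hη, hζ⟩ := (cf_forall (T := T) (a := ξ) (b := η) (c := ζ) (fun z => z ∈ O)).1
    (fun i => hD.1 _ (Algebra.subset_adjoin ⟨i, rfl⟩))
  by_cases hTi : AlgebraicIndependent k (fun o => π (T o))
  swap
  · exfalso
    refine lemRR hF (insert (π ξ) (Set.range fun o => π (T o))) ?_ (π η) (π ζ) ?_
    · refine (rk_insert_le _ _).trans ?_
      have h1 : rk k (Set.range fun o => π (T o)) ≤ (R : ℕ) := by
        by_contra hlt
        push Not at hlt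
        apply hTi
        apply indep_of_rk
        rw [card_tw]
        exact_mod_cast Order.add_one_le_of_lt hlt
      exact_mod_cast add_le_add_left h1 1
    · rw [eq_top_iff]
      intro z _
      refine top_cf hgG (fun o => ?_) ?_ ?_ ?_ z
      · exact IntermediateField.subset_adjoin _ _ (Or.inl (Or.inr ⟨o, rfl⟩))
      · exact IntermediateField.subset_adjoin _ _ (Or.inl (Or.inl rfl))
      · exact IntermediateField.subset_adjoin _ _ (Or.inr (Or.inl rfl))
      · exact IntermediateField.subset_adjoin _ _ (Or.inr (Or.inr rfl))
  obtain ⟨ht1, ht2⟩ := h.twy hTO hTi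
  obtain ⟨hy1, hy2⟩ := ht2 0 (by omega)
  have hyO : twy T 0 ∈ O := (vle O).1 hy1.le
  have hfO : 1 - twy T 0 ^ 5 ∈ O := sub_mem (one_mem _) (pow_mem hyO _)
  have hf : π (1 - twy T 0 ^ 5) = 1 - twy (fun o => π (T o)) 0 ^ 5 := by
    rw [h.sub (one_mem _) (pow_mem hyO _), h.pow hyO, h.map_one, hy2]
  set f := 1 - twy T 0 ^ 5 with hfd
  set T' : Option (Fin R) → G := fun o => π (T o) with hT'
  have hTcl : ∀ S : Set G, Set.range T' ⊆ S → ∀ o, T' o ∈ cl k S := fun S hS o => subset_cl _ (hS ⟨o, rfl⟩)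
  have hfm : ∀ S : Set G, Set.range T' ⊆ S → π f ∈ cl k S := fun S hS => by
    rw [hf]; exact f_mem (hTcl S hS)
  have hSO : f - η * ζ - ξ ^ 2 * ζ - ξ * η ^ 2 ∈ O :=
    sub_mem (sub_mem (sub_mem hfO (mul_mem hη hζ)) (mul_mem (pow_mem hξ _) hζ)) (mul_mem hξ (pow_mem hη _))
  have hπS : π (f - η * ζ - ξ ^ 2 * ζ - ξ * η ^ 2) = π f - π η * π ζ - π ξ ^ 2 * π ζ - π ξ * π η ^ 2 := by
    rw [h.sub, h.sub, h.sub, h.mul, h.mul, h.mul, h.pow, h.pow]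
    all_goals
      first
      | exact hfO | exact hξ | exact hη | exact hζ | exact pow_mem hξ _ | exact pow_mem hη _
      | exact mul_mem hη hζ | exact mul_mem (pow_mem hξ _) hζ | exact mul_mem hξ (pow_mem hη _)
      | exact sub_mem hfO (mul_mem hη hζ) | exact sub_mem (sub_mem hfO (mul_mem hη hζ)) (mul_mem (pow_mem hξ _) hζ)
  by_cases hS0 : π f - π η * π ζ - π ξ ^ 2 * π ζ - π ξ * π η ^ 2 = 0
  · exfalso
    by_cases h1 : π η + π ξ ^ 2 = 0
    · have hx : π ξ ∈ cl k (insert (π ζ) (Set.range T')) := by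
        apply mem_cl_of_pow (n := 5) (by norm_num)
        have e1 : π η = - π ξ ^ 2 := by linear_combination h1
        have : π ξ ^ 5 = π f := by rw [e1] at hS0; linear_combination -hS0
        rw [this]
        exact hfm _ (fun z hz => Or.inr hz)
      refine no1 hrk hgG (d := π ζ) hx ?_ (subset_cl _ (Or.inl rfl))
      rw [show π η = - π ξ ^ 2 by linear_combination h1]
      exact neg_mem (pow_mem hx _)
    · refine lemRR hF (Set.range T') (by have := rk_range_le (k := k) T'; rwa [card_tw] at this) (π ξ) (π η) ?_
      rw [eq_top_iff]
      intro z _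
      have hT2 : ∀ o, T' o ∈ IntermediateField.adjoin k (Set.range T' ∪ {π ξ, π η}) := fun o =>
        IntermediateField.subset_adjoin _ _ (Or.inl ⟨o, rfl⟩)
      have hx : π ξ ∈ IntermediateField.adjoin k (Set.range T' ∪ {π ξ, π η}) :=
        IntermediateField.subset_adjoin _ _ (Or.inr (Or.inl rfl))
      have hy : π η ∈ IntermediateField.adjoin k (Set.range T' ∪ {π ξ, π η}) :=
        IntermediateField.subset_adjoin _ _ (Or.inr (Or.inr rfl))
      refine top_cf hgG hT2 hx hy ?_ z
      rw [show π ζ = (π f - π ξ * π η ^ 2) / (π η + π ξ ^ 2) by rw [eq_div_iff h1]; linear_combination -hS0, hf]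
      exact div_mem (sub_mem (f_mem hT2) (mul_mem hx (pow_mem hy _))) (add_mem hy (pow_mem hx _))
  have hS1 : O.valuation (f - η * ζ - ξ ^ 2 * ζ - ξ * η ^ 2) = 1 := h.v1 hSO (by rw [hπS]; exact hS0)
  have hSne : f - η * ζ - ξ ^ 2 * ζ - ξ * η ^ 2 ≠ 0 := fun h0 => by rw [h0] at hS1; simp at hS1
  have hγ : γ ∈ O := by
    rw [show γ = -(η ^ 3 - ζ ^ 2 + ξ * η * ζ - f * ξ) * (f - η * ζ - ξ ^ 2 * ζ - ξ * η ^ 2)⁻¹ by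
      rw [← div_eq_mul_inv, eq_div_iff hSne]; linear_combination r.c]
    exact mul_mem (neg_mem (sub_mem (add_mem (sub_mem (pow_mem hη _) (pow_mem hζ _)) (mul_mem (mul_mem hξ hη) hζ)) (mul_mem hfO hξ)))
      (inv_mem_of_v1 O hS1)
  have hβ : β ∈ O := by rw [r.b]; exact sub_mem hη (mul_mem hγ hξ)
  have hα : α ∈ O := by rw [r.a]; exact add_mem (sub_mem hζ (mul_mem hη hξ)) (mul_mem hγ (pow_mem hξ _))
  obtain ⟨-, -, rG⟩ := r.place h hfO hα hβ hγ hξ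
  by_cases hV : -π γ * (π α * π γ - π β ^ 2) - π α * π β - π f = 0
  · exfalso
    have hU := rG.h3
    rw [hV, mul_zero, add_zero] at hU
    rcases lemUV hU hV with ⟨h0, h1, h2⟩ | ⟨h0, x, y, h1, h2, h3, h4⟩
    · have hx : π ξ ∈ cl k (insert (π ξ) (Set.range T')) := subset_cl _ (Or.inl rfl)
      have hc : π γ ∈ cl k (insert (π ξ) (Set.range T')) := by rw [h0]; exact zero_mem _
      obtain ⟨ha, hb⟩ := UV_cl hU hV (hfm (insert (π ξ) (Set.range T')) (fun z hz => Or.inr hz)) hc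
      refine no1 hrk hgG (d := π ξ) hx ?_ ?_
      · rw [rG.h1]; exact add_mem hb (mul_mem hc hx)
      · rw [rG.h2]; exact add_mem ha (mul_mem hb hx)
    · refine hE G hF ⟨twx T', twy T', x, y, -1 / π γ, π ξ, ⟨twy_tower hTi, twy_ne hTi, twy_pow_ne hTi,
        div_ne_zero (by simp) h0, h3, by rw [← hf]; exact h4⟩, ?_, hrk⟩
      rw [tw_eq, eq_top_iff]
      intro z _
      set M := IntermediateField.adjoin k (Set.range T' ∪ {x, y, -1 / π γ, π ξ}) with hM
      have m1 : x ∈ M := IntermediateField.subset_adjoin _ _ (Or.inr (Or.inl rfl))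
      have m2 : y ∈ M := IntermediateField.subset_adjoin _ _ (Or.inr (Or.inr (Or.inl rfl)))
      have m3 : -1 / π γ ∈ M := IntermediateField.subset_adjoin _ _ (Or.inr (Or.inr (Or.inr (Or.inl rfl))))
      have m4 : π ξ ∈ M := IntermediateField.subset_adjoin _ _ (Or.inr (Or.inr (Or.inr (Or.inr rfl))))
      have m5 : π γ ∈ M := by
        have := div_mem (neg_mem (one_mem M)) m3
        rwa [show -1 / (-1 / π γ) = π γ by field_simp] at this
      have m6 : π α ∈ M := by rw [h1]; exact mul_mem (add_mem (sub_mem m2 m1) (one_mem _)) (pow_mem m5 _)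
      have m7 : π β ∈ M := by rw [h2]; exact mul_mem (sub_mem m1 (one_mem _)) (pow_mem m5 _)
      refine top_cf hgG (fun o => IntermediateField.subset_adjoin _ _ (Or.inl ⟨o, rfl⟩)) m4 ?_ ?_ z
      · rw [rG.h1]; exact add_mem m7 (mul_mem m5 m4)
      · rw [rG.h2]; exact add_mem m6 (mul_mem m7 m4)
  · refine h.dv hi2 hg2 ((cf_forall (fun z => z ∈ O)).2 ⟨hTO, hα, hβ, hγ⟩) hD.ne_top (m := R + 3) (card_cf R) ?_
    refine hrk.trans (rk_le_of_subset ?_)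
    intro z _
    apply adjoin_le_cl
    have e : (fun i => π (cf T α β γ i)) = cf T' (π α) (π β) (π γ) := funext fun i => cf_comp _ _ _ _ _ _
    rw [e]
    set M := IntermediateField.adjoin k (Set.range (cf T' (π α) (π β) (π γ))) with hM
    obtain ⟨m1, m2, m3, m4⟩ := (cf_forall (T := T') (a := π α) (b := π β) (c := π γ) (fun z => z ∈ M)).1
      (fun i => IntermediateField.subset_adjoin _ _ ⟨i, rfl⟩)
    obtain ⟨m5, m6, m7⟩ := rG.mem1 hV (by rw [hf]; exact f_mem m1) m2 m3 m4
    exact top_cf hgG m1 m5 m6 m7 z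

end c
end Cr

namespace Cr
open Polynomial
universe u

section c
variable {k : Type*} {L : Type u} [Field k] [Field L] [Algebra k L] [CharZero k] {R : ℕ} {T : Option (Fin R) → L} {ξ η ζ α β γ : L}

set_option maxHeartbeats 800000 in
theorem exists_G (hi : AlgebraicIndependent k (cf T ξ η ζ)) :
    ∃ (G : Type u) (_ : Field G) (_ : Algebra k G) (T' : Option (Fin R) → G) (x y u s : G),
      AlgebraicIndependent k T' ∧ TE true R (twx T') (twy T') x y u ∧
      IntermediateField.adjoin k (Set.range T' ∪ {x, y, u, s}) = ⊤ ∧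
      rk k (Set.univ : Set G) = (R + 3 : ℕ) := by
  let Λ := AlgebraicClosure L
  have inj : Function.Injective (IsScalarTower.toAlgHom k L Λ) := (IsScalarTower.toAlgHom k L Λ).toRingHom.injective
  have hiΛ : AlgebraicIndependent k (fun i => IsScalarTower.toAlgHom k L Λ (cf T ξ η ζ i)) := hi.map' inj
  set j := IsScalarTower.toAlgHom k L Λ with hj
  have hx0 : (j ξ) ≠ 0 := hiΛ.ne_zero (Sum.inr 0)
  have hTΛ : AlgebraicIndependent k (fun o => j (T o)) := hiΛ.comp Sum.inl Sum.inl_injective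
  obtain ⟨y, hy⟩ := IsAlgClosed.exists_root (X ^ 2 + X - C ((j ξ) ^ 3 - (j ξ) ^ 2) : Polynomial Λ) (by
    rw [show (X ^ 2 + X - C ((j ξ) ^ 3 - (j ξ) ^ 2) : Polynomial Λ) = C 1 * X ^ 2 + C 1 * X + C (-((j ξ) ^ 3 - (j ξ) ^ 2)) by
      simp; ring, degree_quadratic one_ne_zero]; decide)
  have hcur : y ^ 2 + y = (j ξ) ^ 3 - (j ξ) ^ 2 := by
    simp [IsRoot] at hy; linear_combination hy
  have hg : gg true (j ξ) y ≠ 0 := by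
    intro h0
    apply hx0
    have : (j ξ) ^ 5 = 0 := by
      have e : gg true (j ξ) y * ((j ξ) * (-y-1) + (j ξ) ^ 2 + (-y-1)) = - (j ξ) ^ 5 := by
        simp only [gg, if_true, cond_true]
        linear_combination (-(j ξ)^2 - 2*(j ξ) - 1) * hcur
      rw [h0, zero_mul] at e
      linear_combination e
    exact eq_zero_of_pow_eq_zero this |> fun h => h
  have hf : (1 - twy (fun o => j (T o)) 0 ^ 5) ≠ 0 := sub_ne_zero.2 (twy_pow_ne hTΛ).symm
  obtain ⟨u, hu⟩ := IsAlgClosed.exists_pow_nat_eq (gg true (j ξ) y / (1 - twy (fun o => j (T o)) 0 ^ 5)) (n := 5) (by norm_num)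
  have hu' : (1 - twy (fun o => j (T o)) 0 ^ 5) * u ^ 5 = gg true (j ξ) y := by rw [hu]; exact mul_div_cancel₀ _ hf
  have hu0 : u ≠ 0 := by rintro rfl; apply hg; rw [← hu']; simp
  set S : Set Λ := (Set.range fun o => j (T o)) ∪ {j ξ, y, u, j η} with hS
  set M := IntermediateField.adjoin k S with hM
  have mT : ∀ o, j (T o) ∈ M := fun o => IntermediateField.subset_adjoin _ _ (Or.inl ⟨o, rfl⟩)
  have mx : j ξ ∈ M := IntermediateField.subset_adjoin _ _ (Or.inr (Or.inl rfl))
  have my : y ∈ M := IntermediateField.subset_adjoin _ _ (Or.inr (Or.inr (Or.inl rfl)))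
  have mu : u ∈ M := IntermediateField.subset_adjoin _ _ (Or.inr (Or.inr (Or.inr (Or.inl rfl))))
  have ms : j η ∈ M := IntermediateField.subset_adjoin _ _ (Or.inr (Or.inr (Or.inr (Or.inr rfl))))
  let T' : Option (Fin R) → M := fun o => ⟨j (T o), mT o⟩
  let x' : M := ⟨j ξ, mx⟩
  let y' : M := ⟨y, my⟩
  let u' : M := ⟨u, mu⟩
  let s' : M := ⟨j η, ms⟩
  have hTM : AlgebraicIndependent k T' := AlgebraicIndependent.of_comp M.val hTΛ
  have hte : TE true R (twx T') (twy T') x' y' u' := by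
    refine ⟨twy_tower hTM, twy_ne hTM, twy_pow_ne hTM, fun h => hu0 (congrArg M.val h), ?_, ?_⟩
    · apply Subtype.ext; push_cast; exact hcur
    · apply M.val.toRingHom.injective
      have e1 : M.val (twy T' 0) = twy (fun o => j (T o)) 0 := (twy_map (T := T') (M.val : M →+* Λ) 0).symm
      have e2 : M.val (gg true x' y') = gg true (j ξ) y := by
        simp only [gg, cond_true, map_add, map_mul, map_pow]; rfl
      change M.val _ = M.val _
      rw [e2, map_mul, map_sub, map_pow, map_pow, e1, map_one]
      exact hu'
  have hgen : IntermediateField.adjoin k (Set.range T' ∪ {x', y', u', s'}) = ⊤ := by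
    have e : S = M.val '' (Set.range T' ∪ {x', y', u', s'}) := by
      rw [Set.image_union, ← Set.range_comp, Set.image_insert_eq, Set.image_insert_eq, Set.image_insert_eq, Set.image_singleton]
      rfl
    apply IntermediateField.map_injective M.val
    rw [IntermediateField.adjoin_map, ← e, ← AlgHom.fieldRange_eq_map, IntermediateField.fieldRange_val]
  refine ⟨M, inferInstance, inferInstance, T', x', y', u', s', hTM, hte, hgen, le_antisymm ?_ ?_⟩
  · refine (rk_le_of_subset (T := insert s' (insert x' (Set.range T'))) ?_).trans (rk_T2 _ _)
    intro z _
    have hTc : ∀ o, T' o ∈ cl k (insert s' (insert x' (Set.range T'))) := fun o => subset_cl _ (Or.inr (Or.inr ⟨o, rfl⟩))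
    have hxc : x' ∈ cl k (insert s' (insert x' (Set.range T'))) := subset_cl _ (Or.inr (Or.inl rfl))
    obtain ⟨h1, h2⟩ := hte.mem_cl (k := k) (S := insert s' (insert x' (Set.range T'))) (by
      rintro (_ | o)
      · exact hxc
      · have := hTc o
        rw [← congrFun (tw_eq (T := T')) o] at this
        exact this)
    have h3 : IntermediateField.adjoin k (Set.range T' ∪ {x', y', u', s'}) ≤ cl k (insert s' (insert x' (Set.range T'))) := by
      rw [IntermediateField.adjoin_le_iff]
      rintro z (⟨o, rfl⟩ | rfl | rfl | rfl | rfl)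
      · exact hTc o
      · exact hxc
      · exact h1
      · exact h2
      · exact subset_cl _ (Or.inl rfl)
    rw [hgen] at h3
    exact h3 trivial
  · let g : Option (Fin R) ⊕ Fin 2 → M := Sum.elim T' ![x', s']
    have hgi : AlgebraicIndependent k g := by
      apply AlgebraicIndependent.of_comp M.val
      have h1 := hiΛ.comp (Sum.map id (Fin.castSucc : Fin 2 → Fin 3)) (Function.Injective.sumMap Function.injective_id (Fin.castSucc_injective _))
      convert h1 using 1
      funext i
      rcases i with o | i
      · rfl
      · fin_cases i <;> rfl
    have := rk_of_indep hgi
    have h2 : Fintype.card (Option (Fin R) ⊕ Fin 2) = R + 3 := by simp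
    rw [h2] at this
    rw [← this]; exact rk_mono (Set.subset_univ _)

theorem mem_cl_quad {G : Type*} [Field G] [Algebra k G] {S : Set G} {a b c s : G} (ha : a ∈ cl k S) (hb : b ∈ cl k S) (hc : c ∈ cl k S)
    (h0 : a ≠ 0) (h : a * s ^ 2 + b * s + c = 0) : s ∈ cl k S := by
  refine mem_cl_of_root (C ⟨a, ha⟩ * X ^ 2 + C ⟨b, hb⟩ * X + C ⟨c, hc⟩) ?_ ?_
  · intro h1
    have := congrArg (fun p => p.coeff 2) h1
    simp at this
    exact h0 (congrArg Subtype.val this)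
  · simpa using h

set_option maxHeartbeats 1600000 in
theorem lemC1 (hi : AlgebraicIndependent k (cf T ξ η ζ)) (hg : IntermediateField.adjoin k (Set.range (cf T ξ η ζ)) = ⊤)
    (hi2 : AlgebraicIndependent k (cf T α β γ)) (hg2 : IntermediateField.adjoin k (Set.range (cf T α β γ)) = ⊤)
    (r : Rel (1 - twy T 0 ^ 5) α β γ ξ η ζ) : ∃ O : ValuationSubring L, TypO true R k O ∧
      Dv (Algebra.adjoin k (Set.range (cf T α β γ))) O ∧ ¬ Dv (Algebra.adjoin k (Set.range (cf T ξ η ζ))) O := by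
  classical
  obtain ⟨G, _, _, T', x, y, u, s, hT', hte, hgen, hrk⟩ := exists_G hi
  have := charZero_of_injective_algebraMap (algebraMap k G).injective
  set f' := 1 - twy T' 0 ^ 5 with hf'
  have hu0 := hte.une
  have hcur := hte.curve
  have hcov : f' * u ^ 5 = x * y + x ^ 2 + y := by have := hte.cover; simpa [gg] using this
  set ξ' := 1 / u with hξ'
  have hξ0 : ξ' ≠ 0 := by rw [hξ']; exact div_ne_zero one_ne_zero hu0
  have hcov' : f' = (x * y + x ^ 2 + y) * ξ' ^ 5 := by rw [hξ', ← hcov]; field_simp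
  obtain ⟨hyc, huc⟩ := hte.mem_cl (k := k) (S := insert x (Set.range T')) (by
      rintro (_ | o)
      · exact subset_cl _ (Or.inl rfl)
      · have : T' o ∈ cl k (insert x (Set.range T')) := subset_cl _ (Or.inr ⟨o, rfl⟩)
        rw [← congrFun (tw_eq (T := T')) o] at this
        exact this)
  have hxc : x ∈ cl k (insert x (Set.range T')) := subset_cl _ (Or.inl rfl)
  have hξc : ξ' ∈ cl k (insert x (Set.range T')) := div_mem (one_mem _) huc
  have hfc : f' ∈ cl k (insert x (Set.range T')) := f_mem (fun o => subset_cl _ (Or.inr ⟨o, rfl⟩))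
  have small : ∀ S : Set G, x ∈ cl k S → s ∈ cl k S → (∀ o, T' o ∈ cl k S) → ∀ z, z ∈ cl k S := by
    intro S h1 h2 h3 z
    obtain ⟨h4, h5⟩ := hte.mem_cl (k := k) (S := S) (by
      rintro (_ | o)
      · exact h1
      · have := h3 o
        rw [← congrFun (tw_eq (T := T')) o] at this
        exact this)
    have h6 : IntermediateField.adjoin k (Set.range T' ∪ {x, y, u, s}) ≤ cl k S := by
      rw [IntermediateField.adjoin_le_iff]
      rintro z (⟨o, rfl⟩ | rfl | rfl | rfl | rfl)
      exacts [h3 o, h1, h4, h5, h2]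
    rw [hgen] at h6
    exact h6 trivial
  have hbig : ∀ a, ¬ ∀ z, z ∈ cl k (insert a (Set.range T')) := by
    intro a ha
    have h1 := (rk_le_of_subset (k := k) (S := (Set.univ : Set G)) fun z _ => ha z).trans (rk_T1 _)
    rw [hrk, Nat.cast_le] at h1
    omega
  have hxy : x + y - 1 ≠ 0 := by
    intro h0
    have hx : x ∈ cl k (insert s (Set.range T')) := by
      refine mem_cl_of_root (X ^ 3 - 2 * X ^ 2 + 3 * X - 2) ?_ ?_
      · intro h1
        have := congrArg (fun p => p.coeff 3) h1
        have e2 : (2 : (cl k (insert s (Set.range T')))[X]) = C 2 := rfl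
        have e3 : (3 : (cl k (insert s (Set.range T')))[X]) = C 3 := rfl
        simp only [e2, e3, coeff_sub, coeff_add, coeff_C_mul, coeff_X_pow, coeff_X, coeff_C, coeff_zero] at this
        norm_num at this
      · have e1 : y = 1 - x := by linear_combination h0
        rw [e1] at hcur
        simp only [map_add, map_sub, map_mul, map_pow, map_ofNat, aeval_X]
        linear_combination -hcur
    exact hbig s (small _ hx (subset_cl _ (Or.inl rfl)) fun o => subset_cl _ (Or.inr ⟨o, rfl⟩))
  have hs : s ∉ cl k (insert x (Set.range T')) := fun h =>
    hbig x (small _ hxc h fun o => subset_cl _ (Or.inr ⟨o, rfl⟩))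
  set η' := x * ξ' ^ 2 with hη'
  set ζ' := y * ξ' ^ 3 with hζ'
  set α' := ζ' - η' * ξ' + s * ξ' ^ 2 with hα'
  set β' := η' - s * ξ' with hβ'
  have hηc : η' ∈ cl k (insert x (Set.range T')) := mul_mem hxc (pow_mem hξc _)
  have hζc : ζ' ∈ cl k (insert x (Set.range T')) := mul_mem hyc (pow_mem hξc _)
  have rG : Rel f' α' β' s ξ' η' ζ' := by
    apply Rel.mk' rfl rfl
    rw [hcov', hη', hζ']
    linear_combination (-ξ' ^ 6) * hcur
  have hV : -s * (α' * s - β' ^ 2) - α' * β' - f' ≠ 0 := by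
    intro h0
    apply hs
    refine mem_cl_quad (a := ξ' ^ 3 - ζ' - η' * ξ') (b := η' ^ 2 + (ζ' - η' * ξ') * ξ' - η' * ξ' ^ 2) (c := - (ζ' - η' * ξ') * η' - f') ?_ ?_ ?_ ?_ ?_
    · exact sub_mem (sub_mem (pow_mem hξc _) hζc) (mul_mem hηc hξc)
    · exact sub_mem (add_mem (pow_mem hηc _) (mul_mem (sub_mem hζc (mul_mem hηc hξc)) hξc)) (mul_mem hηc (pow_mem hξc _))
    · exact sub_mem (mul_mem (neg_mem (sub_mem hζc (mul_mem hηc hξc))) hηc) hfc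
    · rw [show ξ' ^ 3 - ζ' - η' * ξ' = -(ξ' ^ 3 * (x + y - 1)) by rw [hη', hζ']; ring]
      exact neg_ne_zero.2 (mul_ne_zero (pow_ne_zero _ hξ0) hxy)
    · rw [← h0, hα', hβ']; ring
  have hgG : IntermediateField.adjoin k (Set.range (cf T' α' β' s)) = ⊤ := by
    rw [eq_top_iff]
    set M := IntermediateField.adjoin k (Set.range (cf T' α' β' s)) with hM
    obtain ⟨m1, m2, m3, m4⟩ := (cf_forall (T := T') (a := α') (b := β') (c := s) (fun z => z ∈ M)).1
      (fun i => IntermediateField.subset_adjoin _ _ ⟨i, rfl⟩)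
    obtain ⟨m5, m6, m7⟩ := rG.mem1 hV (f_mem m1) m2 m3 m4
    rw [← hgen, IntermediateField.adjoin_le_iff]
    rintro z (⟨o, rfl⟩ | rfl | rfl | rfl | rfl)
    · exact m1 o
    · have := div_mem m6 (pow_mem m5 2)
      rwa [hη', mul_div_cancel_right₀ _ (pow_ne_zero _ hξ0)] at this
    · have := div_mem m7 (pow_mem m5 3)
      rwa [hζ', mul_div_cancel_right₀ _ (pow_ne_zero _ hξ0)] at this
    · have := inv_mem m5
      rwa [hξ', one_div, inv_inv] at this
    · exact m4
  obtain ⟨O, π, h, hD, hπ, hsurj⟩ := exists_place hi2 hg2 (cf T' α' β' s) hgG (m := R + 3) (card_cf R) (by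
    rw [← hrk, ← rk_cl, ← cl_adjoin, hgG, rk_cl]; rfl)
  have hπ' : ∀ i, cf (fun o => π (T o)) (π α) (π β) (π γ) i = cf T' α' β' s i := fun i => by
    rw [← cf_comp, hπ i]
  have eT : (fun o => π (T o)) = T' := funext fun o => hπ' (Sum.inl o)
  have eα : π α = α' := hπ' (Sum.inr 0)
  have eβ : π β = β' := hπ' (Sum.inr 1)
  have eγ : π γ = s := hπ' (Sum.inr 2)
  obtain ⟨hTO, hα, hβ, hγ⟩ := (cf_forall (T := T) (a := α) (b := β) (c := γ) (fun z => z ∈ O)).1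
    (fun i => hD.1 _ (Algebra.subset_adjoin ⟨i, rfl⟩))
  obtain ⟨ht1, ht2⟩ := h.twy hTO (by rw [eT]; exact hT')
  obtain ⟨hy1, hy2⟩ := ht2 0 (by omega)
  have hyO : twy T 0 ∈ O := (vle O).1 hy1.le
  have hfO : 1 - twy T 0 ^ 5 ∈ O := sub_mem (one_mem _) (pow_mem hyO _)
  have hf : π (1 - twy T 0 ^ 5) = f' := by
    rw [h.sub (one_mem _) (pow_mem hyO _), h.pow hyO, h.map_one, hy2, eT]
  refine ⟨O, ⟨G, _, _, π, h, hsurj, twx T', twy T', x, y, u, s, hte, by rw [tw_eq]; exact hgen, hrk.ge⟩, hD, fun hD1 => ?_⟩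
  have hξ : ξ ∈ O := hD1.1 _ (Algebra.subset_adjoin ⟨Sum.inr 0, rfl⟩)
  obtain ⟨hη, hζ, r2⟩ := r.place h hfO hα hβ hγ hξ
  rw [hf, eα, eβ, eγ] at r2
  have e1 : π ξ = ξ' := by
    have h1 := r2.h3
    have h2 := rG.h3
    have h3 : (π ξ - ξ') * (-s * (α' * s - β' ^ 2) - α' * β' - f') = 0 := by linear_combination h1 - h2
    rcases mul_eq_zero.1 h3 with h4 | h4
    · exact sub_eq_zero.1 h4
    · exact absurd h4 hV
  have e2 : π η = η' := by rw [r2.h1, rG.h1, e1]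
  have e3 : π ζ = ζ' := by rw [r2.h2, rG.h2, e1]
  have hgG2 := res_gen h hsurj hi hg hD1
  rw [eT, e1, e2, e3] at hgG2
  exact no1 hrk.ge hgG2 (d := x) hξc hηc hζc

end c
end Cr

namespace Cr

/-- the affine equations of the degree five model -/
structure Q5 {F : Type*} [Field F] (a b c d : F) : Prop where
  r1 : a * b = 1 + c * d
  r2 : b ^ 2 = c + a * d
  r3 : c ^ 2 = a + b * d
  r4 : a * c = d ^ 2 + b
  r5 : a ^ 2 = b * c - d

def X0 {F : Type*} [Field F] (a b c d : F) : F := 5*a*d+a+5*b*c+5*b*d+4*b+5*c*d+3*c+5*d^2-3*d+5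
def W0 {F : Type*} [Field F] (a b c d : F) : F :=
  25*a*d^2+15*a*d+13*a+25*b*c*d+10*b*c+25*b*d^2+30*b*d+8*b+25*c*d^2+25*c*d+17*c+25*d^3-5*d^2+17*d

section q
variable {F : Type*} [Field F] {a b c d : F}

theorem Q5.weier (h : Q5 a b c d) : (W0 a b c d) ^ 2 + 25 * W0 a b c d = (X0 a b c d) ^ 3 - 7 * (X0 a b c d) ^ 2 + 6 * X0 a b c d - 168 := by
  rw [X0, W0]
  linear_combination ((-125)*a*d^3 + (-75)*a*d^2 + (-15)*a*d + (-1)*a + (-375)*b*c*d^2 + (-150)*b*c*d + (-15)*b*c + (-375)*b*d^3 + (-450)*b*d^2 + (-135)*b*d + (-12)*b + (-375)*c*d^3 + (-375)*c*d^2 + (-105)*c*d + (-9)*c + (250)*d^4 + (825)*d^3 + (750)*d^2 + (319)*d + (161)) * h.r5 + ((-375)*b*c^2*d + (-75)*b*c^2 + (-750)*b*c*d^2 + (-750)*b*c*d + (-120)*b*c + (-375)*b*d^3 + (-675)*b*d^2 + (-360)*b*d + (-48)*b + (-125)*c^3*d + (-1125)*c^2*d^2 + (-900)*c^2*d + (-215)*c^2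 + (-750)*c*d^3 + (-1075)*c*d^2 + (-1085)*c*d + (-328)*c + (375)*d^4 + (525)*d^3 + (390)*d^2 + (-297)*d + (-188)) * h.r1 + ((-375)*c^2*d^2 + (-225)*c^2*d + (-1250)*c*d^3 + (-1250)*c*d^2 + (-1075)*c*d + (-252)*c + (-500)*d^4 + (275)*d^3 + (-90)*d^2 + (-497)*d + (-108)) * h.r4 + ((-125)*b*c^3 + (-375)*b*c^2*d + (-300)*b*c^2 + (-375)*b*c*d^2 + (-600)*b*c*d + (-240)*b*c + (-125)*b*d^3 + (-300)*b*d^2 + (-240)*b*d + (-64)*b + (-375)*c^3*d + (-225)*c^3 + (-875)*c^2*d^2 + (-600)*c^2*d + (-475)*c^2 + (-1000)*c*d^3 + (-325)*c*d^2 + (-210)*c*d + (-316)*c + (-875)*d^4 + (-125)*d^3 + (295)*d^2 + (-28)*d + (-64)) * h.r2 + ((-125)*b*c^2 + (-750)*b*c*d^2 + (-900)*b*c*d + (-435)*b*c + (-1125)*b*d^3 + (-1250)*b*d^2 + (-925)*b*d + (-332)*b + (-125)*c^2*d^2 + (-375)*c^2*d + (-225)*c^2 + (-1250)*c*d^3 +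 (-2000)*c*d^2 + (-1075)*c*d + (-502)*c + (-875)*d^4 + (-1275)*d^3 + (-1125)*d^2 + (-747)*d + (-314)) * h.r3

theorem Q5.psi_a (h : Q5 a b c d) : (5 * (X0 a b c d) ^ 2 - 15 * (X0 a b c d) - 19) * a = (X0 a b c d)*(W0 a b c d)-(X0 a b c d)^2+4*(W0 a b c d)+32*(X0 a b c d)+23 := by
  rw [X0, W0]
  linear_combination ((125)*a*d^2 + (50)*a*d + (5)*a + (250)*b*c*d + (50)*b*c + (250)*b*d^2 + (250)*b*d + (40)*b + (250)*c*d^2 + (200)*c*d + (30)*c + (125)*d^3 + (-175)*d^2 + (75)*d + (23)) * h.r5 + ((125)*b*c^2 + (250)*b*c*d + (200)*b*c + (125)*b*d^2 + (200)*b*d + (80)*b + (250)*c^2*d + (150)*c^2 + (375)*c*d^2 + (275)*c*d + (235)*c + (110)*d + (158)) * h.r1 + ((250)*c*d^2 + (175)*c*d + (45)*c + (125)*d^3 + (180)*d + (80)) * h.r4 + ((125)*c^2*d + (25)*c^2 + (125)*c*d^2 + (125)*d^3 + (-25)*d^2 + (-50)*d + (-16)) * h.r2 + ((125)*b*c*d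 + (250)*b*d^2 + (200)*b*d + (70)*b + (250)*c*d^2 + (275)*c*d + (25)*c + (250)*d^3 + (225)*d^2 + (355)*d + (108)) * h.r3

theorem Q5.psi_b (h : Q5 a b c d) : (5 * (X0 a b c d) ^ 2 - 15 * (X0 a b c d) - 19) * b = (X0 a b c d)*(W0 a b c d)+(X0 a b c d)^2+4*(W0 a b c d)-7*(X0 a b c d)+77 := by
  rw [X0, W0]
  linear_combination ((125)*b*d^2 + (50)*b*d + (5)*b + (-125)*d^3 + (-125)*d^2 + (-90)*d + (-14)) * h.r5 + ((250)*b*c*d + (50)*b*c + (250)*b*d^2 + (250)*b*d + (40)*b + (125)*c^2*d + (250)*c*d^2 + (200)*c*d + (70)*c + (125)*d^3 + (-175)*d^2 + (130)*d + (67)) * h.r1 + ((125)*c*d^2 + (75)*c*d + (125)*d^3 + (-200)*d^2 + (45)*d + (13)) * h.r4 + ((125)*b*c^2 + (250)*b*c*d + (200)*b*c + (125)*b*d^2 + (200)*b*d + (80)*b + (125)*c^2*d + (75)*c^2 + (375)*c*d^2 + (25)*c*d + (180)*c + (250)*d^3 + (-75)*d^2 + (-45)*d + (92)) * h.r2 +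 ((125)*b*c + (125)*b*d^2 + (150)*b*d + (100)*b + (125)*c*d^2 + (125)*c*d + (75)*c + (125)*d^3 + (350)*d^2 + (30)*d + (120)) * h.r3

theorem Q5.psi_c (h : Q5 a b c d) : (5 * (X0 a b c d) ^ 2 - 15 * (X0 a b c d) - 19) * c = (X0 a b c d)*(W0 a b c d)+2*(X0 a b c d)^2-7*(W0 a b c d)+12*(X0 a b c d)-61 := by
  rw [X0, W0]
  linear_combination ((125)*c*d^2 + (50)*c*d + (5)*c + (-125)*d^3 + (-150)*d^2 + (-100)*d + (-15)) * h.r5 + ((250)*c^2*d + (50)*c^2 + (250)*c*d + (95)*c + (-250)*d^3 + (-75)*d^2 + (-145)*d + (49)) * h.r1 + ((125)*c^2*d + (375)*c*d^2 + (300)*c*d + (155)*c + (125)*d^3 + (-175)*d^2 + (90)*d + (112)) * h.r4 + ((125)*c^3 + (125)*c^2*d + (100)*c^2 + (125)*c*d^2 + (-50)*c*d + (-80)*c + (250)*d^3 + (-150)*d^2 + (-115)*d + (-64)) * h.r2 + ((250)*b*c*d + (150)*b*c + (375)*b*d^2 + (150)*b*d + (125)*b + (125)*c^2 + (375)*c*d^2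 + (325)*c*d + (145)*c + (250)*d^3 + (125)*d^2 + (160)*d + (6)) * h.r3

theorem Q5.psi_d (h : Q5 a b c d) : (5 * (X0 a b c d) ^ 2 - 15 * (X0 a b c d) - 19) * d = (X0 a b c d)*(W0 a b c d)-2*(X0 a b c d)^2-7*(W0 a b c d)+13*(X0 a b c d)-114 := by
  rw [X0, W0]
  linear_combination ((-55)*d + (-11)) * h.r5 + ((-55)*c + (-55)*d + (-99)) * h.r1 + ((-110)*d + (-44)) * h.r4 + ((-55)*d) * h.r2 + ((-55)*b + (-110)*d + (-33)) * h.r3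

theorem Q5.tw (h : Q5 a b c d) {ζ : F} (hζ : ζ ^ 5 = 1) : Q5 (ζ ^ 4 * a) (ζ * b) (ζ ^ 2 * c) (ζ ^ 3 * d) := by
  refine ⟨?_, ?_, ?_, ?_, ?_⟩
  · linear_combination h.r1 + (a * b - c * d) * hζ
  · linear_combination ζ ^ 2 * h.r2 - ζ ^ 2 * a * d * hζ
  · linear_combination ζ ^ 4 * h.r3
  · linear_combination ζ * h.r4 + (ζ * a * c - ζ * d ^ 2) * hζ
  · linear_combination ζ ^ 3 * h.r5 + ζ ^ 3 * a ^ 2 * hζ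

theorem Q5.map {H : Type*} [Field H] (f : F →+* H) (h : Q5 a b c d) : Q5 (f a) (f b) (f c) (f d) := by
  refine ⟨?_, ?_, ?_, ?_, ?_⟩
  · simpa using congrArg f h.r1
  · simpa using congrArg f h.r2
  · simpa using congrArg f h.r3
  · simpa using congrArg f h.r4
  · simpa using congrArg f h.r5

theorem X0_map {H : Type*} [Field H] (f : F →+* H) : X0 (f a) (f b) (f c) (f d) = f (X0 a b c d) := by
  simp only [X0, map_add, map_sub, map_mul, map_pow, map_ofNat]

theorem W0_map {H : Type*} [Field H] (f : F →+* H) : W0 (f a) (f b) (f c) (f d) = f (W0 a b c d) := by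
  simp only [W0, map_add, map_sub, map_mul, map_pow, map_ofNat]

theorem Q5.psi_ne [CharZero F] (h : Q5 a b c d) : 5 * (X0 a b c d) ^ 2 - 15 * (X0 a b c d) - 19 ≠ 0 := by
  intro h0
  have h1 := h.psi_a
  have h2 := h.psi_b
  rw [h0, zero_mul] at h1 h2
  have h3 : X0 a b c d = 28 / 15 := by linear_combination (5 * h2 - 5 * h1 + 2 * h0) / 165
  rw [h3] at h0
  norm_num at h0

/-- coordinates of the short Weierstrass model -/
def XS (a b c d : F) : F := X0 a b c d - 7 / 3
def WS (a b c d : F) : F := W0 a b c d + 25 / 2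

theorem Q5.short [CharZero F] (h : Q5 a b c d) : (WS a b c d) ^ 2 = (XS a b c d) ^ 3 + (-31 / 3) * XS a b c d + (-2501 / 108) := by
  rw [WS, XS]; linear_combination h.weier

theorem Q5.of [CharZero F] {x y ν : F} (hc : y ^ 2 + y = x ^ 3 - x ^ 2) (hν : ν ^ 5 = gg true x y) (hx : x ≠ 0) (hν0 : ν ≠ 0) :
    Q5 (x / ν) ν ((y + 1) * ν ^ 2 / x ^ 2) (y / ν ^ 2) := by
  simp only [gg, if_true] at hν
  refine ⟨?_, ?_, ?_, ?_, ?_⟩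
  · field_simp; linear_combination -hc
  · field_simp; linear_combination (x ^ 2 - y - 1) * hν - (x + 1) * hc
  · field_simp; linear_combination (y + 1) ^ 2 * hν + (x ^ 2 + (x + 1) * (y + 1)) * hc
  · field_simp; linear_combination (y + 1 - x) * hν + hc
  · field_simp; linear_combination (-(y + 1)) * hν - (x + 1) * hc

theorem Q5.mem [CharZero F] {Ω : Type*} [Field Ω] [Algebra Ω F] (h : Q5 a b c d) {E : IntermediateField Ω F} (hX : XS a b c d ∈ E) (hW : WS a b c d ∈ E) :
    a ∈ E ∧ b ∈ E ∧ c ∈ E ∧ d ∈ E := by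
  have hq : ∀ n : ℕ, (n : F) ∈ E := fun n => natCast_mem E n
  have hX : X0 a b c d ∈ E := by
    rw [show X0 a b c d = XS a b c d + (7 : ℕ) / (3 : ℕ) by rw [XS]; push_cast; ring]
    exact add_mem hX (div_mem (hq _) (hq _))
  have hW : W0 a b c d ∈ E := by
    rw [show W0 a b c d = WS a b c d - (25 : ℕ) / (2 : ℕ) by rw [WS]; push_cast; ring]
    exact sub_mem hW (div_mem (hq _) (hq _))
  have hψ := h.psi_ne
  have hXW := mul_mem hX hW
  have hX2 := pow_mem hX 2
  have hp : 5 * (X0 a b c d) ^ 2 - 15 * (X0 a b c d) - 19 ∈ E := by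
    have := sub_mem (sub_mem (mul_mem (hq 5) hX2) (mul_mem (hq 15) hX)) (hq 19)
    exact_mod_cast this
  have key : ∀ e r, (5 * (X0 a b c d) ^ 2 - 15 * (X0 a b c d) - 19) * e = r → r ∈ E → e ∈ E := by
    intro e r h1 h2
    rw [show e = r / (5 * (X0 a b c d) ^ 2 - 15 * (X0 a b c d) - 19) by rw [eq_div_iff hψ, ← h1]; ring]
    exact div_mem h2 hp
  refine ⟨key _ _ h.psi_a ?_, key _ _ h.psi_b ?_, key _ _ h.psi_c ?_, key _ _ h.psi_d ?_⟩
  · exact_mod_cast add_mem (add_mem (add_mem (sub_mem hXW hX2) (mul_mem (hq 4) hW)) (mul_mem (hq 32) hX)) (hq 23)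
  · exact_mod_cast add_mem (sub_mem (add_mem (add_mem hXW hX2) (mul_mem (hq 4) hW)) (mul_mem (hq 7) hX)) (hq 77)
  · exact_mod_cast sub_mem (add_mem (sub_mem (add_mem hXW (mul_mem (hq 2) hX2)) (mul_mem (hq 7) hW)) (mul_mem (hq 12) hX)) (hq 61)
  · exact_mod_cast sub_mem (add_mem (sub_mem (sub_mem hXW (mul_mem (hq 2) hX2)) (mul_mem (hq 7) hW)) (mul_mem (hq 13) hX)) (hq 114)

theorem XS_mem [CharZero F] {Ω : Type*} [Field Ω] [Algebra Ω F] {E : IntermediateField Ω F} (ha : a ∈ E) (hb : b ∈ E) (hc : c ∈ E) (hd : d ∈ E) :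
    XS a b c d ∈ E ∧ WS a b c d ∈ E := by
  lift a to E using ha
  lift b to E using hb
  lift c to E using hc
  lift d to E using hd
  constructor
  · have : XS (a : F) b c d = ((XS a b c d : E) : F) := by simp only [XS, X0]; push_cast; rfl
    rw [this]; exact SetLike.coe_mem _
  · have : WS (a : F) b c d = ((WS a b c d : E) : F) := by simp only [WS, W0]; push_cast; rfl
    rw [this]; exact SetLike.coe_mem _

end q
end Cr

namespace Cr
open Polynomial
namespace EF
variable {Ω F : Type*} [Field Ω] [Field F] [Algebra Ω F] {A B : Ω} {x w : F}

/-- `x/w` is a uniformizer at a pole of `x`. -/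
theorem inf_unif (h : EF Ω F A B x w) (O : ValuationSubring F)
    (hO : ∀ c : Ω, algebraMap Ω F c ∈ O) (hx : x ∉ O) {z : F} (hz : O.valuation z < 1) :
    ∃ b ∈ O, z = (x / w) * b := by
  obtain ⟨hw, ha, hb⟩ := h.inf_chart O hO hx
  have hx0 : x ≠ 0 := by rintro rfl; exact hx (zero_mem O)
  have ham : x / w ∈ Algebra.adjoin Ω {x / w, 1 / w} := Algebra.subset_adjoin (by simp)
  have hbm : 1 / w ∈ Algebra.adjoin Ω {x / w, 1 / w} := Algebra.subset_adjoin (by simp)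
  have hcm : ∀ c, algebraMap Ω F c ∈ Algebra.adjoin Ω {x / w, 1 / w} := fun c => Subalgebra.algebraMap_mem _ c
  have hgen : IntermediateField.adjoin Ω {x / w, 1 / w} = ⊤ := by
    have h1 : x / w ∈ IntermediateField.adjoin Ω {x / w, 1 / w} := IntermediateField.subset_adjoin _ _ (by simp)
    have h2 : 1 / w ∈ IntermediateField.adjoin Ω {x / w, 1 / w} := IntermediateField.subset_adjoin _ _ (by simp)
    apply adj2_congr h.gen
    · have := div_mem h1 h2; field_simp at this; exact this
    · have := inv_mem h2; simpa using this
  have ha' : O.valuation (x / w - algebraMap Ω F 0) < 1 := by simpa using ha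
  have hb' : O.valuation (1 / w - algebraMap Ω F 0) < 1 := by simpa using hb
  have hrel : (1 / w) * (1 - algebraMap Ω F A * (x / w) * (1 / w) - algebraMap Ω F B * (1 / w) ^ 2) = (x / w) * (x / w) ^ 2 := by
    field_simp; linear_combination h.eq
  have hdm : (1 - algebraMap Ω F A * (x / w) * (1 / w) - algebraMap Ω F B * (1 / w) ^ 2) ∈ Algebra.adjoin Ω {x / w, 1 / w} :=
    sub_mem (sub_mem (one_mem _) (mul_mem (mul_mem (hcm _) ham) hbm)) (mul_mem (hcm _) (pow_mem hbm 2))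
  have haO := mem_of_vlt O ha
  have hbO := mem_of_vlt O hb
  have hdv : O.valuation (1 - algebraMap Ω F A * (x / w) * (1 / w) - algebraMap Ω F B * (1 / w) ^ 2) = 1 := by
    have : (1 - algebraMap Ω F A * (x / w) * (1 / w) - algebraMap Ω F B * (1 / w) ^ 2) =
      1 + (1 / w) * (- algebraMap Ω F A * (x / w) - algebraMap Ω F B * (1 / w)) := by ring
    rw [this]
    exact v1_add O (map_one _) (vlt_mul O hb (sub_mem (mul_mem (neg_mem (hO _)) haO) (mul_mem (hO _) hbO)))
  have hloc := core O hO 0 0 ha' hb' hgen (π := x / w) (d := (1 - algebraMap Ω F A * (x / w) * (1 / w) - algebraMap Ω F B * (1 / w) ^ 2))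
      (n1 := (1 - algebraMap Ω F A * (x / w) * (1 / w) - algebraMap Ω F B * (1 / w) ^ 2)) (n2 := (x / w) ^ 2)
      ham hdm hdm (pow_mem ham 2) ha hdv (by simp) (by rw [map_zero, sub_zero]; exact hrel)
  set δ := (1 - algebraMap Ω F A * (x / w) * (1 / w) - algebraMap Ω F B * (1 / w) ^ 2)
  have hδ0 : δ ≠ 0 := fun h => by rw [h] at hdv; simp at hdv
  obtain ⟨n, hn, d, hdA, hd1, e⟩ := hloc z (mem_of_vlt O hz)
  have hAO : ∀ r ∈ Algebra.adjoin Ω {x / w, 1 / w}, r ∈ O := fun r hr => by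
    refine adjoin_le_O O hO ?_ hr
    rintro s (rfl | rfl) <;> assumption
  have hd0 : d ≠ 0 := fun h => by rw [h] at hd1; simp at hd1
  obtain ⟨c, r1, hr1, r2, hr2, e2⟩ := expand (0 : Ω) 0 hn
  simp only [map_zero, sub_zero] at e2
  have hc : c = 0 := by
    by_contra hc
    have h1 := val_const O hO hc
    have h2 : algebraMap Ω F c = z * d - (x / w) * r1 - (1 / w) * r2 := by rw [e, e2]; ring
    have h3 : O.valuation (z * d - (x / w) * r1 - (1 / w) * r2) < 1 :=
      vlt_sub O (vlt_sub O (vlt_mul O hz (hAO _ hdA)) (vlt_mul O ha (hAO _ hr1))) (vlt_mul O hb (hAO _ hr2))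
    rw [← h2, h1] at h3; exact lt_irrefl _ h3
  have hb2 : 1 / w = (x / w) * ((x / w) ^ 2 * δ⁻¹) := by
    rw [← mul_assoc, ← hrel]; field_simp
  refine ⟨(r1 + ((x / w) ^ 2 * δ⁻¹) * r2) * d⁻¹, mul_mem (add_mem (hAO _ hr1)
    (mul_mem (mul_mem (pow_mem haO 2) (inv_mem_of_v1 O hdv)) (hAO _ hr2))) (inv_mem_of_v1 O hd1), ?_⟩
  rw [← mul_assoc, eq_mul_inv_iff_mul_eq₀ hd0, e, e2, hc, map_zero, zero_add]
  rw [mul_add, ← mul_assoc (x / w), ← hb2]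

variable [IsAlgClosed Ω] [CharZero Ω]

/-- Basic facts at a pole for any solution of the equation. -/
theorem pole {x' w' : F} (heq : w' ^ 2 = x' ^ 3 + algebraMap Ω F A * x' + algebraMap Ω F B)
    (O : ValuationSubring F) (hO : ∀ c : Ω, algebraMap Ω F c ∈ O) (hx : x' ∉ O) :
    w' ≠ 0 ∧ O.valuation (x' / w') < 1 ∧ O.valuation (1 / w') < 1 ∧
    (∃ β ∈ O, 1 / w' = (x' / w') ^ 2 * β) ∧ x' - 1 / (x' / w') ^ 2 ∈ O := by
  have hx0 : x' ≠ 0 := by rintro rfl; exact hx (zero_mem O)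
  have hi := inv_vlt O hx
  have hm := mem_of_vlt O hi
  have hu : O.valuation (1 + algebraMap Ω F A * (x'⁻¹) ^ 2 + algebraMap Ω F B * (x'⁻¹) ^ 3) = 1 := by
    rw [add_assoc]
    apply v1_add O (map_one _)
    apply vlt_add O
    · rw [pow_two, ← mul_assoc]; exact vlt_mul' O (mul_mem (hO _) hm) hi
    · rw [pow_succ, ← mul_assoc]; exact vlt_mul' O (mul_mem (hO _) (pow_mem hm 2)) hi
  have e : w' ^ 2 = x' ^ 3 * (1 + algebraMap Ω F A * (x'⁻¹) ^ 2 + algebraMap Ω F B * (x'⁻¹) ^ 3) := by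
    rw [heq]; field_simp
  have hne : (1 + algebraMap Ω F A * (x'⁻¹) ^ 2 + algebraMap Ω F B * (x'⁻¹) ^ 3) ≠ 0 := by
    intro h3; rw [h3] at hu; simp at hu
  have hw : w' ≠ 0 := by
    rintro rfl
    apply hne
    have := e.symm; simpa [hx0] using this
  have ha : O.valuation (x' / w') < 1 := by
    apply vlt_of_pow O (n := 2)
    have : (x' / w') ^ 2 = x'⁻¹ * (1 + algebraMap Ω F A * (x'⁻¹) ^ 2 + algebraMap Ω F B * (x'⁻¹) ^ 3)⁻¹ := by
      rw [div_pow, e, ← mul_inv, div_eq_iff (mul_ne_zero (pow_ne_zero 3 hx0) hne)]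
      generalize (1 + algebraMap Ω F A * (x'⁻¹) ^ 2 + algebraMap Ω F B * (x'⁻¹) ^ 3) = u at hne
      field_simp
    rw [this]; exact vlt_mul O hi (inv_mem_of_v1 O hu)
  have e1 : 1 / w' = (x' / w') * x'⁻¹ := by field_simp
  refine ⟨hw, ha, ?_, ⟨(x' / w') * (1 + algebraMap Ω F A * (x'⁻¹) ^ 2 + algebraMap Ω F B * (x'⁻¹) ^ 3),
    mul_mem (mem_of_vlt O ha) ((vle O).1 hu.le), ?_⟩, ?_⟩
  · rw [e1]; exact vlt_mul' O (mem_of_vlt O ha) hi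
  · have : (x' / w') ^ 2 * (x' / w' * (1 + algebraMap Ω F A * (x'⁻¹) ^ 2 + algebraMap Ω F B * (x'⁻¹) ^ 3)) =
      (1 / w' ^ 3) * (x' ^ 3 * (1 + algebraMap Ω F A * (x'⁻¹) ^ 2 + algebraMap Ω F B * (x'⁻¹) ^ 3)) := by
      generalize (1 + algebraMap Ω F A * (x'⁻¹) ^ 2 + algebraMap Ω F B * (x'⁻¹) ^ 3) = u
      field_simp
    rw [this, ← e]; field_simp
  · have : x' - 1 / (x' / w') ^ 2 = - (algebraMap Ω F A * x'⁻¹ + algebraMap Ω F B * x'⁻¹ ^ 2) := by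
      field_simp; rw [heq]; ring
    rw [this]; exact neg_mem (add_mem (mul_mem (hO _) hm) (mul_mem (hO _) (pow_mem hm 2)))

theorem D_w {D : Derivation Ω F F} {x' w' g : F}
    (heq : w' ^ 2 = x' ^ 3 + algebraMap Ω F A * x' + algebraMap Ω F B) (hw : w' ≠ 0)
    (hg : D x' = 2 * g * w') : D w' = g * (3 * x' ^ 2 + algebraMap Ω F A) := by
  have : CharZero F := charZero_of_injective_algebraMap (algebraMap Ω F).injective
  have := congrArg D heq
  rw [map_add, map_add, D.leibniz_pow, D.leibniz_pow, D.leibniz, D.map_algebraMap, D.map_algebraMap, hg] at this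
  simp only [smul_eq_mul, nsmul_eq_mul] at this
  push_cast at this
  norm_num at this
  have h2 : (2 * w') * (D w' - g * (3 * x' ^ 2 + algebraMap Ω F A)) = 0 := by linear_combination this
  rcases mul_eq_zero.1 h2 with h3 | h3
  · simp [hw] at h3
  · linear_combination h3

theorem D_s {D : Derivation Ω F F} {x' w' g : F}
    (heq : w' ^ 2 = x' ^ 3 + algebraMap Ω F A * x' + algebraMap Ω F B) (hw : w' ≠ 0)
    (hg : D x' = 2 * g * w') : D (x' / w') =
      g * (-1 + 2 * algebraMap Ω F A * (x' / w') * (1 / w') + 3 * algebraMap Ω F B * (1 / w') ^ 2) := by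
  have h1 := D_w heq hw hg
  have e2 : D (x' / w') * w' ^ 2 = D x' * w' - x' * D w' := by
    have : D x' = D (x' / w' * w') := by rw [div_mul_cancel₀ _ hw]
    rw [this, D.leibniz]; simp only [smul_eq_mul]; field_simp; ring
  have e3 : D (x' / w') = (D x' * w' - x' * D w') / w' ^ 2 := by rw [← e2]; field_simp
  rw [e3, hg, h1]; field_simp
  linear_combination 3 * g * heq

theorem wdiff (h : EF Ω F A B x w) (hd : 4 * A ^ 3 + 27 * B ^ 2 ≠ 0)
    {D : Derivation Ω F F} (hDx : D x = 2 * w) (hDw : D w = 3 * x ^ 2 + algebraMap Ω F A)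
    {x' w' : F} (heq : w' ^ 2 = x' ^ 3 + algebraMap Ω F A * x' + algebraMap Ω F B) (hw : w' ≠ 0) :
    ∃ c : Ω, D x' = 2 * algebraMap Ω F c * w' := by
  have : CharZero F := charZero_of_injective_algebraMap (algebraMap Ω F).injective
  have hst := fun O hO z hz => h.stab hd hDx hDw O hO (z := z) hz
  set g := D x' / (2 * w') with hgd
  have hg : D x' = 2 * g * w' := by rw [hgd]; field_simp
  have h1 := D_w heq hw hg
  have h2 := D_s heq hw hg
  obtain ⟨c, hc⟩ : ∃ c : Ω, algebraMap Ω F c = g := by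
    apply const_of_forall
    intro O hO
    have hn : ∀ n : ℕ, (n : F) ∈ O := fun n => natCast_mem O n
    by_cases hx : x' ∈ O
    · have hwO : w' ∈ O := by
        by_contra hwO
        have hi := inv_vlt O hwO
        have : (1 : F) = w'⁻¹ * (w'⁻¹ * (x' ^ 3 + algebraMap Ω F A * x' + algebraMap Ω F B)) := by
          rw [← heq]; field_simp
        have h3 := vlt_mul O hi (mul_mem (mem_of_vlt O hi) (add_mem (add_mem (pow_mem hx 3) (mul_mem (hO A) hx)) (hO B)))
        rw [← this] at h3; simp at h3
      rcases v1_or O hwO with h3 | h3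
      · have h2v : O.valuation (2 : F) = 1 := by
          have := val_const O hO (c := (2 : Ω)) (by norm_num)
          rwa [map_ofNat] at this
        rw [hgd, div_eq_mul_inv]
        exact mul_mem (hst O hO _ hx) (inv_mem_of_v1 O (v1_mul O h2v h3))
      · have hm2 : 3 * x' ^ 2 + algebraMap Ω F A ∈ O := add_mem (mul_mem (hn 3) (pow_mem hx 2)) (hO A)
        rcases v1_or O hm2 with h4 | h4
        · have h40 : 3 * x' ^ 2 + algebraMap Ω F A ≠ 0 := fun h => by rw [h] at h4; simp at h4
          have : g = D w' * (3 * x' ^ 2 + algebraMap Ω F A)⁻¹ := by rw [h1]; field_simp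
          rw [this]; exact mul_mem (hst O hO _ hwO) (inv_mem_of_v1 O h4)
        · exfalso
          have h5 := val_const O hO hd
          have e5 : algebraMap Ω F (4 * A ^ 3 + 27 * B ^ 2) =
            (3 * x' ^ 2 + algebraMap Ω F A) * (6 * algebraMap Ω F A * x' ^ 2 - 9 * algebraMap Ω F B * x' + 4 * algebraMap Ω F A ^ 2)
             + w' * (w' * (27 * algebraMap Ω F B - 18 * algebraMap Ω F A * x')) := by
            rw [← mul_assoc w', ← pow_two w', heq]
            simp only [map_add, map_mul, map_pow, map_ofNat]; ring
          rw [e5] at h5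
          have h6 := vlt_add O (vlt_mul O h4 (b := (6 * algebraMap Ω F A * x' ^ 2 - 9 * algebraMap Ω F B * x' + 4 * algebraMap Ω F A ^ 2)) ?_)
            (vlt_mul O h3 (b := (w' * (27 * algebraMap Ω F B - 18 * algebraMap Ω F A * x'))) ?_)
          · exact absurd h5 h6.ne
          · exact add_mem (sub_mem (mul_mem (mul_mem (hn 6) (hO _)) (pow_mem hx 2)) (mul_mem (mul_mem (hn 9) (hO _)) hx)) (mul_mem (hn 4) (pow_mem (hO _) 2))
          · exact mul_mem hwO (sub_mem (mul_mem (hn 27) (hO _)) (mul_mem (mul_mem (hn 18) (hO _)) hx))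
    · obtain ⟨_, ha, hb, -, -⟩ := pole heq O hO hx
      have hDs := hst O hO _ (mem_of_vlt O ha)
      have ham := mem_of_vlt O ha
      have hbm := mem_of_vlt O hb
      have hv : O.valuation (-1 + (1 / w') * (2 * algebraMap Ω F A * (x' / w') + 3 * algebraMap Ω F B * (1 / w'))) = 1 :=
        v1_add O (by simp) (vlt_mul O hb (add_mem (mul_mem (mul_mem (hn 2) (hO _)) ham) (mul_mem (mul_mem (hn 3) (hO _)) hbm)))
      have hv0 : (-1 + (1 / w') * (2 * algebraMap Ω F A * (x' / w') + 3 * algebraMap Ω F B * (1 / w'))) ≠ 0 :=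
        fun h => by rw [h] at hv; simp at hv
      have : g = D (x' / w') * (-1 + (1 / w') * (2 * algebraMap Ω F A * (x' / w') + 3 * algebraMap Ω F B * (1 / w')))⁻¹ := by
        rw [eq_mul_inv_iff_mul_eq₀ hv0, h2]; ring
      rw [this]; exact mul_mem hDs (inv_mem_of_v1 O hv)
  exact ⟨c, by rw [hc, hg]⟩

end EF
end Cr

namespace Cr
open Polynomial
namespace EF
variable {Ω F : Type*} [Field Ω] [Field F] [Algebra Ω F] {A B : Ω} {x w : F}
variable [IsAlgClosed Ω] [CharZero Ω]

theorem quad_coeff {a b c : Ω} (h : C a * X ^ 2 + C b * X + C c = 0) : a = 0 ∧ b = 0 ∧ c = 0 := by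
  have k2 := congrArg (fun p => p.coeff 2) h
  have k1 := congrArg (fun p => p.coeff 1) h
  have k0 := congrArg (fun p => p.coeff 0) h
  simp [coeff_X, coeff_C] at k2 k1 k0
  exact ⟨k2, k1, k0⟩

theorem near_pole (h : EF Ω F A B x w) (hd : 4 * A ^ 3 + 27 * B ^ 2 ≠ 0)
    {D : Derivation Ω F F} (hDx : D x = 2 * w) (hDw : D w = 3 * x ^ 2 + algebraMap Ω F A)
    {x' w' : F} (heq : w' ^ 2 = x' ^ 3 + algebraMap Ω F A * x' + algebraMap Ω F B)
    {c : Ω} (hc0 : c ≠ 0) (hc : D x' = 2 * algebraMap Ω F c * w')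
    (O : ValuationSubring F) (hO : ∀ c : Ω, algebraMap Ω F c ∈ O) (hx : x ∉ O) (hx' : x' ∉ O) :
    x - algebraMap Ω F c ^ 2 * x' ∈ O := by
  have : CharZero F := charZero_of_injective_algebraMap (algebraMap Ω F).injective
  have hst := fun z hz => h.stab hd hDx hDw O hO (z := z) hz
  have hn : ∀ n : ℕ, (n : F) ∈ O := fun n => natCast_mem O n
  obtain ⟨hw0, hs, hb, ⟨β, hβ, eβ⟩, hxs⟩ := pole h.eq O hO hx
  obtain ⟨hw0', hs', hb', ⟨β', hβ', eβ'⟩, hxs'⟩ := pole heq O hO hx'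
  have hDs := D_s (g := 1) h.eq hw0 (D := D) (by rw [hDx]; ring)
  have hDs' := D_s heq hw0' hc
  have hu := fun z hz => h.inf_unif O hO hx (z := z) hz
  have hx0 : x ≠ 0 := by rintro rfl; exact hx (zero_mem O)
  have hs0 : x / w ≠ 0 := div_ne_zero hx0 hw0
  set s := x / w with hsd
  set b := 1 / w with hbd
  set s' := x' / w' with hsd'
  set b' := 1 / w' with hbd'
  have hsm := mem_of_vlt O hs
  have hbm := mem_of_vlt O hb
  have hsm' := mem_of_vlt O hs'
  have hbm' := mem_of_vlt O hb'
  have hDsv : O.valuation (D s) = 1 := by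
    have : D s = -1 + b * (2 * algebraMap Ω F A * s + 3 * algebraMap Ω F B * b) := by rw [hDs]; ring
    rw [this]
    exact v1_add O (by simp) (vlt_mul O hb (add_mem (mul_mem (mul_mem (hn 2) (hO _)) hsm) (mul_mem (mul_mem (hn 3) (hO _)) hbm)))
  have hDs0 : D s ≠ 0 := fun h => by rw [h] at hDsv; simp at hDsv
  have hcanc : ∀ z, z ∈ O → O.valuation (z * D s) < 1 → O.valuation z < 1 := fun z _ hz => by
    rwa [map_mul, hDsv, mul_one] at hz
  obtain ⟨σ, hσ, eσ⟩ := hu s' hs'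
  -- a = s' - c s
  have hav : O.valuation (s' - algebraMap Ω F c * s) < 1 := vlt_sub O hs' (vlt_mul' O (hO c) hs)
  obtain ⟨a1, ha1, e1⟩ := hu _ hav
  have hDa : ∃ e ∈ O, D (s' - algebraMap Ω F c * s) = s ^ 2 * e := by
    refine ⟨algebraMap Ω F c * (σ ^ 2 * β' * (2 * algebraMap Ω F A * s' + 3 * algebraMap Ω F B * b')
      - β * (2 * algebraMap Ω F A * s + 3 * algebraMap Ω F B * b)), ?_, ?_⟩
    · exact mul_mem (hO _) (sub_mem (mul_mem (mul_mem (pow_mem hσ 2) hβ') (add_mem (mul_mem (mul_mem (hn 2) (hO _)) hsm') (mul_mem (mul_mem (hn 3) (hO _)) hbm')))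
        (mul_mem hβ (add_mem (mul_mem (mul_mem (hn 2) (hO _)) hsm) (mul_mem (mul_mem (hn 3) (hO _)) hbm))))
    · have h1 : b' = s ^ 2 * (σ ^ 2 * β') := by rw [eβ', eσ]; ring
      rw [map_sub, D.leibniz, D.map_algebraMap, hDs, hDs']
      simp only [smul_eq_mul]
      have e3 : algebraMap Ω F c * (-1 + 2 * algebraMap Ω F A * s' * b' + 3 * algebraMap Ω F B * b' ^ 2) -
        (algebraMap Ω F c * (1 * (-1 + 2 * algebraMap Ω F A * s * b + 3 * algebraMap Ω F B * b ^ 2)) + s * 0) =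
        algebraMap Ω F c * (b' * (2 * algebraMap Ω F A * s' + 3 * algebraMap Ω F B * b') -
         b * (2 * algebraMap Ω F A * s + 3 * algebraMap Ω F B * b)) := by ring
      rw [e3]
      linear_combination algebraMap Ω F c * (2 * algebraMap Ω F A * s' + 3 * algebraMap Ω F B * b') * h1
        - algebraMap Ω F c * (2 * algebraMap Ω F A * s + 3 * algebraMap Ω F B * b) * eβ
  obtain ⟨e, he, eDa⟩ := hDa
  rw [e1] at eDa
  have hv1 : O.valuation a1 < 1 := by
    apply hcanc _ ha1
    have : a1 * D s = s * (s * e - D a1) := by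
      rw [D.leibniz] at eDa; simp only [smul_eq_mul] at eDa; linear_combination eDa
    rw [this]; exact vlt_mul O hs (sub_mem (mul_mem hsm he) (hst _ ha1))
  obtain ⟨a2, ha2, e2⟩ := hu _ hv1
  have hv2 : O.valuation a2 < 1 := by
    apply hcanc _ ha2
    have h2v : O.valuation (2 : F) = 1 := by
      have := val_const O hO (c := (2 : Ω)) (by norm_num)
      rwa [map_ofNat] at this
    have : a2 * D s = s * ((e - D a2) * 2⁻¹) := by
      rw [e2, D.leibniz, D.leibniz] at eDa; simp only [smul_eq_mul] at eDa
      apply mul_left_cancel₀ hs0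
      linear_combination eDa / 2
    rw [this]; exact vlt_mul O hs (mul_mem (sub_mem he (hst _ ha2)) (inv_mem_of_v1 O h2v))
  obtain ⟨a3, ha3, e3⟩ := hu _ hv2
  have es' : s' = s * (algebraMap Ω F c + s * (s * a3)) := by
    rw [e2, e3] at e1; linear_combination e1
  have hτ : O.valuation (algebraMap Ω F c + s * (s * a3)) = 1 :=
    v1_add O (val_const O hO hc0) (vlt_mul O hs (mul_mem hsm ha3))
  have hτ0 : (algebraMap Ω F c + s * (s * a3)) ≠ 0 := fun h => by rw [h] at hτ; simp at hτ
  have key : 1 / s ^ 2 - algebraMap Ω F c ^ 2 * (1 / s' ^ 2) =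
      a3 * (2 * algebraMap Ω F c + s * (s * a3)) * ((algebraMap Ω F c + s * (s * a3))⁻¹) ^ 2 := by
    have e5 : a3 * (2 * algebraMap Ω F c + s * (s * a3)) = ((algebraMap Ω F c + s * (s * a3)) ^ 2 - algebraMap Ω F c ^ 2) / s ^ 2 := by
      field_simp; ring
    rw [e5, es']
    generalize algebraMap Ω F c + s * (s * a3) = τ at hτ0
    field_simp
  have : x - algebraMap Ω F c ^ 2 * x' = (x - 1 / s ^ 2) - algebraMap Ω F c ^ 2 * (x' - 1 / s' ^ 2) +
    (1 / s ^ 2 - algebraMap Ω F c ^ 2 * (1 / s' ^ 2)) := by ring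
  rw [this, key]
  exact add_mem (sub_mem hxs (mul_mem (pow_mem (hO _) 2) hxs')) (mul_mem (mul_mem ha3 (add_mem (mul_mem (hn 2) (hO _)) (mul_mem hsm (mul_mem hsm ha3)))) (pow_mem (inv_mem_of_v1 O hτ) 2))

theorem ne_top {O : ValuationSubring F} {x : F} (h : x ∉ O) : O ≠ ⊤ := by
  rintro rfl; exact h trivial

theorem M8a (h : EF Ω F A B x w) (hd : 4 * A ^ 3 + 27 * B ^ 2 ≠ 0) (hA : A ≠ 0) (hB : B ≠ 0)
    {D : Derivation Ω F F} (hDx : D x = 2 * w) (hDw : D w = 3 * x ^ 2 + algebraMap Ω F A)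
    {x' w' : F} (h' : EF Ω F A B x' w')
    (O0 : ValuationSubring F) (hO0 : ∀ c : Ω, algebraMap Ω F c ∈ O0) (hx0 : x ∉ O0) (hx0' : x' ∉ O0)
    {c : Ω} (hc : D x' = 2 * algebraMap Ω F c * w') : c ^ 2 = 1 := by
  have : CharZero F := charZero_of_injective_algebraMap (algebraMap Ω F).injective
  have hc0 : c ≠ 0 := by
    rintro rfl
    obtain ⟨e, he⟩ := h.ker_D hDx (z := x') (by rw [hc]; simp)
    exact hx0' (he ▸ hO0 e)
  have imp : ∀ {x w x' w' : F}, EF Ω F A B x w → x ∉ O0 → x' ∉ O0 →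
      ∀ O : ValuationSubring F, (∀ c : Ω, algebraMap Ω F c ∈ O) → x ∉ O → x' ∉ O := by
    intro x w x' w' h hx hx' O hO hxO
    obtain ⟨D, hDx, hDw⟩ := h.exists_D
    have hi := inv_vlt O0 hx'
    obtain ⟨e, he, he2⟩ := (h.chart hd hDx hDw O0 hO0 (ne_top hx)).2 x'⁻¹ (mem_of_vlt _ hi)
    have he0 : e = 0 := by
      by_contra he0
      have h1 := val_const O0 hO0 he0
      have h2 : algebraMap Ω F e = x'⁻¹ - (x'⁻¹ - algebraMap Ω F e) := by ring
      have h3 := vlt_sub O0 hi he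
      rw [← h2, h1] at h3; exact lt_irrefl _ h3
    have h4 := he2 hx O hO hxO
    rw [he0, map_zero, sub_zero] at h4
    intro h5
    have h6 := vlt_mul O h4 h5
    rw [inv_mul_cancel₀ (by rintro rfl; exact hx' (zero_mem _))] at h6
    simp at h6
  obtain ⟨e, he⟩ : ∃ e : Ω, algebraMap Ω F e = x - algebraMap Ω F c ^ 2 * x' := by
    apply const_of_forall
    intro O hO
    by_cases hx : x ∈ O
    · have hx' : x' ∈ O := by
        by_contra hx'
        exact imp (w := w') (w' := w) h' hx0' hx0 O hO hx' hx
      exact sub_mem hx (mul_mem (pow_mem (hO _) 2) hx')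
    · exact h.near_pole hd hDx hDw h'.eq hc0 hc O hO hx (imp (w := w) (w' := w') h hx0 hx0' O hO hx)
  have ex : x = algebraMap Ω F c ^ 2 * x' + algebraMap Ω F e := by rw [he]; ring
  have ew : w = algebraMap Ω F c ^ 3 * w' := by
    have := congrArg D ex
    rw [map_add, D.leibniz, D.leibniz_pow, D.map_algebraMap, D.map_algebraMap, hDx, hc] at this
    simp only [smul_eq_mul, nsmul_eq_mul] at this
    linear_combination this / 2
  have e1 := h.eq
  rw [ew, mul_pow, h'.eq, ex] at e1
  have e2 := h'.inj (p := C (3 * c ^ 4 * e) * X ^ 2 + C (3 * c ^ 2 * e ^ 2 + A * c ^ 2 - c ^ 6 * A) * X + C (e ^ 3 + A * e + B - c ^ 6 * B)) (by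
    simp only [map_add, map_sub, map_mul, map_pow, aeval_C, aeval_X, map_ofNat]
    linear_combination -e1)
  obtain ⟨k2, k1, k0⟩ := quad_coeff e2
  have he0 : e = 0 := by simpa [hc0] using k2
  rw [he0] at k1 k0
  have c4 : c ^ 2 * A * (c ^ 4 - 1) = 0 := by linear_combination -k1
  have c6 : B * (c ^ 6 - 1) = 0 := by linear_combination -k0
  have c4' : c ^ 4 = 1 := by
    rcases mul_eq_zero.1 c4 with h | h
    · simp_all
    · linear_combination h
  have c6' : c ^ 6 = 1 := by
    rcases mul_eq_zero.1 c6 with h | h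
    · simp_all
    · linear_combination h
  linear_combination c6' - c ^ 2 * c4'

theorem M8b (h : EF Ω F A B x w) (hd : 4 * A ^ 3 + 27 * B ^ 2 ≠ 0) (hA : A ≠ 0) (hB : B ≠ 0)
    {D : Derivation Ω F F} (hDx : D x = 2 * w) (hDw : D w = 3 * x ^ 2 + algebraMap Ω F A)
    {x' w' : F} (h' : EF Ω F A B x' w') : D x' = 2 * w' ∨ D x' = 2 * (-w') := by
  have : CharZero F := charZero_of_injective_algebraMap (algebraMap Ω F).injective
  have hw' := h'.w_ne
  obtain ⟨c, hc⟩ := h.wdiff hd hDx hDw h'.eq hw'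
  suffices hs : c ^ 2 = 1 by
    rcases mul_eq_zero.1 (show (c - 1) * (c + 1) = 0 by linear_combination hs) with h1 | h1
    · left; rw [hc, sub_eq_zero.1 h1]; simp
    · right; rw [hc, eq_neg_of_add_eq_zero_left h1]; simp
  obtain ⟨O, hO, hxO⟩ : ∃ O : ValuationSubring F, (∀ c : Ω, algebraMap Ω F c ∈ O) ∧ x ∉ O := by
    by_contra hcon
    push Not at hcon
    exact h.tr (isAlgebraic_of_forall x hcon)
  by_cases hx' : x' ∉ O
  · exact h.M8a hd hA hB hDx hDw h' O hO hxO hx' hc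
  push Not at hx'
  have hD2 := D_w h'.eq hw' hc
  have hch := (h.chart hd hDx hDw O hO (ne_top hxO)).2
  have hwO := h'.w_mem O hO hx'
  obtain ⟨x0, hx0, -⟩ := hch x' hx'
  obtain ⟨y0, hy0, -⟩ := hch w' hwO
  have eq0 : y0 ^ 2 = x0 ^ 3 + A * x0 + B := by
    by_contra hne
    have h1 := val_const O hO (c := y0 ^ 2 - (x0 ^ 3 + A * x0 + B)) (sub_ne_zero.2 hne)
    have h2 : algebraMap Ω F (y0 ^ 2 - (x0 ^ 3 + A * x0 + B)) =
      (x' - algebraMap Ω F x0) * (x' ^ 2 + x' * algebraMap Ω F x0 + algebraMap Ω F x0 ^ 2 + algebraMap Ω F A)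
       - (w' - algebraMap Ω F y0) * (w' + algebraMap Ω F y0) := by
      simp only [map_add, map_mul, map_pow, map_sub]
      linear_combination h'.eq
    have h3 := vlt_sub O (vlt_mul O hx0 (b := (x' ^ 2 + x' * algebraMap Ω F x0 + algebraMap Ω F x0 ^ 2 + algebraMap Ω F A))
      (add_mem (add_mem (add_mem (pow_mem hx' 2) (mul_mem hx' (hO _))) (pow_mem (hO _) 2)) (hO _)))
      (vlt_mul O hy0 (add_mem hwO (hO y0)))
    rw [← h2, h1] at h3; exact lt_irrefl _ h3
  have hxne : x' - algebraMap Ω F x0 ≠ 0 := sub_ne_zero.2 fun hh => h'.tr (hh ▸ isAlgebraic_algebraMap x0)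
  set a := algebraMap Ω F x0 with ha
  set y := algebraMap Ω F y0 with hy
  have eq0' : y ^ 2 = a ^ 3 + algebraMap Ω F A * a + algebraMap Ω F B := by
    rw [ha, hy, ← map_pow, eq0]; simp
  set l := (w' + y) / (x' - a) with hl
  have el : l * (x' - a) = w' + y := by rw [hl]; field_simp
  clear_value l
  set x2 := l ^ 2 - x' - a with hx2
  set w2 := -(w' + l * (x2 - x')) with hw2
  have eq2 : w2 ^ 2 = x2 ^ 3 + algebraMap Ω F A * x2 + algebraMap Ω F B := by
    have e5 : w2 = y - l * (x2 - a) := by rw [hw2]; linear_combination el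
    have e6 : x' = l ^ 2 - x2 - a := by rw [hx2]; ring
    have e7 : w' = l * (x' - a) - y := by linear_combination -el
    have e8 : algebraMap Ω F B = y ^ 2 - a ^ 3 - algebraMap Ω F A * a := by linear_combination -eq0'
    have e9 := h'.eq
    rw [e8, e7, e6] at e9
    rw [e5, e8]
    rw [e6] at hxne
    apply mul_left_cancel₀ hxne
    clear_value x2
    linear_combination (x2 - a) * e9
  have hQ : l * (w' - y) = x' ^ 2 + x' * a + a ^ 2 + algebraMap Ω F A := by
    apply mul_left_cancel₀ hxne
    linear_combination (w' - y) * el + h'.eq - eq0'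
  have hn : ∀ n : ℕ, (n : F) ∈ O := fun n => natCast_mem O n
  have hnot : x2 ∉ O := by
    intro hmem
    have hl2 : l ^ 2 ∈ O := by
      have : l ^ 2 = x2 + x' + a := by rw [hx2]; ring
      rw [this]; exact add_mem (add_mem hmem hx') (hO _)
    have hlO : l ∈ O := by
      by_contra hlO
      have h5 := inv_vlt O hlO
      have h6 : (1 : F) = l⁻¹ * (l⁻¹ * l ^ 2) := by
        have : l ≠ 0 := by rintro h0; rw [h0] at hlO; exact hlO (zero_mem _)
        field_simp
      have h7 := vlt_mul O h5 (mul_mem (mem_of_vlt O h5) hl2)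
      rw [← h6] at h7; simp at h7
    have hy00 : y0 = 0 := by
      by_contra hy00
      have h5 := val_const O hO (c := 2 * y0) (by simpa using hy00)
      have h6 : algebraMap Ω F (2 * y0) = (x' - a) * l - (w' - y) := by
        rw [map_mul, map_ofNat]; linear_combination -el
      have h7 := vlt_sub O (vlt_mul O hx0 hlO) hy0
      rw [← h6, h5] at h7; exact lt_irrefl _ h7
    have hf0 : 3 * x0 ^ 2 + A = 0 := by
      by_contra hf0
      have h5 := val_const O hO hf0
      have h6 : algebraMap Ω F (3 * x0 ^ 2 + A) = (w' - y) * l - (x' - a) * (x' + 2 * a) := by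
        simp only [map_add, map_mul, map_pow, map_ofNat]; rw [← ha]; linear_combination -hQ
      have h7 := vlt_sub O (vlt_mul O hy0 hlO) (vlt_mul O hx0 (add_mem hx' (mul_mem (hn 2) (hO x0))))
      push_cast at h7
      rw [← h6, h5] at h7; exact lt_irrefl _ h7
    apply hd
    rw [hy00] at eq0
    linear_combination (6 * A * x0 ^ 2 - 9 * B * x0 + 4 * A ^ 2) * hf0 + (18 * A * x0 - 27 * B) * eq0
  have hx2a : x2 - a ≠ 0 := by
    intro hh; apply hnot; rw [sub_eq_zero.1 hh]; exact hO _
  have el2 : l = -(w2 - y) / (x2 - a) := by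
    rw [eq_div_iff hx2a, hw2]; linear_combination el
  have h2 : EF Ω F A B x2 w2 := by
    refine ⟨eq2, fun halg => ?_, ?_⟩
    · obtain ⟨e, he⟩ := const_of_algebraic halg
      exact hnot (he ▸ hO e)
    · have m1 : x2 ∈ IntermediateField.adjoin Ω {x2, w2} := IntermediateField.subset_adjoin _ _ (by simp)
      have m2 : w2 ∈ IntermediateField.adjoin Ω {x2, w2} := IntermediateField.subset_adjoin _ _ (by simp)
      have ma : a ∈ IntermediateField.adjoin Ω {x2, w2} := IntermediateField.algebraMap_mem _ _
      have my : y ∈ IntermediateField.adjoin Ω {x2, w2} := IntermediateField.algebraMap_mem _ _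
      have ml : l ∈ IntermediateField.adjoin Ω {x2, w2} := by
        rw [el2]; exact div_mem (neg_mem (sub_mem m2 my)) (sub_mem m1 ma)
      have mx : x' ∈ IntermediateField.adjoin Ω {x2, w2} := by
        have : x' = l ^ 2 - x2 - a := by rw [hx2]; ring
        rw [this]; exact sub_mem (sub_mem (pow_mem ml 2) m1) ma
      refine adj2_congr h'.gen mx ?_
      have : w' = -w2 - l * (x2 - x') := by rw [hw2]; ring
      rw [this]; exact sub_mem (neg_mem m2) (mul_mem ml (sub_mem m1 mx))
  refine h.M8a hd hA hB hDx hDw h2 O hO hxO hnot (c := c) ?_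
  have hDl : D l * (x' - a) = D w' - l * D x' := by
    have := congrArg D el
    rw [D.leibniz, map_add, map_sub, ha, hy, D.map_algebraMap, D.map_algebraMap] at this
    simp only [smul_eq_mul] at this
    linear_combination this
  have : D x2 = 2 * l * D l - D x' := by
    rw [hx2, map_sub, map_sub, D.leibniz_pow, ha, D.map_algebraMap]
    simp only [smul_eq_mul, nsmul_eq_mul]; push_cast; ring
  rw [this]
  apply mul_left_cancel₀ hxne
  rw [hw2, hx2]
  have h9 : (x' - a) * (2 * l * D l - D x') = 2 * l * (D l * (x' - a)) - (x' - a) * D x' := by ring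
  rw [h9, hDl, hD2, hc]
  linear_combination (-2 * algebraMap Ω F c * l) * hQ + (2 * algebraMap Ω F c * l ^ 2) * el

end EF
end Cr

namespace Cr
open WeierstrassCurve.Affine
namespace EF
variable {Ω F : Type*} [Field Ω] [Field F] [Algebra Ω F] {A B : Ω} {x w : F}

/-- The short Weierstrass curve. -/
def crv (A B : Ω) : WeierstrassCurve Ω := ⟨0, 0, 0, A, B⟩

theorem crv_ns [CharZero F] {x w : F} (heq : w ^ 2 = x ^ 3 + algebraMap Ω F A * x + algebraMap Ω F B) (hw : w ≠ 0) :
    (((crv A B).baseChange F).toAffine).Nonsingular x w := by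
  rw [nonsingular_iff', equation_iff']
  refine ⟨?_, Or.inr ?_⟩
  · simp [crv, heq]
  · simp [crv, hw]

variable [IsAlgClosed Ω] [CharZero Ω]

theorem crv_const [DecidableEq F] (h : EF Ω F A B x w) {D : Derivation Ω F F} (hDx : D x = 2 * w) (hDw : D w = 3 * x ^ 2 + algebraMap Ω F A)
    (P : (((crv A B).baseChange F).toAffine).Point)
    (hP : ∀ hn, P = Point.some x w hn)
    {x1 w1 : F} (heq : w1 ^ 2 = x1 ^ 3 + algebraMap Ω F A * x1 + algebraMap Ω F B) (hw1 : w1 ≠ 0)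
    (hD1 : D x1 = 2 * w1) (Q : (((crv A B).baseChange F).toAffine).Point)
    (hQ : ∀ hn, Q = Point.some x1 w1 hn) (ψ : F →ₐ[Ω] F) : Point.map (W' := crv A B) ψ (Q - P) = Q - P := by
  have : CharZero F := charZero_of_injective_algebraMap (algebraMap Ω F).injective
  have hn := crv_ns (A := A) (B := B) h.eq h.w_ne
  have hn1 := crv_ns heq hw1
  rw [hP hn, hQ hn1]
  have hDw1 := D_w (g := 1) heq hw1 (D := D) (by rw [hD1]; ring)
  by_cases hx : x1 = x
  · have hw : w1 = w := by rw [hx, hDx] at hD1; linear_combination -hD1 / 2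
    subst hx hw
    rw [sub_self, map_zero]
  · rw [sub_eq_add_neg, Point.neg_some, Point.add_of_X_ne hx, Point.map_some]
    have hl := slope_of_X_ne (W := ((crv A B).baseChange F).toAffine) (y₁ := w1) (y₂ := ((crv A B).baseChange F).toAffine.negY x w) hx
    obtain ⟨l, hl0⟩ : ∃ l, ((crv A B).baseChange F).toAffine.slope x1 x w1 (((crv A B).baseChange F).toAffine.negY x w) = l := ⟨_, rfl⟩
    rw [hl0] at hl
    have hX : ((crv A B).baseChange F).toAffine.addX x1 x l = l ^ 2 - x1 - x := by
      simp [addX, crv]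
    have hY : ((crv A B).baseChange F).toAffine.addY x1 x w1 l = -(w1 + l * (l ^ 2 - x1 - x - x1)) := by
      simp [addY, negAddY, negY, addX, crv]; ring
    have hne := sub_ne_zero.2 hx
    have el : l * (x1 - x) = w1 + w := by
      rw [hl]; simp [negY, crv]; field_simp
    have hDl : D l * (x1 - x) = D w1 + D w - l * (D x1 - D x) := by
      have := congrArg D el
      rw [D.leibniz, map_add, map_sub] at this
      simp only [smul_eq_mul] at this
      linear_combination this
    have hQ : l * (w1 - w) = x1 ^ 2 + x1 * x + x ^ 2 + algebraMap Ω F A := by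
      apply mul_left_cancel₀ hne
      linear_combination (w1 - w) * el + heq - h.eq
    have hDl2 : D l = x1 - x := by
      apply mul_right_cancel₀ hne
      rw [hDl, hDw1, hDw, hD1, hDx]
      linear_combination -2 * hQ
    have c1 : D (l ^ 2 - x1 - x) = 0 := by
      rw [map_sub, map_sub, D.leibniz_pow, hD1, hDx]
      simp only [smul_eq_mul, nsmul_eq_mul]; push_cast
      rw [hDl2]
      norm_num
      linear_combination 2 * el
    obtain ⟨X, eX⟩ := h.ker_D hDx c1
    have c2 : D (-(w1 + l * (l ^ 2 - x1 - x - x1))) = 0 := by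
      have e5 : D (l ^ 2 - x1 - x - x1) = - D x1 := by rw [map_sub, c1, zero_sub]
      rw [map_neg, map_add, D.leibniz, e5, hDl2, hDw1, hD1]
      simp only [smul_eq_mul]
      linear_combination hQ - l * el
    obtain ⟨Y, eY⟩ := h.ker_D hDx c2
    simp only [hl0]
    congr 1
    · rw [hX, ← eX]; simp
    · rw [hY, ← eY]; simp

/-- The two commutation relations. -/
theorem comm_pm (h : EF Ω F A B x w) {D : Derivation Ω F F} (hDx : D x = 2 * w) (hDw : D w = 3 * x ^ 2 + algebraMap Ω F A)
    (φ ψ : F →ₐ[Ω] F) (hφ : D (φ x) = 2 * φ w) :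
    (D (ψ x) = 2 * ψ w → φ (ψ x) = ψ (φ x) ∧ φ (ψ w) = ψ (φ w)) ∧
    (D (ψ x) = 2 * (- ψ w) → φ (ψ (φ x)) = ψ x ∧ φ (ψ (φ w)) = ψ w) := by
  classical
  have : CharZero F := charZero_of_injective_algebraMap (algebraMap Ω F).injective
  have hw := h.w_ne
  have hn := crv_ns (A := A) (B := B) h.eq hw
  have him : ∀ χ : F →ₐ[Ω] F, (χ w) ^ 2 = (χ x) ^ 3 + algebraMap Ω F A * χ x + algebraMap Ω F B := fun χ => by
    rw [← map_pow, h.eq]; simp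
  have hwn : ∀ χ : F →ₐ[Ω] F, χ w ≠ 0 := fun χ => by simpa using hw
  set P : (((crv A B).baseChange F).toAffine).Point := Point.some x w hn with hP
  have key : ∀ χ χ' : F →ₐ[Ω] F, Point.map (W' := crv A B) χ P = Point.map (W' := crv A B) χ' P → χ x = χ' x ∧ χ w = χ' w := by
    intro χ χ' hh
    rw [hP, Point.map_some, Point.map_some] at hh
    exact ⟨(Point.some.inj hh).1, (Point.some.inj hh).2⟩
  have hc1 := fun χ => h.crv_const hDx hDw P (fun _ => rfl) (him φ) (hwn φ) hφ (Point.map (W' := crv A B) φ P) (fun _ => rfl) χ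
  set R1 := Point.map (W' := crv A B) φ P - P with hR1
  have e1 : Point.map (W' := crv A B) φ P = P + R1 := by rw [hR1]; abel
  refine ⟨fun hψ => ?_, fun hψ => ?_⟩
  · have hc2 := fun χ => h.crv_const hDx hDw P (fun _ => rfl) (him ψ) (hwn ψ) hψ (Point.map (W' := crv A B) ψ P) (fun _ => rfl) χ
    set R2 := Point.map (W' := crv A B) ψ P - P with hR2
    have e2 : Point.map (W' := crv A B) ψ P = P + R2 := by rw [hR2]; abel
    have := key (φ.comp ψ) (ψ.comp φ) (by
      rw [← Point.map_map, ← Point.map_map, e1, e2, map_add, map_add, hc1, hc2, e1, e2]; abel)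
    exact this
  · have hc2 := fun χ => h.crv_const hDx hDw P (fun _ => rfl) (x1 := ψ x) (w1 := - ψ w) (by rw [neg_sq]; exact him ψ) (neg_ne_zero.2 (hwn ψ)) hψ
      (-(Point.map (W' := crv A B) ψ P)) (fun hn => by
        rw [hP, Point.map_some, Point.neg_some]; congr 1; simp [negY, crv]) χ
    set R2 := -(Point.map (W' := crv A B) ψ P) - P with hR2
    have e2 : Point.map (W' := crv A B) ψ P = -P - R2 := by rw [hR2]; abel
    have := key (φ.comp (ψ.comp φ)) ψ (by
      rw [← Point.map_map, ← Point.map_map, e1, map_add, e2, map_add, map_sub, map_neg, hc1, hc1, hc2, e1]; abel)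
    exact this

theorem minus_sq (h : EF Ω F A B x w) {D : Derivation Ω F F} (hDx : D x = 2 * w) (hDw : D w = 3 * x ^ 2 + algebraMap Ω F A)
    (ψ : F →ₐ[Ω] F) (hψ : D (ψ x) = 2 * (- ψ w)) : ψ (ψ x) = x ∧ ψ (ψ w) = w := by
  classical
  have : CharZero F := charZero_of_injective_algebraMap (algebraMap Ω F).injective
  have hw := h.w_ne
  have hn := crv_ns (A := A) (B := B) h.eq hw
  have him : (ψ w) ^ 2 = (ψ x) ^ 3 + algebraMap Ω F A * ψ x + algebraMap Ω F B := by
    rw [← map_pow, h.eq]; simp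
  have hwn : ψ w ≠ 0 := by simpa using hw
  set P : (((crv A B).baseChange F).toAffine).Point := Point.some x w hn with hP
  have hc2 := fun χ => h.crv_const hDx hDw P (fun _ => rfl) (x1 := ψ x) (w1 := - ψ w) (by rw [neg_sq]; exact him) (neg_ne_zero.2 hwn) hψ
      (-(Point.map (W' := crv A B) ψ P)) (fun hn => by
        rw [hP, Point.map_some, Point.neg_some]; congr 1; simp [negY, crv]) χ
  set R2 := -(Point.map (W' := crv A B) ψ P) - P with hR2
  have e2 : Point.map (W' := crv A B) ψ P = -P - R2 := by rw [hR2]; abel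
  have hh : Point.map (W' := crv A B) (ψ.comp ψ) P = P := by
    rw [← Point.map_map, e2, map_sub, map_neg, hc2, e2]; abel
  rw [hP, Point.map_some] at hh
  exact ⟨(Point.some.inj hh).1, (Point.some.inj hh).2⟩

end EF
end Cr

namespace Cr
open Polynomial

/-- the rational place at infinity of the base curve -/
theorem L0 {N P : Type*} [Field N] [Field P] [Algebra N P] {x y : P} (hc : y ^ 2 + y = x ^ 3 - x ^ 2)
    (ht : Transcendental N x) (hg : IntermediateField.adjoin N {x, y} = ⊤) :
    ∃ (O : ValuationSubring P) (π : P → N), x ∉ O ∧ Place N O π := by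
  classical
  have h1 : ∃ O : ValuationSubring P, (∀ c : N, algebraMap N P c ∈ O) ∧ x ∉ O := by
    by_contra h
    push Not at h
    exact ht (isAlgebraic_of_forall x h)
  obtain ⟨O, hO, hx⟩ := h1
  obtain ⟨hx0, hy0, hp, hq, he⟩ := sw_chart O hc hx
  have hP : x / y ∈ Algebra.adjoin N {x / y, 1 / y} := Algebra.subset_adjoin (by simp)
  have hQ : 1 / y ∈ Algebra.adjoin N {x / y, 1 / y} := Algebra.subset_adjoin (by simp)
  have hpO : x / y ∈ O := mem_of_vlt O hp
  have gen : IntermediateField.adjoin N {x / y, 1 / y} = ⊤ := by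
    refine adj2_congr hg ?_ ?_
    · have h1 : x / y ∈ IntermediateField.adjoin N {x / y, 1 / y} := IntermediateField.subset_adjoin _ _ (by simp)
      have h2 : 1 / y ∈ IntermediateField.adjoin N {x / y, 1 / y} := IntermediateField.subset_adjoin _ _ (by simp)
      have h3 := div_mem h1 h2
      rwa [show (x / y) / (1 / y) = x by field_simp] at h3
    · have h2 : 1 / y ∈ IntermediateField.adjoin N {x / y, 1 / y} := IntermediateField.subset_adjoin _ _ (by simp)
      have h3 := inv_mem h2
      rwa [show (1 / y)⁻¹ = y by field_simp] at h3
  have hd1 : O.valuation (1 + (1 / y + (x / y) ^ 2)) = 1 := by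
    refine v1_add O (by simp) (vlt_add O hq ?_)
    rw [sq]; exact vlt_mul O hp hpO
  have hp' : O.valuation (x / y - algebraMap N P 0) < 1 := by simpa using hp
  have hq' : O.valuation (1 / y - algebraMap N P 0) < 1 := by simpa using hq
  have hcore := core (Ω := N) O hO 0 0 hp' hq' gen (π := x / y) (d := 1 + (1 / y + (x / y) ^ 2))
    (n1 := 1 + (1 / y + (x / y) ^ 2)) (n2 := (x / y) ^ 2) hP
    (add_mem (one_mem _) (add_mem hQ (pow_mem hP 2))) (add_mem (one_mem _) (add_mem hQ (pow_mem hP 2)))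
    (pow_mem hP 2) hp hd1 (by simp) (by rw [map_zero]; linear_combination he)
  have hres : ∀ z : P, ∃ c : N, z ∈ O → O.valuation (z - algebraMap N P c) < 1 := by
    intro z
    by_cases hz : z ∈ O
    · obtain ⟨c, hc⟩ := core_res' O hO 0 0 hp' hq' hcore hz
      exact ⟨c, fun _ => hc O hO hp' hq'⟩
    · exact ⟨0, fun h => absurd h hz⟩
  choose π hπ using hres
  have huniq : ∀ z c, z ∈ O → O.valuation (z - algebraMap N P c) < 1 → π z = c := by
    intro z c hz h
    by_contra hne
    have h1 := vlt_sub O h (hπ z hz)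
    have h2 : z - algebraMap N P c - (z - algebraMap N P (π z)) = algebraMap N P (π z - c) := by
      rw [map_sub]; ring
    rw [h2, val_const O hO (sub_ne_zero.2 hne)] at h1
    exact lt_irrefl _ h1
  refine ⟨O, π, hx, ⟨?_, ?_, hO, ?_, ?_⟩⟩
  · intro a b ha hb
    apply huniq _ _ (add_mem ha hb)
    have := vlt_add O (hπ a ha) (hπ b hb)
    rw [map_add]; convert this using 2; ring
  · intro a b ha hb
    apply huniq _ _ (mul_mem ha hb)
    have h1 := vlt_mul O (hπ a ha) hb
    have h2 := vlt_mul' O (hO (π a)) (hπ b hb)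
    have := vlt_add O h1 h2
    rw [map_mul]; convert this using 2; ring
  · intro c
    apply huniq _ _ (hO c); simp
  · intro a ha
    constructor
    · intro h; have := hπ a ha; rwa [h, map_zero, sub_zero] at this
    · intro h; apply huniq _ _ ha; simpa using h

theorem alg_mem_curve {N P : Type*} [Field N] [Field P] [Algebra N P] {x y : P} (hc : y ^ 2 + y = x ^ 3 - x ^ 2)
    (ht : Transcendental N x) (hg : IntermediateField.adjoin N {x, y} = ⊤) {z : P} (hz : IsAlgebraic N z) :
    ∃ c, algebraMap N P c = z := by
  obtain ⟨O, π, -, hπ⟩ := L0 hc ht hg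
  have hO := hπ.cmem
  by_cases hz0 : z = 0
  · exact ⟨0, by simp [hz0]⟩
  have h1 : z ∈ O := (vle O).1 (val_algebraic O hO hz hz0).le
  refine ⟨π z, ?_⟩
  by_contra hne
  have h2 : z - algebraMap N P (π z) ≠ 0 := fun h => hne (by linear_combination -h)
  have h3 := val_algebraic O hO (hz.sub (isAlgebraic_algebraMap (π z))) h2
  have h4 : O.valuation (z - algebraMap N P (π z)) < 1 := by
    rw [← hπ.zero (sub_mem h1 (hO _)), hπ.sub h1 (hO _), hπ.const]; simp
  exact absurd h3 h4.ne

/-- eigenvectors of a cyclic automorphism -/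
theorem eig {M F : Type*} [Field M] [Field F] [CharZero M] [CharZero F] (j : M →+* F) (T : F →+* F) {u : M} {ζ : F} (hζ : ζ ^ 5 = 1) (hζ1 : ζ ≠ 1)
    (hTζ : T ζ = ζ) (hu : T (j u) = ζ * j u) (c : ℕ → M) (hc : ∀ i, T (j (c i)) = j (c i)) {m : M}
    (hm : m = ∑ i ∈ Finset.range 5, c i * u ^ i) {l : ℕ} (hl : l < 5) (hT : T (j m) = ζ ^ l * j m) :
    m = c l * u ^ l := by
  have h1 : ∀ n : ℕ, (ζ ^ l) ^ n * j m = ∑ i ∈ Finset.range 5, j (c i) * (ζ ^ i) ^ n * j u ^ i := by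
    intro n
    induction n with
    | zero => simp [hm]
    | succ n ih =>
      have h2 := congrArg T ih
      simp only [map_mul, map_pow, hTζ, hT, hu, map_sum, hc] at h2
      rw [pow_succ, mul_assoc, h2]
      apply Finset.sum_congr rfl
      intro i _
      ring
  have : Fact (Nat.Prime 5) := ⟨by norm_num⟩
  have ho : orderOf ζ = 5 := orderOf_eq_prime hζ hζ1
  have h5 : (5 : F) ≠ 0 := by norm_num
  have hg : ∀ i ∈ Finset.range 5, ∑ n ∈ Finset.range 5, (ζ ^ (4 * l + i)) ^ n = if i = l then 5 else 0 := by
    intro i hi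
    rw [Finset.mem_range] at hi
    split_ifs with h
    · subst h
      rw [show 4 * i + i = 5 * i by ring, pow_mul, hζ]; simp
    · have h2 : ζ ^ (4 * l + i) ≠ 1 := by
        intro h3
        have := orderOf_dvd_of_pow_eq_one h3
        rw [ho] at this
        omega
      have h4 : (ζ ^ (4 * l + i)) ^ 5 = 1 := by rw [← pow_mul, mul_comm, pow_mul, hζ, one_pow]
      rw [geom_sum_eq h2, h4]; simp
  have key : 5 * j m = 5 * (j (c l) * j u ^ l) := by
    calc 5 * j m = ∑ n ∈ Finset.range 5, (ζ ^ (4 * l)) ^ n * ((ζ ^ l) ^ n * j m) := by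
          have : ∀ n ∈ Finset.range 5, (ζ ^ (4 * l)) ^ n * ((ζ ^ l) ^ n * j m) = j m := by
            intro n _
            rw [← mul_assoc, ← mul_pow, ← pow_add, show 4 * l + l = 5 * l by ring, pow_mul, hζ]; simp
          rw [Finset.sum_congr rfl this]; simp
      _ = ∑ i ∈ Finset.range 5, (∑ n ∈ Finset.range 5, (ζ ^ (4 * l + i)) ^ n) * (j (c i) * j u ^ i) := by
          simp only [h1, Finset.mul_sum, Finset.sum_mul]
          rw [Finset.sum_comm]
          refine Finset.sum_congr rfl fun i _ => Finset.sum_congr rfl fun n _ => ?_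
          ring
      _ = _ := by
          rw [Finset.sum_congr rfl fun i hi => by rw [hg i hi]]
          simp [hl]
  apply j.injective
  rw [map_mul, map_pow]
  exact mul_left_cancel₀ h5 key
end Cr

namespace Cr
open Polynomial

/-- generators of the function field of the cover -/
structure CP (Ω : Type*) {F : Type*} [Field Ω] [Field F] [Algebra Ω F] (x y ν : F) : Prop where
  curve : y ^ 2 + y = x ^ 3 - x ^ 2
  cov : ν ^ 5 = gg true x y
  ne : ν ≠ 0
  tr : Transcendental Ω x
  gen : IntermediateField.adjoin Ω {x, y, ν} = ⊤

def XC {F : Type*} [Field F] (x y ν : F) : F := XS (x / ν) ν ((y + 1) * ν ^ 2 / x ^ 2) (y / ν ^ 2)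
def WC {F : Type*} [Field F] (x y ν : F) : F := WS (x / ν) ν ((y + 1) * ν ^ 2 / x ^ 2) (y / ν ^ 2)

variable {Ω F : Type*} [Field Ω] [Field F] [Algebra Ω F] [IsAlgClosed Ω] [CharZero Ω] {x y ν x' y' ν' : F}

theorem CP.x0 (h : CP Ω x y ν) : x ≠ 0 := by
  rintro rfl; exact h.tr isAlgebraic_zero

theorem CP.q5 (h : CP Ω x y ν) : Q5 (x / ν) ν ((y + 1) * ν ^ 2 / x ^ 2) (y / ν ^ 2) := by
  have : CharZero F := charZero_of_injective_algebraMap (algebraMap Ω F).injective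
  exact Q5.of h.curve h.cov h.x0 h.ne

theorem CP.mem (h : CP Ω x y ν) {E : IntermediateField Ω F} (hX : XC x y ν ∈ E) (hW : WC x y ν ∈ E) :
    x ∈ E ∧ y ∈ E ∧ ν ∈ E := by
  have : CharZero F := charZero_of_injective_algebraMap (algebraMap Ω F).injective
  obtain ⟨h1, h2, h3, h4⟩ := h.q5.mem hX hW
  have hν := h.ne
  refine ⟨?_, ?_, h2⟩
  · have := mul_mem h1 h2
    rwa [div_mul_cancel₀ _ hν] at this
  · have := mul_mem h4 (pow_mem h2 2)
    rwa [div_mul_cancel₀ _ (pow_ne_zero _ hν)] at this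

theorem CP.ef (h : CP Ω x y ν) : EF Ω F (-31 / 3) (-2501 / 108) (XC x y ν) (WC x y ν) := by
  have : CharZero F := charZero_of_injective_algebraMap (algebraMap Ω F).injective
  have he : (WC x y ν) ^ 2 = (XC x y ν) ^ 3 + algebraMap Ω F (-31 / 3) * XC x y ν + algebraMap Ω F (-2501 / 108) := by
    simp only [map_div₀, map_neg, map_ofNat]
    exact h.q5.short
  refine ⟨he, ?_, ?_⟩
  · intro hX
    obtain ⟨c, hc⟩ := const_of_algebraic hX
    have hW : IsAlgebraic Ω (WC x y ν) := by
      apply IsAlgebraic.of_pow (n := 2) (by norm_num)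
      rw [he]
      exact ((hX.pow 3).add ((isAlgebraic_algebraMap _).mul hX)).add (isAlgebraic_algebraMap _)
    obtain ⟨d, hd⟩ := const_of_algebraic hW
    have := (h.mem (E := ⊥) ⟨c, hc⟩ ⟨d, hd⟩).1
    obtain ⟨e, he⟩ := this
    apply h.tr
    rw [← he]; exact isAlgebraic_algebraMap _
  · rw [eq_top_iff, ← h.gen, IntermediateField.adjoin_le_iff]
    have := h.mem (E := IntermediateField.adjoin Ω {XC x y ν, WC x y ν})
      (IntermediateField.subset_adjoin _ _ (by simp)) (IntermediateField.subset_adjoin _ _ (by simp))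
    rintro z (rfl | rfl | rfl)
    · exact this.1
    · exact this.2.1
    · exact this.2.2

theorem CP.hom (h : CP Ω x y ν) (h' : CP Ω x' y' ν') : ∃ α : F →ₐ[Ω] F,
    α (XC x y ν) = XC x' y' ν' ∧ α (WC x y ν) = WC x' y' ν' ∧ α x = x' ∧ α y = y' ∧ α ν = ν' := by
  have : CharZero F := charZero_of_injective_algebraMap (algebraMap Ω F).injective
  obtain ⟨α, hX, hW⟩ := h.ef.lift h'.ef.eq h'.ef.tr
  refine ⟨α, hX, hW, ?_⟩
  have q := h.q5.map (α : F →+* F)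
  have q' := h'.q5
  have eX : X0 (α (x / ν)) (α ν) (α ((y + 1) * ν ^ 2 / x ^ 2)) (α (y / ν ^ 2)) =
      X0 (x' / ν') ν' ((y' + 1) * ν' ^ 2 / x' ^ 2) (y' / ν' ^ 2) := by
    have := X0_map (α : F →+* F) (a := x / ν) (b := ν) (c := (y + 1) * ν ^ 2 / x ^ 2) (d := y / ν ^ 2)
    refine this.trans ?_
    rw [XC, XC, XS, XS, map_sub, map_div₀, map_ofNat, map_ofNat] at hX
    exact sub_left_injective hX
  have eW : W0 (α (x / ν)) (α ν) (α ((y + 1) * ν ^ 2 / x ^ 2)) (α (y / ν ^ 2)) =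
      W0 (x' / ν') ν' ((y' + 1) * ν' ^ 2 / x' ^ 2) (y' / ν' ^ 2) := by
    have := W0_map (α : F →+* F) (a := x / ν) (b := ν) (c := (y + 1) * ν ^ 2 / x ^ 2) (d := y / ν ^ 2)
    refine this.trans ?_
    rw [WC, WC, WS, WS, map_add, map_div₀, map_ofNat, map_ofNat] at hW
    exact add_left_injective _ hW
  have e1 : α (x / ν) = x' / ν' := by
    apply mul_left_cancel₀ q'.psi_ne
    rw [q'.psi_a, ← eX, ← eW]; exact q.psi_a
  have e2 : α ν = ν' := by
    apply mul_left_cancel₀ q'.psi_ne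
    rw [q'.psi_b, ← eX, ← eW]; exact q.psi_b
  have e4 : α (y / ν ^ 2) = y' / ν' ^ 2 := by
    apply mul_left_cancel₀ q'.psi_ne
    rw [q'.psi_d, ← eX, ← eW]; exact q.psi_d
  have hν := h'.ne
  refine ⟨?_, ?_, e2⟩
  · rw [map_div₀, e2] at e1; field_simp at e1; exact e1
  · rw [map_div₀, map_pow, e2] at e4; field_simp at e4; exact e4

theorem EF.hom_ext {A B : Ω} {x w : F} (h : EF Ω F A B x w) {f g : F →ₐ[Ω] F} (hx : f x = g x) (hw : f w = g w) (z : F) : f z = g z := by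
  have hz : z ∈ IntermediateField.adjoin Ω {x, w} := by rw [h.gen]; trivial
  induction hz using IntermediateField.adjoin_induction with
  | mem z hz =>
    rcases hz with rfl | rfl
    · exact hx
    · exact hw
  | algebraMap c => simp
  | add a b _ _ ha hb => rw [map_add, map_add, ha, hb]
  | inv a _ ha => rw [map_inv₀, map_inv₀, ha]
  | mul a b _ _ ha hb => rw [map_mul, map_mul, ha, hb]

/-- the deck transformation, and its effect on a second set of generators -/
theorem CP.deck (h : CP Ω x y ν) : ∃ (T : F →ₐ[Ω] F) (ζ : Ω), ζ ^ 5 = 1 ∧ ζ ≠ 1 ∧ T x = x ∧ T y = y ∧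
    T ν = algebraMap Ω F ζ * ν ∧ ∀ {x' y' ν' : F}, CP Ω x' y' ν' → T x' = x' ∧ T y' = y' ∧
      ∃ l : ℕ, (l = 1 ∨ l = 4) ∧ T ν' = algebraMap Ω F ζ ^ l * ν' := by
  have : CharZero F := charZero_of_injective_algebraMap (algebraMap Ω F).injective
  obtain ⟨ζ, hζ⟩ := HasEnoughRootsOfUnity.exists_primitiveRoot Ω 5
  have hζ5 : ζ ^ 5 = 1 := hζ.pow_eq_one
  have hζ1 : ζ ≠ 1 := hζ.ne_one (by norm_num)
  have hζ0 : ζ ≠ 0 := hζ.ne_zero (by norm_num)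
  have hz5 : algebraMap Ω F ζ ^ 5 = 1 := by rw [← map_pow, hζ5, map_one]
  have hz0 : algebraMap Ω F ζ ≠ 0 := by simpa using hζ0
  have h2 : CP Ω x y (algebraMap Ω F ζ * ν) := by
    refine ⟨h.curve, by rw [mul_pow, hz5, one_mul, h.cov], mul_ne_zero hz0 h.ne, h.tr, ?_⟩
    rw [eq_top_iff, ← h.gen, IntermediateField.adjoin_le_iff]
    rintro z (rfl | rfl | rfl)
    · exact IntermediateField.subset_adjoin _ _ (by simp)
    · exact IntermediateField.subset_adjoin _ _ (by simp)
    · have h3 : algebraMap Ω F ζ * z ∈ IntermediateField.adjoin Ω {x, y, algebraMap Ω F ζ * z} :=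
        IntermediateField.subset_adjoin _ _ (by simp)
      have h4 := div_mem h3 (IntermediateField.algebraMap_mem (IntermediateField.adjoin Ω {x, y, algebraMap Ω F ζ * z}) ζ)
      rwa [mul_div_cancel_left₀ _ hz0] at h4
  obtain ⟨T, hTX, hTW, hTx, hTy, hTν⟩ := h.hom h2
  obtain ⟨D, hDx, hDw⟩ := h.ef.exists_D
  have hd : 4 * (-31 / 3 : Ω) ^ 3 + 27 * (-2501 / 108) ^ 2 ≠ 0 := by norm_num
  have hA : (-31 / 3 : Ω) ≠ 0 := by norm_num
  have hB : (-2501 / 108 : Ω) ≠ 0 := by norm_num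
  have hTplus : D (T (XC x y ν)) = 2 * T (WC x y ν) := by
    rw [hTX, hTW]
    rcases h.ef.M8b hd hA hB hDx hDw h2.ef with h3 | h3
    · exact h3
    · exfalso
      rw [← hTX, ← hTW] at h3
      obtain ⟨h4, h5⟩ := h.ef.minus_sq hDx hDw T h3
      have h6 := h.ef.hom_ext (f := T.comp T) (g := AlgHom.id Ω F) h4 h5 ν
      simp only [AlgHom.comp_apply, AlgHom.id_apply, hTν, map_mul, AlgHom.commutes] at h6
      have h7 : algebraMap Ω F ζ ^ 2 = 1 := mul_right_cancel₀ h.ne (by linear_combination h6)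
      have h8 : ζ ^ 2 = 1 := (algebraMap Ω F).injective (by rw [map_pow, h7, map_one])
      have := hζ.pow_ne_one_of_pos_of_lt (l := 2) (by norm_num) (by norm_num)
      exact this h8
  refine ⟨T, ζ, hζ5, hζ1, hTx, hTy, hTν, ?_⟩
  intro x' y' ν' h'
  obtain ⟨α, hX, hW, hx, hy, hν⟩ := h.hom h'
  obtain ⟨c1, c2⟩ := h.ef.comm_pm hDx hDw T α hTplus
  rcases h.ef.M8b hd hA hB hDx hDw h'.ef with h3 | h3
  · rw [← hX, ← hW] at h3
    obtain ⟨h4, h5⟩ := c1 h3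
    have h6 := h.ef.hom_ext (f := T.comp α) (g := α.comp T) h4 h5
    simp only [AlgHom.comp_apply] at h6
    refine ⟨?_, ?_, 1, Or.inl rfl, ?_⟩
    · rw [← hx, h6, hTx]
    · rw [← hy, h6, hTy]
    · rw [← hν, h6, hTν, map_mul, AlgHom.commutes, pow_one]
  · rw [← hX, ← hW] at h3
    obtain ⟨h4, h5⟩ := c2 h3
    have h6 := h.ef.hom_ext (f := T.comp (α.comp T)) (g := α) h4 h5
    simp only [AlgHom.comp_apply] at h6
    refine ⟨?_, ?_, 4, Or.inr rfl, ?_⟩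
    · have := h6 x; rwa [hTx, hx] at this
    · have := h6 y; rwa [hTy, hy] at this
    · have := h6 ν; rw [hTν, map_mul, map_mul, AlgHom.commutes, AlgHom.commutes, hν] at this
      linear_combination algebraMap Ω F ζ ^ 4 * this - T ν' * hz5
end Cr

namespace Cr
open Polynomial

theorem top_of_gens {Ω Λ : Type*} [Field Ω] [Field Λ] [Algebra Ω Λ] {S : Set Λ} {P : IntermediateField Ω Λ}
    (hP : P = IntermediateField.adjoin Ω S) {E : IntermediateField Ω P}
    (h : ∀ s (hs : s ∈ P), s ∈ S → (⟨s, hs⟩ : P) ∈ E) : E = ⊤ := by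
  rw [eq_top_iff]
  rintro ⟨z, hz⟩ -
  have h1 : P ≤ E.map P.val := by
    conv_lhs => rw [hP]
    rw [IntermediateField.adjoin_le_iff]
    intro s hs
    exact ⟨⟨s, by rw [hP]; exact IntermediateField.subset_adjoin _ _ hs⟩, h s _ hs, rfl⟩
  obtain ⟨w, hw, hwz⟩ := h1 hz
  have : w = ⟨z, hz⟩ := Subtype.ext hwz
  rwa [← this]

theorem expand5 {P M : Type*} [Field P] [Field M] [Algebra P M] {u : M} {g : P} (hu : u ^ 5 = algebraMap P M g)
    (hg : IntermediateField.adjoin P {u} = ⊤) (m : M) : ∃ c : ℕ → P, m = ∑ i ∈ Finset.range 5, algebraMap P M (c i) * u ^ i := by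
  have hmon : (X ^ 5 - C g : P[X]).Monic := monic_X_pow_sub_C g (by norm_num)
  have hroot : aeval u (X ^ 5 - C g : P[X]) = 0 := by simp [hu]
  have hInt : IsIntegral P u := ⟨X ^ 5 - C g, hmon, by simpa [aeval_def] using hroot⟩
  have h1 : m ∈ (IntermediateField.adjoin P {u}).toSubalgebra := by rw [hg]; trivial
  rw [IntermediateField.adjoin_simple_toSubalgebra_of_isAlgebraic hInt.isAlgebraic, Algebra.adjoin_singleton_eq_range_aeval] at h1
  obtain ⟨p, rfl⟩ := h1
  refine ⟨fun i => (p %ₘ (X ^ 5 - C g)).coeff i, ?_⟩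
  have h2 := modByMonic_add_div p (X ^ 5 - C g)
  have h3 : aeval u p = aeval u (p %ₘ (X ^ 5 - C g)) := by
    conv_lhs => rw [← h2]
    rw [map_add, map_mul, hroot, zero_mul, add_zero]
  have h4 : (p %ₘ (X ^ 5 - C g)).natDegree < 5 := by
    have := natDegree_modByMonic_lt p hmon (by
      intro h; have := congrArg natDegree h; rw [natDegree_X_pow_sub_C] at this; simp at this)
    rwa [natDegree_X_pow_sub_C] at this
  have h5 := aeval_eq_sum_range' h4 u
  refine (h3.trans h5).trans (Finset.sum_congr rfl fun i _ => ?_)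
  rw [Algebra.smul_def]

/-- the field of the tower -/
def NN (k : Type*) {M : Type*} [Field k] [Field M] [Algebra k M] (R : ℕ) (xs ys : ℕ → M) : IntermediateField k M :=
  IntermediateField.adjoin k (Set.range (tw R xs ys))

/-- uniform presentations -/
structure UN (k : Type*) {M : Type*} [Field k] [Field M] [Algebra k M] (e R : ℕ) (xs ys : ℕ → M) (x y u : M) : Prop where
  te : ∃ i v, TE i R xs ys x y v
  une : u ≠ 0
  cover : (1 - ys 0 ^ 5) ^ e * u ^ 5 = gg true x y
  gen : IntermediateField.adjoin k (Set.range (tw R xs ys) ∪ {x, y, u}) = ⊤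
  ind : AlgebraicIndependent k (wf R xs ys x)

section s
variable {k M : Type*} [Field k] [Field M] [Algebra k M] {e e' R : ℕ} {xs ys xs' ys' : ℕ → M} {x y u x' y' u' : M}

theorem UN.tr (h : UN k e R xs ys x y u) : Transcendental (NN k R xs ys) x := by
  have h1 : AlgebraicIndependent k (fun o : Option (Option (Fin R)) => o.elim x (tw R xs ys)) := h.ind
  have h2 := (AlgebraicIndependent.option_iff.1 h1).2
  intro h3
  exact h2 (isAlg_adjoin_iff.1 h3)

theorem UN.curve (h : UN k e R xs ys x y u) : y ^ 2 + y = x ^ 3 - x ^ 2 := by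
  obtain ⟨i, v, h1⟩ := h.te; exact h1.curve

theorem UN.fne (h : UN k e R xs ys x y u) : 1 - ys 0 ^ 5 ≠ 0 := by
  obtain ⟨i, v, h1⟩ := h.te; exact h1.one_sub_ne

theorem UN.tw_mem (o) : tw R xs ys o ∈ NN k R xs ys := IntermediateField.subset_adjoin _ _ ⟨o, rfl⟩

theorem UN.y0_mem (h : UN k e R xs ys x y u) : ys 0 ∈ NN k R xs ys := by
  obtain ⟨i, v, h1⟩ := h.te
  exact ys_mem h1.tower h1.ne UN.tw_mem 0 (by omega)

theorem UN.f_mem (h : UN k e R xs ys x y u) : 1 - ys 0 ^ 5 ∈ NN k R xs ys :=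
  sub_mem (one_mem _) (pow_mem h.y0_mem _)

/-- the field of the base curve -/
def PP (k : Type*) {M : Type*} [Field k] [Field M] [Algebra k M] (R : ℕ) (xs ys : ℕ → M) (x y : M) : IntermediateField (NN k R xs ys) M :=
  IntermediateField.adjoin (NN k R xs ys) {x, y}

theorem UN.x_mem : x ∈ PP k R xs ys x y := IntermediateField.subset_adjoin _ _ (by simp)
theorem UN.yy_mem : y ∈ PP k R xs ys x y := IntermediateField.subset_adjoin _ _ (by simp)
theorem UN.N_mem {z : M} (hz : z ∈ NN k R xs ys) : z ∈ PP k R xs ys x y := (PP k R xs ys x y).algebraMap_mem ⟨z, hz⟩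

theorem UN.ptop : IntermediateField.adjoin (NN k R xs ys) {(⟨x, UN.x_mem⟩ : PP k R xs ys x y), ⟨y, UN.yy_mem⟩} = ⊤ := by
  apply top_of_gens (P := PP k R xs ys x y) (S := {x, y}) rfl
  rintro s hs (rfl | rfl)
  · exact IntermediateField.subset_adjoin _ _ (by simp)
  · exact IntermediateField.subset_adjoin _ _ (by simp)

theorem UN.ptr (h : UN k e R xs ys x y u) : Transcendental (NN k R xs ys) (⟨x, UN.x_mem⟩ : PP k R xs ys x y) := by
  intro h1
  exact h.tr (h1.algebraMap (A := M))

theorem UN.pcurve (h : UN k e R xs ys x y u) : (⟨y, UN.yy_mem⟩ : PP k R xs ys x y) ^ 2 + ⟨y, UN.yy_mem⟩ = ⟨x, UN.x_mem⟩ ^ 3 - ⟨x, UN.x_mem⟩ ^ 2 :=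
  Subtype.ext h.curve

theorem UN.alg_mem (h : UN k e R xs ys x y u) {z : M} (hz : z ∈ PP k R xs ys x y) (ha : IsAlgebraic (NN k R xs ys) z) : z ∈ NN k R xs ys := by
  have ha' : IsAlgebraic (NN k R xs ys) (⟨z, hz⟩ : PP k R xs ys x y) :=
    (isAlgebraic_algebraMap_iff (A := M) (algebraMap (PP k R xs ys x y) M).injective).1 ha
  obtain ⟨c, hc⟩ := alg_mem_curve h.pcurve h.ptr UN.ptop ha'
  have : (c : M) = z := congrArg Subtype.val hc
  rw [← this]; exact c.2

theorem UN.expand (h : UN k e R xs ys x y u) (m : M) : ∃ c : ℕ → M, (∀ i, c i ∈ PP k R xs ys x y) ∧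
    m = ∑ i ∈ Finset.range 5, c i * u ^ i := by
  have hg : gg true x y / (1 - ys 0 ^ 5) ^ e ∈ PP k R xs ys x y :=
    div_mem (gg_mem _ UN.x_mem UN.yy_mem) (pow_mem (UN.N_mem h.f_mem) _)
  have h1 : u ^ 5 = algebraMap (PP k R xs ys x y) M ⟨_, hg⟩ := by
    change u ^ 5 = gg true x y / (1 - ys 0 ^ 5) ^ e
    rw [eq_div_iff (pow_ne_zero _ h.fne), ← h.cover]; ring
  have h2 : IntermediateField.adjoin (PP k R xs ys x y) {u} = ⊤ := by
    rw [eq_top_iff]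
    intro z _
    have hz : z ∈ IntermediateField.adjoin k (Set.range (tw R xs ys) ∪ {x, y, u}) := by rw [h.gen]; trivial
    have h3 : ∀ w ∈ PP k R xs ys x y, w ∈ IntermediateField.adjoin (PP k R xs ys x y) {u} := fun w hw =>
      (IntermediateField.adjoin (PP k R xs ys x y) {u}).algebraMap_mem ⟨w, hw⟩
    induction hz using IntermediateField.adjoin_induction with
    | mem z hz =>
      rcases hz with ⟨o, rfl⟩ | rfl | rfl | rfl
      · exact h3 _ (UN.N_mem (UN.tw_mem o))
      · exact h3 _ UN.x_mem
      · exact h3 _ UN.yy_mem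
      · exact IntermediateField.mem_adjoin_simple_self _ _
    | algebraMap c => exact h3 _ (UN.N_mem ((NN k R xs ys).algebraMap_mem c))
    | add a b _ _ ha hb => exact add_mem (ha trivial) (hb trivial)
    | inv a _ ha => exact inv_mem (ha trivial)
    | mul a b _ _ ha hb => exact mul_mem (ha trivial) (hb trivial)
  obtain ⟨c, hc⟩ := expand5 h1 h2 m
  exact ⟨fun i => c i, fun i => (c i).2, hc⟩
end s
end Cr

namespace Cr
open Polynomial
section s
variable {k M : Type*} [Field k] [Field M] [Algebra k M] {e e' R : ℕ} {xs ys xs' ys' : ℕ → M} {x y u x' y' u' : M}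

/-- geometric model over an algebraically closed constant field -/
theorem UN.model.{v} {k : Type*} {M : Type v} [Field k] [Field M] [Algebra k M] [CharZero k] {xs ys : ℕ → M} {x y u : M} (h : UN k e R xs ys x y u) :
    ∃ (Ω F : Type v) (_ : Field Ω) (_ : Field F) (_ : Algebra Ω F) (_ : IsAlgClosed Ω) (_ : CharZero Ω)
      (j : M →+* F) (φ : Ω), φ ≠ 0 ∧ CP Ω (j x) (j y) (algebraMap Ω F φ * j u) ∧
      (∀ z, (∃ c : Ω, algebraMap Ω F c = j z) ↔ IsAlgebraic (NN k R xs ys) z) := by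
  let N := NN k R xs ys
  let Λ := AlgebraicClosure M
  let Ω := algebraicClosure N Λ
  have hΩ : IsAlgClosed Ω := (algebraicClosure.isAlgClosure N Λ).1
  have hcN : CharZero N := charZero_of_injective_algebraMap (algebraMap k N).injective
  have hc : CharZero Ω := charZero_of_injective_algebraMap (algebraMap N Ω).injective
  have htr : Transcendental Ω (algebraMap M Λ x) := by
    have : Transcendental N (algebraMap M Λ x) := (transcendental_algebraMap_iff (algebraMap M Λ).injective).2 h.tr
    exact this.algebraicClosure
  let F := IntermediateField.adjoin Ω {algebraMap M Λ x, algebraMap M Λ y, algebraMap M Λ u}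
  have hNΩ : ∀ z (hz : z ∈ NN k R xs ys), algebraMap M Λ z ∈ F := by
    intro z hz
    have : algebraMap M Λ z = algebraMap Ω Λ (algebraMap N Ω ⟨z, hz⟩) := rfl
    rw [this]; exact F.algebraMap_mem _
  have hF : ∀ z, algebraMap M Λ z ∈ F := by
    intro z
    have hz : z ∈ IntermediateField.adjoin k (Set.range (tw R xs ys) ∪ {x, y, u}) := by rw [h.gen]; trivial
    induction hz using IntermediateField.adjoin_induction with
    | mem z hz =>
      rcases hz with ⟨o, rfl⟩ | rfl | rfl | rfl
      · exact hNΩ _ (UN.tw_mem o)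
      · exact IntermediateField.subset_adjoin _ _ (by simp)
      · exact IntermediateField.subset_adjoin _ _ (by simp)
      · exact IntermediateField.subset_adjoin _ _ (by simp)
    | algebraMap c => exact hNΩ _ ((NN k R xs ys).algebraMap_mem c)
    | add a b _ _ ha hb => rw [map_add]; exact add_mem ha hb
    | inv a _ ha => rw [map_inv₀]; exact inv_mem ha
    | mul a b _ _ ha hb => rw [map_mul]; exact mul_mem ha hb
  let j : M →+* F := (algebraMap M Λ).codRestrict F.toSubfield.toSubring hF
  let f : Ω := algebraMap N Ω ⟨_, h.f_mem⟩
  have hf : algebraMap Ω F f = j (1 - ys 0 ^ 5) := rfl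
  obtain ⟨φ, hφ⟩ := IsAlgClosed.exists_pow_nat_eq (f ^ e) (n := 5) (by norm_num)
  have hf0 : f ≠ 0 := by
    intro h0
    have h1 : j (1 - ys 0 ^ 5) = 0 := by rw [← hf, h0, map_zero]
    exact h.fne (j.injective (by rw [h1, map_zero]))
  have hφ0 : φ ≠ 0 := by
    rintro rfl
    rw [zero_pow (by norm_num)] at hφ
    exact pow_ne_zero _ hf0 hφ.symm
  have hφF : algebraMap Ω F φ ≠ 0 := by simpa using hφ0
  refine ⟨Ω, F, inferInstance, inferInstance, inferInstance, hΩ, hc, j, φ, hφ0, ⟨?_, ?_, ?_, ?_, ?_⟩, ?_⟩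
  · simpa using congrArg j h.curve
  · have h1 := congrArg j h.cover
    rw [gg_map] at h1
    rw [← h1, mul_pow, ← map_pow, hφ, map_pow, hf]; simp
  · exact mul_ne_zero hφF (by simpa using h.une)
  · intro h1
    exact htr (h1.algebraMap (A := Λ))
  · apply top_of_gens (P := F) rfl
    have a1 : j x ∈ IntermediateField.adjoin Ω {j x, j y, algebraMap Ω F φ * j u} := IntermediateField.subset_adjoin _ _ (by simp)
    have a2 : j y ∈ IntermediateField.adjoin Ω {j x, j y, algebraMap Ω F φ * j u} := IntermediateField.subset_adjoin _ _ (by simp)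
    have a3 : algebraMap Ω F φ * j u ∈ IntermediateField.adjoin Ω {j x, j y, algebraMap Ω F φ * j u} := IntermediateField.subset_adjoin _ _ (by simp)
    have a4 := div_mem a3 (IntermediateField.algebraMap_mem _ φ)
    rw [mul_div_cancel_left₀ _ hφF] at a4
    rintro s hs (rfl | rfl | rfl)
    · exact a1
    · exact a2
    · exact a4
  · intro z
    have h1 : IsAlgebraic N z ↔ IsAlgebraic N (algebraMap M Λ z) :=
      (isAlgebraic_algebraMap_iff (algebraMap M Λ).injective).symm
    constructor
    · rintro ⟨c, hc⟩
      refine h1.2 ?_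
      have h2 : (c : Λ) = algebraMap M Λ z := congrArg Subtype.val hc
      rw [← h2]
      exact mem_algebraicClosure_iff.1 c.2
    · intro hz
      exact ⟨⟨algebraMap M Λ z, mem_algebraicClosure_iff.2 (h1.1 hz)⟩, rfl⟩

theorem alg_y {Ω F : Type*} [Field Ω] [Field F] [Algebra Ω F] [CharZero F] {x y : F} (hc : y ^ 2 + y = x ^ 3 - x ^ 2)
    (hx : x ∈ algebraicClosure Ω F) : y ∈ algebraicClosure Ω F := by
  have h1 : 2 * y + 1 ∈ algebraicClosure Ω F := by
    rw [mem_algebraicClosure_iff]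
    apply IsAlgebraic.of_pow (n := 2) (by norm_num)
    rw [← mem_algebraicClosure_iff]
    rw [show (2 * y + 1) ^ 2 = 1 + 4 * (x ^ 3 - x ^ 2) by linear_combination 4 * hc]
    exact add_mem (one_mem _) (mul_mem (ofNat_mem _ 4) (sub_mem (pow_mem hx 3) (pow_mem hx 2)))
  rw [show y = (2 * y + 1 - 1) / 2 by ring]
  exact div_mem (sub_mem h1 (one_mem _)) (ofNat_mem _ 2)

theorem UN.L1 [CharZero k] (h : UN k e R xs ys x y u) (h' : UN k e' R xs' ys' x' y' u') :
    (∀ o, tw R xs' ys' o ∈ NN k R xs ys) ∧ x' ∈ PP k R xs ys x y ∧ y' ∈ PP k R xs ys x y ∧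
      ∃ l : ℕ, (l = 1 ∨ l = 4) ∧ ∃ H ∈ PP k R xs ys x y, u' = H * u ^ l := by
  obtain ⟨Ω, F, _, _, _, _, _, j, φ, hφ0, hcp, hj⟩ := h.model
  have hcF : CharZero F := charZero_of_injective_algebraMap (algebraMap Ω F).injective
  have hcM : CharZero M := charZero_of_injective_algebraMap (algebraMap k M).injective
  have hφF : algebraMap Ω F φ ≠ 0 := by simpa using hφ0
  have hk : ∀ c : k, ∃ d : Ω, algebraMap Ω F d = j (algebraMap k M c) := fun c =>
    (hj _).2 (isAlgebraic_algebraMap (algebraMap k (NN k R xs ys) c))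
  -- the second tower is constant
  have hconst : ∀ o, ∃ c : Ω, algebraMap Ω F c = j (tw R xs' ys' o) := by
    obtain ⟨i, v, hte⟩ := h'.te
    obtain ⟨h1, h2⟩ := hcp.ef.mach (by norm_num) (hte.map j)
    rintro (_ | o)
    · exact h2 R le_rfl
    · exact h1 o o.2
  have hy0 : ∃ c : Ω, algebraMap Ω F c = j (ys' 0) := by
    obtain ⟨i, v, hte⟩ := h'.te
    exact (hcp.ef.mach (by norm_num) (hte.map j)).2 0 (by omega)
  obtain ⟨c0, hc0⟩ := hy0
  obtain ⟨φ', hφ'⟩ := IsAlgClosed.exists_pow_nat_eq ((1 - c0 ^ 5) ^ e') (n := 5) (by norm_num)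
  have hff : algebraMap Ω F (1 - c0 ^ 5) = j (1 - ys' 0 ^ 5) := by simp [hc0]
  have hφ'0 : φ' ≠ 0 := by
    rintro rfl
    rw [zero_pow (by norm_num)] at hφ'
    have h1 : (1 - c0 ^ 5) = 0 := by
      by_contra hne; exact pow_ne_zero _ hne hφ'.symm
    rw [h1, map_zero] at hff
    exact h'.fne (j.injective (by rw [← hff, map_zero]))
  have hφ'F : algebraMap Ω F φ' ≠ 0 := by simpa using hφ'0
  have hcov : (algebraMap Ω F φ' * j u') ^ 5 = gg true (j x') (j y') := by
    have h1 := congrArg j h'.cover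
    rw [gg_map] at h1
    rw [← h1, mul_pow, ← map_pow, hφ', map_pow, hff]; simp
  have htop : ∀ E : IntermediateField Ω F, j x' ∈ E → j y' ∈ E → j u' ∈ E → E = ⊤ := by
    intro E hx hy hu
    have h1 : ∀ z, j z ∈ E := by
      intro z
      have hz : z ∈ IntermediateField.adjoin k (Set.range (tw R xs' ys') ∪ {x', y', u'}) := by rw [h'.gen]; trivial
      induction hz using IntermediateField.adjoin_induction with
      | mem z hz =>
        rcases hz with ⟨o, rfl⟩ | rfl | rfl | rfl
        · obtain ⟨c, hc⟩ := hconst o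
          rw [← hc]; exact E.algebraMap_mem c
        · exact hx
        · exact hy
        · exact hu
      | algebraMap c => obtain ⟨d, hd⟩ := hk c; rw [← hd]; exact E.algebraMap_mem d
      | add a b _ _ ha hb => rw [map_add]; exact add_mem ha hb
      | inv a _ ha => rw [map_inv₀]; exact inv_mem ha
      | mul a b _ _ ha hb => rw [map_mul]; exact mul_mem ha hb
    rw [eq_top_iff, ← hcp.gen, IntermediateField.adjoin_le_iff]
    rintro z (rfl | rfl | rfl)
    · exact h1 x
    · exact h1 y
    · exact mul_mem (E.algebraMap_mem φ) (h1 u)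
  have hcur : (j y') ^ 2 + j y' = (j x') ^ 3 - (j x') ^ 2 := by simpa using congrArg j h'.curve
  have hcp' : CP Ω (j x') (j y') (algebraMap Ω F φ' * j u') := by
    refine ⟨hcur, hcov, mul_ne_zero hφ'F (by simpa using h'.une), ?_, ?_⟩
    · intro hx
      rw [← mem_algebraicClosure_iff] at hx
      have hy := alg_y hcur hx
      have hν : algebraMap Ω F φ' * j u' ∈ algebraicClosure Ω F := by
        rw [mem_algebraicClosure_iff]
        apply IsAlgebraic.of_pow (n := 5) (by norm_num)
        rw [hcov, ← mem_algebraicClosure_iff]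
        exact gg_mem _ hx hy
      have hu := div_mem hν ((algebraicClosure Ω F).algebraMap_mem φ')
      rw [mul_div_cancel_left₀ _ hφ'F] at hu
      have := htop _ hx hy hu
      have h1 : j x ∈ algebraicClosure Ω F := by rw [this]; trivial
      exact hcp.tr (mem_algebraicClosure_iff.1 h1)
    · have a3 : algebraMap Ω F φ' * j u' ∈ IntermediateField.adjoin Ω {j x', j y', algebraMap Ω F φ' * j u'} := IntermediateField.subset_adjoin _ _ (by simp)
      have a4 := div_mem a3 (IntermediateField.algebraMap_mem _ φ')
      rw [mul_div_cancel_left₀ _ hφ'F] at a4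
      exact htop _ (IntermediateField.subset_adjoin _ _ (by simp)) (IntermediateField.subset_adjoin _ _ (by simp)) a4
  obtain ⟨T, ζ, hζ5, hζ1, hTx, hTy, hTν, hT'⟩ := hcp.deck
  obtain ⟨hTx', hTy', l, hl, hTν'⟩ := hT' hcp'
  rw [map_mul, AlgHom.commutes] at hTν hTν'
  have hTu : T (j u) = algebraMap Ω F ζ * j u := mul_left_cancel₀ hφF (by rw [hTν]; ring)
  have hTu' : T (j u') = algebraMap Ω F ζ ^ l * j u' := mul_left_cancel₀ hφ'F (by rw [hTν']; ring)
  have hTP : ∀ c ∈ PP k R xs ys x y, T (j c) = j c := by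
    intro c hc
    rw [PP] at hc
    induction hc using IntermediateField.adjoin_induction with
    | mem z hz =>
      rcases hz with rfl | rfl
      · exact hTx
      · exact hTy
    | algebraMap c =>
      obtain ⟨d, hd⟩ := (hj _).2 (isAlgebraic_algebraMap (A := M) c)
      rw [← hd, AlgHom.commutes]
    | add a b _ _ ha hb => rw [map_add, map_add, ha, hb]
    | inv a _ ha => rw [map_inv₀, map_inv₀, ha]
    | mul a b _ _ ha hb => rw [map_mul, map_mul, ha, hb]
  have main : ∀ (m : M) (l : ℕ), l < 5 → T (j m) = algebraMap Ω F ζ ^ l * j m → ∃ H ∈ PP k R xs ys x y, m = H * u ^ l := by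
    intro m l hl hm
    obtain ⟨c, hcP, hc⟩ := h.expand m
    refine ⟨c l, hcP l, ?_⟩
    refine eig j (T : F →+* F) (ζ := algebraMap Ω F ζ) (by rw [← map_pow, hζ5, map_one]) ?_ (T.commutes ζ) hTu c
      (fun i => hTP _ (hcP i)) hc hl hm
    intro h1; exact hζ1 ((algebraMap Ω F).injective (by rw [h1, map_one]))
  have main0 : ∀ m : M, T (j m) = j m → m ∈ PP k R xs ys x y := by
    intro m hm
    obtain ⟨H, hH, rfl⟩ := main m 0 (by norm_num) (by rw [hm]; simp)
    simpa using hH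
  refine ⟨?_, main0 _ hTx', main0 _ hTy', l, hl, main u' l (by omega) hTu'⟩
  intro o
  obtain ⟨c, hc⟩ := hconst o
  refine h.alg_mem (main0 _ (by rw [← hc, AlgHom.commutes])) ((hj _).1 ⟨c, hc⟩)
end s
end Cr

namespace Cr

theorem exists_der {k L ι : Type*} [Field k] [Field L] [Algebra k L] {a : ι → L} (hi : AlgebraicIndependent k a)
    (hg : IntermediateField.adjoin k (Set.range a) = ⊤) (d : ι → L) : ∃ D : Derivation k L L, ∀ i, D (a i) = d i := by
  have hfr : IsFractionRing (Algebra.adjoin k (Set.range a)) L := by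
    apply IsFractionRing.of_field
    intro z
    have hz : z ∈ IntermediateField.adjoin k (Set.range a) := by rw [hg]; trivial
    obtain ⟨r, hr, s, hs, h⟩ := IntermediateField.mem_adjoin_iff_div.1 hz
    exact ⟨⟨r, hr⟩, ⟨s, hs⟩, h⟩
  let ψ : MvPolynomial ι k →ₐ[k] TrivSqZeroExt L L :=
    MvPolynomial.aeval fun i => TrivSqZeroExt.inl (a i) + TrivSqZeroExt.inr (d i)
  have h1 : ∀ p, (ψ p).fst = MvPolynomial.aeval a p := by
    intro p
    have : (TrivSqZeroExt.fstHom k L L).comp ψ = MvPolynomial.aeval a := by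
      ext i; simp [ψ]
    exact DFunLike.congr_fun this p
  let φ := ψ.comp (hi.aevalEquiv.symm : Algebra.adjoin k (Set.range a) →ₐ[k] MvPolynomial ι k)
  have h2 : ∀ r, (φ r).fst = algebraMap (Algebra.adjoin k (Set.range a)) L r := by
    intro r
    have h3 : (φ r).fst = MvPolynomial.aeval a (hi.aevalEquiv.symm r) := h1 _
    rw [h3, ← hi.algebraMap_aevalEquiv, AlgEquiv.apply_symm_apply]
  obtain ⟨D, hD⟩ := exists_derivation φ h2
  refine ⟨D, fun i => ?_⟩
  have h3 : hi.aevalEquiv (MvPolynomial.X i) = ⟨a i, Algebra.subset_adjoin ⟨i, rfl⟩⟩ := by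
    apply Subtype.ext
    have := hi.algebraMap_aevalEquiv (MvPolynomial.X i)
    rw [MvPolynomial.aeval_X] at this
    exact this
  have h4 := hD ⟨a i, Algebra.subset_adjoin ⟨i, rfl⟩⟩
  have h5 : φ ⟨a i, Algebra.subset_adjoin ⟨i, rfl⟩⟩ = ψ (MvPolynomial.X i) := by
    change ψ (hi.aevalEquiv.symm _) = _
    rw [← h3, AlgEquiv.symm_apply_apply]
  rw [h5] at h4
  refine h4.trans ?_
  simp [ψ]

/-- presentations of the field of the tower -/
structure TP (k : Type*) {N : Type*} [Field k] [Field N] [Algebra k N] (R : ℕ) (xs ys : ℕ → N) : Prop where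
  tower : ∀ j < R, xs j ^ 5 + ys j * ys (j + 1) ^ 5 = 1
  ne : ∀ j ≤ R, ys j ≠ 0
  ne1 : ys 0 ^ 5 ≠ 1
  gen : IntermediateField.adjoin k (Set.range (tw R xs ys)) = ⊤
  ind : AlgebraicIndependent k (tw R xs ys)

section s
variable {k N : Type*} [Field k] [Field N] [Algebra k N] {R : ℕ} {xs ys : ℕ → N} {O : ValuationSubring N}

/-- generator of the maximal ideal -/
theorem Dv.unif (hN : AlgebraicIndependent k (tw R xs ys)) (hg : IntermediateField.adjoin k (Set.range (tw R xs ys)) = ⊤)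
    (h : Dv (Algebra.adjoin k (Set.range (tw R xs ys))) O) : ∃ q ∈ Algebra.adjoin k (Set.range (tw R xs ys)), q ≠ 0 ∧
    O.valuation q < 1 ∧ ∀ z, O.valuation z < 1 → ∃ w ∈ O, z = q * w := by
  have hA := nice_of hN hg
  obtain ⟨hAO, q, hq, hq0, hqd⟩ := id h
  refine ⟨q, hq, hq0, (hqd q hq).2 ⟨1, one_mem _, by simp⟩, ?_⟩
  intro z hz
  obtain ⟨n, hn, d, hd, hvd, hzd⟩ := hA.num_den h (mem_of_vlt O hz)
  have hvn : O.valuation n < 1 := by rw [← hzd, map_mul, hvd, mul_one]; exact hz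
  obtain ⟨m, hm, hnm⟩ := (hqd n hn).1 hvn
  have hd0 : d ≠ 0 := by rintro rfl; simp at hvd
  refine ⟨m * d⁻¹, mul_mem (hAO m hm) (inv_mem_of_v1 O hvd), ?_⟩
  rw [hnm] at hzd
  field_simp
  linear_combination hzd

theorem TP.V1 [CharZero k] (h : TP k R xs ys) (hD : Dv (Algebra.adjoin k (Set.range (tw R xs ys))) O)
    (hf : O.valuation (1 - ys 0 ^ 5) < 1) {q : N} (hq : q ≠ 0) (hqv : O.valuation q < 1)
    (hqg : ∀ z, O.valuation z < 1 → ∃ w ∈ O, z = q * w) : O.valuation (1 - ys 0 ^ 5) = O.valuation q := by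
  have hcN : CharZero N := charZero_of_injective_algebraMap (algebraMap k N).injective
  have hA := nice_of h.ind h.gen
  have hAO := hD.1
  obtain ⟨w, hw, hfw⟩ := hqg _ hf
  rcases v1_or O hw with hw1 | hw1
  · rw [hfw, map_mul, hw1, mul_one]
  exfalso
  obtain ⟨w', hw', rfl⟩ := hqg _ hw1
  obtain ⟨D, hDv⟩ := exists_der h.ind h.gen (fun o => o.elim (ys R) (fun _ => 0))
  have hDA : ∀ a ∈ Algebra.adjoin k (Set.range (tw R xs ys)), D a ∈ Algebra.adjoin k (Set.range (tw R xs ys)) := by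
    intro a ha
    induction ha using Algebra.adjoin_induction with
    | mem z hz =>
      obtain ⟨o, rfl⟩ := hz
      rw [hDv]
      rcases o with _ | o
      · exact Algebra.subset_adjoin ⟨none, rfl⟩
      · exact zero_mem _
    | algebraMap r => rw [D.map_algebraMap]; exact zero_mem _
    | add a b _ _ ha hb => rw [map_add]; exact add_mem ha hb
    | mul a b ha' hb' ha hb =>
      rw [D.leibniz, smul_eq_mul, smul_eq_mul]
      exact add_mem (mul_mem ha' hb) (mul_mem hb' ha)
  have hDO : ∀ z ∈ O, D z ∈ O := by
    intro z hz
    obtain ⟨n, hn, d, hd, hvd, hzd⟩ := hA.num_den hD hz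
    have hd0 : d ≠ 0 := by rintro rfl; simp at hvd
    have h1 := congrArg D hzd
    rw [D.leibniz, smul_eq_mul, smul_eq_mul] at h1
    have h2 : D z = (D n - z * D d) * d⁻¹ := by field_simp; linear_combination h1
    rw [h2]
    exact mul_mem (sub_mem (hAO _ (hDA _ hn)) (mul_mem hz (hAO _ (hDA _ hd)))) (inv_mem_of_v1 O hvd)
  have hDx : ∀ j < R, D (xs j) = 0 := fun j hj => hDv (some ⟨j, hj⟩)
  have hDy : ∀ d j, j + d = R → D (ys j) = (-5) ^ d * ys j := by
    intro d
    induction d with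
    | zero => intro j hj; simp at hj; subst hj; have h0 : D (ys j) = ys j := hDv none; simpa using h0
    | succ d ih =>
      intro j hj
      have h1 := ih (j + 1) (by omega)
      have h2 := congrArg D (h.tower j (by omega))
      simp only [map_add, D.leibniz, D.leibniz_pow, hDx j (by omega), h1, smul_eq_mul, nsmul_eq_mul, mul_zero, zero_add, Derivation.map_one_eq_zero] at h2
      apply mul_right_cancel₀ (pow_ne_zero 5 (h.ne (j + 1) (by omega)))
      push_cast at h2
      rw [pow_succ]
      linear_combination h2
  have hD0 := hDy R 0 (by omega)
  have h1 : D (1 - ys 0 ^ 5) = ((-5) ^ (R + 1)) * ys 0 ^ 5 := by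
    simp only [map_sub, D.leibniz_pow, hD0, smul_eq_mul, nsmul_eq_mul, Derivation.map_one_eq_zero]
    push_cast; ring
  have hy5 : O.valuation (ys 0 ^ 5) = 1 := by
    rw [show ys 0 ^ 5 = 1 + -(1 - ys 0 ^ 5) by ring]
    exact v1_add O (by simp) (by rwa [Valuation.map_neg])
  have h2 : O.valuation (D (1 - ys 0 ^ 5)) = 1 := by
    rw [h1, map_mul, hy5, mul_one]
    have : ((-5) ^ (R + 1) : N) = algebraMap k N ((-5) ^ (R + 1)) := by
      simp only [map_pow, map_neg, map_ofNat]
    rw [this]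
    exact val_const O (fun c => hAO _ (Subalgebra.algebraMap_mem _ c)) (pow_ne_zero _ (by norm_num))
  have hqO := mem_of_vlt O hqv
  have h3 : O.valuation (D (1 - ys 0 ^ 5)) < 1 := by
    rw [hfw, D.leibniz, D.leibniz, smul_eq_mul, smul_eq_mul, smul_eq_mul, smul_eq_mul]
    have h4 : q * (q * D w' + w' * D q) + q * w' * D q = q * (q * D w' + w' * D q + w' * D q) := by ring
    rw [h4]
    exact vlt_mul O hqv (add_mem (add_mem (mul_mem hqO (hDO _ hw')) (mul_mem hw' (hDO _ hqO))) (mul_mem hw' (hDO _ hqO)))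
  rw [h2] at h3
  exact lt_irrefl _ h3
end s
end Cr

namespace Cr
universe v

theorem no_fifth {N : Type*} [Field N] {O : ValuationSubring N} {q : N} (hq : q ≠ 0) (hqv : O.valuation q < 1)
    (hqg : ∀ z, O.valuation z < 1 → ∃ w ∈ O, z = q * w) (t : N) (ht : O.valuation q = O.valuation t ^ 5) : False := by
  have h1 : O.valuation t < 1 := by
    apply vlt_of_pow O (n := 5)
    rw [map_pow, ← ht]; exact hqv
  obtain ⟨w, hw, rfl⟩ := hqg t h1
  have hw1 : O.valuation w ≤ 1 := (vle O).2 hw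
  have hq0 : 0 < O.valuation q := by rw [zero_lt_iff]; simpa using hq
  have h2 : O.valuation (q * w) ^ 5 < O.valuation q := by
    calc O.valuation (q * w) ^ 5 ≤ O.valuation q ^ 5 := by
          rw [map_mul]; exact pow_le_pow_left₀ zero_le' (mul_le_of_le_one_right' hw1) 5
      _ < O.valuation q := pow_lt_self_of_lt_one₀ hq0 hqv (by norm_num)
  rw [← ht] at h2
  exact lt_irrefl _ h2

section s
variable {k : Type*} {N : Type v} [Field k] [Field N] [Algebra k N] {R : ℕ} {xs ys : ℕ → N}

/-- the divisor `y₀⁵ = 1` -/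
theorem TP.exO [CharZero k] (h : TP k R xs ys) : ∃ O : ValuationSubring N, (∀ c : k, algebraMap k N c ∈ O) ∧
    O.valuation (1 - ys 0 ^ 5) < 1 ∧ Dv (Algebra.adjoin k (Set.range (tw R xs ys))) O ∧ (∀ j ≤ R, O.valuation (ys j) = 1) ∧
    (∀ z ∈ Algebra.adjoin k (Set.range fun j : Fin R => xs j), z ≠ 0 → O.valuation z = 1) := by
  set S : Set N := Set.range fun j : Fin R => xs j with hS
  have hf0 : 1 - ys 0 ^ 5 ≠ 0 := fun h0 => h.ne1 (by linear_combination -h0)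
  have hnot : ys R ∉ cl k S := by
    have h1 : AlgebraicIndependent k (fun o : Option (Fin R) => o.elim (ys R) (fun j => xs j)) := h.ind
    have h2 := (AlgebraicIndependent.option_iff.1 h1).2
    intro h3
    exact h2 (isAlg_adjoin_iff.1 (mem_cl.1 h3))
  have hxcl : ∀ j < R, xs j ∈ cl k S := fun j hj => subset_cl S (show xs j ∈ S from ⟨⟨j, hj⟩, rfl⟩)
  have hnot0 : ys 0 ∉ cl k S := fun h0 =>
    hnot (tower_cl h.tower h.ne (fun j hj => hxcl j hj) h0 R le_rfl)
  have h1 : ∃ O : ValuationSubring N, (∀ c : IntermediateField.adjoin k S, algebraMap _ N c ∈ O) ∧ (1 - ys 0 ^ 5)⁻¹ ∉ O := by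
    by_contra hcon
    push Not at hcon
    have h2 := isAlgebraic_of_forall _ hcon
    rw [← mem_cl] at h2
    have h3 := inv_mem h2
    rw [inv_inv] at h3
    apply hnot0
    apply mem_cl_of_pow (n := 5) (by norm_num)
    have := sub_mem (one_mem _) h3
    rwa [sub_sub_cancel] at this
  obtain ⟨O, hO, hfO⟩ := h1
  have hvf : O.valuation (1 - ys 0 ^ 5) < 1 := (vlt_iff O hf0).2 hfO
  have hk : ∀ c : k, algebraMap k N c ∈ O := fun c => hO (algebraMap k (IntermediateField.adjoin k S) c)
  have hxO : ∀ j < R, xs j ∈ IntermediateField.adjoin k S := fun j hj => IntermediateField.subset_adjoin _ _ ⟨⟨j, hj⟩, rfl⟩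
  have hv1 : ∀ z ∈ IntermediateField.adjoin k S, z ≠ 0 → O.valuation z = 1 := by
    intro z hz hz0
    have := val_const O hO (c := ⟨z, hz⟩) (by intro h0; exact hz0 (congrArg Subtype.val h0))
    exact this
  have hpow : ∀ z, O.valuation (z ^ 5) = 1 → O.valuation z = 1 := by
    intro z hz
    rw [map_pow] at hz
    exact (pow_eq_one_iff_of_nonneg zero_le' (by norm_num)).1 hz
  have hys : ∀ j ≤ R, O.valuation (ys j) = 1 := by
    intro j
    induction j with
    | zero =>
      intro _
      apply hpow
      rw [show ys 0 ^ 5 = 1 + -(1 - ys 0 ^ 5) by ring]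
      exact v1_add O (by simp) (by rwa [Valuation.map_neg])
    | succ j ih =>
      intro hj
      have h1 := ih (by omega)
      apply hpow
      have h2 : O.valuation (1 - xs j ^ 5) = 1 := by
        apply hv1 _ (sub_mem (one_mem _) (pow_mem (hxO j (by omega)) _))
        rw [show 1 - xs j ^ 5 = ys j * ys (j + 1) ^ 5 by linear_combination -h.tower j (by omega)]
        exact mul_ne_zero (h.ne j (by omega)) (pow_ne_zero _ (h.ne _ hj))
      rw [show 1 - xs j ^ 5 = ys j * ys (j + 1) ^ 5 by linear_combination -h.tower j (by omega), map_mul, h1, one_mul] at h2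
      exact h2
  have hSx : ∀ z ∈ Algebra.adjoin k S, z ≠ 0 → O.valuation z = 1 := fun z hz hz0 =>
    hv1 z (IntermediateField.algebra_adjoin_le_adjoin k S hz) hz0
  refine ⟨O, hk, hvf, ?_, hys, hSx⟩
  refine lemmaH' h.ind h.gen none ?_ ?_ ?_
  · intro n hn
    induction hn using Algebra.adjoin_induction with
    | mem z hz =>
      obtain ⟨o, rfl⟩ := hz
      rcases o with _ | o
      · exact (vle O).1 (hys R le_rfl).le
      · exact hO ⟨xs o, hxO o o.2⟩
    | algebraMap r => exact hk r
    | add a b _ _ ha hb => exact add_mem ha hb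
    | mul a b _ _ ha hb => exact mul_mem ha hb
  · exact fun h => hfO (by rw [h]; trivial)
  · intro z hz hz0
    refine hSx z ?_ hz0
    refine Algebra.adjoin_mono ?_ hz
    rintro _ ⟨⟨o, ho⟩, rfl⟩
    rcases o with _ | o
    · exact absurd rfl ho
    · exact ⟨o, rfl⟩

/-- the divisor is a divisor for any other presentation -/
theorem TP.Dv2 [CharZero k] (h : TP k R xs ys) {xs' ys' : ℕ → N} (h' : TP k R xs' ys') (hR : 1 ≤ R) {O : ValuationSubring N}
    (hk : ∀ c : k, algebraMap k N c ∈ O) (hf : O.valuation (1 - ys 0 ^ 5) < 1) (hys : ∀ j ≤ R, O.valuation (ys j) = 1)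
    (hxs : ∀ z ∈ Algebra.adjoin k (Set.range fun j : Fin R => xs j), z ≠ 0 → O.valuation z = 1) :
    Dv (Algebra.adjoin k (Set.range (tw R xs' ys'))) O := by
  obtain ⟨G, _, _, π, hπ, hs⟩ := exists_resplace O hk
  obtain ⟨m, rfl⟩ : ∃ m, R = m + 1 := ⟨R - 1, by omega⟩
  have hxO : ∀ j < m + 1, xs j ∈ O := by
    intro j hj
    by_cases h0 : xs j = 0
    · rw [h0]; exact zero_mem _
    · exact (vle O).1 (hxs _ (Algebra.subset_adjoin ⟨⟨j, hj⟩, rfl⟩) h0).le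
  have hyO : ∀ j ≤ m + 1, ys j ∈ O := fun j hj => (vle O).1 (hys j hj).le
  have hx1 : AlgebraicIndependent k (fun j : Fin (m + 1) => xs j) :=
    h.ind.comp (fun j : Fin (m + 1) => some j) (Option.some_injective _)
  have htop : O ≠ ⊤ := by
    rintro rfl
    have hf0 : 1 - ys 0 ^ 5 ≠ 0 := fun h0 => h.ne1 (by linear_combination -h0)
    exact (vlt_iff _ hf0).1 hf trivial
  have hbar : ∀ j < m + 1, π (xs j) ^ 5 + π (ys j) * π (ys (j + 1)) ^ 5 = 1 := by
    intro j hj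
    have := congrArg π (h.tower j hj)
    rw [hπ.add (pow_mem (hxO j hj) _) (mul_mem (hyO j (by omega)) (pow_mem (hyO (j + 1) (by omega)) _)),
      hπ.mul (hyO j (by omega)) (pow_mem (hyO (j + 1) (by omega)) _), hπ.pow (hxO j hj), hπ.pow (hyO (j + 1) (by omega)), hπ.map_one] at this
    exact this
  have hne : ∀ j ≤ m + 1, π (ys j) ≠ 0 := fun j hj => hπ.ne_zero (hys j hj)
  have h0 : π (ys 0) ^ 5 = 1 := by
    have h1 := (hπ.zero (sub_mem (one_mem _) (pow_mem (hyO 0 (by omega)) _))).2 hf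
    rw [hπ.sub (one_mem _) (pow_mem (hyO 0 (by omega)) _), hπ.pow (hyO 0 (by omega)), hπ.map_one] at h1
    linear_combination -h1
  refine WO h'.ind h'.gen hπ hs htop (m := m) (by simp) (κ := Fin (m + 1)) (w := fun j => π (xs j)) (by simp) ?_ ?_
  · rw [algebraicIndependent_iff]
    intro p hp
    obtain ⟨h1, h2⟩ := hπ.mvaeval (a := fun j : Fin (m + 1) => xs j) (fun j => hxO j j.2) p
    rw [hp] at h2
    by_contra hp0
    have h3 : MvPolynomial.aeval (fun j : Fin (m + 1) => xs j) p ≠ 0 := fun h4 =>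
      hp0 (algebraicIndependent_iff.1 hx1 p h4)
    have h4 := hxs _ (by rw [Algebra.adjoin_range_eq_range_aeval]; exact ⟨p, rfl⟩) h3
    exact hπ.ne_zero h4 h2
  · intro Λ _ _ f E ρ hf'
    have : CharZero E := charZero_of_injective_algebraMap (algebraMap k E).injective
    have ht := rigid_tower (E := E) (ρ := ρ) (R := m + 1) (xs := fun j => ⟨f (π (xs j)), hf' _⟩) (ys := fun j => ⟨f (π (ys j)), hf' _⟩)
      ?_ ?_ ?_
    · exact fun i => ht.1 i i.2
    · intro j hj
      apply Subtype.ext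
      have := congrArg f (hbar j hj)
      simpa using this
    · intro j hj h1
      have h2 : f (π (ys j)) = 0 := congrArg Subtype.val h1
      exact hne j hj ((map_eq_zero f).1 h2)
    · apply IsAlgebraic.of_pow (n := 5) (by norm_num)
      have : f (π (ys 0)) ^ 5 = 1 := by rw [← map_pow, h0, map_one]
      change IsAlgebraic E (f (π (ys 0)) ^ 5)
      rw [this]; exact isAlgebraic_one
end s
end Cr

namespace Cr

section comp
variable {N P : Type*} [Field N] [Field P] [Algebra N P] {O : ValuationSubring P} {π : P → N}

/-- composite valuation ring -/
def compO (h : Place N O π) (V : ValuationSubring N) : ValuationSubring P where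
  carrier := {z | z ∈ O ∧ π z ∈ V}
  mul_mem' := fun ha hb => ⟨mul_mem ha.1 hb.1, by rw [h.mul ha.1 hb.1]; exact mul_mem ha.2 hb.2⟩
  one_mem' := ⟨one_mem _, by rw [h.map_one]; exact one_mem _⟩
  add_mem' := fun ha hb => ⟨add_mem ha.1 hb.1, by rw [h.add ha.1 hb.1]; exact add_mem ha.2 hb.2⟩
  zero_mem' := ⟨zero_mem _, by rw [h.map_zero]; exact zero_mem _⟩
  neg_mem' := fun {a} ha => ⟨neg_mem ha.1, by rw [h.neg ha.1]; exact neg_mem ha.2⟩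
  mem_or_inv_mem' := by
    intro z
    by_cases hz : z ∈ O
    · by_cases hv : π z ∈ V
      · exact Or.inl ⟨hz, hv⟩
      · right
        have h0 : π z ≠ 0 := fun h0 => hv (by rw [h0]; exact zero_mem _)
        have h1 := h.v1 hz h0
        have h2 : π z⁻¹ = (π z)⁻¹ := h.inv h1
        exact ⟨inv_mem_of_v1 O h1, by rw [h2]; exact (V.mem_or_inv_mem _).resolve_left hv⟩
    · right
      have h1 := inv_vlt O hz
      have h2 : z⁻¹ ∈ O := (vle O).1 h1.le
      exact ⟨h2, by rw [(h.zero h2).2 h1]; exact zero_mem _⟩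

theorem compO_v1 (h : Place N O π) (V : ValuationSubring N) {z : P} (hz : (compO h V).valuation z = 1) :
    O.valuation z = 1 ∧ V.valuation (π z) = 1 := by
  have h1 : z ∈ compO h V := (vle _).1 hz.le
  have h2 : z⁻¹ ∈ compO h V := inv_mem_of_v1 _ hz
  have hz0 : z ≠ 0 := by rintro rfl; simp at hz
  have h3 : O.valuation z = 1 := by
    refine le_antisymm ((vle O).2 h1.1) ?_
    have h4 := (vle O).2 h2.1
    rw [map_inv₀] at h4
    exact (inv_le_one₀ (by rw [zero_lt_iff]; simpa using hz0)).1 h4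
  refine ⟨h3, le_antisymm ((vle V).2 h1.2) ?_⟩
  have h4 := (vle V).2 h2.2
  rw [h.inv h3, map_inv₀] at h4
  exact (inv_le_one₀ (by rw [zero_lt_iff]; simpa using h.ne_zero h3)).1 h4

theorem comp_fin (h : Place N O π) (V : ValuationSubring N) {f f' : N} (hf : f ≠ 0) (hf' : f' ≠ 0) {x y x' y' H : P}
    (hc : y ^ 2 + y = x ^ 3 - x ^ 2) (hc' : y' ^ 2 + y' = x' ^ 3 - x' ^ 2) (hg' : gg true x' y' ≠ 0) {l : ℕ}
    (hrel : gg true x' y' * algebraMap N P f ^ l = algebraMap N P f' ^ 2 * H ^ 5 * gg true x y ^ l) :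
    ∃ Z ε : N, Z ≠ 0 ∧ V.valuation ε = 1 ∧ f ^ l = f' ^ 2 * Z ^ 5 * ε := by
  obtain ⟨ϖ, ε, h1, h2, -⟩ := loc5 true (compO h V) hc
  obtain ⟨ϖ', ε', h1', h2', -⟩ := loc5 true (compO h V) hc'
  have hε' : ε' ≠ 0 := by rintro rfl; simp at h1'
  have hϖ' : ϖ' ≠ 0 := by rintro rfl; apply hg'; rw [h2']; ring
  set Z := H * ϖ ^ l / ϖ' with hZ
  set δ := ε ^ l / ε' with hδ
  have hv : (compO h V).valuation δ = 1 := by rw [hδ, map_div₀, map_pow, h1, h1']; simp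
  obtain ⟨h3, h4⟩ := compO_v1 h V hv
  have hr : algebraMap N P f ^ l = algebraMap N P f' ^ 2 * Z ^ 5 * δ := by
    rw [h2, h2'] at hrel
    rw [hZ, hδ]
    field_simp
    linear_combination hrel
  have hu : ∀ c : N, c ≠ 0 → O.valuation (algebraMap N P c) = 1 := fun c hc => val_const O h.cmem hc
  have hZv : O.valuation Z = 1 := by
    have h5 := congrArg O.valuation hr
    rw [map_mul, map_mul, map_pow, map_pow, map_pow, hu f hf, hu f' hf', h3] at h5
    simp only [one_pow, one_mul, mul_one] at h5
    exact (pow_eq_one_iff_of_nonneg zero_le' (by norm_num)).1 h5.symm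
  have hZO : Z ∈ O := (vle O).1 hZv.le
  have hδO : δ ∈ O := (vle O).1 h3.le
  refine ⟨π Z, π δ, h.ne_zero hZv, h4, ?_⟩
  have h6 := congrArg π hr
  rw [h.mul (mul_mem (pow_mem (h.cmem f') 2) (pow_mem hZO 5)) hδO, h.mul (pow_mem (h.cmem f') 2) (pow_mem hZO 5),
    h.pow (h.cmem f), h.pow (h.cmem f'), h.pow hZO, h.const, h.const] at h6
  simpa using h6
end comp

/-- the arithmetic contradiction -/
theorem arith_fin {N : Type*} [Field N] {V : ValuationSubring N} {q f f' y Z ε : N} {l : ℕ} (hl : l = 1 ∨ l = 4) (hq : q ≠ 0)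
    (hqv : V.valuation q < 1) (hqg : ∀ z, V.valuation z < 1 → ∃ w ∈ V, z = q * w) (hf : V.valuation f = V.valuation q)
    (hff : f' = 1 - y ^ 5) (hf' : V.valuation f' < 1 → V.valuation f' = V.valuation q) (hZ : Z ≠ 0)
    (hε : V.valuation ε = 1) (hr : f ^ l = f' ^ 2 * Z ^ 5 * ε) : False := by
  have h1 := congrArg V.valuation hr
  simp only [map_mul, map_pow, hf, hε, mul_one] at h1
  set Q := V.valuation q with hQ
  have hQ0 : Q ≠ 0 := by simpa [hQ] using hq
  have hZ0 : V.valuation Z ≠ 0 := by simpa using hZ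
  have key : ∀ s : N, s ≠ 0 → Q ^ l = V.valuation s ^ 5 → False := by
    intro s hs h2
    have hs0 : V.valuation s ≠ 0 := by simpa using hs
    rcases hl with rfl | rfl
    · exact no_fifth hq hqv hqg s (by simpa using h2)
    · refine no_fifth hq hqv hqg (q / s) ?_
      rw [map_div₀, ← hQ, div_pow, ← h2]
      field_simp
  by_cases hm : f' ∈ V
  · rcases v1_or V hm with h2 | h2
    · refine key Z hZ ?_
      rw [h1, h2]; simp
    · rw [hf' h2] at h1
      rcases hl with rfl | rfl
      · refine no_fifth hq hqv hqg Z⁻¹ ?_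
        rw [map_inv₀, ← hQ, inv_pow]
        apply eq_inv_of_mul_eq_one_left
        apply mul_left_cancel₀ hQ0
        rw [← mul_assoc, ← pow_two, ← h1]; simp
      · have h3 : Q ^ 2 = V.valuation Z ^ 5 := by
          apply mul_left_cancel₀ (pow_ne_zero 2 hQ0)
          rw [← h1, ← pow_add]
        refine no_fifth hq hqv hqg (q / Z ^ 2) ?_
        rw [map_div₀, map_pow, ← hQ, div_pow, ← pow_mul, mul_comm 2 5, pow_mul, ← h3]
        field_simp
  · have hy : 1 < V.valuation (y ^ 5) := by
      by_contra h2
      apply hm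
      rw [hff]
      exact sub_mem (one_mem _) ((vle V).1 (not_lt.1 h2))
    have h3 : V.valuation f' = V.valuation y ^ 5 := by
      rw [hff, Valuation.map_sub_swap, sub_eq_add_neg, Valuation.map_add_eq_of_lt_left _ (by simpa using hy), map_pow]
    have hy0 : y ≠ 0 := by rintro rfl; simp at hy
    refine key (y ^ 2 * Z) (mul_ne_zero (pow_ne_zero _ hy0) hZ) ?_
    rw [h1, h3, map_mul, map_pow, mul_pow, ← pow_mul, ← pow_mul]
end Cr

namespace Cr
section s
variable {k M : Type*} [Field k] [Field M] [Algebra k M] {e e' R : ℕ} {xs ys xs' ys' : ℕ → M} {x y u x' y' u' : M}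

theorem UN.tp (h : UN k e R xs ys x y u) {N : IntermediateField k M} (hN : N = NN k R xs ys) {c : M → N}
    (hc : ∀ z ∈ N, (c z : M) = z) : TP k R (fun j => c (xs j)) (fun j => c (ys j)) := by
  have htw : ∀ o, tw R xs ys o ∈ N := fun o => by rw [hN]; exact UN.tw_mem o
  have htc : ∀ o, ((tw R (fun j => c (xs j)) (fun j => c (ys j)) o : N) : M) = tw R xs ys o := by
    rintro (_ | o)
    · exact hc _ (htw none)
    · exact hc _ (htw (some o))
  obtain ⟨i, v, h1⟩ := h.te
  have hy : ∀ j ≤ R, (c (ys j) : M) = ys j := fun j hj => hc _ (ys_mem h1.tower h1.ne htw j hj)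
  have hx : ∀ j < R, (c (xs j) : M) = xs j := fun j hj => hc _ (htw (some ⟨j, hj⟩))
  refine ⟨?_, ?_, ?_, ?_, ?_⟩
  · intro j hj
    apply Subtype.ext
    push_cast
    rw [hx j hj, hy j hj.le, hy (j + 1) hj]
    exact h1.tower j hj
  · intro j hj h0
    apply h1.ne j hj
    rw [← hy j hj, h0]; rfl
  · intro h0
    apply h1.ne1
    have := congrArg Subtype.val h0
    push_cast at this
    rwa [hy 0 (by omega)] at this
  · apply top_of_gens (P := N) (S := Set.range (tw R xs ys)) hN
    rintro _ hs ⟨o, rfl⟩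
    apply IntermediateField.subset_adjoin
    exact ⟨o, Subtype.ext (htc o)⟩
  · have h2 : AlgebraicIndependent k (fun o => wf R xs ys x (some o)) := h.ind.comp _ (Option.some_injective _)
    have h3 : (fun o => wf R xs ys x (some o)) = N.val ∘ tw R (fun j => c (xs j)) (fun j => c (ys j)) := by
      funext o; exact (htc o).symm
    rw [h3] at h2
    exact h2.of_comp N.val

theorem UN.contra [CharZero k] (hR : 1 ≤ R) (h : UN k 1 R xs ys x y u) (h' : UN k 2 R xs' ys' x' y' u') : False := by
  classical
  obtain ⟨a1, a2, a3, l, hl, H, hH, hu⟩ := h.L1 h'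
  obtain ⟨b1, -⟩ := h'.L1 h
  have hN : NN k R xs ys = NN k R xs' ys' := by
    apply le_antisymm
    · refine IntermediateField.adjoin_le_iff.2 ?_
      rintro _ ⟨o, rfl⟩; exact b1 o
    · refine IntermediateField.adjoin_le_iff.2 ?_
      rintro _ ⟨o, rfl⟩; exact a1 o
  obtain ⟨c, hc⟩ : ∃ c : M → NN k R xs ys, ∀ z ∈ NN k R xs ys, (c z : M) = z :=
    ⟨fun z => if hz : z ∈ NN k R xs ys then ⟨z, hz⟩ else 0, fun z hz => by simp only [dif_pos hz]⟩
  have T := h.tp rfl hc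
  have T' := h'.tp hN hc
  have hy0 : (c (ys 0) : M) = ys 0 := hc _ h.y0_mem
  have hy0' : (c (ys' 0) : M) = ys' 0 := hc _ (by rw [hN]; exact h'.y0_mem)
  obtain ⟨V, hk, hvf, hD, hvy, hvx⟩ := T.exO
  obtain ⟨q, -, hq, hqv, hqg⟩ := Dv.unif T.ind T.gen hD
  have hfq := T.V1 hD hvf hq hqv hqg
  have hD' := T.Dv2 T' hR hk hvf hvy hvx
  have hfq' : V.valuation (1 - c (ys' 0) ^ 5) < 1 → V.valuation (1 - c (ys' 0) ^ 5) = V.valuation q := fun hv =>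
    T'.V1 hD' hv hq hqv hqg
  obtain ⟨O, π, -, hπ⟩ := L0 h.pcurve h.ptr UN.ptop
  have hcast : ∀ a b : PP k R xs ys x y, ((gg true a b : PP k R xs ys x y) : M) = gg true (a : M) (b : M) := fun a b =>
    gg_map (algebraMap (PP k R xs ys x y) M) true a b
  have hg' : gg true (⟨x', a2⟩ : PP k R xs ys x y) ⟨y', a3⟩ ≠ 0 := by
    intro h0
    have h1 := congrArg Subtype.val h0
    rw [hcast] at h1
    change gg true x' y' = 0 at h1
    rw [← h'.cover] at h1
    exact mul_ne_zero (pow_ne_zero _ h'.fne) (pow_ne_zero _ h'.une) h1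
  obtain ⟨Z, ε, hZ, hε, hr⟩ := comp_fin hπ V (f := 1 - c (ys 0) ^ 5) (f' := 1 - c (ys' 0) ^ 5)
    (x := ⟨x, UN.x_mem⟩) (y := ⟨y, UN.yy_mem⟩) (x' := ⟨x', a2⟩) (y' := ⟨y', a3⟩) (H := ⟨H, hH⟩) (l := l)
    (fun h0 => T.ne1 (by linear_combination -h0)) (fun h0 => T'.ne1 (by linear_combination -h0))
    h.pcurve (Subtype.ext h'.curve) hg' (by
      apply Subtype.ext
      have e1 : ((algebraMap (NN k R xs ys) (PP k R xs ys x y) (1 - c (ys 0) ^ 5) : PP k R xs ys x y) : M) = 1 - ys 0 ^ 5 := by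
        change ((1 - c (ys 0) ^ 5 : NN k R xs ys) : M) = _
        push_cast; rw [hy0]
      have e2 : ((algebraMap (NN k R xs ys) (PP k R xs ys x y) (1 - c (ys' 0) ^ 5) : PP k R xs ys x y) : M) = 1 - ys' 0 ^ 5 := by
        change ((1 - c (ys' 0) ^ 5 : NN k R xs ys) : M) = _
        push_cast; rw [hy0']
      rw [MulMemClass.coe_mul, MulMemClass.coe_mul, MulMemClass.coe_mul, SubmonoidClass.coe_pow, SubmonoidClass.coe_pow, SubmonoidClass.coe_pow,
        SubmonoidClass.coe_pow, hcast, hcast, e1, e2]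
      change gg true x' y' * (1 - ys 0 ^ 5) ^ l = (1 - ys' 0 ^ 5) ^ 2 * H ^ 5 * gg true x y ^ l
      rw [← h.cover, ← h'.cover, hu, pow_one, mul_pow _ _ l]
      ring)
  exact arith_fin hl hq hqv hqg hfq rfl hfq' hZ hε hr
end s
end Cr

namespace Cr
section s
variable {k G : Type*} [Field k] [Field G] [Algebra k G] {R R' : ℕ} {xs ys xs' ys' : ℕ → G} {x y u s x' y' u' : G}

theorem y5_eq (h : y ^ 2 + y = x ^ 3 - x ^ 2) : y ^ 5 = gg true x y ^ 2 * gg false x y := by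
  simp only [gg, if_true, Bool.false_eq_true, if_false]
  linear_combination (y ^ 3 - y ^ 2 - 3 * x ^ 2 * y - x * y + y - 2 * x ^ 3 + x ^ 2) * h

theorem TE.tr_s {i : Bool} (h : TE i R xs ys x y u)
    (hg : IntermediateField.adjoin k (Set.range (tw R xs ys) ∪ {x, y, u, s}) = ⊤)
    (hr : ((R + 3 : ℕ) : ℕ∞) ≤ rk k (Set.univ : Set G)) :
    Transcendental (IntermediateField.adjoin k (Set.range (tw R xs ys) ∪ {x, y, u})) s := by
  intro hs
  have h2 : ∀ o, wf R xs ys x o ∈ cl k (Set.range (wf R xs ys x)) := fun o => subset_cl _ ⟨o, rfl⟩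
  have h3 := h.mem_cl h2
  have hE : IntermediateField.adjoin k (Set.range (tw R xs ys) ∪ {x, y, u}) ≤ cl k (Set.range (wf R xs ys x)) := by
    rw [IntermediateField.adjoin_le_iff]
    rintro z (⟨o, rfl⟩ | rfl | rfl | rfl)
    · exact h2 (some o)
    · exact h2 none
    · exact h3.1
    · exact h3.2
  have hsc : s ∈ cl k (Set.range (wf R xs ys x)) := mem_cl_of_alg hE hs
  have h1 : rk k (Set.univ : Set G) ≤ rk k (Set.range (wf R xs ys x)) := by
    apply rk_le_of_subset
    have : IntermediateField.adjoin k (Set.range (tw R xs ys) ∪ {x, y, u, s}) ≤ cl k (Set.range (wf R xs ys x)) := by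
      rw [IntermediateField.adjoin_le_iff]
      rintro z (⟨o, rfl⟩ | rfl | rfl | rfl | rfl)
      · exact h2 (some o)
      · exact h2 none
      · exact h3.1
      · exact h3.2
      · exact hsc
    rw [hg] at this
    intro z _; exact this trivial
  have h4 := (hr.trans h1).trans (rk_range_le _)
  rw [card_wf] at h4
  have : R + 3 ≤ R + 2 := by exact_mod_cast h4
  omega

theorem TE.M_le [CharZero k] {i i' : Bool} (h : TE i R xs ys x y u)
    (hg : IntermediateField.adjoin k (Set.range (tw R xs ys) ∪ {x, y, u, s}) = ⊤)
    (hr : ((R + 3 : ℕ) : ℕ∞) ≤ rk k (Set.univ : Set G)) (h' : TE i' R' xs' ys' x' y' u') :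
    IntermediateField.adjoin k (Set.range (tw R' xs' ys') ∪ {x', y', u'}) ≤
      IntermediateField.adjoin k (Set.range (tw R xs ys) ∪ {x, y, u}) := by
  have hs := h.tr_s hg hr
  set E := IntermediateField.adjoin k (Set.range (tw R xs ys) ∪ {x, y, u}) with hE
  have hall : ∀ z : G, z ∈ IntermediateField.adjoin E {s} := by
    intro z
    refine mem_adj_of_adj (k := k) s (S := Set.range (tw R xs ys) ∪ {x, y, u, s}) ?_ (by rw [hg]; trivial)
    have h3 : ∀ w ∈ Set.range (tw R xs ys) ∪ {x, y, u}, w ∈ IntermediateField.adjoin E {s} := fun w hw =>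
      mem_adj_of_mem s (IntermediateField.subset_adjoin _ _ hw)
    rintro z (hz | rfl | rfl | rfl | rfl)
    · exact h3 _ (Or.inl hz)
    · exact h3 _ (by simp)
    · exact h3 _ (by simp)
    · exact h3 _ (by simp)
    · exact IntermediateField.mem_adjoin_simple_self _ _
  let g : G →+* IntermediateField.adjoin E {s} :=
    (RingHom.id G).codRestrict (IntermediateField.adjoin E {s}).toSubfield.toSubring hall
  have : CharZero E := charZero_of_injective_algebraMap (algebraMap k E).injective
  obtain ⟨h1, h2, h3, h4, h5⟩ := rigid (h'.map g)
  have key : ∀ z : G, IsAlgebraic E z → z ∈ E := by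
    intro z hz
    obtain ⟨c, hc⟩ := alg_mem hs (hall z) hz
    rw [← hc]; exact c.2
  rw [IntermediateField.adjoin_le_iff]
  rintro z (⟨o, rfl⟩ | rfl | rfl | rfl)
  · rcases o with _ | o
    · exact key _ (h2 R' le_rfl)
    · exact key _ (h1 o o.2)
  · exact key _ h3
  · exact key _ h4
  · exact key _ h5

theorem TE.toUN {i : Bool} (h : TE i R xs ys x y u) (hi : AlgebraicIndependent k (wf R xs ys x)) {M : IntermediateField k G} {w : G}
    (hM : M = IntermediateField.adjoin k (Set.range (tw R xs ys) ∪ {x, y, w})) (hu : u ∈ M) (hw0 : w ≠ 0) {e : ℕ}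
    (hw : (1 - ys 0 ^ 5) ^ e * w ^ 5 = gg true x y) {c : G → M} (hc : ∀ z ∈ M, (c z : G) = z) :
    UN k e R (fun j => c (xs j)) (fun j => c (ys j)) (c x) (c y) (c w) := by
  have hS : ∀ z ∈ Set.range (tw R xs ys) ∪ {x, y, w}, z ∈ M := fun z hz => by
    rw [hM]; exact IntermediateField.subset_adjoin _ _ hz
  have htw : ∀ o, tw R xs ys o ∈ M := fun o => hS _ (Or.inl ⟨o, rfl⟩)
  have htc : ∀ o, ((tw R (fun j => c (xs j)) (fun j => c (ys j)) o : M) : G) = tw R xs ys o := by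
    rintro (_ | o)
    · exact hc _ (htw none)
    · exact hc _ (htw (some o))
  have hy : ∀ j ≤ R, (c (ys j) : G) = ys j := fun j hj => hc _ (ys_mem h.tower h.ne htw j hj)
  have hx : ∀ j < R, (c (xs j) : G) = xs j := fun j hj => hc _ (htw (some ⟨j, hj⟩))
  have hcx : (c x : G) = x := hc _ (hS _ (by simp))
  have hcy : (c y : G) = y := hc _ (hS _ (by simp))
  have hcw : (c w : G) = w := hc _ (hS _ (by simp))
  have hcu : (c u : G) = u := hc _ hu
  have hcast : ∀ (i) (a b : M), ((gg i a b : M) : G) = gg i (a : G) (b : G) := fun i a b => gg_map (algebraMap M G) i a b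
  refine ⟨⟨i, c u, ?_⟩, ?_, ?_, ?_, ?_⟩
  · refine ⟨?_, ?_, ?_, ?_, ?_, ?_⟩
    · intro j hj
      apply Subtype.ext
      push_cast
      rw [hx j hj, hy j hj.le, hy (j + 1) hj]
      exact h.tower j hj
    · intro j hj h0
      apply h.ne j hj
      rw [← hy j hj, h0]; rfl
    · intro h0
      apply h.ne1
      have := congrArg Subtype.val h0
      push_cast at this
      rwa [hy 0 (by omega)] at this
    · intro h0; apply h.une; rw [← hcu, h0]; rfl
    · apply Subtype.ext
      push_cast
      rw [hcx, hcy]; exact h.curve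
    · apply Subtype.ext
      rw [hcast]; push_cast
      rw [hcx, hcy, hcu, hy 0 (by omega)]; exact h.cover
  · intro h0; apply hw0; rw [← hcw, h0]; rfl
  · apply Subtype.ext
    rw [hcast]; push_cast
    rw [hcx, hcy, hcw, hy 0 (by omega)]; exact hw
  · apply top_of_gens (P := M) (S := Set.range (tw R xs ys) ∪ {x, y, w}) hM
    rintro z hs hz
    apply IntermediateField.subset_adjoin
    rcases hz with ⟨o, rfl⟩ | rfl | rfl | rfl
    · exact Or.inl ⟨o, Subtype.ext (htc o)⟩
    · exact Or.inr (Or.inl (Subtype.ext hcx.symm))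
    · exact Or.inr (Or.inr (Or.inl (Subtype.ext hcy.symm)))
    · exact Or.inr (Or.inr (Or.inr (Subtype.ext hcw.symm)))
  · have h3 : wf R xs ys x = M.val ∘ wf R (fun j => c (xs j)) (fun j => c (ys j)) (c x) := by
      funext o
      rcases o with _ | o
      · exact hcx.symm
      · exact (htc o).symm
    rw [h3] at hi
    exact hi.of_comp M.val

theorem TypeF.contra [CharZero k] (hR : 1 ≤ R) (ht : TypeF true R k G) (hf : TypeF false R k G) : False := by
  classical
  obtain ⟨xs, ys, x, y, u, s, h, hg, hr⟩ := ht
  obtain ⟨xs', ys', x', y', u', s', h', hg', -⟩ := hf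
  have hi := h.indep hg hr
  have hi' := h'.indep hg' hr
  have hM := le_antisymm (h'.M_le hg' hr h) (h.M_le hg hr h')
  set M := IntermediateField.adjoin k (Set.range (tw R xs ys) ∪ {x, y, u}) with hMd
  obtain ⟨c, hc⟩ : ∃ c : G → M, ∀ z ∈ M, (c z : G) = z :=
    ⟨fun z => if hz : z ∈ M then ⟨z, hz⟩ else 0, fun z hz => by simp only [dif_pos hz]⟩
  have U := h.toUN hi (M := M) (w := u) (e := 1) rfl (IntermediateField.subset_adjoin _ _ (by simp)) h.une
    (by rw [pow_one]; exact h.cover) hc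
  have hf0 := h'.one_sub_ne
  have hg2 : gg false x' y' ≠ 0 := by
    rw [← h'.cover]; exact mul_ne_zero hf0 (pow_ne_zero _ h'.une)
  have hy0 : y' ≠ 0 := by
    intro h0
    have h1 := h'.curve
    rw [h0] at h1
    have hx0 : x' ≠ 0 := hi'.ne_zero none
    have h2 : x' = 1 := by
      have : x' ^ 2 * (x' - 1) = 0 := by linear_combination -h1
      rcases mul_eq_zero.1 this with h3 | h3
      · exact absurd h3 (pow_ne_zero _ hx0)
      · exact sub_eq_zero.1 h3
    apply hg2
    rw [h0, h2]; simp only [gg, Bool.false_eq_true, if_false]; ring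
  have h5 := y5_eq h'.curve
  have hg1 : gg true x' y' ≠ 0 := by
    intro h0; rw [h0] at h5; apply pow_ne_zero 5 hy0; rw [h5]; ring
  have hcov := h'.cover
  set w := u' ^ 2 * gg true x' y' / y' ^ 2 with hw
  have hw0 : w ≠ 0 := div_ne_zero (mul_ne_zero (pow_ne_zero _ h'.une) hg1) (pow_ne_zero _ hy0)
  have hwc : (1 - ys' 0 ^ 5) ^ 2 * w ^ 5 = gg true x' y' := by
    have e1 : (1 - ys' 0 ^ 5) ^ 2 * w ^ 5 = ((1 - ys' 0 ^ 5) * u' ^ 5) ^ 2 * gg true x' y' ^ 5 / (y' ^ 5) ^ 2 := by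
      rw [hw]; field_simp
    rw [e1, hcov, h5]; field_simp
  have huw : u' = y' / ((1 - ys' 0 ^ 5) * w ^ 2) := by
    rw [eq_div_iff (mul_ne_zero hf0 (pow_ne_zero _ hw0))]
    have e1 : u' * ((1 - ys' 0 ^ 5) * w ^ 2) = ((1 - ys' 0 ^ 5) * u' ^ 5) * gg true x' y' ^ 2 * y' / y' ^ 5 := by
      rw [hw]; field_simp
    rw [e1, hcov, h5]; field_simp
  have hM' : M = IntermediateField.adjoin k (Set.range (tw R xs' ys') ∪ {x', y', w}) := by
    rw [hM]
    apply le_antisymm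
    · rw [IntermediateField.adjoin_le_iff]
      have hS : ∀ z ∈ Set.range (tw R xs' ys') ∪ {x', y', w},
        z ∈ IntermediateField.adjoin k (Set.range (tw R xs' ys') ∪ {x', y', w}) := fun z hz => IntermediateField.subset_adjoin _ _ hz
      have hy := ys_mem h'.tower h'.ne (fun o => hS _ (Or.inl ⟨o, rfl⟩)) 0 (by omega)
      rintro z (⟨o, rfl⟩ | rfl | rfl | rfl)
      · exact hS _ (Or.inl ⟨o, rfl⟩)
      · exact hS _ (by simp)
      · exact hS _ (by simp)
      · rw [huw]
        exact div_mem (hS _ (by simp)) (mul_mem (sub_mem (one_mem _) (pow_mem hy _)) (pow_mem (hS _ (by simp)) _))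
    · rw [IntermediateField.adjoin_le_iff]
      have hS : ∀ z ∈ Set.range (tw R xs' ys') ∪ {x', y', u'},
        z ∈ IntermediateField.adjoin k (Set.range (tw R xs' ys') ∪ {x', y', u'}) := fun z hz => IntermediateField.subset_adjoin _ _ hz
      rintro z (⟨o, rfl⟩ | rfl | rfl | hz)
      · exact hS _ (Or.inl ⟨o, rfl⟩)
      · exact hS _ (by simp)
      · exact hS _ (by simp)
      · have hz' : z = u' ^ 2 * gg true x' y' / y' ^ 2 := hz
        rw [hz']
        exact div_mem (mul_mem (pow_mem (hS _ (by simp)) _) (gg_mem _ (hS _ (by simp)) (hS _ (by simp)))) (pow_mem (hS _ (by simp)) _)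
  have U' := h'.toUN hi' hM' (by rw [hM]; exact IntermediateField.subset_adjoin _ _ (by simp)) hw0 hwc hc
  exact UN.contra hR U U'
end s
end Cr

namespace Cr
universe u v w

theorem final (k : Type u) (K : Type v) (K' : Type w) [Field k] [Field K] [Field K'] [CharZero k] [Algebra k K] [Algebra K K'] [Algebra k K'] [IsScalarTower k K K'] (n : ℕ) (hn : 4 ≤ n)
    (hE : ∀ (R : ℕ), 1 ≤ R → ∀ (G : Type w) [Field G] [Algebra k G], TypeF true R k G → TypeF false R k G → False)
    (x : Fin n → K) (hx : AlgebraicIndependent k x) (hxgen : IntermediateField.adjoin k (Set.range x) = ⊤) (t : K') (ht : Transcendental K t) (htgen : IntermediateField.adjoin K {t} = ⊤) (ι : (K ≃ₐ[k] K) →* (K' ≃ₐ[k] K')) (hι : ∀ σ, (∀ a : K, ι σ (algebraMap K K' a) = algebraMap K K' (σ a)) ∧ ι σ t = t) : ¬ Function.Surjective (Abelianization.map ι) := by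
  obtain ⟨R, rfl⟩ : ∃ R, n = R + 3 := ⟨n - 3, by omega⟩
  have hc : Fintype.card (Fin (R + 3)) = R + 3 := by simp
  let e : Option (Fin R) ⊕ Fin 3 ≃ Option (Fin (R + 3)) := Fintype.equivOfCardEq (by simp)
  set T : Option (Fin R) → K' := fun o => bf x t (e (Sum.inl o)) with hT
  set ξ := bf x t (e (Sum.inr 0)) with hξ
  set η := bf x t (e (Sum.inr 1)) with hη
  set ζ := bf x t (e (Sum.inr 2)) with hζ
  have hcf : cf T ξ η ζ = fun i => bf x t (e i) := by
    funext i
    rcases i with o | i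
    · rfl
    · fin_cases i <;> rfl
  have hr : Set.range (cf T ξ η ζ) = Set.range (bf x t) := by
    rw [hcf]; exact e.surjective.range_comp (bf x t)
  have hi : AlgebraicIndependent k (cf T ξ η ζ) := by
    rw [hcf]; exact (bf_indep hx ht).comp e e.injective
  have hg : IntermediateField.adjoin k (Set.range (cf T ξ η ζ)) = ⊤ := by
    rw [hr]; exact bf_gen hxgen htgen
  obtain ⟨α, β, γ, r, hi2, hg2⟩ := exists_rel hi hg
  obtain ⟨φ, hφ⟩ := exists_phi hi hi2 hg hg2
  have hr2 : Set.range (fun i => φ (bf x t i)) = Set.range (cf T α β γ) := by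
    have : cf T α β γ = (fun i => φ (bf x t i)) ∘ e := by
      funext i; rw [← hφ i, hcf]; rfl
    rw [this, e.surjective.range_comp]
  obtain ⟨O₁, h2, h3, h4⟩ := lemC1 hi hg hi2 hg2 r
  refine reduction R hc x hx hxgen t ht htgen ι hι φ ?_ O₁ h2 ?_ ?_
  · intro O hD hTy
    rw [hr2]
    rw [← hr] at hD
    exact lemC2 (hE R (by omega)) hi hg hi2 hg2 r hD hTy
  · rw [hr2]; exact h3
  · rw [← hr]; exact h4
end Cr


/-!
STATEMENT 5: Let `k` be a field of characteristic zero.  For `n ≥ 1` let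
`Cr_n(k) = Aut_k(k(x₁,…,x_n))` and let `ι_n : Cr_n(k) → Cr_{n+1}(k)` send `σ` to its
unique extension agreeing with `σ` on `k(x₁,…,x_n)` and fixing `x_{n+1}`.  Then for
every `n ≥ 4` the induced homomorphism of abelianizations
`Cr_n(k)^{ab} → Cr_{n+1}(k)^{ab}` is not surjective.
Here `K = k(x₁,…,x_n)` and `K' = K(t) = k(x₁,…,x_{n+1})`. -/
theorem stmt5 (k K K' : Type*) [Field k] [Field K] [Field K'] [CharZero k]
    [Algebra k K] [Algebra K K'] [Algebra k K'] [IsScalarTower k K K']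
    (n : ℕ) (hn : 4 ≤ n)
    (x : Fin n → K) (hx : AlgebraicIndependent k x)
    (hxgen : IntermediateField.adjoin k (Set.range x) = ⊤)
    (t : K') (ht : Transcendental K t)
    (htgen : IntermediateField.adjoin K {t} = ⊤)
    (ι : (K ≃ₐ[k] K) →* (K' ≃ₐ[k] K'))
    (hι : ∀ σ : K ≃ₐ[k] K,
      (∀ a : K, ι σ (algebraMap K K' a) = algebraMap K K' (σ a)) ∧ ι σ t = t) :
    ¬ Function.Surjective (Abelianization.map ι) := by
  exact Cr.final k K K' n hn (fun _R hR _G _ _ h1 h2 => Cr.TypeF.contra hR h1 h2) x hx hxgen t ht htgen ι hι
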